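/- If f is a cubic polynomial with integer coefficients and no repeated roots, and for every prime q there exists x in (Z/q²Z)* with f(x) not congruent to 0 mod q², then there are infinitely many primes p such that f(p) is square-free. -/

import Mathlib

section SecE1

/-- The family of integer points close to the cuspidal cone `y^2 z = x^3`. -/
structure NFam (M : ℝ) (x y z : ℤ) : Prop where
  xpos : 1 ≤ x
  ypos : 1 ≤ y
  hxy : (x : ℝ) ≤ M * y
  hyx : (y : ℝ) ≤ M * x
  hz : |(y : ℝ) ^ 2 * z - (x : ℝ) ^ 3| ≤ M * x

/-- Primitive triples, in Bezout form. -/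
def NPrim (x y z : ℤ) : Prop := ∃ r s t : ℤ, r * x + s * y + t * z = 1

lemma exists_nprim (a b c : ℤ) (hc : 0 < c) :
    ∃ g α β γ : ℤ, 0 < g ∧ a = g * α ∧ b = g * β ∧ c = g * γ ∧ NPrim α β γ ∧ 0 < γ := by
  set g : ℤ := (Int.gcd (Int.gcd a b) c : ℤ) with hg
  have hgpos : 0 < g := by
    have : Int.gcd (Int.gcd a b) c ≠ 0 := by
      intro h
      rw [Int.gcd_eq_zero_iff] at h
      omega
    omega
  have h1 : g ∣ (Int.gcd a b : ℤ) := Int.gcd_dvd_left _ _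
  have h3 : g ∣ c := Int.gcd_dvd_right _ _
  have h2 : g ∣ a := h1.trans (Int.gcd_dvd_left _ _)
  have h4 : g ∣ b := h1.trans (Int.gcd_dvd_right _ _)
  obtain ⟨α, hα⟩ := h2
  obtain ⟨β, hβ⟩ := h4
  obtain ⟨γ, hγ⟩ := h3
  refine ⟨g, α, β, γ, hgpos, hα, hβ, hγ, ?_, ?_⟩
  · have e1 := Int.gcd_eq_gcd_ab a b
    have e2 := Int.gcd_eq_gcd_ab (Int.gcd a b) c
    rw [← hg, e1] at e2
    set r := Int.gcdA a b
    set s := Int.gcdB a b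
    set r' := Int.gcdA (a * r + b * s) c
    set s' := Int.gcdB (a * r + b * s) c
    refine ⟨r * r', s * r', s', ?_⟩
    have : g * (r * r' * α + s * r' * β + s' * γ) = g * 1 := by
      calc g * (r * r' * α + s * r' * β + s' * γ)
          = ((g * α) * r + (g * β) * s) * r' + (g * γ) * s' := by ring
        _ = g * 1 := by rw [← hα, ← hβ, ← hγ, mul_one]; exact e2.symm
    exact mul_left_cancel₀ hgpos.ne' this
  · by_contra h
    push Not at h
    nlinarith

lemma nprim_dvd {α β γ D : ℤ} (h : NPrim α β γ) (h1 : γ ∣ α * D) (h2 : γ ∣ β * D) : γ ∣ D := by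
  obtain ⟨r, s, t, e⟩ := h
  have : D = r * (α * D) + s * (β * D) + γ * (t * D) := by linear_combination (-D) * e
  rw [this]
  exact dvd_add (dvd_add (h1.mul_left _) (h2.mul_left _)) (Dvd.intro _ rfl)

lemma nprim_eq {x y z x' y' z' : ℤ} (h : NPrim x y z) (h' : NPrim x' y' z') (hx : 0 < x) (hx' : 0 < x')
    (e1 : x * y' = x' * y) (e2 : x * z' = x' * z) : x = x' ∧ y = y' ∧ z = z' := by
  have key : ∀ {x y z x' y' z' : ℤ}, NPrim x y z → x * y' = x' * y → x * z' = x' * z → x ∣ x' := by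
    intro x y z x' y' z' h e1 e2
    obtain ⟨r, s, t, e⟩ := h
    exact ⟨r * x' + s * y' + t * z', by linear_combination (-x') * e - s * e1 - t * e2⟩
  have d1 := key h e1 e2
  have d2 := key h' e1.symm e2.symm
  have : x = x' := Int.dvd_antisymm hx.le hx'.le d1 d2
  subst this
  refine ⟨rfl, ?_, ?_⟩
  · exact (mul_left_cancel₀ hx.ne' e1).symm
  · exact (mul_left_cancel₀ hx.ne' e2).symm

/-- Spaced reals in an interval. -/
lemma spaced_card {ι : Type*} (B : Finset ι) (f : ι → ℝ) (δ a b : ℝ) (hδ : 0 < δ)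
    (hB : B.Nonempty)
    (hsp : ∀ i ∈ B, ∀ j ∈ B, i ≠ j → δ ≤ |f i - f j|) (ha : ∀ i ∈ B, a ≤ f i) (hb : ∀ i ∈ B, f i ≤ b) :
    ((B.card : ℝ) - 1) * δ ≤ b - a := by
  have hab : a ≤ b := by
    obtain ⟨i, hi⟩ := hB
    exact (ha i hi).trans (hb i hi)
  have hinj : Set.InjOn (fun i => ⌊(f i - a) / δ⌋₊) B := by
    intro i hi j hj hij
    by_contra hne
    have h1 := hsp i hi j hj hne
    have p1 : 0 ≤ (f i - a) / δ := div_nonneg (by linarith [ha i hi]) hδ.le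
    have p2 : 0 ≤ (f j - a) / δ := div_nonneg (by linarith [ha j hj]) hδ.le
    have q1 := Nat.floor_le p1
    have q2 := Nat.lt_floor_add_one ((f i - a) / δ)
    have q3 := Nat.floor_le p2
    have q4 := Nat.lt_floor_add_one ((f j - a) / δ)
    simp only at hij
    rw [hij] at q1 q2
    have : |(f i - a) / δ - (f j - a) / δ| < 1 := by
      rw [abs_lt]; constructor <;> linarith
    rw [← sub_div, abs_div, abs_of_pos hδ, div_lt_one hδ] at this
    have e : f i - a - (f j - a) = f i - f j := by ring
    rw [e] at this
    linarith
  have hmaps : ∀ i ∈ B, (fun i => ⌊(f i - a) / δ⌋₊) i ∈ Finset.range (⌊(b - a) / δ⌋₊ + 1) := by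
    intro i hi
    simp only [Finset.mem_range]
    apply Nat.lt_succ_of_le
    apply Nat.floor_mono
    gcongr
    exact hb i hi
  have hc := Finset.card_le_card_of_injOn _ hmaps hinj
  rw [Finset.card_range] at hc
  have h3 : (B.card : ℝ) ≤ ⌊(b - a) / δ⌋₊ + 1 := by exact_mod_cast hc
  have h4 := Nat.floor_le (div_nonneg (sub_nonneg.2 hab) hδ.le)
  have : (B.card : ℝ) - 1 ≤ (b - a) / δ := by linarith
  rwa [le_div_iff₀ hδ] at this

lemma fam_real {M K : ℝ} {x y z : ℤ} (h : NFam M x y z) (hM : 2 ≤ M) (hK : 1 ≤ K) (hx : K ≤ x) :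
    1 ≤ M * ((y : ℝ) / x) ∧ 0 < (y : ℝ) / x ∧ (y : ℝ) / x ≤ M ∧
      |((y : ℝ) / x) ^ 2 * ((z : ℝ) / x) - 1| ≤ M / K ^ 2 := by
  have hx0 : (0 : ℝ) < x := by linarith
  have hy0 : (0 : ℝ) < y := by have := h.ypos; exact_mod_cast this
  refine ⟨?_, by positivity, ?_, ?_⟩
  · rw [← mul_div_assoc, le_div_iff₀ hx0]; linarith [h.hxy]
  · rw [div_le_iff₀ hx0]; exact h.hyx
  · have e : ((y : ℝ) / x) ^ 2 * ((z : ℝ) / x) - 1 = ((y : ℝ) ^ 2 * z - (x : ℝ) ^ 3) / x ^ 3 := by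
      field_simp
    rw [e, abs_div, abs_of_pos (by positivity : (0 : ℝ) < (x : ℝ) ^ 3), div_le_div_iff₀ (by positivity) (by positivity)]
    have h2 : K ^ 2 ≤ (x : ℝ) ^ 2 := by gcongr
    calc |(y : ℝ) ^ 2 * z - (x : ℝ) ^ 3| * K ^ 2 ≤ (M * x) * (x : ℝ) ^ 2 := by
          gcongr; exact h.hz
      _ = M * (x : ℝ) ^ 3 := by ring

lemma det_small {M K x1 x2 x3 u1 u2 u3 w1 w2 w3 : ℝ} (hM : 2 ≤ M) (hK : 1 ≤ K)
    (hx1 : 0 < x1) (hx2 : 0 < x2) (hx3 : 0 < x3) (hx1' : x1 ≤ 2 * K) (hx2' : x2 ≤ 2 * K) (hx3' : x3 ≤ 2 * K)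
    (a1 : 1 ≤ M * u1) (a2 : 1 ≤ M * u2) (a3 : 1 ≤ M * u3)
    (b1 : u1 ≤ M) (b2 : u2 ≤ M) (b3 : u3 ≤ M)
    (p1 : 0 < u1) (p2 : 0 < u2) (p3 : 0 < u3)
    (v1 : |u1 ^ 2 * w1 - 1| ≤ M / K ^ 2) (v2 : |u2 ^ 2 * w2 - 1| ≤ M / K ^ 2)
    (v3 : |u3 ^ 2 * w3 - 1| ≤ M / K ^ 2)
    (d12 : |u2 - u1| ≤ 1 / (M ^ 20 * K)) (d13 : |u3 - u1| ≤ 1 / (M ^ 20 * K))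
    (d23 : |u3 - u2| ≤ 1 / (M ^ 20 * K)) :
    |x1 * x2 * x3 * ((u2 - u1) * (w3 - w1) - (u3 - u1) * (w2 - w1))| < 1 := by
  have hM0 : 0 < M := by linarith
  have hK0 : 0 < K := by linarith
  set Δ := 1 / (M ^ 20 * K) with hΔ
  have hΔ0 : 0 < Δ := by positivity
  set D := (u2 - u1) * (w3 - w1) - (u3 - u1) * (w2 - w1) with hD
  have id : u1 ^ 2 * u2 ^ 2 * u3 ^ 2 * D =
      (u2 - u1) * (u3 - u1) * (u3 - u2) * (u1 * u2 + u1 * u3 + u2 * u3)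
      + (u1 ^ 2 * w1 - 1) * (u2 ^ 2 * u3 ^ 2 * (u3 - u2))
      - (u2 ^ 2 * w2 - 1) * (u1 ^ 2 * u3 ^ 2 * (u3 - u1))
      + (u3 ^ 2 * w3 - 1) * (u1 ^ 2 * u2 ^ 2 * (u2 - u1)) := by
    rw [hD]; ring
  have t0 : |(u2 - u1) * (u3 - u1) * (u3 - u2) * (u1 * u2 + u1 * u3 + u2 * u3)| ≤
      Δ * Δ * Δ * (M * M + M * M + M * M) := by
    rw [abs_mul, abs_mul, abs_mul, abs_of_pos (by positivity : 0 < u1 * u2 + u1 * u3 + u2 * u3)]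
    gcongr
  have t1 : |(u1 ^ 2 * w1 - 1) * (u2 ^ 2 * u3 ^ 2 * (u3 - u2))| ≤ M / K ^ 2 * (M ^ 2 * M ^ 2 * Δ) := by
    rw [abs_mul, abs_mul, abs_of_pos (by positivity : 0 < u2 ^ 2 * u3 ^ 2)]
    gcongr
  have t2 : |(u2 ^ 2 * w2 - 1) * (u1 ^ 2 * u3 ^ 2 * (u3 - u1))| ≤ M / K ^ 2 * (M ^ 2 * M ^ 2 * Δ) := by
    rw [abs_mul, abs_mul, abs_of_pos (by positivity : 0 < u1 ^ 2 * u3 ^ 2)]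
    gcongr
  have t3 : |(u3 ^ 2 * w3 - 1) * (u1 ^ 2 * u2 ^ 2 * (u2 - u1))| ≤ M / K ^ 2 * (M ^ 2 * M ^ 2 * Δ) := by
    rw [abs_mul, abs_mul, abs_of_pos (by positivity : 0 < u1 ^ 2 * u2 ^ 2)]
    gcongr
  have hb : |u1 ^ 2 * u2 ^ 2 * u3 ^ 2 * D| ≤ 3 * M ^ 2 * Δ ^ 3 + 3 * M ^ 5 / K ^ 2 * Δ := by
    rw [id]
    refine (abs_add_le _ _).trans ?_
    have := (abs_sub ((u2 - u1) * (u3 - u1) * (u3 - u2) * (u1 * u2 + u1 * u3 + u2 * u3)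
      + (u1 ^ 2 * w1 - 1) * (u2 ^ 2 * u3 ^ 2 * (u3 - u2))) ((u2 ^ 2 * w2 - 1) * (u1 ^ 2 * u3 ^ 2 * (u3 - u1))))
    have h4 := abs_add_le ((u2 - u1) * (u3 - u1) * (u3 - u2) * (u1 * u2 + u1 * u3 + u2 * u3))
      ((u1 ^ 2 * w1 - 1) * (u2 ^ 2 * u3 ^ 2 * (u3 - u2)))
    have e : 3 * M ^ 2 * Δ ^ 3 + 3 * M ^ 5 / K ^ 2 * Δ = Δ * Δ * Δ * (M * M + M * M + M * M)
      + M / K ^ 2 * (M ^ 2 * M ^ 2 * Δ) + M / K ^ 2 * (M ^ 2 * M ^ 2 * Δ) + M / K ^ 2 * (M ^ 2 * M ^ 2 * Δ) := by ring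
    rw [e]
    linarith
  have hlow : 1 ≤ M ^ 6 * (u1 ^ 2 * u2 ^ 2 * u3 ^ 2) := by
    have e : M ^ 6 * (u1 ^ 2 * u2 ^ 2 * u3 ^ 2) = (M * u1) ^ 2 * (M * u2) ^ 2 * (M * u3) ^ 2 := by ring
    rw [e]
    have := one_le_pow₀ a1 (n := 2)
    have := one_le_pow₀ a2 (n := 2)
    have := one_le_pow₀ a3 (n := 2)
    exact one_le_mul_of_one_le_of_one_le (one_le_mul_of_one_le_of_one_le ‹_› ‹_›) ‹_›
  have hDb : |D| ≤ M ^ 6 * (3 * M ^ 2 * Δ ^ 3 + 3 * M ^ 5 / K ^ 2 * Δ) := by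
    calc |D| = 1 * |D| := (one_mul _).symm
      _ ≤ M ^ 6 * (u1 ^ 2 * u2 ^ 2 * u3 ^ 2) * |D| := by gcongr
      _ = M ^ 6 * |u1 ^ 2 * u2 ^ 2 * u3 ^ 2 * D| := by
          rw [abs_mul, abs_of_pos (by positivity : 0 < u1 ^ 2 * u2 ^ 2 * u3 ^ 2)]; ring
      _ ≤ _ := by gcongr
  have hfin : |x1 * x2 * x3 * D| ≤ (2 * K) * (2 * K) * (2 * K) * (M ^ 6 * (3 * M ^ 2 * Δ ^ 3 + 3 * M ^ 5 / K ^ 2 * Δ)) := by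
    rw [abs_mul, abs_of_pos (by positivity : 0 < x1 * x2 * x3)]
    gcongr
  have e2 : (2 * K) * (2 * K) * (2 * K) * (M ^ 6 * (3 * M ^ 2 * Δ ^ 3 + 3 * M ^ 5 / K ^ 2 * Δ))
      = 24 / M ^ 52 + 24 / M ^ 9 := by
    rw [hΔ]; field_simp; ring
  have e3 : (24 : ℝ) / M ^ 52 ≤ 24 / 2 ^ 52 := by gcongr
  have e4 : (24 : ℝ) / M ^ 9 ≤ 24 / 2 ^ 9 := by gcongr
  rw [e2] at hfin
  norm_num at e3 e4
  linarith

end SecE1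

section SecE2

set_option maxHeartbeats 1000000 in
lemma dense_real {M K n α β γ u1 u2 : ℝ} (hM : 2 ≤ M) (hK : 1 ≤ K) (hn : M ^ 13 ≤ n) (hγ : 1 ≤ γ)
    (a1 : 1 ≤ M * u1) (a2 : 1 ≤ M * u2) (b1 : u1 ≤ M) (b2 : u2 ≤ M) (p1 : 0 < u1) (p2 : 0 < u2)
    (hG1 : |γ + α * u1 ^ 2 + β * u1 ^ 3| ≤ γ * (M / K ^ 2))
    (hG2 : |γ + α * u2 ^ 2 + β * u2 ^ 3| ≤ γ * (M / K ^ 2))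
    (hd : u2 - u1 ≤ 1 / (M ^ 20 * K)) (hs : n * (γ / (4 * K ^ 2)) ≤ u2 - u1) :
    n * γ * M ^ 20 ≤ 4 * K ∧ γ ≤ 2 * M ^ 3 * β ∧ β ≤ M ^ 9 * γ ∧
    (∀ u, u1 ≤ u → u ≤ u2 → |2 * α + 3 * β * u| * M ^ 6 ≤ 1) ∧
    γ ≤ 2 * M ^ 4 * (-α) ∧ -α ≤ M ^ 12 * γ ∧
    |4 * α ^ 3 + 27 * β ^ 2 * γ| ≤ M ^ 25 * γ := by
  have hM0 : 0 < M := by linarith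
  have hK0 : 0 < K := by linarith
  have hγ0 : 0 < γ := by linarith
  have hM12 : (8192 : ℝ) ≤ M ^ 13 := by
    calc (8192 : ℝ) = 2 ^ 13 := by norm_num
      _ ≤ M ^ 13 := by gcongr
  have hn0 : 0 < n := by linarith
  have hM2 : (4 : ℝ) ≤ M ^ 2 := by nlinarith only [hM]
  -- first claim
  have c1 : n * γ * M ^ 20 ≤ 4 * K := by
    have h := hs.trans hd
    rw [← mul_div_assoc, div_le_div_iff₀ (by positivity) (by positivity)] at h
    have : (n * γ * M ^ 20) * K ≤ (4 * K) * K := by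
      calc (n * γ * M ^ 20) * K = n * γ * (M ^ 20 * K) := by ring
        _ ≤ 1 * (4 * K ^ 2) := h
        _ = _ := by ring
    exact le_of_mul_le_mul_right this hK0
  set k := u2 - u1 with hk
  clear_value k
  have hk0 : 0 < k := lt_of_lt_of_le (by positivity) hs
  set G1 := γ + α * u1 ^ 2 + β * u1 ^ 3 with hG1d
  clear_value G1
  set G2 := γ + α * u2 ^ 2 + β * u2 ^ 3 with hG2d
  clear_value G2
  set δ := α * (u1 + u2) + β * (u1 ^ 2 + u1 * u2 + u2 ^ 2) with hδ
  clear_value δ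
  have hδk : δ * k = G2 - G1 := by rw [hδ, hk, hG1d, hG2d]; ring
  have hδn : |δ| * n ≤ 8 * M := by
    have h1 : |δ| * k ≤ 2 * (γ * (M / K ^ 2)) := by
      rw [← abs_of_pos hk0, ← abs_mul, hδk]
      have := abs_sub G2 G1
      linarith
    have h2 : |δ| * (n * (γ / (4 * K ^ 2))) ≤ 2 * (γ * (M / K ^ 2)) := by
      refine le_trans ?_ h1; gcongr
    have e1 : |δ| * (n * (γ / (4 * K ^ 2))) = (|δ| * n) * (γ / (4 * K ^ 2)) := by ring
    have e2 : 2 * (γ * (M / K ^ 2)) = (8 * M) * (γ / (4 * K ^ 2)) := by field_simp; ring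
    rw [e1, e2] at h2
    exact le_of_mul_le_mul_right h2 (by positivity)
  have hδM : |δ| * M ^ 12 ≤ 8 := by
    have : (|δ| * M ^ 12) * M ≤ 8 * M := by
      refine le_trans ?_ hδn
      calc (|δ| * M ^ 12) * M = |δ| * M ^ 13 := by ring
        _ ≤ _ := by gcongr
    exact le_of_mul_le_mul_right this hM0
  have hKbig : M ^ 30 ≤ K := by
    have h1 : M ^ 13 * 1 * M ^ 19 ≤ n * γ * M ^ 20 := by
      have : M ^ 19 ≤ M ^ 20 := pow_le_pow_right₀ (by linarith) (by norm_num)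
      gcongr
    have h2 : (4 : ℝ) * M ^ 30 ≤ M ^ 13 * 1 * M ^ 19 := by
      have : M ^ 13 * 1 * M ^ 19 = M ^ 2 * M ^ 30 := by ring
      rw [this]; gcongr
    linarith
  have hγK : γ ≤ K := by
    have : γ * 4 ≤ n * γ * M ^ 20 := by
      have h1 : (4 : ℝ) ≤ n := by linarith
      have h2 : (1 : ℝ) ≤ M ^ 20 := one_le_pow₀ (by linarith)
      calc γ * 4 ≤ γ * n := by gcongr
        _ = n * γ * 1 := by ring
        _ ≤ _ := by gcongr
    linarith
  have hMK : M / K ^ 2 ≤ 1 / 4 := by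
    rw [div_le_div_iff₀ (by positivity) (by norm_num)]
    have h1 : M * 1 ≤ M ^ 30 * M ^ 29 / 4 := by
      have : (4 : ℝ) ≤ M ^ 58 := by
        calc (4 : ℝ) ≤ 2 ^ 58 := by norm_num
          _ ≤ _ := by gcongr
      have e : M ^ 30 * M ^ 29 / 4 = M * (M ^ 58 / 4) := by ring
      rw [e]; gcongr; linarith
    have h2 : M ^ 30 * M ^ 29 ≤ K * K := by
      have : M ^ 29 ≤ M ^ 30 := pow_le_pow_right₀ (by linarith) (by norm_num)
      gcongr
      linarith
    linarith [pow_two K]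
  have hG1' : |G1| ≤ γ / 4 := by
    refine hG1.trans ?_
    have := mul_le_mul_of_nonneg_left hMK hγ0.le
    linarith
  -- β identity
  have hβid : β * (u1 ^ 2 * u2 ^ 2) = δ * u1 ^ 2 + (γ - G1) * (u1 + u2) := by
    rw [hδ, hG1d]; ring
  have hδu : |δ * u1 ^ 2| ≤ u1 / 4 := by
    rw [abs_mul, abs_of_pos (by positivity : 0 < u1 ^ 2)]
    have h1 : |δ| * M ≤ 1 / 4 := by
      have : |δ| * M * 2048 ≤ 8 := by
        refine le_trans ?_ hδM
        have : (2048 : ℝ) ≤ M ^ 11 := by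
          calc (2048 : ℝ) = 2 ^ 11 := by norm_num
            _ ≤ _ := by gcongr
        calc |δ| * M * 2048 ≤ |δ| * M * M ^ 11 := by gcongr
          _ = _ := by ring
      linarith
    calc |δ| * u1 ^ 2 = |δ| * u1 * u1 := by ring
      _ ≤ |δ| * M * u1 := by gcongr
      _ ≤ 1 / 4 * u1 := by gcongr
      _ = _ := by ring
  have hG1a := abs_le.1 hG1'
  have hδa := abs_le.1 hδu
  have hβlow : γ * (u1 + u2) / 2 ≤ β * (u1 ^ 2 * u2 ^ 2) := by
    rw [hβid]
    have h1 : (3 / 4 * γ) * (u1 + u2) ≤ (γ - G1) * (u1 + u2) := by gcongr; linarith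
    have h2 : u1 ≤ γ * (u1 + u2) := by
      calc u1 ≤ 1 * (u1 + u2) := by linarith
        _ ≤ _ := by gcongr
    linarith
  have hβup : β * (u1 ^ 2 * u2 ^ 2) ≤ 2 * γ * (u1 + u2) := by
    rw [hβid]
    have h1 : (γ - G1) * (u1 + u2) ≤ (5 / 4 * γ) * (u1 + u2) := by gcongr; linarith
    have h2 : u1 ≤ γ * (u1 + u2) := by
      calc u1 ≤ 1 * (u1 + u2) := by linarith
        _ ≤ _ := by gcongr
    linarith
  have hβ0 : 0 < β := by
    by_contra h
    push Not at h
    have : β * (u1 ^ 2 * u2 ^ 2) ≤ 0 := mul_nonpos_of_nonpos_of_nonneg h (by positivity)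
    have : 0 < γ * (u1 + u2) / 2 := by positivity
    linarith
  have c2 : γ ≤ 2 * M ^ 3 * β := by
    have h1 : β * (u1 ^ 2 * u2 ^ 2) ≤ (M ^ 3 * β) * u2 := by
      calc β * (u1 ^ 2 * u2 ^ 2) = β * (u1 ^ 2 * u2) * u2 := by ring
        _ ≤ β * (M ^ 2 * M) * u2 := by gcongr
        _ = _ := by ring
    have h3 : 0 < γ * u1 := by positivity
    have h2 : γ * u2 ≤ (2 * M ^ 3 * β) * u2 := by linarith
    exact le_of_mul_le_mul_right h2 p2
  have c3 : β ≤ M ^ 9 * γ := by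
    have h1 : 1 ≤ M ^ 4 * (u1 ^ 2 * u2 ^ 2) := by
      have e : M ^ 4 * (u1 ^ 2 * u2 ^ 2) = (M * u1) ^ 2 * (M * u2) ^ 2 := by ring
      rw [e]
      exact one_le_mul_of_one_le_of_one_le (one_le_pow₀ a1) (one_le_pow₀ a2)
    calc β = β * 1 := (mul_one _).symm
      _ ≤ β * (M ^ 4 * (u1 ^ 2 * u2 ^ 2)) := by gcongr
      _ = M ^ 4 * (β * (u1 ^ 2 * u2 ^ 2)) := by ring
      _ ≤ M ^ 4 * (2 * γ * (M + M)) := by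
          refine mul_le_mul_of_nonneg_left (hβup.trans ?_) (by positivity)
          gcongr
      _ = 4 * M ^ 5 * γ := by ring
      _ ≤ M ^ 4 * M ^ 5 * γ := by
          gcongr
          calc (4 : ℝ) ≤ 2 ^ 4 := by norm_num
            _ ≤ _ := by gcongr
      _ = _ := by ring
  have hkM : k * (M ^ 20 * K) ≤ 1 := by
    rwa [le_div_iff₀ (by positivity)] at hd
  have hk1 : k ≤ M := by linarith
  have c4 : ∀ u, u1 ≤ u → u ≤ u2 → |2 * α + 3 * β * u| * M ^ 6 ≤ 1 := by
    intro u h1 h2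
    have id : (u1 + u2) * (2 * α + 3 * β * u) =
        2 * δ + β * (-3 * u1 * k + 6 * u1 * (u - u1) + 3 * (u - u1) * k - 2 * k ^ 2) := by
      rw [hδ, hk]; ring
    have hb : |(-3 * u1 * k + 6 * u1 * (u - u1) + 3 * (u - u1) * k - 2 * k ^ 2)| ≤ 14 * M * k := by
      have q0 : 0 ≤ u - u1 := by linarith
      have q1 : u - u1 ≤ k := by linarith
      have q2 : u1 * k ≤ M * k := by gcongr
      have q3 : u1 * (u - u1) ≤ M * k := by gcongr
      have q4 : (u - u1) * k ≤ M * k := by gcongr; linarith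
      have q5 : k * k ≤ M * k := by gcongr
      have q6 : 0 ≤ u1 * (u - u1) := by positivity
      have q7 : 0 ≤ (u - u1) * k := by positivity
      have q8 : 0 < u1 * k := by positivity
      have q9 : 0 < k * k := by positivity
      rw [abs_le, pow_two]; constructor <;> linarith
    have hβk : β * (14 * M * k) * M ^ 9 ≤ 1 := by
      have h3 : β * (14 * M * k) * M ^ 9 ≤ (M ^ 9 * γ) * (M ^ 4 * M * k) * M ^ 9 := by
        gcongr
        calc (14 : ℝ) ≤ 2 ^ 4 := by norm_num
            _ ≤ _ := by gcongr
      have e : (M ^ 9 * γ) * (M ^ 4 * M * k) * M ^ 9 = (M ^ 3 * γ) * (k * M ^ 20) := by ring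
      have h4 : M ^ 3 * γ ≤ K := by
        have : 4 * (M ^ 3 * γ) ≤ n * γ * M ^ 20 := by
          have g1 : (4 : ℝ) ≤ n := by linarith
          have g2 : M ^ 3 ≤ M ^ 20 := pow_le_pow_right₀ (by linarith) (by norm_num)
          calc 4 * (M ^ 3 * γ) ≤ n * (M ^ 20 * γ) := by gcongr
            _ = _ := by ring
        linarith
      calc _ ≤ (M ^ 3 * γ) * (k * M ^ 20) := by rw [← e]; exact h3
        _ ≤ K * (k * M ^ 20) := by gcongr
        _ = k * (M ^ 20 * K) := by ring
        _ ≤ 1 := hkM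
    have h5 : (u1 + u2) * |2 * α + 3 * β * u| ≤ 2 * |δ| + β * (14 * M * k) := by
      have e5 : (u1 + u2) * |2 * α + 3 * β * u| = |(u1 + u2) * (2 * α + 3 * β * u)| := by
        rw [abs_mul, abs_of_pos (by positivity : 0 < u1 + u2)]
      rw [e5, id]
      refine (abs_add_le _ _).trans ?_
      rw [abs_mul, abs_mul, abs_of_pos hβ0, abs_two]
      gcongr
    set X := |2 * α + 3 * β * u| with hX
    clear_value X
    have hX0 : 0 ≤ X := by rw [hX]; exact abs_nonneg _
    have h6 : X ≤ M * (2 * |δ| + β * (14 * M * k)) := by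
      calc X = 1 * X := (one_mul _).symm
        _ ≤ (M * u1) * X := by gcongr
        _ = M * (u1 * X) := by ring
        _ ≤ M * ((u1 + u2) * X) := by gcongr; linarith
        _ ≤ _ := by gcongr
    -- refine the second term
    have h13 : β * (14 * M * k) * M ^ 11 ≤ 1 / 4 := by
      have h3 : β * (14 * M * k) * M ^ 11 ≤ (M ^ 9 * γ) * (M ^ 4 * M * k) * M ^ 11 := by
        gcongr
        calc (14 : ℝ) ≤ 2 ^ 4 := by norm_num
            _ ≤ _ := by gcongr
      have e : (M ^ 9 * γ) * (M ^ 4 * M * k) * M ^ 11 = (M ^ 5 * γ) * (k * M ^ 20) := by ring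
      have h4 : 4 * (M ^ 5 * γ) ≤ K := by
        have : 16 * (M ^ 5 * γ) ≤ n * γ * M ^ 20 := by
          have g1 : (16 : ℝ) ≤ n := by linarith
          have g2 : M ^ 5 ≤ M ^ 20 := pow_le_pow_right₀ (by linarith) (by norm_num)
          calc 16 * (M ^ 5 * γ) ≤ n * (M ^ 20 * γ) := by gcongr
            _ = _ := by ring
        linarith
      calc _ ≤ (M ^ 5 * γ) * (k * M ^ 20) := by rw [← e]; exact h3
        _ ≤ (K / 4) * (k * M ^ 20) := by gcongr; linarith
        _ = k * (M ^ 20 * K) / 4 := by ring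
        _ ≤ 1 / 4 := by linarith
    have h7 : M * |δ| * M ^ 10 ≤ 4 := by
      have : (M * |δ| * M ^ 10) * M ≤ 4 * M := by
        calc (M * |δ| * M ^ 10) * M = |δ| * M ^ 12 := by ring
          _ ≤ 8 := hδM
          _ ≤ 4 * M := by linarith
      exact le_of_mul_le_mul_right this hM0
    have h14 : X * M ^ 6 * M ^ 4 ≤ 1 * M ^ 4 := by
      have h15 : X * M ^ 10 ≤ 8 + 1 / 4 := by
        calc X * M ^ 10 ≤ (M * (2 * |δ| + β * (14 * M * k))) * M ^ 10 := by gcongr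
          _ = 2 * (M * |δ| * M ^ 10) + (β * (14 * M * k) * M ^ 11) := by ring
          _ ≤ 2 * 4 + 1 / 4 := by gcongr
          _ = _ := by ring
      have : (2:ℝ) ^ 4 ≤ M ^ 4 := by gcongr
      calc X * M ^ 6 * M ^ 4 = X * M ^ 10 := by ring
        _ ≤ _ := by linarith
    exact le_of_mul_le_mul_right h14 (by positivity)
  have hd1 := c4 u1 le_rfl (by linarith)
  set d := 2 * α + 3 * β * u1 with hdd
  clear_value d
  have hM4 : (16 : ℝ) ≤ M ^ 4 := by
    calc (16 : ℝ) = 2 ^ 4 := by norm_num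
      _ ≤ _ := by gcongr
  have hd2 : |d| * (4 * M ^ 4) ≤ 1 := by
    refine le_trans ?_ hd1
    have : 4 * M ^ 4 ≤ M ^ 6 := by
      have e : M ^ 6 = M ^ 2 * M ^ 4 := by ring
      rw [e]; gcongr
    gcongr
  have hd3 : |d| ≤ 1 := by
    calc |d| = |d| * 1 := (mul_one _).symm
      _ ≤ |d| * (4 * M ^ 4) := by gcongr; linarith
      _ ≤ 1 := hd2
  have hd4 := abs_le.1 hd3
  have c5 : γ ≤ 2 * M ^ 4 * (-α) := by
    have h1 : -d * (4 * M ^ 4) ≥ -1 := by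
      have : d * (4 * M ^ 4) ≤ |d| * (4 * M ^ 4) := by gcongr; exact le_abs_self d
      linarith
    have e : 2 * M ^ 4 * (-α) = M ^ 4 * (3 * β * u1) + (-d * (4 * M ^ 4)) / 4 := by rw [hdd]; ring
    have h2 : (3 / 2) * γ ≤ M ^ 4 * (3 * β * u1) := by
      calc (3 / 2) * γ ≤ (3 / 2) * (2 * M ^ 3 * β) := by gcongr
        _ = 3 * M ^ 3 * β * 1 := by ring
        _ ≤ 3 * M ^ 3 * β * (M * u1) := by gcongr
        _ = _ := by ring
    rw [e]; linarith
  have c6 : -α ≤ M ^ 12 * γ := by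
    have h1 : β * u1 ≤ M ^ 9 * γ * M := by gcongr
    have h2 : -α = (3 * (β * u1) - d) / 2 := by rw [hdd]; ring
    have g1 : (1:ℝ) ≤ M ^ 9 * γ * M := by
      have : (1:ℝ) ≤ M ^ 9 := one_le_pow₀ (by linarith)
      calc (1:ℝ) = 1 * 1 * 1 := by norm_num
        _ ≤ M ^ 9 * γ * M := by gcongr; linarith
    have h3 : 2 * (M ^ 9 * γ * M) + 1 ≤ M ^ 12 * γ := by
      have e : M ^ 12 * γ = M ^ 2 * (M ^ 9 * γ * M) := by ring
      rw [e]
      calc 2 * (M ^ 9 * γ * M) + 1 ≤ 4 * (M ^ 9 * γ * M) := by linarith only [g1]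
        _ ≤ _ := by gcongr
    rw [h2]; linarith only [h1, h3, hd4.1, hd4.2, g1]
  refine ⟨c1, c2, c3, c4, c5, c6, ?_⟩
  have id : 4 * α ^ 3 + 27 * β ^ 2 * γ = 27 * β ^ 2 * G1 + d ^ 3 / 2 - 9 / 2 * (β * u1) * d ^ 2 := by
    rw [hdd, hG1d]; ring
  have t1 : |27 * β ^ 2 * G1| ≤ 27 * M ^ 19 * γ := by
    rw [abs_mul, abs_of_pos (by positivity : 0 < 27 * β ^ 2)]
    calc 27 * β ^ 2 * |G1| ≤ 27 * (M ^ 9 * γ) ^ 2 * (γ * (M / K ^ 2)) := by gcongr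
      _ = 27 * M ^ 19 * γ * (γ ^ 2 / K ^ 2) := by ring
      _ ≤ 27 * M ^ 19 * γ * 1 := by
          gcongr
          rw [div_le_one (by positivity)]
          gcongr
      _ = _ := by ring
  have t2 : |d ^ 3 / 2| ≤ γ := by
    rw [abs_div, abs_pow, abs_two]
    have : |d| ^ 3 ≤ 1 := pow_le_one₀ (abs_nonneg _) hd3
    linarith
  have t3 : |9 / 2 * (β * u1) * d ^ 2| ≤ 5 * M ^ 10 * γ := by
    rw [abs_mul, abs_of_pos (by positivity : 0 < 9 / 2 * (β * u1)), abs_pow]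
    calc 9 / 2 * (β * u1) * |d| ^ 2 ≤ 5 * (M ^ 9 * γ * M) * 1 := by
          gcongr
          · norm_num
          · exact pow_le_one₀ (abs_nonneg _) hd3
      _ = _ := by ring
  have t4 : |4 * α ^ 3 + 27 * β ^ 2 * γ| ≤ 27 * M ^ 19 * γ + γ + 5 * M ^ 10 * γ := by
    rw [id]
    refine (abs_sub _ _).trans ?_
    have := abs_add_le (27 * β ^ 2 * G1) (d ^ 3 / 2)
    linarith
  refine t4.trans ?_
  have g1 : (1:ℝ) ≤ M ^ 19 := one_le_pow₀ (by linarith)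
  have g2 : M ^ 10 ≤ M ^ 19 := pow_le_pow_right₀ (by linarith) (by norm_num)
  have g3 : (64:ℝ) ≤ M ^ 6 := by
    calc (64 : ℝ) = 2 ^ 6 := by norm_num
      _ ≤ _ := by gcongr
  calc 27 * M ^ 19 * γ + γ + 5 * M ^ 10 * γ ≤ 27 * M ^ 19 * γ + M ^ 19 * γ + 5 * M ^ 19 * γ := by
        gcongr
        exact le_mul_of_one_le_left hγ0.le g1
    _ = 33 * M ^ 19 * γ := by ring
    _ ≤ M ^ 6 * M ^ 19 * γ := by gcongr; linarith
    _ = _ := by ring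

end SecE2

section SecE3

/-- slope of a point -/
noncomputable def nsl (p : ℤ × ℤ × ℤ) : ℝ := (p.2.1 : ℝ) / (p.1 : ℝ)

/-- points of the family in a dyadic range -/
def NPt (M K : ℝ) (p : ℤ × ℤ × ℤ) : Prop :=
  NFam M p.1 p.2.1 p.2.2 ∧ NPrim p.1 p.2.1 p.2.2 ∧ K ≤ (p.1 : ℝ) ∧ (p.1 : ℝ) ≤ 2 * K

structure NDense (M K n : ℝ) (c : ℤ × ℤ × ℤ) : Prop where
  prim : NPrim c.1 c.2.1 c.2.2
  pos : 1 ≤ c.2.2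
  small : n * (c.2.2 : ℝ) * M ^ 20 ≤ 4 * K
  b1 : (c.2.2 : ℝ) ≤ 2 * M ^ 3 * c.2.1
  b2 : (c.2.1 : ℝ) ≤ M ^ 9 * c.2.2
  a1 : (c.2.2 : ℝ) ≤ 2 * M ^ 4 * (-c.1)
  a2 : -(c.1 : ℝ) ≤ M ^ 12 * c.2.2
  e : |4 * (c.1 : ℝ) ^ 3 + 27 * (c.2.1 : ℝ) ^ 2 * c.2.2| ≤ M ^ 25 * c.2.2

def NOn (M : ℝ) (c p : ℤ × ℤ × ℤ) : Prop :=
  c.1 * p.1 + c.2.1 * p.2.1 + c.2.2 * p.2.2 = 0 ∧ |2 * (c.1 : ℝ) + 3 * c.2.1 * nsl p| * M ^ 6 ≤ 1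

lemma npt_pos {M K : ℝ} (hK : 1 ≤ K) {p : ℤ × ℤ × ℤ} (h : NPt M K p) : (0 : ℝ) < p.1 := by
  linarith [h.2.2.1]

lemma ngap {M K : ℝ} (hK : 1 ≤ K) {c p q : ℤ × ℤ × ℤ} (hc : NPrim c.1 c.2.1 c.2.2) (hγ : 1 ≤ c.2.2)
    (hp : NPt M K p) (hq : NPt M K q)
    (ep : c.1 * p.1 + c.2.1 * p.2.1 + c.2.2 * p.2.2 = 0)
    (eq : c.1 * q.1 + c.2.1 * q.2.1 + c.2.2 * q.2.2 = 0) (hne : p ≠ q) :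
    (c.2.2 : ℝ) / (4 * K ^ 2) ≤ |nsl p - nsl q| := by
  have hp0 := npt_pos hK hp
  have hq0 := npt_pos hK hq
  have hp0' : 0 < p.1 := by exact_mod_cast hp0
  have hq0' : 0 < q.1 := by exact_mod_cast hq0
  set D : ℤ := p.2.1 * q.1 - q.2.1 * p.1 with hD
  have hdvd : c.2.2 ∣ D := by
    apply nprim_dvd hc
    · exact ⟨q.2.1 * p.2.2 - p.2.1 * q.2.2, by rw [hD]; linear_combination p.2.1 * eq - q.2.1 * ep⟩
    · exact ⟨p.1 * q.2.2 - q.1 * p.2.2, by rw [hD]; linear_combination q.1 * ep - p.1 * eq⟩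
  have hD0 : D ≠ 0 := by
    intro h0
    apply hne
    have e1 : p.1 * q.2.1 = q.1 * p.2.1 := by linarith
    have e2 : p.1 * q.2.2 = q.1 * p.2.2 := by
      have : c.2.2 * (p.1 * q.2.2) = c.2.2 * (q.1 * p.2.2) := by
        linear_combination p.1 * eq - q.1 * ep - c.2.1 * e1
      exact mul_left_cancel₀ (by omega) this
    obtain ⟨h1, h2, h3⟩ := nprim_eq hp.2.1 hq.2.1 hp0' hq0' e1 e2
    exact Prod.ext h1 (Prod.ext h2 h3)
  have hle : c.2.2 ≤ |D| := Int.le_of_dvd (abs_pos.2 hD0) ((dvd_abs _ _).2 hdvd)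
  have hle' : (c.2.2 : ℝ) ≤ |(D : ℝ)| := by exact_mod_cast hle
  have e : nsl p - nsl q = (D : ℝ) / (p.1 * q.1) := by
    unfold nsl; rw [hD]; push_cast; field_simp
  rw [e, abs_div, abs_of_pos (mul_pos hp0 hq0)]
  have hxx : (p.1 : ℝ) * q.1 ≤ 4 * K ^ 2 := by
    calc (p.1 : ℝ) * q.1 ≤ (2 * K) * (2 * K) := by
          have := hp.2.2.2; have := hq.2.2.2; gcongr
      _ = _ := by ring
  exact div_le_div₀ (abs_nonneg _) hle' (mul_pos hp0 hq0) hxx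

lemma nG_eq {M K : ℝ} (hM : 2 ≤ M) (hK : 1 ≤ K) {c p : ℤ × ℤ × ℤ} (hγ : 1 ≤ c.2.2)
    (hp : NPt M K p) (ep : c.1 * p.1 + c.2.1 * p.2.1 + c.2.2 * p.2.2 = 0) :
    |(c.2.2 : ℝ) + c.1 * nsl p ^ 2 + c.2.1 * nsl p ^ 3| ≤ c.2.2 * (M / K ^ 2) := by
  have hp0 := npt_pos hK hp
  obtain ⟨-, -, -, h4⟩ := fam_real hp.1 hM hK hp.2.2.1
  have epR : (c.1 : ℝ) * p.1 + c.2.1 * p.2.1 + c.2.2 * p.2.2 = 0 := by exact_mod_cast ep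
  have hγ0 : (0 : ℝ) < c.2.2 := by exact_mod_cast (by omega : 0 < c.2.2)
  have id : (c.2.2 : ℝ) + c.1 * nsl p ^ 2 + c.2.1 * nsl p ^ 3 =
      - (c.2.2 * (((p.2.1 : ℝ) / p.1) ^ 2 * ((p.2.2 : ℝ) / p.1) - 1)) := by
    unfold nsl
    have : (c.1 : ℝ) = - (c.2.1 * p.2.1 + c.2.2 * p.2.2) / p.1 := by
      field_simp; linarith
    rw [this]; field_simp; ring
  rw [id, abs_neg, abs_mul, abs_of_pos hγ0]
  gcongr

lemma nsame_slope {M K n : ℝ} (hM : 2 ≤ M) (hK : 1 ≤ K) (hn : M ^ 13 ≤ n) (B : Finset (ℤ × ℤ × ℤ))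
    (hB : ∀ p ∈ B, NPt M K p) (hcard : n + 1 ≤ B.card) (u : ℝ) (hs : ∀ p ∈ B, nsl p = u) : False := by
  have hM0 : 0 < M := by linarith
  have hK0 : 0 < K := by linarith
  have hne : B.Nonempty := by
    rw [← Finset.card_pos]
    have : (0 : ℝ) < B.card := by
      have : 0 < M ^ 13 := by positivity
      linarith
    exact_mod_cast this
  obtain ⟨p0, hp0⟩ := hne
  have hfr := fun p hp => fam_real (hB p hp).1 hM hK (hB p hp).2.2.1
  have hu : 1 ≤ M * u ∧ 0 < u := by
    have := hfr p0 hp0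
    have e := hs p0 hp0
    unfold nsl at e
    rw [e] at this
    exact ⟨this.1, this.2.1⟩
  have hiv : 1 / u ^ 2 ≤ M ^ 2 := by
    rw [div_le_iff₀ (by have := hu.2; positivity)]
    have := one_le_pow₀ hu.1 (n := 2)
    rwa [mul_pow] at this
  have hw : ∀ p ∈ B, |(p.2.2 : ℝ) / p.1 - 1 / u ^ 2| ≤ M ^ 3 / K ^ 2 := by
    intro p hp
    have h4 := (hfr p hp).2.2.2
    have e := hs p hp
    unfold nsl at e
    rw [e] at h4
    have hu0 := hu.2
    have e2 : (p.2.2 : ℝ) / p.1 - 1 / u ^ 2 = (u ^ 2 * ((p.2.2 : ℝ) / p.1) - 1) * (1 / u ^ 2) := by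
      field_simp
    rw [e2, abs_mul, abs_of_pos (by positivity : 0 < 1 / u ^ 2)]
    calc _ ≤ M / K ^ 2 * M ^ 2 := by gcongr
      _ = _ := by ring
  have := spaced_card B (fun p => (p.2.2 : ℝ) / p.1) (1 / (4 * K ^ 2)) (1 / u ^ 2 - M ^ 3 / K ^ 2)
    (1 / u ^ 2 + M ^ 3 / K ^ 2) (by positivity) ⟨p0, hp0⟩ ?_ (fun p hp => by linarith [(abs_le.1 (hw p hp)).1])
    (fun p hp => by linarith [(abs_le.1 (hw p hp)).2])
  · have h2 : ((B.card : ℝ) - 1) ≤ 8 * M ^ 3 := by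
      have e1 : 1 / u ^ 2 + M ^ 3 / K ^ 2 - (1 / u ^ 2 - M ^ 3 / K ^ 2) = 8 * M ^ 3 * (1 / (4 * K ^ 2)) := by
        field_simp; ring
      rw [e1] at this
      exact le_of_mul_le_mul_right this (by positivity)
    have h3 : 8 * M ^ 3 < M ^ 13 := by
      have e : M ^ 13 = M ^ 10 * M ^ 3 := by ring
      have : (8 : ℝ) < M ^ 10 := by
        calc (8 : ℝ) < 2 ^ 10 := by norm_num
          _ ≤ _ := by gcongr
      rw [e]; gcongr
    linarith
  · intro p hp q hq hne
    have hp1 := npt_pos hK (hB p hp)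
    have hq1 := npt_pos hK (hB q hq)
    have hp1' : 0 < p.1 := by exact_mod_cast hp1
    have hq1' : 0 < q.1 := by exact_mod_cast hq1
    have e1 : p.1 * q.2.1 = q.1 * p.2.1 := by
      have h := (hs p hp).trans (hs q hq).symm
      unfold nsl at h
      rw [div_eq_div_iff hp1.ne' hq1.ne'] at h
      have : p.2.1 * q.1 = q.2.1 * p.1 := by exact_mod_cast h
      linarith
    set D : ℤ := p.2.2 * q.1 - q.2.2 * p.1 with hD
    have hD0 : D ≠ 0 := by
      intro h0
      apply hne
      obtain ⟨h1, h2, h3⟩ := nprim_eq (hB p hp).2.1 (hB q hq).2.1 hp1' hq1' e1 (by linarith)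
      exact Prod.ext h1 (Prod.ext h2 h3)
    have hle : (1 : ℝ) ≤ |(D : ℝ)| := by exact_mod_cast Int.one_le_abs hD0
    have e : (p.2.2 : ℝ) / p.1 - (q.2.2 : ℝ) / q.1 = (D : ℝ) / (p.1 * q.1) := by
      rw [hD]; push_cast; field_simp
    rw [e, abs_div, abs_of_pos (mul_pos hp1 hq1)]
    have hxx : (p.1 : ℝ) * q.1 ≤ 4 * K ^ 2 := by
      calc (p.1 : ℝ) * q.1 ≤ (2 * K) * (2 * K) := by
            have := (hB p hp).2.2.2; have := (hB q hq).2.2.2; gcongr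
        _ = _ := by ring
    exact div_le_div₀ (abs_nonneg _) hle (mul_pos hp1 hq1) hxx

lemma ndet_zero {M K : ℝ} (hM : 2 ≤ M) (hK : 1 ≤ K) {p q r : ℤ × ℤ × ℤ} (hp : NPt M K p) (hq : NPt M K q)
    (hr : NPt M K r) (h1 : |nsl q - nsl p| ≤ 1 / (M ^ 20 * K)) (h2 : |nsl r - nsl p| ≤ 1 / (M ^ 20 * K))
    (h3 : |nsl r - nsl q| ≤ 1 / (M ^ 20 * K)) :
    (p.2.1 * q.2.2 - p.2.2 * q.2.1) * r.1 + (p.2.2 * q.1 - p.1 * q.2.2) * r.2.1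
      + (p.1 * q.2.1 - p.2.1 * q.1) * r.2.2 = 0 := by
  have hp0 := npt_pos hK hp
  have hq0 := npt_pos hK hq
  have hr0 := npt_pos hK hr
  obtain ⟨a1, a2, a3, a4⟩ := fam_real hp.1 hM hK hp.2.2.1
  obtain ⟨b1, b2, b3, b4⟩ := fam_real hq.1 hM hK hq.2.2.1
  obtain ⟨c1, c2, c3, c4⟩ := fam_real hr.1 hM hK hr.2.2.1
  unfold nsl at h1 h2 h3
  have := det_small hM hK hp0 hq0 hr0 hp.2.2.2 hq.2.2.2 hr.2.2.2 a1 b1 c1 a3 b3 c3 a2 b2 c2 a4 b4 c4 h1 h2 h3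
  rw [← Int.abs_lt_one_iff]
  have e : (((p.2.1 * q.2.2 - p.2.2 * q.2.1) * r.1 + (p.2.2 * q.1 - p.1 * q.2.2) * r.2.1
      + (p.1 * q.2.1 - p.2.1 * q.1) * r.2.2 : ℤ) : ℝ) = (p.1 : ℝ) * q.1 * r.1 *
      (((q.2.1 : ℝ) / q.1 - (p.2.1 : ℝ) / p.1) * ((r.2.2 : ℝ) / r.1 - (p.2.2 : ℝ) / p.1)
      - ((r.2.1 : ℝ) / r.1 - (p.2.1 : ℝ) / p.1) * ((q.2.2 : ℝ) / q.1 - (p.2.2 : ℝ) / p.1)) := by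
    push_cast
    field_simp
    ring
  rw [← e] at this
  exact_mod_cast this

lemma ndense_block {M K n : ℝ} (hM : 2 ≤ M) (hK : 1 ≤ K) (hn : M ^ 13 ≤ n) (B : Finset (ℤ × ℤ × ℤ))
    (hB : ∀ p ∈ B, NPt M K p) (hcard : n + 1 ≤ B.card)
    (hdiam : ∀ p ∈ B, ∀ q ∈ B, |nsl p - nsl q| ≤ 1 / (M ^ 20 * K)) :
    ∃ c : ℤ × ℤ × ℤ, NDense M K n c ∧ ∀ p ∈ B, NOn M c p := by
  have hM0 : 0 < M := by linarith
  have hK0 : 0 < K := by linarith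
  have hn0 : 0 < n := lt_of_lt_of_le (by positivity) hn
  have hne : B.Nonempty := by
    rw [← Finset.card_pos]
    have : (0 : ℝ) < B.card := by linarith
    exact_mod_cast this
  obtain ⟨p, hp, hpmin⟩ := B.exists_min_image nsl hne
  obtain ⟨q, hq, hqmax⟩ := B.exists_max_image nsl hne
  have hp0 := npt_pos hK (hB p hp)
  have hq0 := npt_pos hK (hB q hq)
  rcases (hpmin q hq).eq_or_lt with heq | hlt
  · exact (nsame_slope hM hK hn B hB hcard (nsl p) (fun r hr => le_antisymm (heq ▸ hqmax r hr) (hpmin r hr))).elim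
  have hD : 0 < p.1 * q.2.1 - p.2.1 * q.1 := by
    unfold nsl at hlt
    rw [div_lt_div_iff₀ hp0 hq0] at hlt
    have : p.2.1 * q.1 < q.2.1 * p.1 := by exact_mod_cast hlt
    linarith
  obtain ⟨g, α, β, γ, hg, ha, hb, hc, hprim, hγ⟩ := exists_nprim (p.2.1 * q.2.2 - p.2.2 * q.2.1)
    (p.2.2 * q.1 - p.1 * q.2.2) (p.1 * q.2.1 - p.2.1 * q.1) hD
  have hplane : ∀ r ∈ B, α * r.1 + β * r.2.1 + γ * r.2.2 = 0 := by
    intro r hr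
    have h := ndet_zero hM hK (hB p hp) (hB q hq) (hB r hr) (hdiam q hq p hp) (hdiam r hr p hp) (hdiam r hr q hq)
    rw [ha, hb, hc] at h
    have : g * (α * r.1 + β * r.2.1 + γ * r.2.2) = 0 := by linarith
    rcases mul_eq_zero.1 this with h | h
    · omega
    · exact h
  have hγ1 : (1 : ℝ) ≤ γ := by exact_mod_cast hγ
  obtain ⟨a1, a2, a3, -⟩ := fam_real (hB p hp).1 hM hK (hB p hp).2.2.1
  obtain ⟨b1, b2, b3, -⟩ := fam_real (hB q hq).1 hM hK (hB q hq).2.2.1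
  have hsp := spaced_card B nsl ((γ : ℝ) / (4 * K ^ 2)) (nsl p) (nsl q) (by positivity) hne
    (fun i hi j hj hij => ngap (c := (α, β, γ)) hK hprim hγ (hB i hi) (hB j hj) (hplane i hi) (hplane j hj) hij)
    hpmin hqmax
  have hs : n * ((γ : ℝ) / (4 * K ^ 2)) ≤ nsl q - nsl p := by
    refine le_trans ?_ hsp
    gcongr
    linarith
  have hd := (le_abs_self _).trans (hdiam q hq p hp)
  obtain ⟨c1, c2, c3, c4, c5, c6, c7⟩ := dense_real hM hK hn hγ1 a1 b1 a3 b3 a2 b2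
    (nG_eq (c := (α, β, γ)) hM hK hγ (hB p hp) (hplane p hp)) (nG_eq (c := (α, β, γ)) hM hK hγ (hB q hq) (hplane q hq)) hd hs
  exact ⟨(α, β, γ), ⟨hprim, hγ, c1, c2, c3, c5, c6, c7⟩, fun r hr => ⟨hplane r hr, c4 _ (hpmin r hr) (hqmax r hr)⟩⟩

end SecE3

section SecE4

lemma nspace_three {M K α β γ u1 u2 u3 : ℝ} (hM : 2 ≤ M) (hK : 1 ≤ K) (hγ : 1 ≤ γ)
    (ha : γ ≤ 2 * M ^ 4 * (-α))
    (d1 : |2 * α + 3 * β * u1| * M ^ 6 ≤ 1) (d2 : |2 * α + 3 * β * u2| * M ^ 6 ≤ 1)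
    (d3 : |2 * α + 3 * β * u3| * M ^ 6 ≤ 1)
    (g1 : |γ + α * u1 ^ 2 + β * u1 ^ 3| ≤ γ * (M / K ^ 2))
    (g2 : |γ + α * u2 ^ 2 + β * u2 ^ 3| ≤ γ * (M / K ^ 2))
    (g3 : |γ + α * u3 ^ 2 + β * u3 ^ 3| ≤ γ * (M / K ^ 2))
    (h12 : u1 + M ^ 4 / K < u2) (h23 : u2 + M ^ 4 / K < u3) : False := by
  have hM0 : 0 < M := by linarith
  have hK0 : 0 < K := by linarith
  have hκ : γ ≤ 4 * M ^ 4 * (α + β * (u1 + u2 + u3)) := by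
    have hM6 : 0 < M ^ 6 := by positivity
    have low : ∀ u, |2 * α + 3 * β * u| * M ^ 6 ≤ 1 → -1 ≤ (2 * α + 3 * β * u) * M ^ 6 := by
      intro u hu
      have := neg_abs_le (2 * α + 3 * β * u)
      nlinarith only [this, hu, hM6]
    have l1 := low _ d1
    have l2 := low _ d2
    have l3 := low _ d3
    have h5 : -1 ≤ (α + β * (u1 + u2 + u3) + α) * M ^ 6 := by linarith only [l1, l2, l3]
    have hM2 : (4 : ℝ) ≤ M ^ 2 := by nlinarith only [hM]
    have h6 : -1 ≤ 4 * ((α + β * (u1 + u2 + u3) + α) * M ^ 4) := by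
      by_contra hcon
      push Not at hcon
      have h7 : (α + β * (u1 + u2 + u3) + α) * M ^ 6 = ((α + β * (u1 + u2 + u3) + α) * M ^ 4) * M ^ 2 := by ring
      rw [h7] at h5
      nlinarith only [h5, hcon, hM2]
    linarith only [h6, ha, hγ]
  set κ := α + β * (u1 + u2 + u3) with hκd
  set a := u2 - u1 with had
  set b := u3 - u2 with hbd
  have id : κ * (a * b * (a + b)) = (γ + α * u1 ^ 2 + β * u1 ^ 3) * b - (γ + α * u2 ^ 2 + β * u2 ^ 3) * (a + b)
      + (γ + α * u3 ^ 2 + β * u3 ^ 3) * a := by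
    rw [hκd, had, hbd]; ring
  have hτ : 0 < M ^ 4 / K := by positivity
  have ha0 : M ^ 4 / K < a := by rw [had]; linarith only [h12]
  have hb0 : M ^ 4 / K < b := by rw [hbd]; linarith only [h23]
  clear_value κ a b
  generalize γ + α * u1 ^ 2 + β * u1 ^ 3 = G1 at *
  generalize γ + α * u2 ^ 2 + β * u2 ^ 3 = G2 at *
  generalize γ + α * u3 ^ 2 + β * u3 ^ 3 = G3 at *
  have ha1 : 0 < a := hτ.trans ha0
  have hb1 : 0 < b := hτ.trans hb0
  set ε := γ * (M / K ^ 2) with hε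
  have h8 : κ * (a * b * (a + b)) ≤ ε * b + ε * (a + b) + ε * a := by
    rw [id]
    have t1 : G1 * b ≤ ε * b := by gcongr; exact (le_abs_self _).trans g1
    have t2 : -G2 * (a + b) ≤ ε * (a + b) := by gcongr; exact (neg_le_abs _).trans g2
    have t3 : G3 * a ≤ ε * a := by gcongr; exact (le_abs_self _).trans g3
    linarith only [t1, t2, t3]
  have h9 : κ * (a * b) ≤ 2 * ε := by
    have : (κ * (a * b)) * (a + b) ≤ (2 * ε) * (a + b) := by linarith only [h8]
    exact le_of_mul_le_mul_right this (by positivity)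
  have h10 : γ * (a * b) ≤ 8 * M ^ 4 * ε := by
    calc γ * (a * b) ≤ 4 * M ^ 4 * κ * (a * b) := by gcongr
      _ = 4 * M ^ 4 * (κ * (a * b)) := by ring
      _ ≤ 4 * M ^ 4 * (2 * ε) := by gcongr
      _ = _ := by ring
  have h11 : γ * ((M ^ 4 / K) * (M ^ 4 / K)) < γ * (a * b) := by gcongr
  have h12 : 8 * M ^ 4 * ε ≤ γ * ((M ^ 4 / K) * (M ^ 4 / K)) := by
    have e : γ * ((M ^ 4 / K) * (M ^ 4 / K)) = M ^ 3 * (M ^ 4 * (γ * (M / K ^ 2))) := by ring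
    rw [e, hε, mul_assoc]
    gcongr
    calc (8 : ℝ) = 2 ^ 3 := by norm_num
      _ ≤ _ := by gcongr
  linarith

lemma ncount_c {M K n : ℝ} (hM : 2 ≤ M) (hK : 1 ≤ K) (hn : M ^ 13 ≤ n) {c : ℤ × ℤ × ℤ} (hc : NDense M K n c)
    (T : Finset (ℤ × ℤ × ℤ)) (hT : ∀ p ∈ T, NPt M K p ∧ NOn M c p) :
    (T.card : ℝ) ≤ M ^ 8 * K / c.2.2 := by
  have hM0 : 0 < M := by linarith
  have hK0 : 0 < K := by linarith
  have hγ1 : (1 : ℝ) ≤ c.2.2 := by exact_mod_cast hc.pos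
  have hγ0 : (0 : ℝ) < c.2.2 := by linarith
  rcases T.eq_empty_or_nonempty with h0 | hne
  · subst h0; simp; positivity
  obtain ⟨p, hp, hpmin⟩ := T.exists_min_image nsl hne
  obtain ⟨q, hq, hqmax⟩ := T.exists_max_image nsl hne
  set τ := M ^ 4 / K with hτ
  have hτ0 : 0 < τ := by positivity
  have hγK : (c.2.2 : ℝ) ≤ K := by
    have h1 := hc.small
    have h2 : (4 : ℝ) ≤ M ^ 13 := by
      calc (4 : ℝ) ≤ 2 ^ 13 := by norm_num
        _ ≤ _ := by gcongr
    have hn4 : 4 ≤ n := h2.trans hn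
    have h20 : 1 ≤ M ^ 20 := one_le_pow₀ (by linarith only [hM])
    have hn0 : 0 < n := by linarith only [hn4]
    have h3 : (4:ℝ) * c.2.2 * 1 ≤ n * c.2.2 * M ^ 20 := by
      gcongr
    linarith only [h3, h1]
  have piece : ∀ (P : ℤ × ℤ × ℤ → Prop) [DecidablePred P] (a : ℝ), (∀ r ∈ T, P r → a ≤ nsl r ∧ nsl r ≤ a + τ) →
      ((T.filter P).card : ℝ) ≤ 1 + 4 * M ^ 4 * K / c.2.2 := by
    intro P _ a hP
    rcases (T.filter P).eq_empty_or_nonempty with h0 | hne'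
    · rw [h0]; simp; positivity
    have := spaced_card (T.filter P) nsl ((c.2.2 : ℝ) / (4 * K ^ 2)) a (a + τ) (by positivity) hne'
      (fun i hi j hj hij => ngap hK hc.prim hc.pos (hT i (Finset.mem_filter.1 hi).1).1 (hT j (Finset.mem_filter.1 hj).1).1
        (hT i (Finset.mem_filter.1 hi).1).2.1 (hT j (Finset.mem_filter.1 hj).1).2.1 hij)
      (fun i hi => (hP i (Finset.mem_filter.1 hi).1 (Finset.mem_filter.1 hi).2).1)
      (fun i hi => (hP i (Finset.mem_filter.1 hi).1 (Finset.mem_filter.1 hi).2).2)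
    have e : a + τ - a = (4 * M ^ 4 * K / c.2.2) * ((c.2.2 : ℝ) / (4 * K ^ 2)) := by
      rw [hτ]; field_simp; ring
    rw [e] at this
    have := le_of_mul_le_mul_right this (by positivity)
    linarith
  have hsub : T ⊆ T.filter (fun r => nsl r ≤ nsl p + τ) ∪ T.filter (fun r => nsl q - τ ≤ nsl r) := by
    intro r hr
    rw [Finset.mem_union, Finset.mem_filter, Finset.mem_filter]
    by_contra hcon
    push Not at hcon
    have h1 := hcon.1 hr
    have h2 := hcon.2 hr
    exact nspace_three hM hK hγ1 hc.a1 (hT p hp).2.2 (hT r hr).2.2 (hT q hq).2.2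
      (nG_eq hM hK hc.pos (hT p hp).1 (hT p hp).2.1) (nG_eq hM hK hc.pos (hT r hr).1 (hT r hr).2.1)
      (nG_eq hM hK hc.pos (hT q hq).1 (hT q hq).2.1) h1 (by linarith)
  have h1 := piece (fun r => nsl r ≤ nsl p + τ) (nsl p) (fun r hr h => ⟨hpmin r hr, h⟩)
  have h2 := piece (fun r => nsl q - τ ≤ nsl r) (nsl q - τ) (fun r hr h => ⟨h, by linarith [hqmax r hr]⟩)
  have h3 : (T.card : ℝ) ≤ ((T.filter (fun r => nsl r ≤ nsl p + τ)).card : ℝ) +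
      ((T.filter (fun r => nsl q - τ ≤ nsl r)).card : ℝ) := by
    exact_mod_cast (Finset.card_le_card hsub).trans (Finset.card_union_le _ _)
  have h4 : 1 ≤ K / c.2.2 := by rwa [le_div_iff₀ hγ0, one_mul]
  have h5 : (16 : ℝ) ≤ M ^ 4 := by
    calc (16 : ℝ) = 2 ^ 4 := by norm_num
      _ ≤ _ := by gcongr
  calc (T.card : ℝ) ≤ 2 + 8 * M ^ 4 * (K / c.2.2) := by
        have e : 4 * M ^ 4 * K / c.2.2 = 4 * M ^ 4 * (K / c.2.2) := by ring
        rw [e] at h1 h2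
        linarith
    _ ≤ (2 + 8 * M ^ 4) * (K / c.2.2) := by linarith
    _ ≤ (M ^ 4 * M ^ 4) * (K / c.2.2) := by
        gcongr
        nlinarith
    _ = _ := by ring

end SecE4

section SecE5

def NIm (c p : ℤ × ℤ × ℤ) : Prop :=
  ∃ g : ℤ, 0 < g ∧ -6 * c.1 = g * p.1 ∧ 27 * c.2.1 = g * p.2.1 ∧ 2 * c.2.2 = g * p.2.2

lemma nim_inj {c c' p : ℤ × ℤ × ℤ} (h : NIm c p) (h' : NIm c' p)
    (hc : NPrim c.1 c.2.1 c.2.2) (hc' : NPrim c'.1 c'.2.1 c'.2.2) (h0 : 1 ≤ c.2.2) (h0' : 1 ≤ c'.2.2) : c = c' := by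
  obtain ⟨g, hg, a1, a2, a3⟩ := h
  obtain ⟨g', hg', b1, b2, b3⟩ := h'
  obtain ⟨r, s, t, e⟩ := hc
  obtain ⟨r', s', t', e'⟩ := hc'
  have k1 : c.2.2 * c'.1 = c'.2.2 * c.1 := by
    have : (-12 : ℤ) * (c.2.2 * c'.1) = (-12) * (c'.2.2 * c.1) := by
      calc (-12 : ℤ) * (c.2.2 * c'.1) = (2 * c.2.2) * (-6 * c'.1) := by ring
        _ = (2 * c'.2.2) * (-6 * c.1) := by rw [a3, b1, b3, a1]; ring
        _ = _ := by ring
    exact mul_left_cancel₀ (by norm_num) this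
  have k2 : c.2.2 * c'.2.1 = c'.2.2 * c.2.1 := by
    have : (54 : ℤ) * (c.2.2 * c'.2.1) = 54 * (c'.2.2 * c.2.1) := by
      calc (54 : ℤ) * (c.2.2 * c'.2.1) = (2 * c.2.2) * (27 * c'.2.1) := by ring
        _ = (2 * c'.2.2) * (27 * c.2.1) := by rw [a3, b2, b3, a2]; ring
        _ = _ := by ring
    exact mul_left_cancel₀ (by norm_num) this
  obtain ⟨h1, h2, h3⟩ := nprim_eq (x := c.2.2) (y := c.1) (z := c.2.1) (x' := c'.2.2) (y' := c'.1) (z' := c'.2.1)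
    ⟨t, r, s, by linarith⟩ ⟨t', r', s', by linarith⟩ (by omega) (by omega) k1 k2
  exact Prod.ext h2 (Prod.ext h3 h1)

lemma nimage {M K n : ℝ} (hM : 2 ≤ M) {c : ℤ × ℤ × ℤ} (hc : NDense M K n c) :
    ∃ p : ℤ × ℤ × ℤ, NFam (M ^ 35) p.1 p.2.1 p.2.2 ∧ NPrim p.1 p.2.1 p.2.2 ∧ (p.1 : ℝ) ≤ 6 * M ^ 12 * c.2.2 ∧ NIm c p := by
  have hM0 : 0 < M := by linarith
  have hγ1 : (1 : ℝ) ≤ c.2.2 := by exact_mod_cast hc.pos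
  have hγ := hc.pos
  obtain ⟨g, x, y, z, hg, e1, e2, e3, hp, hz⟩ := exists_nprim (-6 * c.1) (27 * c.2.1) (2 * c.2.2) (by omega)
  have r1 : (-6 : ℝ) * c.1 = g * x := by exact_mod_cast e1
  have r2 : (27 : ℝ) * c.2.1 = g * y := by exact_mod_cast e2
  have r3 : (2 : ℝ) * c.2.2 = g * z := by exact_mod_cast e3
  have hg1 : (1 : ℝ) ≤ g := by exact_mod_cast hg
  have hg0 : (0 : ℝ) < g := by linarith
  obtain ⟨-, -, -, b1, b2, a1, a2, e⟩ := hc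
  generalize (c.1 : ℝ) = α at *
  generalize (c.2.1 : ℝ) = β at *
  generalize (c.2.2 : ℝ) = γ at *
  have hα : 0 < -α := by
    by_contra h
    have : 2 * M ^ 4 * (-α) ≤ 0 := mul_nonpos_of_nonneg_of_nonpos (by positivity) (by linarith)
    linarith
  have hβ : 0 < β := by
    by_contra h
    have : 2 * M ^ 3 * β ≤ 0 := mul_nonpos_of_nonneg_of_nonpos (by positivity) (by linarith)
    linarith
  have hx : (0 : ℝ) < x := by
    by_contra h
    have : (g : ℝ) * x ≤ 0 := mul_nonpos_of_nonneg_of_nonpos (by positivity) (by linarith)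
    linarith
  have hy : (0 : ℝ) < y := by
    by_contra h
    have : (g : ℝ) * y ≤ 0 := mul_nonpos_of_nonneg_of_nonpos (by positivity) (by linarith)
    linarith
  have hpw : ∀ k : ℕ, (2 : ℝ) ^ k ≤ M ^ k := fun k => by gcongr
  have hpm : ∀ i j : ℕ, i ≤ j → M ^ i ≤ M ^ j := fun i j h => pow_le_pow_right₀ (by linarith) h
  have p4 := hpw 4
  refine ⟨(x, y, z), ⟨?_, ?_, ?_, ?_, ?_⟩, hp, ?_, g, hg, e1, e2, e3⟩
  · exact_mod_cast hx
  · exact_mod_cast hy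
  · have : (g : ℝ) * x ≤ g * (M ^ 35 * y) := by
      calc (g : ℝ) * x = 6 * (-α) := by linarith
        _ ≤ 6 * (M ^ 12 * (2 * M ^ 3 * β)) := by gcongr; exact a2.trans (by gcongr)
        _ = (12/27) * M ^ 15 * (27 * β) := by ring
        _ ≤ 1 * M ^ 35 * (27 * β) := by
            gcongr
            · norm_num
            · linarith
            · norm_num
        _ = g * (M ^ 35 * y) := by rw [r2]; ring
    exact le_of_mul_le_mul_left this hg0
  · have : (g : ℝ) * y ≤ g * (M ^ 35 * x) := by
      calc (g : ℝ) * y = 27 * β := by linarith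
        _ ≤ 27 * (M ^ 9 * (2 * M ^ 4 * (-α))) := by gcongr; exact b2.trans (by gcongr)
        _ = 9 * M ^ 13 * (-6 * α) := by ring
        _ ≤ M ^ 4 * M ^ 13 * (-6 * α) := by
            gcongr
            · linarith
            · linarith
        _ = M ^ 17 * (-6 * α) := by ring
        _ ≤ M ^ 35 * (-6 * α) := mul_le_mul_of_nonneg_right (hpm 17 35 (by norm_num)) (by linarith)
        _ = g * (M ^ 35 * x) := by rw [r1]; ring
    exact le_of_mul_le_mul_left this hg0
  · have id : (g : ℝ) ^ 3 * ((y : ℝ) ^ 2 * z - (x : ℝ) ^ 3) = 54 * (4 * α ^ 3 + 27 * β ^ 2 * γ) := by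
      calc (g : ℝ) ^ 3 * ((y : ℝ) ^ 2 * z - (x : ℝ) ^ 3) = (g * y) ^ 2 * (g * z) - (g * x) ^ 3 := by ring
        _ = _ := by rw [← r1, ← r2, ← r3]; ring
    have hg3 : (0 : ℝ) < (g : ℝ) ^ 3 := by positivity
    have : (g : ℝ) ^ 3 * |(y : ℝ) ^ 2 * z - (x : ℝ) ^ 3| ≤ (g : ℝ) ^ 3 * (M ^ 35 * x) := by
      calc (g : ℝ) ^ 3 * |(y : ℝ) ^ 2 * z - (x : ℝ) ^ 3| = |(g : ℝ) ^ 3 * ((y : ℝ) ^ 2 * z - (x : ℝ) ^ 3)| := by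
            rw [abs_mul, abs_of_pos hg3]
        _ = 54 * |4 * α ^ 3 + 27 * β ^ 2 * γ| := by rw [id, abs_mul]; norm_num
        _ ≤ 54 * (M ^ 25 * (2 * M ^ 4 * (-α))) := by gcongr; exact e.trans (by gcongr)
        _ = 18 * M ^ 29 * (g * x) := by rw [← r1]; ring
        _ ≤ M ^ 6 * M ^ 29 * (g * x) := by
            gcongr
            linarith [hpw 6]
        _ = M ^ 35 * x * g ^ 1 := by ring
        _ ≤ M ^ 35 * x * g ^ 3 := by
            gcongr
            norm_num
        _ = _ := by ring
    exact le_of_mul_le_mul_left this hg3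
  · have : 1 * (x : ℝ) ≤ g * x := by gcongr
    simp only
    linarith

lemma nsum_c {M K n S : ℝ} (hM : 2 ≤ M) (hK : 1 ≤ K) (hn : M ^ 13 ≤ n)
    (hS : ∀ T : Finset (ℤ × ℤ × ℤ), (∀ p ∈ T, NFam (M ^ 35) p.1 p.2.1 p.2.2 ∧ NPrim p.1 p.2.1 p.2.2 ∧ (p.1 : ℝ) ≤ K / n) →
      ∑ p ∈ T, 1 / (p.1 : ℝ) ≤ S)
    (C : Finset (ℤ × ℤ × ℤ)) (hC : ∀ c ∈ C, NDense M K n c) :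
    ∑ c ∈ C, 1 / (c.2.2 : ℝ) ≤ 6 * M ^ 12 * S := by
  classical
  have hM0 : 0 < M := by linarith
  have hn0 : 0 < n := lt_of_lt_of_le (by positivity) hn
  have ex : ∀ c : ℤ × ℤ × ℤ, ∃ p : ℤ × ℤ × ℤ, c ∈ C → NFam (M ^ 35) p.1 p.2.1 p.2.2 ∧ NPrim p.1 p.2.1 p.2.2 ∧ (p.1 : ℝ) ≤ 6 * M ^ 12 * c.2.2 ∧ NIm c p := by
    intro c
    by_cases h : c ∈ C
    · obtain ⟨p, hp⟩ := nimage hM (hC c h)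
      exact ⟨p, fun _ => hp⟩
    · exact ⟨c, fun h' => absurd h' h⟩
  choose φ hφ using ex
  have hinj : Set.InjOn φ C := by
    intro c hc c' hc' h
    have h1 := (hφ c hc).2.2.2
    have h2 := (hφ c' hc').2.2.2
    rw [← h] at h2
    exact nim_inj h1 h2 (hC c hc).prim (hC c' hc').prim (hC c hc).pos (hC c' hc').pos
  have h1 := hS (C.image φ) (by
    intro p hp
    obtain ⟨c, hc, rfl⟩ := Finset.mem_image.1 hp
    obtain ⟨a, b, d, -⟩ := hφ c hc
    refine ⟨a, b, ?_⟩
    rw [le_div_iff₀ hn0]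
    have hs := (hC c hc).small
    have hγ1 : (1 : ℝ) ≤ c.2.2 := by exact_mod_cast (hC c hc).pos
    have h8 : (24 : ℝ) ≤ M ^ 8 := by
      calc (24 : ℝ) ≤ 2 ^ 8 := by norm_num
        _ ≤ _ := by gcongr
    have : 24 * M ^ 12 * (((φ c).1 : ℝ) * n) ≤ 24 * M ^ 12 * K := by
      calc 24 * M ^ 12 * (((φ c).1 : ℝ) * n) ≤ 24 * M ^ 12 * ((6 * M ^ 12 * c.2.2) * n) := by gcongr
        _ = 6 * M ^ 12 * (24 * M ^ 12 * (n * c.2.2)) := by ring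
        _ ≤ 6 * M ^ 12 * (M ^ 8 * M ^ 12 * (n * c.2.2)) := by gcongr
        _ = 6 * M ^ 12 * (n * c.2.2 * M ^ 20) := by ring
        _ ≤ 6 * M ^ 12 * (4 * K) := by gcongr
        _ = _ := by ring
    exact le_of_mul_le_mul_left this (by positivity))
  rw [Finset.sum_image hinj] at h1
  calc ∑ c ∈ C, 1 / (c.2.2 : ℝ) ≤ ∑ c ∈ C, 6 * M ^ 12 * (1 / ((φ c).1 : ℝ)) := by
        apply Finset.sum_le_sum
        intro c hc
        obtain ⟨a, b, d, -⟩ := hφ c hc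
        have hγ1 : (1 : ℝ) ≤ c.2.2 := by exact_mod_cast (hC c hc).pos
        have hx1 : (1 : ℝ) ≤ (φ c).1 := by exact_mod_cast a.xpos
        rw [mul_one_div, div_le_div_iff₀ (by linarith) (by linarith)]
        linarith
    _ = 6 * M ^ 12 * ∑ c ∈ C, 1 / ((φ c).1 : ℝ) := by rw [Finset.mul_sum]
    _ ≤ _ := by gcongr

lemma nstep {M K n S : ℝ} (hM : 2 ≤ M) (hK : 1 ≤ K) (hn : M ^ 13 ≤ n)
    (hS : ∀ T : Finset (ℤ × ℤ × ℤ), (∀ p ∈ T, NFam (M ^ 35) p.1 p.2.1 p.2.2 ∧ NPrim p.1 p.2.1 p.2.2 ∧ (p.1 : ℝ) ≤ K / n) →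
      ∑ p ∈ T, 1 / (p.1 : ℝ) ≤ S)
    (T : Finset (ℤ × ℤ × ℤ)) (hT : ∀ p ∈ T, NPt M K p) :
    (T.card : ℝ) ≤ (M ^ 21 * K + 1) * (n + 1) + 6 * M ^ 20 * K * S := by
  classical
  have hM0 : 0 < M := by linarith
  have hK0 : 0 < K := by linarith
  have hn0 : 0 < n := lt_of_lt_of_le (by positivity) hn
  set L := M ^ 20 * K with hL
  have hL0 : 0 < L := by positivity
  set bk : ℤ × ℤ × ℤ → ℤ := fun p => ⌊nsl p * L⌋ with hbk
  have hbr : ∀ p ∈ T, bk p ∈ Finset.Icc (0 : ℤ) ⌊M ^ 21 * K⌋ := by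
    intro p hp
    have h := hT p hp
    have hp0 := npt_pos hK h
    have hs0 : 0 ≤ nsl p := by
      unfold nsl
      have : (1 : ℝ) ≤ p.2.1 := by exact_mod_cast h.1.ypos
      positivity
    have hs1 : nsl p ≤ M := by
      unfold nsl
      rw [div_le_iff₀ hp0]
      exact h.1.hyx
    rw [Finset.mem_Icc]
    constructor
    · exact Int.floor_nonneg.2 (by positivity)
    · apply Int.floor_le_floor
      calc nsl p * L ≤ M * L := by gcongr
        _ = _ := by rw [hL]; ring
  set I := Finset.Icc (0 : ℤ) ⌊M ^ 21 * K⌋ with hI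
  have hIcard : (I.card : ℝ) ≤ M ^ 21 * K + 1 := by
    have h0 : 0 ≤ ⌊M ^ 21 * K⌋ := Int.floor_nonneg.2 (by positivity)
    have : (I.card : ℤ) = ⌊M ^ 21 * K⌋ + 1 := by
      rw [hI, Int.card_Icc]; omega
    have h2 : (I.card : ℝ) = (⌊M ^ 21 * K⌋ : ℝ) + 1 := by exact_mod_cast this
    rw [h2]
    have := Int.floor_le (M ^ 21 * K)
    linarith
  set dn : ℤ → Prop := fun b => n + 1 ≤ ((T.filter (fun p => bk p = b)).card : ℝ) with hdn
  have ex : ∀ b : ℤ, ∃ c : ℤ × ℤ × ℤ, dn b → NDense M K n c ∧ ∀ p ∈ T.filter (fun p => bk p = b), NOn M c p := by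
    intro b
    by_cases h : dn b
    · obtain ⟨c, hc⟩ := ndense_block hM hK hn (T.filter (fun p => bk p = b))
        (fun p hp => hT p (Finset.mem_filter.1 hp).1) h (by
          intro p hp q hq
          have h1 : bk p = b := (Finset.mem_filter.1 hp).2
          have h2 : bk q = b := (Finset.mem_filter.1 hq).2
          have h3 : |nsl p * L - nsl q * L| < 1 := Int.abs_sub_lt_one_of_floor_eq_floor (h1.trans h2.symm)
          rw [le_div_iff₀ hL0]
          rw [← sub_mul, abs_mul, abs_of_pos hL0] at h3
          exact h3.le)
      exact ⟨c, fun _ => hc⟩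
    · exact ⟨(0, 0, 0), fun h' => absurd h' h⟩
  choose cc hcc using ex
  have hsplit : T.card = (T.filter (fun p => dn (bk p))).card + (T.filter (fun p => ¬ dn (bk p))).card :=
    (Finset.card_filter_add_card_filter_not _).symm
  have hsparse : ((T.filter (fun p => ¬ dn (bk p))).card : ℝ) ≤ (M ^ 21 * K + 1) * (n + 1) := by
    have e := Finset.card_eq_sum_card_fiberwise (f := bk) (s := T.filter (fun p => ¬ dn (bk p))) (t := I)
      (fun p hp => hbr p (Finset.mem_filter.1 hp).1)
    rw [e]
    push_cast
    calc ∑ b ∈ I, (((T.filter (fun p => ¬ dn (bk p))).filter (fun p => bk p = b)).card : ℝ) ≤ ∑ b ∈ I, (n + 1) := by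
          apply Finset.sum_le_sum
          intro b hb
          by_cases h : dn b
          · have : (T.filter (fun p => ¬ dn (bk p))).filter (fun p => bk p = b) = ∅ := by
              apply Finset.filter_eq_empty_iff.2
              intro p hp hpb
              apply (Finset.mem_filter.1 hp).2
              rw [hpb]; exact h
            rw [this]; simp; linarith
          · have h' : ((T.filter (fun p => bk p = b)).card : ℝ) < n + 1 := not_le.1 h
            refine le_trans ?_ h'.le
            exact_mod_cast Finset.card_le_card (Finset.filter_subset_filter _ (Finset.filter_subset _ _))
      _ = I.card * (n + 1) := by rw [Finset.sum_const, nsmul_eq_mul]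
      _ ≤ _ := by gcongr
  set C := (T.filter (fun p => dn (bk p))).image (fun p => cc (bk p)) with hC
  have hCd : ∀ c ∈ C, NDense M K n c := by
    intro c hc
    obtain ⟨p, hp, rfl⟩ := Finset.mem_image.1 hc
    exact (hcc _ (Finset.mem_filter.1 hp).2).1
  have hdense : ((T.filter (fun p => dn (bk p))).card : ℝ) ≤ 6 * M ^ 20 * K * S := by
    have e := Finset.card_eq_sum_card_fiberwise (f := fun p => cc (bk p)) (s := T.filter (fun p => dn (bk p))) (t := C)
      (fun p hp => Finset.mem_image_of_mem _ hp)
    rw [e]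
    push_cast
    calc ∑ c ∈ C, (((T.filter (fun p => dn (bk p))).filter (fun p => cc (bk p) = c)).card : ℝ)
        ≤ ∑ c ∈ C, M ^ 8 * K * (1 / (c.2.2 : ℝ)) := by
          apply Finset.sum_le_sum
          intro c hc
          have := ncount_c hM hK hn (hCd c hc) ((T.filter (fun p => dn (bk p))).filter (fun p => cc (bk p) = c)) (by
            intro p hp
            obtain ⟨h1, h2⟩ := Finset.mem_filter.1 hp
            obtain ⟨h3, h4⟩ := Finset.mem_filter.1 h1
            refine ⟨hT p h3, ?_⟩
            rw [← h2]
            exact (hcc _ h4).2 p (Finset.mem_filter.2 ⟨h3, rfl⟩))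
          rw [mul_one_div]; exact this
      _ = M ^ 8 * K * ∑ c ∈ C, 1 / (c.2.2 : ℝ) := by rw [Finset.mul_sum]
      _ ≤ M ^ 8 * K * (6 * M ^ 12 * S) := by
          gcongr
          exact nsum_c hM hK hn hS C hCd
      _ = _ := by ring
  rw [hsplit]
  push_cast
  linarith only [hsparse, hdense]

end SecE5

section SecE6

def NP (j : ℕ) : Prop := ∃ C : ℕ, ∀ M : ℝ, 2 ≤ M → ∀ X : ℝ, 0 < X → ∀ T : Finset (ℤ × ℤ × ℤ),
  (∀ p ∈ T, NFam M p.1 p.2.1 p.2.2 ∧ NPrim p.1 p.2.1 p.2.2 ∧ (p.1 : ℝ) ≤ X) →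
  ∑ p ∈ T, 1 / (p.1 : ℝ) ≤ M ^ C * X ^ ((1 : ℝ) / j)

lemma int_card_le (B : Finset ℤ) (a b : ℝ) (hab : a ≤ b) (h : ∀ z ∈ B, a ≤ (z : ℝ) ∧ (z : ℝ) ≤ b) : (B.card : ℝ) ≤ b - a + 1 := by
  rcases B.eq_empty_or_nonempty with h0 | hne
  · subst h0; simp; linarith
  have := spaced_card B (fun z : ℤ => (z : ℝ)) 1 a b one_pos hne (by
    intro i _ j _ hij
    have : 1 ≤ |i - j| := Int.one_le_abs (sub_ne_zero.2 hij)
    exact_mod_cast this) (fun z hz => (h z hz).1) (fun z hz => (h z hz).2)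
  linarith

lemma nfam_card_xy {M : ℝ} (hM : 2 ≤ M) (T : Finset (ℤ × ℤ × ℤ)) (x y : ℤ)
    (hT : ∀ p ∈ T, NFam M p.1 p.2.1 p.2.2 ∧ p.1 = x ∧ p.2.1 = y) : (T.card : ℝ) ≤ 2 * M ^ 2 + 1 := by
  classical
  rcases T.eq_empty_or_nonempty with h0 | ⟨p0, hp0⟩
  · subst h0; simp; positivity
  have hinj : Set.InjOn (fun p : ℤ × ℤ × ℤ => p.2.2) T := by
    intro p hp q hq h
    obtain ⟨-, h1, h2⟩ := hT p hp
    obtain ⟨-, h3, h4⟩ := hT q hq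
    exact Prod.ext (h1.trans h3.symm) (Prod.ext (h2.trans h4.symm) h)
  rw [← Finset.card_image_of_injOn hinj]
  obtain ⟨h, e1, e2⟩ := hT p0 hp0
  have hM0 : 0 < M := by linarith
  have hx : (1 : ℝ) ≤ x := by rw [← e1]; exact_mod_cast h.xpos
  have hy : (1 : ℝ) ≤ y := by rw [← e2]; exact_mod_cast h.ypos
  have hy0 : (0 : ℝ) < y := by linarith
  have := int_card_le (T.image (fun p : ℤ × ℤ × ℤ => p.2.2)) ((x : ℝ) ^ 3 / y ^ 2 - M ^ 2) ((x : ℝ) ^ 3 / y ^ 2 + M ^ 2)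
    (by nlinarith) (by
      intro z hz
      obtain ⟨p, hp, rfl⟩ := Finset.mem_image.1 hz
      obtain ⟨h, e1, e2⟩ := hT p hp
      have h1 := h.hz
      have h2 := h.hxy
      rw [e1, e2] at h1
      rw [e1, e2] at h2
      have e : (y : ℝ) ^ 2 * p.2.2 - (x : ℝ) ^ 3 = y ^ 2 * (p.2.2 - (x : ℝ) ^ 3 / y ^ 2) := by field_simp
      rw [e, abs_mul, abs_of_pos (by positivity)] at h1
      have h3 : (y : ℝ) ^ 2 * |(p.2.2 : ℝ) - (x : ℝ) ^ 3 / y ^ 2| ≤ y ^ 2 * M ^ 2 := by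
        calc _ ≤ M * x := h1
          _ ≤ M * (M * y) := by gcongr
          _ = y * M ^ 2 := by ring
          _ ≤ y ^ 2 * M ^ 2 := by gcongr; nlinarith
      have h4 := abs_le.1 (le_of_mul_le_mul_left h3 (by positivity))
      constructor <;> linarith [h4.1, h4.2])
  linarith

lemma nfam_card_x {M : ℝ} (hM : 2 ≤ M) (T : Finset (ℤ × ℤ × ℤ)) (x : ℤ) (hx : 1 ≤ x)
    (hT : ∀ p ∈ T, NFam M p.1 p.2.1 p.2.2 ∧ p.1 = x) : (T.card : ℝ) ≤ M ^ 5 * x := by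
  classical
  have hM0 : 0 < M := by linarith
  have hx1 : (1 : ℝ) ≤ x := by exact_mod_cast hx
  have hm : ∀ p ∈ T, p.2.1 ∈ Finset.Icc (1 : ℤ) ⌊M * x⌋ := by
    intro p hp
    obtain ⟨h, e⟩ := hT p hp
    rw [Finset.mem_Icc]
    refine ⟨h.ypos, Int.le_floor.2 ?_⟩
    rw [← e]; exact h.hyx
  rw [Finset.card_eq_sum_card_fiberwise (f := fun p : ℤ × ℤ × ℤ => p.2.1) (t := Finset.Icc (1 : ℤ) ⌊M * x⌋) hm]
  push_cast
  have hc : ((Finset.Icc (1 : ℤ) ⌊M * x⌋).card : ℝ) ≤ M * x := by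
    have h0 : 0 ≤ ⌊M * (x : ℝ)⌋ := Int.floor_nonneg.2 (by positivity)
    have : ((Finset.Icc (1 : ℤ) ⌊M * x⌋).card : ℤ) = ⌊M * x⌋ := by
      rw [Int.card_Icc]; omega
    have h2 : ((Finset.Icc (1 : ℤ) ⌊M * x⌋).card : ℝ) = (⌊M * x⌋ : ℝ) := by exact_mod_cast this
    rw [h2]
    exact Int.floor_le _
  calc ∑ y ∈ Finset.Icc (1 : ℤ) ⌊M * x⌋, ((T.filter (fun p : ℤ × ℤ × ℤ => p.2.1 = y)).card : ℝ)
      ≤ ∑ y ∈ Finset.Icc (1 : ℤ) ⌊M * x⌋, (2 * M ^ 2 + 1) := by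
        apply Finset.sum_le_sum
        intro y hy
        exact nfam_card_xy hM _ x y (fun p hp => ⟨(hT p (Finset.mem_filter.1 hp).1).1, (hT p (Finset.mem_filter.1 hp).1).2, (Finset.mem_filter.1 hp).2⟩)
    _ ≤ (M * x) * (2 * M ^ 2 + 1) := by
        rw [Finset.sum_const, nsmul_eq_mul]; gcongr
    _ ≤ (M * x) * M ^ 4 := by
        gcongr
        have : 4 ≤ M ^ 2 := by nlinarith only [hM]
        nlinarith only [this]
    _ = _ := by ring

lemma np_one : NP 1 := by
  classical
  refine ⟨5, fun M hM X hX T hT => ?_⟩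
  have hM0 : 0 < M := by linarith
  have hm : ∀ p ∈ T, p.1 ∈ Finset.Icc (1 : ℤ) ⌊X⌋ := by
    intro p hp
    obtain ⟨h, -, e⟩ := hT p hp
    rw [Finset.mem_Icc]
    exact ⟨h.xpos, Int.le_floor.2 e⟩
  rw [← Finset.sum_fiberwise_of_maps_to hm]
  have hc : ((Finset.Icc (1 : ℤ) ⌊X⌋).card : ℝ) ≤ X := by
    have h0 : 0 ≤ ⌊X⌋ := Int.floor_nonneg.2 (by positivity)
    have : ((Finset.Icc (1 : ℤ) ⌊X⌋).card : ℤ) = ⌊X⌋ := by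
      rw [Int.card_Icc]; omega
    have h2 : ((Finset.Icc (1 : ℤ) ⌊X⌋).card : ℝ) = (⌊X⌋ : ℝ) := by exact_mod_cast this
    rw [h2]
    exact Int.floor_le _
  calc ∑ x ∈ Finset.Icc (1 : ℤ) ⌊X⌋, ∑ p ∈ T.filter (fun p : ℤ × ℤ × ℤ => p.1 = x), 1 / (p.1 : ℝ)
      ≤ ∑ x ∈ Finset.Icc (1 : ℤ) ⌊X⌋, M ^ 5 := by
        apply Finset.sum_le_sum
        intro x hx
        have hx1 := (Finset.mem_Icc.1 hx).1
        have hx1' : (1 : ℝ) ≤ x := by exact_mod_cast hx1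
        have := nfam_card_x hM (T.filter (fun p : ℤ × ℤ × ℤ => p.1 = x)) x hx1
          (fun p hp => ⟨(hT p (Finset.mem_filter.1 hp).1).1, (Finset.mem_filter.1 hp).2⟩)
        rw [Finset.sum_congr rfl (g := fun _ => 1 / (x : ℝ)) (fun p hp => by rw [(Finset.mem_filter.1 hp).2])]
        rw [Finset.sum_const, nsmul_eq_mul, mul_one_div, div_le_iff₀ (by linarith)]
        exact this
    _ ≤ X * M ^ 5 := by
        rw [Finset.sum_const, nsmul_eq_mul]; gcongr
    _ = _ := by simp; ring

lemma ndyadic {j C : ℕ} (hj : 1 ≤ j) (hC : ∀ M : ℝ, 2 ≤ M → ∀ X : ℝ, 0 < X → ∀ T : Finset (ℤ × ℤ × ℤ),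
    (∀ p ∈ T, NFam M p.1 p.2.1 p.2.2 ∧ NPrim p.1 p.2.1 p.2.2 ∧ (p.1 : ℝ) ≤ X) →
    ∑ p ∈ T, 1 / (p.1 : ℝ) ≤ M ^ C * X ^ ((1 : ℝ) / j)) {M K : ℝ} (hM : 2 ≤ M) (hK : 1 ≤ K)
    (T : Finset (ℤ × ℤ × ℤ)) (hT : ∀ p ∈ T, NPt M K p) :
    ∑ p ∈ T, 1 / (p.1 : ℝ) ≤ M ^ (60 + 35 * C) * K ^ ((1 : ℝ) / (j + 1 : ℕ)) := by
  have hM0 : 0 < M := by linarith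
  have hK0 : 0 < K := by linarith
  have hj0 : (0 : ℝ) < j := by exact_mod_cast hj
  set κ := K ^ ((1 : ℝ) / (j + 1 : ℕ)) with hκ
  have hκ1 : 1 ≤ κ := Real.one_le_rpow hK (by positivity)
  have hκ0 : 0 < κ := by linarith
  have hM13 : 1 ≤ M ^ 13 := one_le_pow₀ (by linarith)
  have hpw : ∀ k : ℕ, (2 : ℝ) ^ k ≤ M ^ k := fun k => by gcongr
  have hpm : ∀ i j : ℕ, i ≤ j → M ^ i ≤ M ^ j := fun i j h => pow_le_pow_right₀ (by linarith) h
  have hX : K / (M ^ 13 * κ) ≤ κ ^ (j : ℝ) := by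
    rw [div_le_iff₀ (by positivity)]
    have e : κ ^ (j : ℝ) * κ = K := by
      rw [hκ, ← Real.rpow_mul hK0.le, ← Real.rpow_add hK0]
      have : (1 : ℝ) / (j + 1 : ℕ) * j + 1 / (j + 1 : ℕ) = 1 := by push_cast; field_simp
      rw [this, Real.rpow_one]
    calc K = κ ^ (j : ℝ) * (1 * κ) := by rw [one_mul, e]
      _ ≤ _ := by gcongr
  have hstep := nstep (M := M) (K := K) (n := M ^ 13 * κ) (S := (M ^ 35) ^ C * κ) hM hK
    (le_mul_of_one_le_right (by positivity) hκ1) (by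
      intro T' hT'
      refine (hC (M ^ 35) ?_ (K / (M ^ 13 * κ)) (by positivity) T' hT').trans ?_
      · calc (2 : ℝ) ≤ 2 ^ 35 := by norm_num
          _ ≤ _ := hpw 35
      · gcongr
        calc (K / (M ^ 13 * κ)) ^ ((1 : ℝ) / j) ≤ (κ ^ (j : ℝ)) ^ ((1 : ℝ) / j) := by gcongr
          _ = κ := by rw [← Real.rpow_mul hκ0.le, mul_one_div, div_self hj0.ne', Real.rpow_one]) T hT
  have hcard : (T.card : ℝ) ≤ K * (M ^ (60 + 35 * C) * κ) := by
    refine hstep.trans ?_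
    have p21 : 1 ≤ M ^ 21 := one_le_pow₀ (by linarith)
    have t1 : M ^ 21 * K + 1 ≤ 2 * (M ^ 21 * K) := by
      have := one_le_mul_of_one_le_of_one_le p21 hK; linarith
    have t2 : M ^ 13 * κ + 1 ≤ 2 * (M ^ 13 * κ) := by
      have := one_le_mul_of_one_le_of_one_le hM13 hκ1; linarith
    have t3 : (1 : ℝ) ≤ (M ^ 35) ^ C := one_le_pow₀ (one_le_pow₀ (by linarith))
    have t4 : (10 : ℝ) ≤ M ^ 4 := by linarith [hpw 4]
    calc (M ^ 21 * K + 1) * (M ^ 13 * κ + 1) + 6 * M ^ 20 * K * ((M ^ 35) ^ C * κ)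
        ≤ (2 * (M ^ 21 * K)) * (2 * (M ^ 13 * κ)) + 6 * M ^ 20 * K * ((M ^ 35) ^ C * κ) := by gcongr
      _ = (4 * M ^ 34 * 1 + 6 * M ^ 20 * (M ^ 35) ^ C) * (K * κ) := by ring
      _ ≤ (4 * M ^ 34 * (M ^ 35) ^ C + 6 * M ^ 34 * (M ^ 35) ^ C) * (K * κ) := by
          have := hpm 20 34 (by norm_num)
          gcongr
      _ = (10 * M ^ 34 * (M ^ 35) ^ C) * (K * κ) := by ring
      _ ≤ (M ^ 4 * M ^ 34 * (M ^ 35) ^ C) * (K * κ) := by gcongr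
      _ = M ^ (38 + 35 * C) * (K * κ) := by ring
      _ ≤ M ^ (60 + 35 * C) * (K * κ) := by
          have := hpm (38 + 35 * C) (60 + 35 * C) (by omega)
          gcongr
      _ = _ := by ring
  calc ∑ p ∈ T, 1 / (p.1 : ℝ) ≤ ∑ p ∈ T, 1 / K := by
        apply Finset.sum_le_sum
        intro p hp
        have := (hT p hp).2.2.1
        gcongr
    _ = T.card / K := by rw [Finset.sum_const, nsmul_eq_mul, mul_one_div]
    _ ≤ _ := by rw [div_le_iff₀ hK0]; linarith

lemma np_succ {j : ℕ} (hj : 1 ≤ j) (h : NP j) : NP (j + 1) := by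
  classical
  obtain ⟨C, hC⟩ := h
  set e : ℝ := (1 : ℝ) / (j + 1 : ℕ) with he
  have he0 : 0 < e := by positivity
  set r : ℝ := (2 : ℝ) ^ e with hr
  have hr1 : 1 < r := Real.one_lt_rpow (by norm_num) he0
  have hr2 : r ≤ 2 := by
    calc r ≤ 2 ^ (1 : ℝ) := by
          apply Real.rpow_le_rpow_of_exponent_le (by norm_num)
          rw [he, div_le_one (by positivity)]
          push_cast; linarith [(Nat.cast_nonneg j : (0:ℝ) ≤ j)]
      _ = 2 := by simp
  obtain ⟨c, hc⟩ := pow_unbounded_of_one_lt (2 / (r - 1)) (by norm_num : (1 : ℝ) < 2)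
  have hr0 : 0 < r - 1 := by linarith
  refine ⟨c + (60 + 35 * C), fun M hM X hX T hT => ?_⟩
  have hM0 : 0 < M := by linarith
  set C' := M ^ (60 + 35 * C) with hC'
  have hC'0 : 0 < C' := by positivity
  have key : ∀ I : ℕ, ∀ T : Finset (ℤ × ℤ × ℤ), (∀ p ∈ T, NFam M p.1 p.2.1 p.2.2 ∧ NPrim p.1 p.2.1 p.2.2 ∧ (p.1 : ℝ) < 2 ^ I) →
      ∑ p ∈ T, 1 / (p.1 : ℝ) ≤ C' / (r - 1) * r ^ I := by
    intro I
    induction I with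
    | zero =>
      intro T hT
      have : T = ∅ := by
        apply Finset.eq_empty_of_forall_notMem
        intro p hp
        obtain ⟨h1, -, h2⟩ := hT p hp
        have : (1 : ℝ) ≤ p.1 := by exact_mod_cast h1.xpos
        simp at h2
        linarith
      rw [this]; simp; positivity
    | succ I ih =>
      intro T hT
      rw [← Finset.sum_filter_add_sum_filter_not T (fun p => (p.1 : ℝ) < 2 ^ I)]
      have h1 := ih (T.filter (fun p => (p.1 : ℝ) < 2 ^ I)) (fun p hp => by
        obtain ⟨a, b⟩ := Finset.mem_filter.1 hp
        exact ⟨(hT p a).1, (hT p a).2.1, b⟩)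
      have h2 := ndyadic hj hC hM (K := 2 ^ I) (one_le_pow₀ (by norm_num)) (T.filter (fun p => ¬ (p.1 : ℝ) < 2 ^ I)) (fun p hp => by
        obtain ⟨a, b⟩ := Finset.mem_filter.1 hp
        refine ⟨(hT p a).1, (hT p a).2.1, not_lt.1 b, ?_⟩
        have := (hT p a).2.2
        rw [pow_succ] at this
        linarith)
      have e2 : ((2 : ℝ) ^ I) ^ e = r ^ I := by
        rw [hr, ← Real.rpow_natCast, ← Real.rpow_mul (by norm_num), mul_comm, Real.rpow_mul (by norm_num), Real.rpow_natCast]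
      rw [e2] at h2
      calc _ ≤ C' / (r - 1) * r ^ I + C' * r ^ I := add_le_add h1 h2
        _ = _ := by rw [pow_succ]; field_simp; ring
  by_cases hX1 : X < 1
  · have : T = ∅ := by
      apply Finset.eq_empty_of_forall_notMem
      intro p hp
      obtain ⟨h1, -, h2⟩ := hT p hp
      have : (1 : ℝ) ≤ p.1 := by exact_mod_cast h1.xpos
      linarith
    rw [this]; simp; positivity
  push Not at hX1
  obtain ⟨I, hI1, hI2⟩ := exists_nat_pow_near hX1 (by norm_num : (1 : ℝ) < 2)
  have h3 := key (I + 1) T (fun p hp => ⟨(hT p hp).1, (hT p hp).2.1, (hT p hp).2.2.trans_lt hI2⟩)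
  have h4 : r ^ I ≤ X ^ e := by
    calc r ^ I = ((2 : ℝ) ^ I) ^ e := by
          rw [hr, ← Real.rpow_natCast, ← Real.rpow_mul (by norm_num), mul_comm, Real.rpow_mul (by norm_num), Real.rpow_natCast]
      _ ≤ _ := by gcongr
  refine h3.trans ?_
  calc C' / (r - 1) * r ^ (I + 1) = C' / (r - 1) * (r ^ I * r) := by rw [pow_succ]
    _ ≤ C' / (r - 1) * (X ^ e * 2) := by gcongr
    _ = (2 / (r - 1)) * C' * X ^ e := by ring
    _ ≤ 2 ^ c * C' * X ^ e := by gcongr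
    _ ≤ M ^ c * C' * X ^ e := by gcongr
    _ = _ := by rw [hC']; ring

lemma np_all (j : ℕ) (hj : 1 ≤ j) : NP j := by
  induction j, hj using Nat.le_induction with
  | base => exact np_one
  | succ j hj ih => exact np_succ hj ih

/-- version for all (not nec. primitive) triples -/
lemma np_full (j : ℕ) (hj : 1 ≤ j) : ∃ C : ℕ, ∀ M : ℝ, 2 ≤ M → ∀ X : ℝ, 1 ≤ X → ∀ T : Finset (ℤ × ℤ × ℤ),
    (∀ p ∈ T, NFam M p.1 p.2.1 p.2.2 ∧ (p.1 : ℝ) ≤ X) →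
    ∑ p ∈ T, 1 / (p.1 : ℝ) ≤ M ^ C * X ^ ((1 : ℝ) / j) * (1 + Real.log X) := by
  classical
  obtain ⟨C, hC⟩ := np_all j hj
  refine ⟨C, fun M hM X hX T hT => ?_⟩
  have hM0 : 0 < M := by linarith
  have ex : ∀ p : ℤ × ℤ × ℤ, ∃ gq : ℤ × ℤ × ℤ × ℤ, p ∈ T → (1 ≤ gq.1 ∧ (gq.1 : ℝ) ≤ X) ∧ (NFam M gq.2.1 gq.2.2.1 gq.2.2.2 ∧
      NPrim gq.2.1 gq.2.2.1 gq.2.2.2 ∧ (gq.2.1 : ℝ) ≤ X) ∧ p = (gq.1 * gq.2.1, gq.1 * gq.2.2.1, gq.1 * gq.2.2.2) := by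
    intro p
    by_cases hp : p ∈ T
    swap
    · exact ⟨(0, p), fun h => absurd h hp⟩
    obtain ⟨h, hx⟩ := hT p hp
    obtain ⟨g, z, y, x, hg, e1, e2, e3, hpr, hx0⟩ := exists_nprim p.2.2 p.2.1 p.1 (by linarith [h.xpos])
    have hg1 : (1 : ℝ) ≤ g := by exact_mod_cast hg
    have hg0 : (0 : ℝ) < g := by linarith
    have hx1 : (1 : ℝ) ≤ x := by exact_mod_cast hx0
    have r1 : (p.1 : ℝ) = g * x := by exact_mod_cast e3
    have r2 : (p.2.1 : ℝ) = g * y := by exact_mod_cast e2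
    have r3 : (p.2.2 : ℝ) = g * z := by exact_mod_cast e1
    obtain ⟨a1, a2, a3, a4, a5⟩ := h
    refine ⟨(g, x, y, z), fun _ => ⟨⟨hg, ?_⟩, ⟨⟨hx0, ?_, ?_, ?_, ?_⟩, ?_, ?_⟩, ?_⟩⟩
    · rw [r1] at hx; simp only; nlinarith
    · simp only
      rw [e2] at a2
      by_contra hcon
      push Not at hcon
      nlinarith
    · simp only
      rw [r1, r2] at a3
      have : (g : ℝ) * x ≤ g * (M * y) := by linarith
      exact le_of_mul_le_mul_left this hg0
    · simp only
      rw [r1, r2] at a4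
      have : (g : ℝ) * y ≤ g * (M * x) := by linarith
      exact le_of_mul_le_mul_left this hg0
    · simp only
      rw [r1, r2, r3] at a5
      have e : ((g : ℝ) * y) ^ 2 * (g * z) - (g * x) ^ 3 = g ^ 3 * ((y : ℝ) ^ 2 * z - x ^ 3) := by ring
      rw [e, abs_mul, abs_of_pos (by positivity)] at a5
      have : (g : ℝ) ^ 3 * |(y : ℝ) ^ 2 * z - x ^ 3| ≤ g ^ 3 * (M * x) := by
        calc _ ≤ M * (g * x) := a5
          _ = g ^ 1 * (M * x) := by ring
          _ ≤ _ := by gcongr; norm_num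
      exact le_of_mul_le_mul_left this (by positivity)
    · obtain ⟨r, s, t, e⟩ := hpr
      exact ⟨t, s, r, by simp only; linarith⟩
    · rw [r1] at hx; simp only; nlinarith
    · exact Prod.ext e3 (Prod.ext e2 e1)
  choose φ hφ using ex
  have hm : ∀ p ∈ T, (φ p).1 ∈ Finset.Icc (1 : ℤ) ⌊X⌋ := by
    intro p hp
    rw [Finset.mem_Icc]
    exact ⟨(hφ p hp).1.1, Int.le_floor.2 (hφ p hp).1.2⟩
  rw [← Finset.sum_fiberwise_of_maps_to hm]
  have hb : ∀ g ∈ Finset.Icc (1 : ℤ) ⌊X⌋, ∑ p ∈ T.filter (fun p => (φ p).1 = g), 1 / (p.1 : ℝ) ≤ (M ^ C * X ^ ((1 : ℝ) / j)) * (1 / (g : ℝ)) := by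
    intro g hg
    have hg1 : (1 : ℝ) ≤ g := by exact_mod_cast (Finset.mem_Icc.1 hg).1
    have hinj : Set.InjOn (fun p => (φ p).2) (T.filter (fun p => (φ p).1 = g)) := by
      intro p hp q hq hpq
      obtain ⟨a, b⟩ := Finset.mem_filter.1 hp
      obtain ⟨a', b'⟩ := Finset.mem_filter.1 hq
      have e : φ p = φ q := Prod.ext (b.trans b'.symm) hpq
      rw [(hφ p a).2.2, (hφ q a').2.2, e]
    have h1 := hC M hM X (by linarith) ((T.filter (fun p => (φ p).1 = g)).image (fun p => (φ p).2)) (by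
      intro q hq
      obtain ⟨p, hp, rfl⟩ := Finset.mem_image.1 hq
      exact (hφ p (Finset.mem_filter.1 hp).1).2.1)
    rw [Finset.sum_image hinj] at h1
    calc ∑ p ∈ T.filter (fun p => (φ p).1 = g), 1 / (p.1 : ℝ) = (∑ p ∈ T.filter (fun p => (φ p).1 = g), 1 / ((φ p).2.1 : ℝ)) * (1 / (g : ℝ)) := by
          rw [Finset.sum_mul]
          apply Finset.sum_congr rfl
          intro p hp
          obtain ⟨a, b⟩ := Finset.mem_filter.1 hp
          have e := congrArg Prod.fst (hφ p a).2.2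
          simp only at e
          rw [b] at e
          have e' : (p.1 : ℝ) = g * (φ p).2.1 := by exact_mod_cast e
          rw [e']
          rw [one_div, mul_inv, one_div, one_div, mul_comm]
      _ ≤ _ := by gcongr
  refine (Finset.sum_le_sum hb).trans ?_
  rw [← Finset.mul_sum]
  gcongr
  have hh := harmonic_floor_le_one_add_log X hX
  refine le_trans (le_of_eq ?_) hh
  rw [harmonic_eq_sum_Icc]
  push_cast
  have hfl : ((⌊X⌋₊ : ℕ) : ℤ) = ⌊X⌋ := Int.natCast_floor_eq_floor (by linarith)
  symm
  apply Finset.sum_bij (fun (i : ℕ) _ => (i : ℤ))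
  · intro i hi
    rw [Finset.mem_Icc] at hi ⊢
    omega
  · intro i _ j _ h; exact_mod_cast h
  · intro b hb
    rw [Finset.mem_Icc] at hb
    exact ⟨b.toNat, by rw [Finset.mem_Icc]; omega, by omega⟩
  · intro i _; simp

end SecE6

section SecF1

lemma int_relation {k : ℕ} {ι : Type*} (T : Finset ι) (v : ι → Fin k → ℤ)
    (h : ∀ p : Fin k → ι, (∀ i, p i ∈ T) → Matrix.det (Matrix.of fun i => v (p i)) = 0) :
    ∃ c : Fin k → ℤ, (∀ d : ℤ, (∀ i, d ∣ c i) → IsUnit d) ∧ ∀ t ∈ T, ∑ i, c i * v t i = 0 := by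
  classical
  set v' : ι → Fin k → ℚ := fun t i => (v t i : ℚ) with hv'
  set W := Submodule.span ℚ (Set.image v' T) with hW
  have hWtop : W < ⊤ := by
    rw [lt_top_iff_ne_top]
    intro htop
    obtain ⟨b, hbs, hspan, hli⟩ := exists_linearIndependent ℚ (Set.image v' T)
    have hsp : ⊤ ≤ Submodule.span ℚ (Set.range (Subtype.val : b → (Fin k → ℚ))) := by
      rw [Subtype.range_coe, hspan, ← hW, htop]
    let B := Module.Basis.mk hli hsp
    have hbfin : Finite b := Set.Finite.subset (T.finite_toSet.image v') hbs |>.to_subtype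
    have hcard : Nat.card b = k := by
      have := Module.finrank_eq_nat_card_basis B
      rw [← this]; simp
    let e : Fin k ≃ b := (Finite.equivFinOfCardEq hcard).symm
    have hex : ∀ i : Fin k, ∃ t ∈ T, v' t = (e i : Fin k → ℚ) := by
      intro i
      obtain ⟨t, ht, h2⟩ := hbs (e i).2
      exact ⟨t, ht, h2⟩
    choose p hp hpe using hex
    have hdet := h p hp
    have hli2 : LinearIndependent ℚ (fun i => ((e i : b) : Fin k → ℚ)) := hli.comp e e.injective
    have hli3 : LinearIndependent ℚ (Matrix.of fun i => v' (p i)).row := by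
      have : (Matrix.of fun i => v' (p i)).row = (fun i => ((e i : b) : Fin k → ℚ)) := by
        funext i; exact hpe i
      rw [this]; exact hli2
    have hu := Matrix.linearIndependent_rows_iff_isUnit.1 hli3
    rw [Matrix.isUnit_iff_isUnit_det] at hu
    apply hu.ne_zero
    have : (Matrix.of fun i => v' (p i)) = (Int.castRingHom ℚ).mapMatrix (Matrix.of fun i => v (p i)) := by
      ext i j; simp [hv']
    rw [this, ← RingHom.map_det, hdet, map_zero]
  obtain ⟨φ, hφ0, hφ⟩ := Submodule.exists_le_ker_of_lt_top W hWtop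
  obtain ⟨D, hD⟩ := IsLocalization.exist_integer_multiples_of_finset (nonZeroDivisors ℤ) (Finset.univ.image (fun i : Fin k => φ (Pi.single i 1)))
  have hex : ∀ i : Fin k, ∃ z : ℤ, (z : ℚ) = (D : ℤ) * φ (Pi.single i 1) := by
    intro i
    obtain ⟨z, hz⟩ := hD (φ (Pi.single i 1)) (Finset.mem_image_of_mem _ (Finset.mem_univ i))
    refine ⟨z, ?_⟩
    simpa [Algebra.smul_def] using hz
  choose z hz using hex
  have hD0 : ((D : ℤ) : ℚ) ≠ 0 := by
    exact_mod_cast nonZeroDivisors.ne_zero D.2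
  have hkpos : (Finset.univ : Finset (Fin k)).Nonempty := by
    by_contra hne
    rw [Finset.not_nonempty_iff_eq_empty] at hne
    apply hφ0
    ext i
    have : i ∈ (Finset.univ : Finset (Fin k)) := Finset.mem_univ i
    rw [hne] at this
    simp at this
  obtain ⟨c, hc1, hc2⟩ := Finset.extract_gcd z hkpos
  have hg0 : Finset.univ.gcd z ≠ 0 := by
    intro hg
    rw [Finset.gcd_eq_zero_iff] at hg
    apply hφ0
    ext i
    have h1 := hz i
    rw [hg i (Finset.mem_univ i)] at h1
    simp only [Int.cast_zero] at h1
    have h2 := (mul_eq_zero.1 h1.symm).resolve_left hD0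
    simpa using h2
  refine ⟨c, ?_, ?_⟩
  · intro d hd
    have : d ∣ Finset.univ.gcd c := Finset.dvd_gcd (fun i _ => hd i)
    rw [hc2] at this
    exact isUnit_of_dvd_one this
  · intro t ht
    have h1 : φ (v' t) = 0 := hφ (Submodule.subset_span (Set.mem_image_of_mem _ ht))
    have h2 : φ (v' t) = ∑ i, v' t i * φ (Pi.single i 1) := by
      conv_lhs => rw [pi_eq_sum_univ' (v' t)]
      rw [map_sum]
      apply Finset.sum_congr rfl
      intro i _
      rw [map_smul, smul_eq_mul]
    have h3 : ((Finset.univ.gcd z * ∑ i, c i * v t i : ℤ) : ℚ) = 0 := by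
      rw [Finset.mul_sum]
      push_cast
      calc ∑ i, ((Finset.univ.gcd z : ℤ) : ℚ) * ((c i : ℚ) * (v t i : ℚ)) = ∑ i, ((D : ℤ) : ℚ) * (v' t i * φ (Pi.single i 1)) := by
            apply Finset.sum_congr rfl
            intro i _
            have e1 : ((Finset.univ.gcd z : ℤ) : ℚ) * (c i : ℚ) = z i := by
              exact_mod_cast (hc1 i (Finset.mem_univ i)).symm
            rw [← mul_assoc, e1, hz i]
            simp only [hv']
            ring
        _ = 0 := by rw [← Finset.mul_sum, ← h2, h1, mul_zero]
    have h4 : Finset.univ.gcd z * ∑ i, c i * v t i = 0 := by exact_mod_cast h3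
    exact (mul_eq_zero.1 h4).resolve_left hg0

lemma det_col_bound {k : ℕ} (A : Matrix (Fin k) (Fin k) ℝ) (b : Fin k → ℝ) (h : ∀ i j, |A i j| ≤ b j) :
    |A.det| ≤ (k.factorial : ℝ) * ∏ j, b j := by
  rw [Matrix.det_apply]
  refine (Finset.abs_sum_le_sum_abs _ _).trans ?_
  calc ∑ σ : Equiv.Perm (Fin k), |Equiv.Perm.sign σ • ∏ i, A (σ i) i| ≤ ∑ σ : Equiv.Perm (Fin k), ∏ j, b j := by
        apply Finset.sum_le_sum
        intro σ _
        have : |Equiv.Perm.sign σ • ∏ i, A (σ i) i| = ∏ i, |A (σ i) i| := by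
          rw [← Finset.abs_prod]
          rcases Int.units_eq_one_or (Equiv.Perm.sign σ) with h | h <;> rw [h] <;> simp
        rw [this]
        apply Finset.prod_le_prod
        · intro i _; exact abs_nonneg _
        · intro i _; exact h _ _
    _ = _ := by
        rw [Finset.sum_const, nsmul_eq_mul, Finset.card_univ, Fintype.card_perm, Fintype.card_fin]

lemma int_det_zero {k : ℕ} (A : Matrix (Fin k) (Fin k) ℤ) (U : Matrix (Fin k) (Fin k) ℝ) (hU : U.det = 1) (b : Fin k → ℝ)
    (h : ∀ i j, |(A.map (Int.cast : ℤ → ℝ) * U) i j| ≤ b j) (hb : (k.factorial : ℝ) * ∏ j, b j < 1) : A.det = 0 := by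
  have h1 := det_col_bound _ b h
  rw [Matrix.det_mul, hU, mul_one] at h1
  have h2 : (A.map (Int.cast : ℤ → ℝ)).det = (A.det : ℝ) := by
    have := (Int.castRingHom ℝ).map_det A
    simp only [RingHom.mapMatrix_apply] at this
    exact this.symm
  rw [h2] at h1
  have h3 : |A.det| < 1 := by exact_mod_cast h1.trans_lt hb
  exact Int.abs_lt_one_iff.1 h3

end SecF1

section SecF2

lemma strip_real {M N V A B u v n q m s : ℝ} (hM : 2 ≤ M) (hN : 1 ≤ N) (hV : 1 ≤ V) (hA : |A| ≤ M) (hB : |B| ≤ M)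
    (huv : u * v = 1) (hu0 : 0 < u) (hv : v ≤ 4 * M) (hn : N ≤ n) (hs0 : 0 ≤ s) (hs : s ≤ 2 * V)
    (hq : q = u * n + s) (he : q ^ 2 * m = n ^ 3 + A * n + B) :
    |m + 2 * v ^ 3 * q - 3 * v ^ 2 * n| ≤ M ^ 16 * V ^ 2 / N ∧
    |n * (m + 2 * v ^ 3 * q - 3 * v ^ 2 * n) - 3 * v ^ 4 * s ^ 2 - A * v ^ 2| ≤ M ^ 21 * V ^ 3 / N := by
  have hM0 : 0 < M := by linarith
  have hN0 : 0 < N := by linarith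
  have hn0 : 0 < n := by linarith
  have hV0 : 0 < V := by linarith
  have hv0 : 0 < v := by
    by_contra h
    have : u * v ≤ 0 := mul_nonpos_of_nonneg_of_nonpos hu0.le (by linarith)
    linarith
  have hun : 0 < u * n := by positivity
  have hq0 : 0 < q := by rw [hq]; positivity
  set i := q⁻¹ with hi
  have hiq : i * q = 1 := inv_mul_cancel₀ hq0.ne'
  have hi0 : 0 < i := by positivity
  have hm : m = i ^ 2 * (n ^ 3 + A * n + B) := by
    rw [← he]
    calc m = (i * q) ^ 2 * m := by rw [hiq]; ring
      _ = _ := by ring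
  have hin : i * n ≤ v := by
    have h1 : n ≤ v * q := by
      calc n = v * (u * n) := by rw [← mul_assoc, mul_comm v u, huv, one_mul]
        _ ≤ v * q := by gcongr; linarith
    calc i * n ≤ i * (v * q) := by gcongr
      _ = v * (i * q) := by ring
      _ = v := by rw [hiq, mul_one]
  have hiN : i ≤ 4 * M / N := by
    rw [le_div_iff₀ hN0]
    calc i * N ≤ i * n := by gcongr
      _ ≤ v := hin
      _ ≤ _ := hv
  have hin4 : i * n ≤ 4 * M := hin.trans hv
  clear_value i
  -- the key identities
  have w_id : m + 2 * v ^ 3 * q - 3 * v ^ 2 * n = i ^ 2 * (v ^ 3 * s ^ 2 * (3 * (u * n) + 2 * s)) + i ^ 2 * (A * n + B) := by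
    have e0 : 2 * v ^ 3 * q - 3 * v ^ 2 * n = (i * q) ^ 2 * (2 * v ^ 3 * q - 3 * v ^ 2 * n) := by rw [hiq]; ring
    have e1 : q ^ 2 * (2 * v ^ 3 * q - 3 * v ^ 2 * n) = v ^ 3 * (2 * q ^ 3 - 3 * (u * n) * q ^ 2) := by
      linear_combination (3 * v ^ 2 * n * q ^ 2) * huv
    have e2 : 2 * q ^ 3 - 3 * (u * n) * q ^ 2 = s ^ 2 * (3 * (u * n) + 2 * s) - (u * n) ^ 3 := by rw [hq]; ring
    have e3 : v ^ 3 * (u * n) ^ 3 = n ^ 3 := by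
      calc v ^ 3 * (u * n) ^ 3 = (u * v) ^ 3 * n ^ 3 := by ring
        _ = _ := by rw [huv]; ring
    calc m + 2 * v ^ 3 * q - 3 * v ^ 2 * n = m + (2 * v ^ 3 * q - 3 * v ^ 2 * n) := by ring
      _ = i ^ 2 * (n ^ 3 + A * n + B) + i ^ 2 * (v ^ 3 * (s ^ 2 * (3 * (u * n) + 2 * s) - (u * n) ^ 3)) := by
          rw [e0, hm, mul_pow, mul_assoc (i ^ 2), e1, e2]
      _ = _ := by rw [mul_sub, e3]; ring
  have Q_id : n * (m + 2 * v ^ 3 * q - 3 * v ^ 2 * n) - 3 * v ^ 4 * s ^ 2 - A * v ^ 2 =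
      -(i ^ 2 * (v ^ 4 * s ^ 3 * (4 * (u * n) + 3 * s))) + i ^ 2 * n * B - i ^ 2 * (A * v ^ 2 * s * (2 * (u * n) + s)) := by
    rw [w_id]
    have e0 : 3 * v ^ 4 * s ^ 2 + A * v ^ 2 = (i * q) ^ 2 * (3 * v ^ 4 * s ^ 2 + A * v ^ 2) := by rw [hiq]; ring
    have e1 : n * (v ^ 3 * s ^ 2 * (3 * (u * n) + 2 * s)) = v ^ 4 * s ^ 2 * ((u * n) * (3 * (u * n) + 2 * s)) := by
      linear_combination (-(n * v ^ 3 * s ^ 2 * (3 * (u * n) + 2 * s))) * huv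
    have e2 : A * n ^ 2 = A * v ^ 2 * (u * n) ^ 2 := by
      calc A * n ^ 2 = A * ((u * v) ^ 2 * n ^ 2) := by rw [huv]; ring
        _ = _ := by ring
    have : n * (i ^ 2 * (v ^ 3 * s ^ 2 * (3 * (u * n) + 2 * s)) + i ^ 2 * (A * n + B)) - (3 * v ^ 4 * s ^ 2 + A * v ^ 2) =
       i ^ 2 * (n * (v ^ 3 * s ^ 2 * (3 * (u * n) + 2 * s)) + A * n ^ 2 + n * B) - (i * q) ^ 2 * (3 * v ^ 4 * s ^ 2 + A * v ^ 2) := by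
      rw [← e0]; ring
    calc _ = _ := sub_sub _ _ _
      _ = _ := this
      _ = _ := by rw [e1, e2, hq]; ring
  have hsq : s ≤ q := by rw [hq]; linarith
  have hunq : u * n ≤ q := by rw [hq]; linarith
  have hd1 : 3 * (u * n) + 2 * s ≤ 3 * q := by rw [hq]; linarith
  have hd2 : 4 * (u * n) + 3 * s ≤ 4 * q := by rw [hq]; linarith
  have hd3 : 2 * (u * n) + s ≤ 2 * q := by rw [hq]; linarith
  have hAB : |A * n + B| ≤ 2 * M * n := by
    calc |A * n + B| ≤ |A * n| + |B| := abs_add_le _ _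
      _ = |A| * n + |B| := by rw [abs_mul, abs_of_pos hn0]
      _ ≤ M * n + M * n := by
          gcongr
          calc |B| ≤ M * 1 := by linarith
            _ ≤ M * n := by gcongr; linarith
      _ = _ := by ring
  have hpw : ∀ k : ℕ, (2 : ℝ) ^ k ≤ M ^ k := fun k => by gcongr
  have hpm : ∀ i j : ℕ, i ≤ j → M ^ i ≤ M ^ j := fun i j h => pow_le_pow_right₀ (by linarith) h
  have hVm : ∀ i j : ℕ, i ≤ j → V ^ i ≤ V ^ j := fun i j h => pow_le_pow_right₀ (by linarith) h
  constructor
  · rw [w_id]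
    have t1 : |i ^ 2 * (v ^ 3 * s ^ 2 * (3 * (u * n) + 2 * s))| ≤ 3072 * M ^ 4 * V ^ 2 / N := by
      rw [abs_of_nonneg (by positivity)]
      calc i ^ 2 * (v ^ 3 * s ^ 2 * (3 * (u * n) + 2 * s)) ≤ i ^ 2 * (v ^ 3 * s ^ 2 * (3 * q)) := by gcongr
        _ = 3 * v ^ 3 * s ^ 2 * i * (i * q) := by ring
        _ = 3 * v ^ 3 * s ^ 2 * i := by rw [hiq, mul_one]
        _ ≤ 3 * (4 * M) ^ 3 * (2 * V) ^ 2 * (4 * M / N) := by gcongr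
        _ = _ := by ring
    have t2 : |i ^ 2 * (A * n + B)| ≤ 32 * M ^ 3 / N := by
      rw [abs_mul, abs_of_nonneg (by positivity : 0 ≤ i ^ 2)]
      calc i ^ 2 * |A * n + B| ≤ i ^ 2 * (2 * M * n) := by gcongr
        _ = 2 * M * i * (i * n) := by ring
        _ ≤ 2 * M * (4 * M / N) * (4 * M) := by gcongr
        _ = _ := by ring
    refine (abs_add_le _ _).trans ((add_le_add t1 t2).trans ?_)
    rw [← add_div]
    gcongr
    have h1 : M ^ 3 ≤ M ^ 4 * V ^ 2 := by
      calc M ^ 3 = M ^ 3 * 1 := by ring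
        _ ≤ M ^ 4 * V ^ 2 := by
          gcongr
          · linarith
          · norm_num
          · exact one_le_pow₀ hV
    calc 3072 * M ^ 4 * V ^ 2 + 32 * M ^ 3 ≤ 2 ^ 12 * (M ^ 4 * V ^ 2) := by
          have : 0 ≤ M ^ 4 * V ^ 2 := by positivity
          linarith
      _ ≤ M ^ 12 * (M ^ 4 * V ^ 2) := by gcongr
      _ = _ := by ring
  · rw [Q_id]
    have t1 : |i ^ 2 * (v ^ 4 * s ^ 3 * (4 * (u * n) + 3 * s))| ≤ 32768 * M ^ 5 * V ^ 3 / N := by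
      rw [abs_of_nonneg (by positivity)]
      calc i ^ 2 * (v ^ 4 * s ^ 3 * (4 * (u * n) + 3 * s)) ≤ i ^ 2 * (v ^ 4 * s ^ 3 * (4 * q)) := by gcongr
        _ = 4 * v ^ 4 * s ^ 3 * i * (i * q) := by ring
        _ = 4 * v ^ 4 * s ^ 3 * i := by rw [hiq, mul_one]
        _ ≤ 4 * (4 * M) ^ 4 * (2 * V) ^ 3 * (4 * M / N) := by gcongr
        _ = _ := by ring
    have t2 : |i ^ 2 * n * B| ≤ 16 * M ^ 3 / N := by
      rw [abs_mul, abs_of_nonneg (by positivity : 0 ≤ i ^ 2 * n)]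
      calc i ^ 2 * n * |B| ≤ i ^ 2 * n * M := by gcongr
        _ = M * i * (i * n) := by ring
        _ ≤ M * (4 * M / N) * (4 * M) := by gcongr
        _ = _ := by ring
    have t3 : |i ^ 2 * (A * v ^ 2 * s * (2 * (u * n) + s))| ≤ 256 * M ^ 4 * V / N := by
      have : i ^ 2 * (A * v ^ 2 * s * (2 * (u * n) + s)) = A * (i ^ 2 * (v ^ 2 * s * (2 * (u * n) + s))) := by ring
      rw [this, abs_mul, abs_of_nonneg (by positivity : 0 ≤ i ^ 2 * (v ^ 2 * s * (2 * (u * n) + s)))]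
      calc |A| * (i ^ 2 * (v ^ 2 * s * (2 * (u * n) + s))) ≤ M * (i ^ 2 * (v ^ 2 * s * (2 * q))) := by gcongr
        _ = 2 * M * v ^ 2 * s * i * (i * q) := by ring
        _ = 2 * M * v ^ 2 * s * i := by rw [hiq, mul_one]
        _ ≤ 2 * M * (4 * M) ^ 2 * (2 * V) * (4 * M / N) := by gcongr
        _ = _ := by ring
    have t4 := (abs_sub _ _).trans (add_le_add ((abs_add_le (-(i ^ 2 * (v ^ 4 * s ^ 3 * (4 * (u * n) + 3 * s)))) (i ^ 2 * n * B)).trans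
      (add_le_add ((abs_neg _).le.trans t1) t2)) t3)
    refine t4.trans ?_
    rw [← add_div, ← add_div]
    gcongr
    have h1 : M ^ 3 ≤ M ^ 5 * V ^ 3 := by
      calc M ^ 3 = M ^ 3 * 1 := by ring
        _ ≤ M ^ 5 * V ^ 3 := by
          gcongr
          · linarith
          · norm_num
          · exact one_le_pow₀ hV
    have h2 : M ^ 4 * V ≤ M ^ 5 * V ^ 3 := by
      calc M ^ 4 * V = M ^ 4 * V ^ 1 := by ring
        _ ≤ M ^ 5 * V ^ 3 := by
          gcongr
          · linarith
          · norm_num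
          · linarith
    calc 32768 * M ^ 5 * V ^ 3 + 16 * M ^ 3 + 256 * M ^ 4 * V ≤ 2 ^ 16 * (M ^ 5 * V ^ 3) := by
          have : 0 ≤ M ^ 5 * V ^ 3 := by positivity
          linarith
      _ ≤ M ^ 16 * (M ^ 5 * V ^ 3) := by gcongr
      _ = _ := by ring

end SecF2

section SecF3

/-- points in the critical range -/
structure CPt (A B : ℤ) (M N : ℝ) (p : ℤ × ℤ × ℤ) : Prop where
  n1 : N ≤ (p.1 : ℝ)
  n2 : (p.1 : ℝ) ≤ 2 * N
  qp : Prime p.2.1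
  q0 : 0 < p.2.1
  q1 : N ≤ M * p.2.1
  q2 : (p.2.1 : ℝ) ≤ M * N
  e : p.2.1 ^ 2 * p.2.2 = p.1 ^ 3 + A * p.1 + B

def CStrip (u V : ℝ) (p : ℤ × ℤ × ℤ) : Prop := 0 ≤ (p.2.1 : ℝ) - u * p.1 ∧ (p.2.1 : ℝ) - u * p.1 ≤ 2 * V

def stripU (u v A : ℝ) : Matrix (Fin 7) (Fin 7) ℝ :=
  !![1, 0, 0, 0, -A * v ^ 2, 0, 0;
     0, 1, -u, u ^ 2, -6 * v ^ 2, 3 * v, 9 * v ^ 4;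
     0, 0, 1, -2 * u, 8 * v ^ 3, -5 * v ^ 2, -12 * v ^ 5;
     0, 0, 0, 1, -3 * v ^ 4, 2 * v ^ 3, 4 * v ^ 6;
     0, 0, 0, 0, 1, -u, -6 * v ^ 2;
     0, 0, 0, 0, 0, 1, 4 * v ^ 3;
     0, 0, 0, 0, 0, 0, 1]

lemma stripU_det (u v A : ℝ) : (stripU u v A).det = 1 := by
  have h : (stripU u v A).BlockTriangular id := by
    intro i j hij
    fin_cases i <;> fin_cases j <;> first | rfl | (exfalso; revert hij; decide)
  rw [Matrix.det_of_upperTriangular h]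
  simp [Fin.prod_univ_succ, stripU]

def cvec (p : ℤ × ℤ × ℤ) : Fin 7 → ℤ :=
  ![1, p.1 ^ 2, p.1 * p.2.1, p.2.1 ^ 2, p.1 * p.2.2, p.2.1 * p.2.2, p.2.2 ^ 2]

lemma strip_relation {A B : ℤ} {M V N u : ℝ} (hM : 2 ≤ M) (hA : |(A : ℝ)| ≤ M) (hB : |(B : ℝ)| ≤ M) (hV : M ^ 90 ≤ V)
    (hN : N = V ^ 14) (hu : 1 ≤ 4 * M * u)
    (T : Finset (ℤ × ℤ × ℤ)) (hT : ∀ p ∈ T, CPt A B M N p ∧ CStrip u V p) :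
    ∃ c : Fin 7 → ℤ, (∀ d : ℤ, (∀ i, d ∣ c i) → IsUnit d) ∧ ∀ p ∈ T, ∑ i, c i * cvec p i = 0 := by
  apply int_relation
  intro p hp
  have hM0 : 0 < M := by linarith
  have hV1 : 1 ≤ V := le_trans (one_le_pow₀ (by linarith)) hV
  have hN1 : 1 ≤ N := by rw [hN]; exact one_le_pow₀ hV1
  have hV0 : 0 < V := by linarith
  have hN0 : 0 < N := by linarith
  have hu0 : 0 < u := by
    by_contra h
    have : 4 * M * u ≤ 0 := mul_nonpos_of_nonneg_of_nonpos (by positivity) (by linarith)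
    linarith
  set v := u⁻¹ with hv
  have huv : u * v = 1 := mul_inv_cancel₀ hu0.ne'
  have hv0 : 0 < v := by positivity
  have hv4 : v ≤ 4 * M := by
    calc v = v * 1 := by ring
      _ ≤ v * (4 * M * u) := by gcongr
      _ = 4 * M * (u * v) := by ring
      _ = _ := by rw [huv, mul_one]
  clear_value v
  refine int_det_zero (Matrix.of fun i => cvec (p i)) (stripU u v A) (stripU_det _ _ _)
    ![1, 4 * N ^ 2, 4 * N * V, 4 * V ^ 2, M ^ 21 * V ^ 3 / N, 2 * V * (M ^ 16 * V ^ 2 / N), (M ^ 16 * V ^ 2 / N) ^ 2] ?_ ?_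
  · intro i j
    obtain ⟨hc, hs1, hs2⟩ := hT (p i) (hp i)
    have hn1 := hc.n1
    have hn2 := hc.n2
    have he : ((p i).2.1 : ℝ) ^ 2 * (p i).2.2 = ((p i).1 : ℝ) ^ 3 + A * (p i).1 + B := by exact_mod_cast hc.e
    have key : ∀ j, (Matrix.map (Matrix.of fun i => cvec (p i)) (Int.cast : ℤ → ℝ) * stripU u v A) i j =
       ∑ k, ((cvec (p i) k : ℤ) : ℝ) * stripU u v A k j := by
      intro j
      rw [Matrix.mul_apply]; rfl
    rw [key]
    have hrow : ∀ k, ((cvec (p i) k : ℤ) : ℝ) = ![1, ((p i).1 : ℝ) ^ 2, (p i).1 * (p i).2.1, ((p i).2.1 : ℝ) ^ 2, (p i).1 * (p i).2.2,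
        (p i).2.1 * (p i).2.2, ((p i).2.2 : ℝ) ^ 2] k := by
      intro k
      fin_cases k <;> simp [cvec]
    simp only [hrow]
    clear key hrow
    have hst := strip_real hM hN1 hV1 hA hB huv hu0 hv4 hn1 hs1 hs2 (by ring : ((p i).2.1 : ℝ) = u * (p i).1 + ((p i).2.1 - u * (p i).1)) he
    generalize ((p i).1 : ℝ) = n at *
    generalize ((p i).2.1 : ℝ) = q at *
    generalize ((p i).2.2 : ℝ) = m at *
    obtain ⟨hw, hQ⟩ := hst
    have hn0 : 0 < n := by linarith
    have k1 : |q - u * n| ≤ 2 * V := by rw [abs_of_nonneg hs1]; exact hs2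
    rw [Fin.sum_univ_seven]
    fin_cases j
    · simp [stripU]
    · simp [stripU]
      calc n ^ 2 ≤ (2 * N) ^ 2 := by gcongr
        _ = _ := by ring
    · simp [stripU]
      have e : -(n ^ 2 * u) + n * q = n * (q - u * n) := by ring
      rw [e, abs_mul, abs_of_pos hn0]
      calc n * |q - u * n| ≤ (2 * N) * (2 * V) := by gcongr
        _ = _ := by ring
    · simp [stripU]
      have e : n ^ 2 * u ^ 2 + -(n * q * (2 * u)) + q ^ 2 = (q - u * n) ^ 2 := by ring
      rw [e, abs_pow]
      calc |q - u * n| ^ 2 ≤ (2 * V) ^ 2 := by gcongr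
        _ = _ := by ring
    · simp [stripU]
      refine le_trans (le_of_eq (congrArg abs ?_)) hQ
      linear_combination (3 * v ^ 2 * n ^ 2 - 6 * v ^ 3 * n * q + 3 * n ^ 2 * v ^ 3 * u) * huv
    · simp [stripU]
      refine le_trans (le_of_eq ?_) (?_ : |q - u * n| * |m + 2 * v ^ 3 * q - 3 * v ^ 2 * n| ≤ _)
      · rw [← abs_mul]
        congr 1
        linear_combination (2 * v ^ 2 * n * q - 3 * n ^ 2 * v) * huv
      · gcongr
    · simp [stripU]
      refine le_trans (le_of_eq ?_) (?_ : |m + 2 * v ^ 3 * q - 3 * v ^ 2 * n| ^ 2 ≤ _)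
      · rw [← abs_pow]
        congr 1
        ring
      · gcongr
  · have e : ∏ j, (![1, 4 * N ^ 2, 4 * N * V, 4 * V ^ 2, M ^ 21 * V ^ 3 / N, 2 * V * (M ^ 16 * V ^ 2 / N), (M ^ 16 * V ^ 2 / N) ^ 2] : Fin 7 → ℝ) j
      = 128 * M ^ 69 * V ^ 13 / N := by
      simp [Fin.prod_univ_succ]
      field_simp
      ring
    rw [e, hN]
    have : (Nat.factorial 7 : ℝ) * (128 * M ^ 69 * V ^ 13 / V ^ 14) = 645120 * M ^ 69 / V := by
      simp [Nat.factorial]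
      field_simp
      ring
    rw [this, div_lt_one hV0]
    refine lt_of_lt_of_le ?_ hV
    calc 645120 * M ^ 69 < 2 ^ 21 * M ^ 69 := by gcongr; norm_num
      _ ≤ M ^ 21 * M ^ 69 := by gcongr
      _ = _ := by ring

end SecF3

section SecG1

open Polynomial in
/-- the bivariate polynomial attached to a relation -/
noncomputable def HH {R : Type*} [CommRing R] (c : Fin 7 → R) (A B : R) : R[X][X] :=
  C (C (c 3)) * X ^ 6 + C (C (c 2) * X) * X ^ 5 + C (C (c 1) * X ^ 2 + C (c 0)) * X ^ 4
   + C (C (c 5) * (X ^ 3 + C A * X + C B)) * X ^ 3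
   + C (C (c 4) * X * (X ^ 3 + C A * X + C B)) * X ^ 2
   + C (C (c 6) * (X ^ 3 + C A * X + C B) ^ 2)

open Polynomial in
lemma HH_evalEval {R : Type*} [CommRing R] (c : Fin 7 → R) (A B x y : R) :
    (HH c A B).evalEval x y = c 3 * y ^ 6 + c 2 * x * y ^ 5 + (c 1 * x ^ 2 + c 0) * y ^ 4
      + c 5 * (x ^ 3 + A * x + B) * y ^ 3 + c 4 * x * (x ^ 3 + A * x + B) * y ^ 2
      + c 6 * (x ^ 3 + A * x + B) ^ 2 := by
  simp [HH, evalEval]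

lemma HH_evalEval_eq {R : Type*} [CommRing R] (c : Fin 7 → R) (A B x y m : R) (h : y ^ 2 * m = x ^ 3 + A * x + B) :
    (HH c A B).evalEval x y = y ^ 4 * (c 0 + c 1 * x ^ 2 + c 2 * (x * y) + c 3 * y ^ 2 + c 4 * (x * m) + c 5 * (y * m) + c 6 * m ^ 2) := by
  rw [HH_evalEval, ← h]; ring

open Polynomial in
lemma HH_coeff {R : Type*} [CommRing R] (c : Fin 7 → R) (A B : R) (i : ℕ) :
    (HH c A B).coeff i = if i = 6 then C (c 3) else if i = 5 then C (c 2) * X else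
      if i = 4 then C (c 1) * X ^ 2 + C (c 0) else if i = 3 then C (c 5) * (X ^ 3 + C A * X + C B) else
      if i = 2 then C (c 4) * X * (X ^ 3 + C A * X + C B) else
      if i = 0 then C (c 6) * (X ^ 3 + C A * X + C B) ^ 2 else 0 := by
  unfold HH
  simp only [coeff_add, coeff_C_mul_X_pow, coeff_C]
  split_ifs <;> first | omega | simp

open Polynomial in
lemma HH_natDegree {R : Type*} [CommRing R] (c : Fin 7 → R) (A B : R) : (HH c A B).natDegree ≤ 6 := by
  rw [natDegree_le_iff_coeff_eq_zero]
  intro i hi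
  rw [HH_coeff]
  split_ifs <;> first | omega | rfl

open Polynomial in
lemma HH_coeff_natDegree {R : Type*} [CommRing R] (c : Fin 7 → R) (A B : R) (i : ℕ) :
    ((HH c A B).coeff i).natDegree ≤ 6 := by
  rw [HH_coeff]
  split_ifs
  all_goals first | (compute_degree; done) | (compute_degree!)

open Polynomial in
lemma gmonic {R : Type*} [CommRing R] (A B : R) : (X ^ 3 + C A * X + C B : R[X]).Monic := by
  monicity!

open Polynomial in
lemma HH_ne_zero {R : Type*} [CommRing R] [Nontrivial R] (c : Fin 7 → R) (A B : R) (hc : ∃ i, c i ≠ 0) : HH c A B ≠ 0 := by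
  intro h
  have hco : ∀ i, (HH c A B).coeff i = 0 := by intro i; rw [h]; simp
  simp only [HH_coeff] at hco
  have h6 := hco 6
  have h5 := hco 5
  have h4 := hco 4
  have h3 := hco 3
  have h2 := hco 2
  have h0 := hco 0
  simp only [if_true, if_false, Nat.reduceEqDiff, OfNat.ofNat_ne_zero, OfNat.zero_ne_ofNat] at h6 h5 h4 h3 h2 h0
  have g := gmonic A B
  obtain ⟨i, hi⟩ := hc
  apply hi
  have k3 : c 3 = 0 := by simpa using h6
  have k2 : c 2 = 0 := by simpa using congrArg (fun p => p.coeff 1) h5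
  have k1 : c 1 = 0 := by simpa using congrArg (fun p => p.coeff 2) h4
  have k0 : c 0 = 0 := by simpa using congrArg (fun p => p.coeff 0) h4
  have k5 : c 5 = 0 := by simpa using (g.isRegular.right).eq_iff.mp (h3.trans (zero_mul _).symm)
  have k4 : c 4 = 0 := by
    have := (g.isRegular.right).eq_iff.mp (h2.trans (zero_mul _).symm)
    simpa using congrArg (fun p => p.coeff 1) this
  have k6 : c 6 = 0 := by simpa using ((g.pow 2).isRegular.right).eq_iff.mp (h0.trans (zero_mul _).symm)
  fin_cases i <;> assumption

open Polynomial in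
lemma HH_map {R S : Type*} [CommRing R] [CommRing S] (φ : R →+* S) (c : Fin 7 → R) (A B : R) :
    (HH c A B).map (mapRingHom φ) = HH (fun i => φ (c i)) (φ A) (φ B) := by
  simp [HH]

open Polynomial in
lemma zero_count {F : Type*} [Field F] [Fintype F] [DecidableEq F] (h : F[X][X]) (h0 : h ≠ 0) (K : ℕ)
    (hY : h.natDegree ≤ K) (hX : ∀ i, (h.coeff i).natDegree ≤ K) :
    (Finset.univ.filter fun p : F × F => h.evalEval p.1 p.2 = 0).card ≤ 2 * K * Fintype.card F := by
  classical
  have hl : h.leadingCoeff ≠ 0 := leadingCoeff_ne_zero.mpr h0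
  have hsub : (Finset.univ.filter fun p : F × F => h.evalEval p.1 p.2 = 0) ⊆
      (h.leadingCoeff.roots.toFinset ×ˢ (Finset.univ : Finset F)) ∪
      (Finset.univ : Finset F).biUnion (fun x => ((h.map (evalRingHom x)).roots.toFinset).image (fun y => (x, y))) := by
    intro p hp
    simp only [Finset.mem_filter, Finset.mem_univ, true_and] at hp
    simp only [Finset.mem_union, Finset.mem_product, Finset.mem_univ, and_true, Finset.mem_biUnion, true_and, Finset.mem_image,
      Multiset.mem_toFinset]
    by_cases hx : h.leadingCoeff.eval p.1 = 0
    · left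
      rw [mem_roots hl]; exact hx
    · right
      refine ⟨p.1, p.2, ?_, rfl⟩
      have hne : h.map (evalRingHom p.1) ≠ 0 := by
        intro h'
        apply hx
        have := congrArg (fun q => q.coeff h.natDegree) h'
        simpa using this
      rw [mem_roots hne]
      show eval _ _ = 0
      rw [← hp, ← eval₂_evalRingHom, eval_map]
  refine (Finset.card_le_card hsub).trans ((Finset.card_union_le _ _).trans ?_)
  have e1 : (h.leadingCoeff.roots.toFinset ×ˢ (Finset.univ : Finset F)).card ≤ K * Fintype.card F := by
    rw [Finset.card_product, Finset.card_univ]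
    gcongr
    exact (Multiset.toFinset_card_le _).trans ((card_roots' _).trans (hX _))
  have e2 : ((Finset.univ : Finset F).biUnion (fun x => ((h.map (evalRingHom x)).roots.toFinset).image (fun y => (x, y)))).card
      ≤ Fintype.card F * K := by
    refine Finset.card_biUnion_le_card_mul _ _ _ fun x _ => ?_
    exact Finset.card_image_le.trans ((Multiset.toFinset_card_le _).trans ((card_roots' _).trans ((natDegree_map_le).trans hY)))
  nlinarith [e1, e2]

end SecG1

section SecG2

open Polynomial in
lemma swap_coeff_coeff {R : Type*} [CommRing R] (p : R[X][X]) (i j : ℕ) :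
    ((Bivariate.swap p).coeff j).coeff i = (p.coeff i).coeff j := by
  induction p using Polynomial.induction_on' with
  | add p q hp hq => simp only [map_add, coeff_add, hp, hq]
  | monomial n a =>
    induction a using Polynomial.induction_on' with
    | add p q hp hq => simp only [map_add, coeff_add, hp, hq]
    | monomial m r =>
      rw [Bivariate.swap_monomial_monomial]
      simp only [coeff_monomial]
      split_ifs <;> simp_all [coeff_monomial]

open Polynomial in
lemma coeff_natDegree_le_iff {R : Type*} [CommRing R] (p : R[X][X]) (K : ℕ) :
    (∀ i, (p.coeff i).natDegree ≤ K) ↔ (Bivariate.swap p).natDegree ≤ K := by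
  simp only [natDegree_le_iff_coeff_eq_zero]
  constructor
  · intro h N hN
    ext i
    rw [swap_coeff_coeff, coeff_zero, h i N hN]
  · intro h i N hN
    rw [← swap_coeff_coeff, h N hN, coeff_zero]

open Polynomial in
lemma dvd_coeff_natDegree {p q : ℚ[X][X]} (hq : q ≠ 0) (hd : p ∣ q) {K : ℕ} (h : ∀ i, (q.coeff i).natDegree ≤ K) :
    ∀ i, (p.coeff i).natDegree ≤ K := by
  rw [coeff_natDegree_le_iff] at h ⊢
  exact (natDegree_le_of_dvd (_root_.map_dvd Bivariate.swap hd) (by simpa using hq)).trans h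

open Polynomial in
lemma resultant_deg {p q : ℚ[X][X]} {K : ℕ} (hp : ∀ i, (p.coeff i).natDegree ≤ K) (hq : ∀ i, (q.coeff i).natDegree ≤ K) (m n : ℕ) :
    (resultant p q m n).natDegree ≤ (m + n) * K := by
  unfold resultant
  rw [Matrix.det_apply]
  refine natDegree_sum_le_of_forall_le _ _ fun σ _ => ?_
  refine (natDegree_smul_le _ _).trans ?_
  refine (natDegree_prod_le _ _).trans ?_
  calc _ ≤ ∑ i : Fin (m + n), K := by
        refine Finset.sum_le_sum fun i _ => ?_
        simp only [sylvester, Matrix.of_apply]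
        refine Fin.addCases (fun j => ?_) (fun j => ?_) i
        · simp only [Fin.addCases_left]
          split_ifs
          · exact hq _
          · simp
        · simp only [Fin.addCases_right]
          split_ifs
          · exact hp _
          · simp
    _ = _ := by simp

open Polynomial in
lemma irred_coprime {p q : ℚ[X][X]} (hp : Irreducible p) (hq : Irreducible q) (hp1 : 1 ≤ p.natDegree) (hq1 : 1 ≤ q.natDegree)
    (hn : ¬ p ∣ q) {K : ℕ} (hpK : ∀ i, (p.coeff i).natDegree ≤ K) (hqK : ∀ i, (q.coeff i).natDegree ≤ K) :
    ∃ r : ℚ[X], r ≠ 0 ∧ r.natDegree ≤ (p.natDegree + q.natDegree) * K ∧ ∀ x y, p.evalEval x y = 0 → q.evalEval x y = 0 → r.eval x = 0 := by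
  refine ⟨resultant p q, ?_, resultant_deg hpK hqK _ _, ?_⟩
  · have hpp : p.IsPrimitive := hp.isPrimitive (by omega)
    have hqp : q.IsPrimitive := hq.isPrimitive (by omega)
    have hpi : Irreducible (p.map (algebraMap ℚ[X] (RatFunc ℚ))) :=
      (hpp.irreducible_iff_irreducible_map_fraction_map (K := RatFunc ℚ)).mp hp
    have hnd : ¬ p.map (algebraMap ℚ[X] (RatFunc ℚ)) ∣ q.map (algebraMap ℚ[X] (RatFunc ℚ)) := by
      intro h
      exact hn ((IsPrimitive.dvd_iff_fraction_map_dvd_fraction_map (RatFunc ℚ) hpp).mpr h)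
    have hco : IsCoprime (p.map (algebraMap ℚ[X] (RatFunc ℚ))) (q.map (algebraMap ℚ[X] (RatFunc ℚ))) :=
      (hpi.coprime_iff_not_dvd).mpr hnd
    have h := resultant_ne_zero _ _ hco
    have hinj := IsFractionRing.injective ℚ[X] (RatFunc ℚ)
    rw [natDegree_map_eq_of_injective hinj, natDegree_map_eq_of_injective hinj, resultant_map_map] at h
    intro h0
    rw [h0] at h
    simp at h
  · intro x y h1 h2
    obtain ⟨a, b, _, _, hab⟩ := exists_mul_add_mul_eq_C_resultant p q (le_refl _) (le_refl _) (Or.inl (by omega))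
    have := congrArg (evalEval x y) hab
    rw [evalEval_add, evalEval_mul, evalEval_mul, h1, h2, evalEval_C] at this
    simpa using this.symm

open Polynomial in
/-- translation -/
noncomputable def tr (a b : ℚ) : ℚ[X][X] ≃+* ℚ[X][X] :=
  (mapEquiv (taylorEquiv a).toRingEquiv).trans (taylorEquiv (C b)).toRingEquiv

open Polynomial in
lemma tr_apply (a b : ℚ) (p : ℚ[X][X]) : tr a b p = taylor (C b) (p.map ((taylorEquiv a).toRingEquiv : ℚ[X] →+* ℚ[X])) := rfl

open Polynomial in
lemma tr_evalEval (a b : ℚ) (p : ℚ[X][X]) (x y : ℚ) : (tr a b p).evalEval x y = p.evalEval (x + a) (y + b) := by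
  rw [tr_apply, evalEval, taylor_eval, ← C_add]
  induction p using Polynomial.induction_on' with
  | add p q hp hq => simp only [evalEval_add, Polynomial.map_add, eval_add, hp, hq]
  | monomial n c =>
    simp only [map_monomial, eval_monomial, evalEval, eval_mul, eval_pow, eval_C]
    congr 1
    exact taylor_eval a c x

open Polynomial in
lemma tr_natDegree (a b : ℚ) (p : ℚ[X][X]) : (tr a b p).natDegree = p.natDegree := by
  rw [tr_apply, natDegree_taylor]
  exact natDegree_map_eq_of_injective ((taylorEquiv a).toRingEquiv.injective) _

open Polynomial in
lemma tr_coeff_natDegree (a b : ℚ) (p : ℚ[X][X]) (K : ℕ) (h : ∀ i, (p.coeff i).natDegree ≤ K) (i : ℕ) : ((tr a b p).coeff i).natDegree ≤ K := by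
  rw [tr_apply, taylor_coeff, eval_eq_sum_range]
  refine natDegree_sum_le_of_forall_le _ _ fun j _ => ?_
  rw [← C_pow]
  refine (natDegree_mul_C_le _ _).trans ?_
  rw [hasseDeriv_coeff, ← C_eq_natCast]
  refine (natDegree_C_mul_le _ _).trans ?_
  rw [coeff_map]
  exact (natDegree_taylor _ _).le.trans (h _)

open Polynomial in
/-- dichotomy for irreducible curves -/
lemma translate_dich {h : ℚ[X][X]} (hi : Irreducible h) (h1 : 1 ≤ h.natDegree) (h6 : h.natDegree ≤ 6) (hX : ∀ i, (h.coeff i).natDegree ≤ 6)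
    (a b : ℚ) (ha : a ≠ 0) (x0 y0 : ℚ) (hz : h.evalEval x0 y0 = 0) :
    (∃ r : ℚ[X], r ≠ 0 ∧ r.natDegree ≤ 72 ∧ ∀ x y, h.evalEval x y = 0 → h.evalEval (x + a) (y + b) = 0 → r.eval x = 0) ∨
    (∀ x y, h.evalEval x y = 0 → a * (y - y0) = b * (x - x0)) := by
  have hi' : Irreducible (tr a b h) := (MulEquiv.irreducible_iff (tr a b)).mpr hi
  by_cases hd : h ∣ tr a b h
  · right
    have hit : ∀ k : ℕ, h.evalEval (x0 + k * a) (y0 + k * b) = 0 := by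
      intro k
      induction k with
      | zero => simpa using hz
      | succ k ih =>
        have := evalEval_dvd (x0 + k * a) (y0 + k * b) hd
        rw [ih, zero_dvd_iff, tr_evalEval] at this
        rw [← this]
        congr 1 <;> (push_cast; ring)
    set lam : ℚ[X] := C y0 + C (b / a) * (X - C x0) with hlam
    have hroot : h.IsRoot lam := by
      show h.eval lam = 0
      by_contra hne
      have hinj : Function.Injective (fun k : ℕ => x0 + k * a) := by
        intro k l hkl
        have : (k : ℚ) * a = l * a := by simpa using hkl
        exact_mod_cast mul_right_cancel₀ ha this
      have hsub : Set.range (fun k : ℕ => x0 + k * a) ⊆ {x | (h.eval lam).IsRoot x} := by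
        rintro _ ⟨k, rfl⟩
        show eval (x0 + k * a) (eval lam h) = 0
        have e : eval (x0 + k * a) (eval lam h) = h.evalEval (x0 + k * a) (eval (x0 + k * a) lam) := by
          rw [← eval₂_evalRingHom]
          exact (eval₂_hom (evalRingHom (x0 + k * a)) lam).symm
        rw [e, ← hit k]
        congr 1
        simp [hlam]
        field_simp
      exact (Set.infinite_range_of_injective hinj).mono hsub (finite_setOfPred_isRoot hne)
    rw [← dvd_iff_isRoot] at hroot
    obtain ⟨w, hw⟩ := hroot
    have hu : IsUnit w := (hi.isUnit_or_isUnit hw).resolve_left (not_isUnit_X_sub_C _)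
    intro x y hxy
    obtain ⟨w', hw'⟩ := hu.exists_right_inv
    have e : X - C lam = h * w' := by rw [hw, mul_assoc, hw', mul_one]
    have := congrArg (evalEval x y) e
    rw [evalEval_mul, hxy, zero_mul, evalEval_sub, evalEval_X, evalEval_C, hlam] at this
    simp at this
    field_simp at this
    linear_combination this
  · left
    obtain ⟨r, hr, hr2, hr3⟩ := irred_coprime hi hi' h1 (by rw [tr_natDegree]; exact h1) hd hX (tr_coeff_natDegree a b h 6 hX)
    refine ⟨r, hr, hr2.trans ?_, ?_⟩
    · rw [tr_natDegree]; omega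
    · intro x y hx hy
      exact hr3 x y hx (by rw [tr_evalEval]; exact hy)

end SecG2

section SecG3

open Polynomial in
lemma factor_split {H : ℚ[X][X]} (h0 : H ≠ 0) (hY : H.natDegree ≤ 6) (hX : ∀ i, (H.coeff i).natDegree ≤ 6) :
    ∃ Fs : Finset ℚ[X][X], Fs.card ≤ 6 ∧ (∀ h ∈ Fs, Irreducible h ∧ 1 ≤ h.natDegree ∧ h.natDegree ≤ 6 ∧ ∀ i, (h.coeff i).natDegree ≤ 6) ∧
      ∀ x y, H.evalEval x y = 0 → H.leadingCoeff.eval x = 0 ∨ ∃ h ∈ Fs, h.evalEval x y = 0 := by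
  classical
  have hprod := UniqueFactorizationMonoid.factors_prod h0
  set s := UniqueFactorizationMonoid.factors H with hs
  have hirr : ∀ p ∈ s, Irreducible p := fun p hp => UniqueFactorizationMonoid.irreducible_of_factor p hp
  have hdvd : ∀ p ∈ s, p ∣ H := fun p hp => (Multiset.dvd_prod hp).trans hprod.dvd
  clear_value s
  refine ⟨(s.filter fun p => 1 ≤ p.natDegree).toFinset, ?_, ?_, ?_⟩
  · refine (Multiset.toFinset_card_le _).trans ?_
    have h1 : s.prod.natDegree ≤ 6 := by
      exact (natDegree_le_of_dvd hprod.dvd h0).trans hY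
    have h00 : (0 : ℚ[X][X]) ∉ s := fun h => (hirr 0 h).ne_zero rfl
    rw [natDegree_multiset_prod _ h00] at h1
    refine le_trans ?_ h1
    clear * -
    induction s using Multiset.induction_on with
    | empty => simp
    | cons a s ih =>
      simp only [Multiset.map_cons, Multiset.sum_cons, Multiset.filter_cons]
      split_ifs with h
      · simp; omega
      · simp; omega
  · intro h hh
    simp only [Multiset.mem_toFinset, Multiset.mem_filter] at hh
    exact ⟨hirr h hh.1, hh.2, (natDegree_le_of_dvd (hdvd h hh.1) h0).trans hY, dvd_coeff_natDegree h0 (hdvd h hh.1) hX⟩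
  · intro x y hxy
    obtain ⟨u, hu⟩ := hprod
    have : s.prod.evalEval x y = 0 := by
      have e : s.prod = H * ((u⁻¹ : (ℚ[X][X])ˣ) : ℚ[X][X]) := by rw [← hu]; simp
      rw [e, evalEval_mul, hxy, zero_mul]
    rw [evalEval_multiset_prod, Multiset.prod_eq_zero_iff, Multiset.mem_map] at this
    obtain ⟨p, hp, hp0⟩ := this
    by_cases hp1 : 1 ≤ p.natDegree
    · right
      refine ⟨p, ?_, hp0⟩
      simp [hp, hp1]
    · left
      have hc := eq_C_of_natDegree_eq_zero (by omega : p.natDegree = 0)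
      obtain ⟨k, hk⟩ := hdvd p hp
      rw [hk, leadingCoeff_mul, hc, leadingCoeff_C, eval_mul]
      rw [hc, evalEval_C] at hp0
      rw [hp0, zero_mul]

/-- fibre counting: at most 72 points -/
lemma fst_card {T : Finset (ℤ × ℤ × ℤ)} (hinj : Set.InjOn Prod.fst (T : Set (ℤ × ℤ × ℤ))) {r : Polynomial ℚ} (hr : r ≠ 0)
    (h : ∀ p ∈ T, r.eval (p.1 : ℚ) = 0) : T.card ≤ r.natDegree := by
  classical
  have h1 : (T.image (fun p => (p.1 : ℚ))).card = T.card := by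
    apply Finset.card_image_of_injOn
    intro p hp q hq hpq
    have hpq' : (p.1 : ℚ) = q.1 := hpq
    exact hinj hp hq (by exact_mod_cast hpq')
  rw [← h1]
  refine (Finset.card_le_card (t := r.roots.toFinset) ?_).trans ((Multiset.toFinset_card_le _).trans (Polynomial.card_roots' _))
  intro x hx
  obtain ⟨p, hp, rfl⟩ := Finset.mem_image.mp hx
  rw [Multiset.mem_toFinset, Polynomial.mem_roots hr]
  exact h p hp

/-- points with the same prime q -/
lemma same_q_card {A B : ℤ} {M N : ℝ} (hM : 2 ≤ M) (hN : 0 < N) {T : Finset (ℤ × ℤ × ℤ)}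
    (hinj : Set.InjOn Prod.fst (T : Set (ℤ × ℤ × ℤ)))
    (hT : ∀ p ∈ T, CPt A B M N p) (q : ℤ) (hq : ∀ p ∈ T, p.2.1 = q) : (T.card : ℝ) ≤ 3 * (M + 1) := by
  classical
  rcases T.eq_empty_or_nonempty with rfl | ⟨p0, hp0⟩
  · simp; linarith
  have hC := hT p0 hp0
  have hqp : Prime q := hq p0 hp0 ▸ hC.qp
  have hq0 : 0 < q := hq p0 hp0 ▸ hC.q0
  have hq1 : N ≤ M * q := hq p0 hp0 ▸ hC.q1
  obtain ⟨q', rfl⟩ := Int.eq_ofNat_of_zero_le hq0.le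
  have hqp' : q'.Prime := Nat.prime_iff_prime_int.mpr hqp
  have := Fact.mk hqp'
  let g : Polynomial (ZMod q') := Polynomial.X ^ 3 + Polynomial.C (A : ZMod q') * Polynomial.X + Polynomial.C (B : ZMod q')
  have hg : g.Monic := gmonic _ _
  have hgd : g.natDegree ≤ 3 := by simp only [g]; compute_degree
  have h1 : ∀ p ∈ T, (p.1 : ZMod q') ∈ g.roots.toFinset := by
    intro p hp
    rw [Multiset.mem_toFinset, Polynomial.mem_roots hg.ne_zero]
    have e := (hT p hp).e
    rw [hq p hp] at e
    have e' := congrArg (fun z : ℤ => (z : ZMod q')) e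
    simp at e'
    show Polynomial.eval _ g = 0
    simp [g, ← e']
  have h2 : ∀ c ∈ g.roots.toFinset, ((T.filter fun p => (p.1 : ZMod q') = c).card : ℝ) ≤ M + 1 := by
    intro c _
    set T' := T.filter fun p => (p.1 : ZMod q') = c with hT'
    rcases T'.eq_empty_or_nonempty with h | ⟨p1, hp1⟩
    · rw [h]; simp; linarith
    have hqr : (0 : ℝ) < q' := by exact_mod_cast hq0
    have hsp := spaced_card (T'.image Prod.fst) (fun n : ℤ => (n : ℝ)) q' N (2 * N) hqr ⟨p1.1, Finset.mem_image_of_mem _ hp1⟩ ?_ ?_ ?_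
    · rw [Finset.card_image_of_injOn (hinj.mono (by intro x hx; exact (Finset.mem_filter.mp hx).1))] at hsp
      have : ((T'.card : ℝ) - 1) * q' ≤ M * q' := by
        refine hsp.trans ?_
        have hq1' : N ≤ M * (q' : ℝ) := by exact_mod_cast hq1
        linarith only [hq1']
      have := le_of_mul_le_mul_right this hqr
      linarith only [this]
    · intro a ha b hb hab
      obtain ⟨pa, hpa, rfl⟩ := Finset.mem_image.mp ha
      obtain ⟨pb, hpb, rfl⟩ := Finset.mem_image.mp hb
      have e : ((pa.1 : ℤ) : ZMod q') = (pb.1 : ℤ) := (Finset.mem_filter.mp hpa).2.trans (Finset.mem_filter.mp hpb).2.symm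
      rw [ZMod.intCast_eq_intCast_iff_dvd_sub] at e
      have hne : pb.1 - pa.1 ≠ 0 := sub_ne_zero.mpr (fun h => hab h.symm)
      have hle := Int.le_of_dvd (abs_pos.mpr hne) ((dvd_abs _ _).mpr e)
      rw [abs_sub_comm] at hle
      exact_mod_cast hle
    · intro a ha
      obtain ⟨pa, hpa, rfl⟩ := Finset.mem_image.mp ha
      exact (hT _ (Finset.mem_filter.mp hpa).1).n1
    · intro a ha
      obtain ⟨pa, hpa, rfl⟩ := Finset.mem_image.mp ha
      exact (hT _ (Finset.mem_filter.mp hpa).1).n2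
  have h3 := Finset.card_eq_sum_card_fiberwise (f := fun p : ℤ × ℤ × ℤ => (p.1 : ZMod q')) (s := T) (t := g.roots.toFinset) (fun p hp => h1 p hp)
  rw [h3]
  push_cast
  calc _ ≤ ∑ c ∈ g.roots.toFinset, (M + 1) := Finset.sum_le_sum fun c hc => h2 c hc
    _ = (g.roots.toFinset.card : ℝ) * (M + 1) := by rw [Finset.sum_const, nsmul_eq_mul]
    _ ≤ 3 * (M + 1) := by
        have : g.roots.toFinset.card ≤ 3 := (Multiset.toFinset_card_le _).trans ((Polynomial.card_roots' _).trans hgd)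
        gcongr
        exact_mod_cast this

lemma prime_prod_card (Q : Finset ℤ) (E : ℤ) (hE : E ≠ 0) (N : ℝ) (hN : 1 < N) (k : ℕ) (hEN : ((E : ℝ)) ^ 2 ≤ N ^ k)
    (hQ : ∀ q ∈ Q, Prime q ∧ 0 < q ∧ q ∣ E ∧ N ≤ (q : ℝ) ^ 2) : Q.card ≤ k := by
  have hd : ∏ q ∈ Q, q ∣ E := by
    refine Finset.prod_dvd_of_coprime ?_ (fun q hq => (hQ q hq).2.2.1)
    intro a ha b hb hab
    refine ((hQ a ha).1.irreducible.coprime_iff_not_dvd).mpr fun hdv => hab ?_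
    have hass := ((hQ a ha).1.dvd_prime_iff_associated (hQ b hb).1).mp hdv
    rcases Int.associated_iff.mp hass with h | h
    · exact h
    · have h1 := (hQ a ha).2.1
      have h2 := (hQ b hb).2.1
      omega
  have h1 : (∏ q ∈ Q, q) ^ 2 ≤ E ^ 2 := by
    rw [sq_le_sq]
    exact Int.le_of_dvd (abs_pos.mpr hE) (by simpa using hd)
  have h2 : N ^ Q.card ≤ N ^ k := by
    calc N ^ Q.card = ∏ q ∈ Q, N := by simp
      _ ≤ ∏ q ∈ Q, ((q : ℝ)) ^ 2 := Finset.prod_le_prod (fun _ _ => by linarith) (fun q hq => (hQ q hq).2.2.2)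
      _ = ((∏ q ∈ Q, q : ℤ) : ℝ) ^ 2 := by push_cast; rw [Finset.prod_pow]
      _ ≤ (E : ℝ) ^ 2 := by exact_mod_cast h1
      _ ≤ _ := hEN
  exact (pow_le_pow_iff_right₀ hN).mp h2

end SecG3

section SecG4

lemma line_card {A B : ℤ} {M N : ℝ} (hM : 2 ≤ M) (hA : |(A : ℝ)| ≤ M) (hB : |(B : ℝ)| ≤ M) (hN : M ^ 11 ≤ N)
    (hnr : ∀ a b : ℤ, b ≠ 0 → a ^ 3 + A * a * b ^ 2 + B * b ^ 3 ≠ 0)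
    {T : Finset (ℤ × ℤ × ℤ)} (hinj : Set.InjOn Prod.fst (T : Set (ℤ × ℤ × ℤ)))
    (hT : ∀ p ∈ T, CPt A B M N p) (d1 d2 n0 q0 : ℤ) (hd1 : d1 ≠ 0) (h1 : |(d1 : ℝ)| ≤ N) (h2 : |(d2 : ℝ)| ≤ M * N)
    (h3 : |(n0 : ℝ)| ≤ 2 * N) (h4 : |(q0 : ℝ)| ≤ M * N) (hl : ∀ p ∈ T, d1 * (p.2.1 - q0) = d2 * (p.1 - n0)) :
    (T.card : ℝ) ≤ 3 * (M + 1) + 14 := by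
  classical
  have hM0 : 0 < M := by linarith
  have hN1 : 1 < N := by
    refine lt_of_lt_of_le ?_ hN
    exact one_lt_pow₀ (by linarith) (by norm_num)
  have hN0 : 0 < N := by linarith
  by_cases hd2 : d2 = 0
  · have := same_q_card hM hN0 hinj hT q0 (by
      intro p hp
      have := hl p hp
      rw [hd2, zero_mul] at this
      have := (mul_eq_zero.mp this).resolve_left hd1
      omega)
    linarith
  have hE := hnr (d2 * n0 - d1 * q0) d2 hd2
  set a := d2 * n0 - d1 * q0 with ha
  set E := a ^ 3 + A * a * d2 ^ 2 + B * d2 ^ 3 with hEdef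
  have hc : (T.image fun p => p.2.1).card = T.card := by
    apply Finset.card_image_of_injOn
    intro p hp p' hp' hpp
    apply hinj hp hp'
    have e1 := hl p hp
    have e2 := hl p' hp'
    have hpp' : p.2.1 = p'.2.1 := hpp
    rw [hpp', e2] at e1
    have := mul_left_cancel₀ hd2 e1
    omega
  have hY : |(a : ℝ)| ≤ 3 * M * N ^ 2 := by
    rw [ha]; push_cast
    calc |(d2 : ℝ) * n0 - d1 * q0| ≤ |(d2 : ℝ) * n0| + |(d1 : ℝ) * q0| := abs_sub _ _
      _ = |(d2 : ℝ)| * |(n0 : ℝ)| + |(d1 : ℝ)| * |(q0 : ℝ)| := by rw [abs_mul, abs_mul]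
      _ ≤ (M * N) * (2 * N) + N * (M * N) := by gcongr
      _ = _ := by ring
  have hY2 : |(d2 : ℝ)| ≤ 3 * M * N ^ 2 := by
    refine h2.trans ?_
    calc M * N = 1 * M * N * 1 := by ring
      _ ≤ 3 * M * N * N := by gcongr; norm_num
      _ = _ := by ring
  have hEb : |(E : ℝ)| ≤ N ^ 7 := by
    rw [hEdef]; push_cast
    calc |(a : ℝ) ^ 3 + A * a * d2 ^ 2 + B * d2 ^ 3| ≤ |(a : ℝ) ^ 3 + A * a * d2 ^ 2| + |(B : ℝ) * d2 ^ 3| := abs_add_le _ _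
      _ ≤ |(a : ℝ) ^ 3| + |(A : ℝ) * a * d2 ^ 2| + |(B : ℝ) * d2 ^ 3| := by gcongr; exact abs_add_le _ _
      _ = |(a : ℝ)| ^ 3 + |(A : ℝ)| * |(a : ℝ)| * |(d2 : ℝ)| ^ 2 + |(B : ℝ)| * |(d2 : ℝ)| ^ 3 := by
          simp only [abs_mul, abs_pow]
      _ ≤ (3 * M * N ^ 2) ^ 3 + M * (3 * M * N ^ 2) * (3 * M * N ^ 2) ^ 2 + M * (3 * M * N ^ 2) ^ 3 := by gcongr
      _ = 27 * M ^ 3 * (1 + 2 * M) * N ^ 6 := by ring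
      _ ≤ 2 ^ 5 * M ^ 3 * (M + 2 * M) * N ^ 6 := by gcongr <;> linarith
      _ = 2 ^ 5 * 3 * M ^ 4 * N ^ 6 := by ring
      _ ≤ 2 ^ 5 * 2 ^ 2 * M ^ 4 * N ^ 6 := by gcongr; norm_num
      _ ≤ M ^ 5 * M ^ 2 * M ^ 4 * N ^ 6 := by gcongr
      _ = M ^ 11 * N ^ 6 := by ring
      _ ≤ N * N ^ 6 := by gcongr
      _ = _ := by ring
  have hcard := prime_prod_card (T.image fun p => p.2.1) E hE N hN1 14 (by
      rw [← sq_abs]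
      calc |(E : ℝ)| ^ 2 ≤ (N ^ 7) ^ 2 := by gcongr
        _ = _ := by ring) (by
      intro q hq
      obtain ⟨p, hp, rfl⟩ := Finset.mem_image.mp hq
      have hP := hT p hp
      refine ⟨hP.qp, hP.q0, ?_, ?_⟩
      · have e := hP.e
        have el : d2 * p.1 = d1 * p.2.1 + a := by rw [ha]; linear_combination -(hl p hp)
        refine ⟨d2 ^ 3 * p.2.1 * p.2.2 - d1 * ((d2 * p.1) ^ 2 + d2 * p.1 * a + a ^ 2 + A * d2 ^ 2), ?_⟩
        rw [hEdef]
        have e3 : d1 * p.2.1 = d2 * p.1 - a := by rw [el]; ring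
        linear_combination -d2 ^ 3 * e + ((d2 * p.1) ^ 2 + d2 * p.1 * a + a ^ 2 + A * d2 ^ 2) * e3
      · have hq1 := hP.q1
        have hM2 : M ^ 2 ≤ N := le_trans (pow_le_pow_right₀ (by linarith) (by norm_num)) hN
        have : N * N ≤ N * (p.2.1 : ℝ) ^ 2 := by
          calc N * N ≤ (M * p.2.1) * (M * p.2.1) := mul_le_mul hq1 hq1 hN0.le (hN0.le.trans hq1)
            _ = M ^ 2 * (p.2.1 : ℝ) ^ 2 := by ring
            _ ≤ N * (p.2.1 : ℝ) ^ 2 := by gcongr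
        exact le_of_mul_le_mul_left this hN0)
  rw [hc] at hcard
  have : (T.card : ℝ) ≤ 14 := by exact_mod_cast hcard
  linarith

lemma pair_count {ι κ : Type*} [DecidableEq κ] (T : Finset ι) (cl : ι → κ) (K : Finset κ) (hK : ∀ p ∈ T, cl p ∈ K) :
    T.card ^ 2 ≤ K.card * ((T ×ˢ T).filter fun p => cl p.1 = cl p.2).card := by
  have h3 := Finset.card_eq_sum_card_fiberwise (f := cl) (s := T) (t := K) (fun p hp => hK p hp)
  have h4 := Finset.card_eq_sum_card_fiberwise (f := fun p : ι × ι => cl p.1) (s := (T ×ˢ T).filter fun p => cl p.1 = cl p.2) (t := K)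
    (fun p hp => hK p.1 (by
      have := (Finset.mem_filter.mp hp).1
      exact (Finset.mem_product.mp this).1))
  rw [h3, h4]
  refine (sq_sum_le_card_mul_sum_sq).trans ?_
  rw [Nat.cast_id]
  gcongr with c hc
  rw [sq, ← Finset.card_product]
  apply le_of_eq
  congr 1
  ext ⟨p, q⟩
  simp only [Finset.mem_product, Finset.mem_filter]
  constructor
  · rintro ⟨⟨h1, h2⟩, h3, h4⟩
    exact ⟨⟨⟨h1, h3⟩, h2.trans h4.symm⟩, h2⟩
  · rintro ⟨⟨⟨h1, h3⟩, h2⟩, h4⟩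
    exact ⟨⟨h1, h4⟩, h3, h2.symm.trans h4⟩

lemma tri_count (T : Finset (ℤ × ℤ × ℤ)) (hinj : Set.InjOn Prod.fst (T : Set (ℤ × ℤ × ℤ))) (R : (ℤ × ℤ × ℤ) → (ℤ × ℤ × ℤ) → Prop)
    [∀ p q, Decidable (R p q)] (hR : ∀ p q, R p q → R q p) :
    ((T ×ˢ T).filter fun p => R p.1 p.2).card ≤ T.card + 2 * ((T ×ˢ T).filter fun p => R p.1 p.2 ∧ p.1.1 < p.2.1).card := by
  classical
  have hsub : ((T ×ˢ T).filter fun p => R p.1 p.2) ⊆ (T.image fun p => (p, p)) ∪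
      (((T ×ˢ T).filter fun p => R p.1 p.2 ∧ p.1.1 < p.2.1) ∪ ((T ×ˢ T).filter fun p => R p.1 p.2 ∧ p.1.1 < p.2.1).image Prod.swap) := by
    rintro ⟨p, q⟩ h
    simp only [Finset.mem_filter, Finset.mem_product] at h
    simp only [Finset.mem_union, Finset.mem_image, Finset.mem_filter, Finset.mem_product]
    rcases lt_trichotomy p.1 q.1 with h1 | h1 | h1
    · right; left; exact ⟨h.1, h.2, h1⟩
    · left
      have := hinj h.1.1 h.1.2 h1
      exact ⟨p, h.1.1, by rw [this]⟩
    · right; right; exact ⟨(q, p), ⟨⟨h.1.2, h.1.1⟩, hR _ _ h.2, h1⟩, rfl⟩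
  refine (Finset.card_le_card hsub).trans ((Finset.card_union_le _ _).trans ?_)
  have h1 : (T.image fun p => (p, p)).card ≤ T.card := Finset.card_image_le
  have h2 := Finset.card_union_le ((T ×ˢ T).filter fun p => R p.1 p.2 ∧ p.1.1 < p.2.1)
    (((T ×ˢ T).filter fun p => R p.1 p.2 ∧ p.1.1 < p.2.1).image Prod.swap)
  have h3 : (((T ×ˢ T).filter fun p => R p.1 p.2 ∧ p.1.1 < p.2.1).image Prod.swap).card ≤
    ((T ×ˢ T).filter fun p => R p.1 p.2 ∧ p.1.1 < p.2.1).card := Finset.card_image_le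
  omega

end SecG4

section SecG5

/-- congruent modulo l in the first two coordinates -/
def CCong (l : ℕ) (p q : ℤ × ℤ × ℤ) : Prop := ((p.1 : ZMod l), (p.2.1 : ZMod l)) = ((q.1 : ZMod l), (q.2.1 : ZMod l))

lemma CCong.dvd {l : ℕ} {p q : ℤ × ℤ × ℤ} (h : CCong l p q) : (l : ℤ) ∣ q.1 - p.1 ∧ (l : ℤ) ∣ q.2.1 - p.2.1 := by
  have h' := Prod.mk.inj h
  exact ⟨(ZMod.intCast_eq_intCast_iff_dvd_sub _ _ _).mp h'.1, (ZMod.intCast_eq_intCast_iff_dvd_sub _ _ _).mp h'.2⟩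

def cdiff (l : ℕ) (p q : ℤ × ℤ × ℤ) : ℤ × ℤ × ℤ := ((q.1 - p.1) / l, (q.2.1 - p.2.1) / l, (q.2.2 - p.2.2) / l)

open Polynomial in
lemma curve_card {A B : ℤ} {M N : ℝ} (hM : 2 ≤ M) (hA : |(A : ℝ)| ≤ M) (hB : |(B : ℝ)| ≤ M) (hN : M ^ 11 ≤ N)
    (hnr : ∀ a b : ℤ, b ≠ 0 → a ^ 3 + A * a * b ^ 2 + B * b ^ 3 ≠ 0)
    {T : Finset (ℤ × ℤ × ℤ)} (hinj : Set.InjOn Prod.fst (T : Set (ℤ × ℤ × ℤ)))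
    (hT : ∀ p ∈ T, CPt A B M N p) {h : ℚ[X][X]} (hi : Irreducible h) (h1 : 1 ≤ h.natDegree) (h6 : h.natDegree ≤ 6)
    (hX : ∀ i, (h.coeff i).natDegree ≤ 6) (hz : ∀ p ∈ T, h.evalEval (p.1 : ℚ) (p.2.1 : ℚ) = 0) (l : ℕ) (K : Finset (ZMod l × ZMod l))
    (hK : ∀ p ∈ T, ((p.1 : ZMod l), (p.2.1 : ZMod l)) ∈ K) (hKc : K.card ≤ 12 * l) (D : Finset (ℤ × ℤ × ℤ))
    (hD : ∀ p ∈ T, ∀ q ∈ T, p.1 < q.1 → CCong l p q → cdiff l p q ∈ D) :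
    (T.card : ℝ) ≤ 24 * l + 144 * D.card + (3 * (M + 1) + 14) := by
  classical
  have hM0 : 0 < M := by linarith
  by_cases hline : ∃ p0 ∈ T, ∃ p1 ∈ T, p0.1 ≠ p1.1 ∧
      ∀ x y, h.evalEval x y = 0 → ((p1.1 - p0.1 : ℤ) : ℚ) * (y - (p0.2.1 : ℚ)) = ((p1.2.1 - p0.2.1 : ℤ) : ℚ) * (x - (p0.1 : ℚ))
  · obtain ⟨p0, hp0, p1, hp1, hne, hl⟩ := hline
    have c0 := hT p0 hp0
    have c1 := hT p1 hp1
    have n0 := c0.n1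
    have n0' := c0.n2
    have n1 := c1.n1
    have n1' := c1.n2
    have hN0 : 0 < N := lt_of_lt_of_le (by positivity) hN
    have r0 : (0 : ℝ) < p0.2.1 := by exact_mod_cast c0.q0
    have r1 : (0 : ℝ) < p1.2.1 := by exact_mod_cast c1.q0
    have r0' := c0.q2
    have r1' := c1.q2
    have := line_card hM hA hB hN hnr hinj hT (p1.1 - p0.1) (p1.2.1 - p0.2.1) p0.1 p0.2.1 (sub_ne_zero.mpr hne.symm)
      (by push_cast; rw [abs_le]; constructor <;> linarith only [n0, n0', n1, n1'])
      (by push_cast; rw [abs_le]; constructor <;> linarith only [r0, r0', r1, r1'])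
      (by rw [abs_le]; constructor <;> linarith only [n0, n0', hN0])
      (by rw [abs_le]; constructor <;> linarith only [r0, r0'])
      (by intro p hp; exact_mod_cast hl _ _ (hz p hp))
    have h0 : (0 : ℝ) ≤ 24 * l + 144 * D.card := by positivity
    linarith only [this, h0]
  · push Not at hline
    have hlt : ((T ×ˢ T).filter fun p => CCong l p.1 p.2 ∧ p.1.1 < p.2.1).card ≤ 72 * D.card := by
      refine Finset.card_le_mul_card_image_of_maps_to (f := fun p => cdiff l p.1 p.2) ?_ 72 ?_
      · intro p hp
        obtain ⟨hp1, hp2, hp3⟩ := Finset.mem_filter.mp hp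
        exact hD _ (Finset.mem_product.mp hp1).1 _ (Finset.mem_product.mp hp1).2 hp3 hp2
      · intro d hd
        set Fb := (((T ×ˢ T).filter fun p => CCong l p.1 p.2 ∧ p.1.1 < p.2.1).filter fun p => cdiff l p.1 p.2 = d) with hFb
        rcases Fb.eq_empty_or_nonempty with he | ⟨⟨p0, p1⟩, hp⟩
        · rw [he]; simp
        have hmem : ∀ p ∈ Fb, p.1 ∈ T ∧ p.2 ∈ T ∧ CCong l p.1 p.2 ∧ p.1.1 < p.2.1 ∧ p.2.1 = p.1.1 + l * d.1 ∧ p.2.2.1 = p.1.2.1 + l * d.2.1 := by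
          intro p hp
          rw [hFb, Finset.mem_filter, Finset.mem_filter, Finset.mem_product] at hp
          obtain ⟨⟨⟨a1, a2⟩, a3, a4⟩, a5⟩ := hp
          refine ⟨a1, a2, a3, a4, ?_, ?_⟩
          · rw [← a5]
            simp only [cdiff]
            rw [Int.mul_ediv_cancel' a3.dvd.1]; ring
          · rw [← a5]
            simp only [cdiff]
            rw [Int.mul_ediv_cancel' a3.dvd.2]; ring
        obtain ⟨b1, b2, b3, b4, b5, b6⟩ := hmem _ hp
        simp only at b1 b2 b3 b4 b5 b6
        rcases translate_dich hi h1 h6 hX ((p1.1 - p0.1 : ℤ) : ℚ) ((p1.2.1 - p0.2.1 : ℤ) : ℚ)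
          (by exact_mod_cast sub_ne_zero.mpr b4.ne') (p0.1 : ℚ) (p0.2.1 : ℚ) (hz _ b1) with ⟨r, hr, hr72, hr3⟩ | hbad
        · have hinj1 : Set.InjOn (Prod.fst : (ℤ × ℤ × ℤ) × (ℤ × ℤ × ℤ) → _) Fb := by
            intro p hp q hq hpq
            obtain ⟨_, a2, _, _, a5, _⟩ := hmem p hp
            obtain ⟨_, e2, _, _, e5, _⟩ := hmem q hq
            refine Prod.ext hpq (hinj a2 e2 ?_)
            rw [a5, e5, hpq]
          rw [← Finset.card_image_of_injOn hinj1]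
          refine (fst_card (hinj.mono ?_) hr ?_).trans hr72
          · intro x hx
            obtain ⟨p, hp, rfl⟩ := Finset.mem_image.mp hx
            exact (hmem p hp).1
          · intro x hx
            obtain ⟨p, hp, rfl⟩ := Finset.mem_image.mp hx
            obtain ⟨a1, a2, a3, a4, a5, a6⟩ := hmem p hp
            refine hr3 _ _ (hz _ a1) ?_
            have := hz _ a2
            rw [a5, a6] at this
            rw [← this]
            congr 1
            · rw [b5]; push_cast; ring
            · rw [b6]; push_cast; ring
        · obtain ⟨x, y, hxy, hxy'⟩ := hline p0 b1 p1 b2 b4.ne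
          exact absurd (hbad x y hxy) hxy'
    have hp := pair_count T (fun p => ((p.1 : ZMod l), (p.2.1 : ZMod l))) K hK
    have ht := tri_count T hinj (CCong l) (fun p q hpq => hpq.symm)
    have hp' : T.card ^ 2 ≤ 12 * l * (T.card + 144 * D.card) := by
      refine hp.trans (Nat.mul_le_mul hKc ?_)
      refine le_trans (le_of_eq ?_) (ht.trans (by omega))
      congr
    have hk : T.card ≤ 24 * l + 144 * D.card := by
      by_contra hcon
      push Not at hcon
      generalize T.card = k at hp' hcon
      generalize D.card = e at hp' hcon
      nlinarith
    have : (T.card : ℝ) ≤ 24 * l + 144 * D.card := by exact_mod_cast hk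
    linarith

end SecG5

section SecG6

open Polynomial in
lemma strip_bound {A B : ℤ} {M V N u : ℝ} (hM : 2 ≤ M) (hA : |(A : ℝ)| ≤ M) (hB : |(B : ℝ)| ≤ M) (hV : M ^ 90 ≤ V)
    (hN : N = V ^ 14) (hu : 1 ≤ 4 * M * u)
    (hnr : ∀ a b : ℤ, b ≠ 0 → a ^ 3 + A * a * b ^ 2 + B * b ^ 3 ≠ 0)
    (T : Finset (ℤ × ℤ × ℤ)) (hinj : Set.InjOn Prod.fst (T : Set (ℤ × ℤ × ℤ))) (hT : ∀ p ∈ T, CPt A B M N p ∧ CStrip u V p)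
    (l : ℕ) (hl : l.Prime) (D : Finset (ℤ × ℤ × ℤ))
    (hD : ∀ p ∈ T, ∀ q ∈ T, p.1 < q.1 → CCong l p q → cdiff l p q ∈ D) :
    (T.card : ℝ) ≤ 6 + 6 * (24 * l + 144 * D.card + (3 * (M + 1) + 14)) := by
  classical
  obtain ⟨c, hc1, hc2⟩ := strip_relation hM hA hB hV hN hu T hT
  have := Fact.mk hl
  have hev : ∀ p ∈ T, (HH c A B).evalEval p.1 p.2.1 = 0 := by
    intro p hp
    rw [HH_evalEval_eq c A B p.1 p.2.1 p.2.2 (hT p hp).1.e]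
    have := hc2 p hp
    rw [Fin.sum_univ_seven] at this
    simp [cvec] at this
    rw [this, mul_zero]
  have hM1 : 1 ≤ M := by linarith
  have hNM : M ^ 11 ≤ N := by
    rw [hN]
    calc M ^ 11 ≤ M ^ (90 * 14) := pow_le_pow_right₀ hM1 (by norm_num)
      _ = (M ^ 90) ^ 14 := by rw [pow_mul]
      _ ≤ V ^ 14 := by gcongr
  -- mod l
  have hmod : ∃ i, ((c i : ℤ) : ZMod l) ≠ 0 := by
    by_contra hcon
    push Not at hcon
    have := hc1 l (fun i => (ZMod.intCast_zmod_eq_zero_iff_dvd _ _).mp (hcon i))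
    exact (Nat.prime_iff_prime_int.mp hl).not_isUnit this
  have hevl : ∀ p ∈ T, (HH (fun i => (c i : ZMod l)) A B).evalEval (p.1 : ZMod l) (p.2.1 : ZMod l) = 0 := by
    intro p hp
    have h1 := HH_map (Int.castRingHom (ZMod l)) c A B
    have h2 := map_mapRingHom_evalEval (Int.castRingHom (ZMod l)) (HH c A B) p.1 p.2.1
    rw [hev p hp, h1] at h2
    simpa using h2
  have hevq : ∀ p ∈ T, (HH (fun i => (c i : ℚ)) A B).evalEval (p.1 : ℚ) (p.2.1 : ℚ) = 0 := by
    intro p hp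
    have h1 := HH_map (Int.castRingHom ℚ) c A B
    have h2 := map_mapRingHom_evalEval (Int.castRingHom ℚ) (HH c A B) p.1 p.2.1
    rw [hev p hp, h1] at h2
    simpa using h2
  have hq0 : HH (fun i => (c i : ℚ)) (A : ℚ) (B : ℚ) ≠ 0 := by
    apply HH_ne_zero
    by_contra hcon
    push Not at hcon
    obtain ⟨i, hi⟩ := hmod
    apply hi
    have : c i = 0 := by exact_mod_cast hcon i
    rw [this]; simp
  set H := HH (fun i => (c i : ℚ)) (A : ℚ) (B : ℚ) with hH
  have hHY : H.natDegree ≤ 6 := HH_natDegree _ _ _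
  have hHX : ∀ i, (H.coeff i).natDegree ≤ 6 := HH_coeff_natDegree _ _ _
  clear_value H
  obtain ⟨Fs, hFs, hF1, hF2⟩ := factor_split hq0 hHY hHX
  set K := Finset.univ.filter fun p : ZMod l × ZMod l => (HH (fun i => (c i : ZMod l)) (A : ZMod l) B).evalEval p.1 p.2 = 0 with hK
  have hKc : K.card ≤ 12 * l := by
    have := zero_count (HH (fun i => (c i : ZMod l)) (A : ZMod l) B) (HH_ne_zero _ _ _ hmod) 6 (HH_natDegree _ _ _) (HH_coeff_natDegree _ _ _)
    rw [ZMod.card] at this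
    exact this
  have hTK : ∀ p ∈ T, ((p.1 : ZMod l), (p.2.1 : ZMod l)) ∈ K := by
    intro p hp
    rw [hK, Finset.mem_filter]
    exact ⟨Finset.mem_univ _, hevl p hp⟩
  have hcov : T ⊆ (T.filter fun p => H.leadingCoeff.eval (p.1 : ℚ) = 0) ∪
      Fs.biUnion (fun h => T.filter fun p => h.evalEval (p.1 : ℚ) (p.2.1 : ℚ) = 0) := by
    intro p hp
    rcases hF2 _ _ (hevq p hp) with h | ⟨h, hh, hh2⟩
    · exact Finset.mem_union_left _ (Finset.mem_filter.mpr ⟨hp, h⟩)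
    · exact Finset.mem_union_right _ (Finset.mem_biUnion.mpr ⟨h, hh, Finset.mem_filter.mpr ⟨hp, hh2⟩⟩)
  have c1 : (T.filter fun p => H.leadingCoeff.eval (p.1 : ℚ) = 0).card ≤ 6 := by
    refine (fst_card (r := H.leadingCoeff) (hinj.mono (by intro x hx; exact (Finset.mem_filter.mp hx).1)) (leadingCoeff_ne_zero.mpr hq0) ?_).trans (hHX _)
    intro p hp
    exact (Finset.mem_filter.mp hp).2
  have c2 : ∀ h ∈ Fs, ((T.filter fun p => h.evalEval (p.1 : ℚ) (p.2.1 : ℚ) = 0).card : ℝ) ≤ 24 * l + 144 * D.card + (3 * (M + 1) + 14) := by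
    intro h hh
    obtain ⟨i1, i2, i3, i4⟩ := hF1 h hh
    refine curve_card hM hA hB hNM hnr (hinj.mono (by intro x hx; exact (Finset.mem_filter.mp hx).1)) ?_ i1 i2 i3 i4 ?_ l K ?_ hKc D ?_
    · intro p hp; exact (hT p (Finset.mem_filter.mp hp).1).1
    · intro p hp; exact (Finset.mem_filter.mp hp).2
    · intro p hp; exact hTK p (Finset.mem_filter.mp hp).1
    · intro p hp q hq; exact hD p (Finset.mem_filter.mp hp).1 q (Finset.mem_filter.mp hq).1
  have c3 : (T.card : ℝ) ≤ (T.filter fun p => H.leadingCoeff.eval (p.1 : ℚ) = 0).card +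
      ∑ h ∈ Fs, ((T.filter fun p => h.evalEval (p.1 : ℚ) (p.2.1 : ℚ) = 0).card : ℝ) := by
    have := (Finset.card_le_card hcov).trans ((Finset.card_union_le _ _).trans (Nat.add_le_add_left Finset.card_biUnion_le _))
    exact_mod_cast this
  refine c3.trans (add_le_add (by exact_mod_cast c1) ?_)
  calc _ ≤ ∑ h ∈ Fs, (24 * (l : ℝ) + 144 * D.card + (3 * (M + 1) + 14)) := Finset.sum_le_sum c2
    _ = (Fs.card : ℝ) * _ := by rw [Finset.sum_const, nsmul_eq_mul]
    _ ≤ 6 * _ := by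
        have : (Fs.card : ℝ) ≤ 6 := by exact_mod_cast hFs
        gcongr

end SecG6

section SecH1

lemma cdiff_third {A B : ℤ} {l : ℕ} (hl : l.Prime) {p q : ℤ × ℤ × ℤ} (ep : p.2.1 ^ 2 * p.2.2 = p.1 ^ 3 + A * p.1 + B)
    (eq : q.2.1 ^ 2 * q.2.2 = q.1 ^ 3 + A * q.1 + B) (hpr : Prime p.2.1) (hlt : (l : ℤ) < p.2.1) (h : CCong l p q) :
    (l : ℤ) ∣ q.2.2 - p.2.2 := by
  have := Fact.mk hl
  rw [← ZMod.intCast_eq_intCast_iff_dvd_sub]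
  have h' := Prod.mk.inj h
  have e1 := congrArg (fun z : ℤ => (z : ZMod l)) ep
  have e2 := congrArg (fun z : ℤ => (z : ZMod l)) eq
  simp only [Int.cast_mul, Int.cast_pow, Int.cast_add] at e1 e2
  rw [← h'.1, ← h'.2, ← e1] at e2
  have hne : (p.2.1 : ZMod l) ≠ 0 := by
    intro h0
    rw [ZMod.intCast_zmod_eq_zero_iff_dvd] at h0
    have hlp := Nat.prime_iff_prime_int.mp hl
    have hass := (hlp.dvd_prime_iff_associated hpr).mp h0
    rcases Int.associated_iff.mp hass with h | h <;> omega
  exact (mul_left_cancel₀ (pow_ne_zero 2 hne) e2).symm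

lemma pair_delta {A B : ℤ} {M V N u v : ℝ} (hM : 2 ≤ M) (hA : |(A : ℝ)| ≤ M) (hB : |(B : ℝ)| ≤ M) (hV : 1 ≤ V) (hN : 1 ≤ N)
    (huv : u * v = 1) (hu0 : 0 < u) (hv4 : v ≤ 4 * M) {l : ℕ} (hl : l.Prime) (hl1 : V ≤ 2 * M ^ 3 * l)
    {p q : ℤ × ℤ × ℤ} (cp : CPt A B M N p) (cq : CPt A B M N q) (sp : CStrip u V p) (sq : CStrip u V q) (hlt : (l : ℤ) < p.2.1)
    (h : CCong l p q) (hpq : p.1 < q.1) :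
    1 ≤ (cdiff l p q).1 ∧ ((cdiff l p q).1 : ℝ) * l ≤ N ∧ |((cdiff l p q).2.1 : ℝ) - u * (cdiff l p q).1| ≤ 4 * M ^ 3 ∧
    |((cdiff l p q).2.2 : ℝ) + 2 * v ^ 3 * (cdiff l p q).2.1 - 3 * v ^ 2 * (cdiff l p q).1| ≤ 4 * M ^ 19 * V / N := by
  obtain ⟨d1, d2⟩ := h.dvd
  have d3 := cdiff_third hl cp.e cq.e cp.qp hlt h
  have hM0 : 0 < M := by linarith
  have hl0 : (0 : ℝ) < l := by exact_mod_cast hl.pos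
  have hN0 : 0 < N := by linarith
  obtain ⟨x, hx⟩ := d1
  obtain ⟨y, hy⟩ := d2
  obtain ⟨z, hz⟩ := d3
  have hlz : (l : ℤ) ≠ 0 := by exact_mod_cast hl.pos.ne'
  have hd : cdiff l p q = (x, y, z) := by
    simp only [cdiff, hx, hy, hz, Int.mul_ediv_cancel_left _ hlz]
  rw [hd]
  simp only
  have rp := (strip_real hM hN hV hA hB huv hu0 hv4 cp.n1 sp.1 sp.2 (by ring : (p.2.1 : ℝ) = u * p.1 + (p.2.1 - u * p.1)) (by exact_mod_cast cp.e : (p.2.1 : ℝ) ^ 2 * p.2.2 = _)).1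
  have rq := (strip_real hM hN hV hA hB huv hu0 hv4 cq.n1 sq.1 sq.2 (by ring : (q.2.1 : ℝ) = u * q.1 + (q.2.1 - u * q.1)) (by exact_mod_cast cq.e : (q.2.1 : ℝ) ^ 2 * q.2.2 = _)).1
  have hx' : (l : ℝ) * x = q.1 - p.1 := by exact_mod_cast hx.symm
  have hy' : (l : ℝ) * y = q.2.1 - p.2.1 := by exact_mod_cast hy.symm
  have hz' : (l : ℝ) * z = q.2.2 - p.2.2 := by exact_mod_cast hz.symm
  have n1 := cp.n1
  have n2 := cq.n2
  refine ⟨?_, ?_, ?_, ?_⟩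
  · have : 0 < (l : ℤ) * x := by rw [← hx]; omega
    have := (mul_pos_iff_of_pos_left (by exact_mod_cast hl.pos : (0 : ℤ) < l)).mp this
    omega
  · rw [mul_comm, hx']; linarith only [n1, n2]
  · have e : (l : ℝ) * (y - u * x) = (q.2.1 - u * q.1) - (p.2.1 - u * p.1) := by
      linear_combination hy' - u * hx'
    have : (l : ℝ) * |y - u * x| ≤ l * (4 * M ^ 3) := by
      rw [← abs_of_pos hl0, ← abs_mul, abs_of_pos hl0, e]
      have s1 := sp.1
      have s2 := sp.2
      have s3 := sq.1
      have s4 := sq.2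
      rw [abs_le]
      constructor <;> linarith only [s1, s2, s3, s4, hl1]
    exact le_of_mul_le_mul_left this hl0
  · have e : (l : ℝ) * (z + 2 * v ^ 3 * y - 3 * v ^ 2 * x) = ((q.2.2 : ℝ) + 2 * v ^ 3 * q.2.1 - 3 * v ^ 2 * q.1) - (p.2.2 + 2 * v ^ 3 * p.2.1 - 3 * v ^ 2 * p.1) := by
      linear_combination hz' + 2 * v ^ 3 * hy' - 3 * v ^ 2 * hx'
    have : (l : ℝ) * |z + 2 * v ^ 3 * y - 3 * v ^ 2 * x| ≤ l * (4 * M ^ 19 * V / N) := by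
      rw [← abs_of_pos hl0, ← abs_mul, abs_of_pos hl0, e]
      refine (abs_sub _ _).trans ?_
      have h1 : M ^ 16 * V ^ 2 / N ≤ l * (2 * M ^ 19 * V / N) := by
        rw [mul_div_assoc', div_le_div_iff_of_pos_right hN0]
        calc M ^ 16 * V ^ 2 = M ^ 16 * V * V := by ring
          _ ≤ M ^ 16 * V * (2 * M ^ 3 * l) := by gcongr
          _ = _ := by ring
      have h2 : (l : ℝ) * (4 * M ^ 19 * V / N) = l * (2 * M ^ 19 * V / N) + l * (2 * M ^ 19 * V / N) := by ring
      linarith only [rp, rq, h1, h2]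
    exact le_of_mul_le_mul_left this hl0

lemma delta_nfam {M V N u v l : ℝ} (hM : 8 ≤ M) (hV : 1 ≤ V) (hN : 1 ≤ N) (huv : u * v = 1) (hu0 : 0 < u) (huM : u ≤ M) (hv4 : v ≤ 4 * M)
    (hl0 : 0 < l) (hl1 : V ≤ 2 * M ^ 3 * l) {x y z : ℤ} (hx : M ^ 6 ≤ (x : ℝ)) (hxl : (x : ℝ) * l ≤ N) (hy : |(y : ℝ) - u * x| ≤ 4 * M ^ 3)
    (hz : |(z : ℝ) + 2 * v ^ 3 * y - 3 * v ^ 2 * x| ≤ 4 * M ^ 19 * V / N) : NFam (M ^ 30) x y z := by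
  have hM0 : 0 < M := by linarith
  have hM1 : 1 ≤ M := by linarith
  have hN0 : 0 < N := by linarith
  have hx0 : (0 : ℝ) < x := lt_of_lt_of_le (by positivity) hx
  have hv0 : 0 < v := by
    by_contra h
    have : u * v ≤ 0 := mul_nonpos_of_nonneg_of_nonpos hu0.le (by linarith)
    linarith
  have h1 : 8 * M ^ 3 ≤ u * x := by
    have : v * (8 * M ^ 3) ≤ v * (u * x) := by
      calc v * (8 * M ^ 3) ≤ 4 * M * (8 * M ^ 3) := by gcongr
        _ = 32 * M ^ 4 := by ring
        _ ≤ 8 ^ 2 * M ^ 4 := by gcongr; norm_num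
        _ ≤ M ^ 2 * M ^ 4 := by gcongr
        _ = M ^ 6 := by ring
        _ ≤ x := hx
        _ = (u * v) * x := by rw [huv, one_mul]
        _ = _ := by ring
    exact le_of_mul_le_mul_left this hv0
  obtain ⟨hya, hyb⟩ := abs_le.mp hy
  have hM3 : 1 ≤ M ^ 3 := one_le_pow₀ hM1
  have y1 : u * x ≤ 2 * y := by linarith only [hya, h1]
  have y2 : (y : ℝ) ≤ 2 * (u * x) := by linarith only [hyb, h1, hM3]
  have y0 : (1 : ℝ) ≤ y := by linarith only [y1, h1, hM3]
  have y3 : (y : ℝ) ≤ 2 * M * x := by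
    refine y2.trans ?_
    calc 2 * (u * x) ≤ 2 * (M * x) := by gcongr
      _ = _ := by ring
  have x1 : (1 : ℝ) ≤ x := le_trans (one_le_pow₀ hM1) hx
  refine ⟨?_, ?_, ?_, ?_, ?_⟩
  · exact_mod_cast x1
  · exact_mod_cast y0
  · calc (x : ℝ) = (u * v) * x := by rw [huv, one_mul]
      _ = v * (u * x) := by ring
      _ ≤ (4 * M) * (2 * y) := by gcongr
      _ = 8 * M * y := by ring
      _ ≤ M * M * y := by gcongr
      _ = M ^ 2 * y := by ring
      _ ≤ M ^ 30 * y := by gcongr; norm_num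
  · refine y3.trans ?_
    calc 2 * M * (x : ℝ) ≤ M * M * x := by gcongr; linarith
      _ = M ^ 2 * x := by ring
      _ ≤ M ^ 30 * x := by gcongr; norm_num
  · set s := (y : ℝ) - u * x with hs
    set w := (z : ℝ) + 2 * v ^ 3 * y - 3 * v ^ 2 * x with hw
    have key : (y : ℝ) ^ 2 * z - x ^ 3 = y ^ 2 * w - 3 * v ^ 2 * x * s ^ 2 - 2 * v ^ 3 * s ^ 3 := by
      have e1 : (v ^ 3) * (u ^ 3) = 1 := by rw [← mul_pow, mul_comm v u, huv, one_pow]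
      have e2 : (v * u) = 1 := by rw [mul_comm, huv]
      have hvi : v = 1 / u := by field_simp; linear_combination huv
      rw [hw, hs, hvi]
      field_simp
      ring
    rw [key]
    clear_value s w
    have t1 : |(y : ℝ) ^ 2 * w| ≤ 32 * M ^ 24 * x := by
      rw [abs_mul, abs_pow, abs_of_nonneg (by linarith only [y0] : (0 : ℝ) ≤ y)]
      calc (y : ℝ) ^ 2 * |w| ≤ (2 * M * x) ^ 2 * (4 * M ^ 19 * V / N) := by gcongr
        _ ≤ (2 * M * x) ^ 2 * (4 * M ^ 19 * (2 * M ^ 3 * l) / N) := by gcongr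
        _ = 32 * M ^ 24 * x * ((x * l) / N) := by ring
        _ ≤ 32 * M ^ 24 * x * 1 := by
            gcongr
            rw [div_le_one hN0]; exact hxl
        _ = _ := by ring
    have t2 : |3 * v ^ 2 * x * s ^ 2| ≤ 768 * M ^ 8 * x := by
      rw [abs_mul, abs_pow, abs_of_nonneg (by positivity : (0 : ℝ) ≤ 3 * v ^ 2 * x)]
      calc 3 * v ^ 2 * x * |s| ^ 2 ≤ 3 * (4 * M) ^ 2 * x * (4 * M ^ 3) ^ 2 := by gcongr
        _ = _ := by ring
    have t3 : |2 * v ^ 3 * s ^ 3| ≤ 8192 * M ^ 12 * x := by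
      rw [abs_mul, abs_pow, abs_of_nonneg (by positivity : (0 : ℝ) ≤ 2 * v ^ 3)]
      calc 2 * v ^ 3 * |s| ^ 3 ≤ 2 * (4 * M) ^ 3 * (4 * M ^ 3) ^ 3 := by gcongr
        _ = 8192 * M ^ 12 * 1 := by ring
        _ ≤ _ := by gcongr
    calc |(y : ℝ) ^ 2 * w - 3 * v ^ 2 * x * s ^ 2 - 2 * v ^ 3 * s ^ 3|
        ≤ |(y : ℝ) ^ 2 * w| + |3 * v ^ 2 * x * s ^ 2| + |2 * v ^ 3 * s ^ 3| := (abs_sub _ _).trans (by gcongr; exact abs_sub _ _)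
      _ ≤ 32 * M ^ 24 * x + 768 * M ^ 8 * x + 8192 * M ^ 12 * x := by gcongr
      _ ≤ 32 * M ^ 24 * x + 768 * M ^ 24 * x + 8192 * M ^ 24 * x := by gcongr <;> first | exact hM1 | norm_num
      _ = 8992 * M ^ 24 * x := by ring
      _ ≤ 8 ^ 6 * M ^ 24 * x := by gcongr; norm_num
      _ ≤ M ^ 6 * M ^ 24 * x := by gcongr
      _ = _ := by ring

end SecH1

section SecH2

lemma card_fib_real {α β : Type*} [DecidableEq β] (s : Finset α) (f : α → β) (c : ℝ)
    (h : ∀ b ∈ s.image f, ((s.filter fun a => f a = b).card : ℝ) ≤ c) : (s.card : ℝ) ≤ (s.image f).card * c := by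
  rw [Finset.card_eq_sum_card_image f s]
  push_cast
  calc _ ≤ ∑ b ∈ s.image f, c := Finset.sum_le_sum h
    _ = _ := by rw [Finset.sum_const, nsmul_eq_mul]

lemma small_card {M u v : ℝ} (hM : 8 ≤ M) (D : Finset (ℤ × ℤ × ℤ))
    (hD : ∀ d ∈ D, 1 ≤ d.1 ∧ (d.1 : ℝ) ≤ M ^ 6 ∧ |(d.2.1 : ℝ) - u * d.1| ≤ 4 * M ^ 3 ∧
      |(d.2.2 : ℝ) + 2 * v ^ 3 * d.2.1 - 3 * v ^ 2 * d.1| ≤ 1) : (D.card : ℝ) ≤ M ^ 15 := by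
  classical
  have hM0 : 0 < M := by linarith
  have hM1 : 1 ≤ M := by linarith
  have hM6 : 1 ≤ M ^ 6 := one_le_pow₀ hM1
  have hM3 : 1 ≤ M ^ 3 := one_le_pow₀ hM1
  have h1 : (D.card : ℝ) ≤ (D.image fun d => (d.1, d.2.1)).card * 3 := by
    refine card_fib_real D _ 3 fun b hb => ?_
    have hi : ((D.filter fun a => (a.1, a.2.1) = b).image fun a => a.2.2).card = (D.filter fun a => (a.1, a.2.1) = b).card := by
      apply Finset.card_image_of_injOn
      rintro ⟨x, y, z⟩ h ⟨x', y', z'⟩ h' hz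
      have e1 := (Finset.mem_filter.mp h).2
      have e2 := (Finset.mem_filter.mp h').2
      simp only at e1 e2 hz
      obtain ⟨a1, a2⟩ := Prod.mk.inj (e1.trans e2.symm)
      rw [a1, a2, hz]
    rw [← hi]
    have := int_card_le ((D.filter fun a => (a.1, a.2.1) = b).image fun a => a.2.2) (3 * v ^ 2 * b.1 - 2 * v ^ 3 * b.2 - 1)
      (3 * v ^ 2 * b.1 - 2 * v ^ 3 * b.2 + 1) (by linarith) (by
        intro z hz
        obtain ⟨d, hd, rfl⟩ := Finset.mem_image.mp hz
        obtain ⟨hd1, hd2⟩ := Finset.mem_filter.mp hd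
        have h := abs_le.mp (hD d hd1).2.2.2
        rw [← hd2]
        simp only
        constructor <;> linarith only [h.1, h.2])
    linarith only [this]
  have h2 : ((D.image fun d => (d.1, d.2.1)).card : ℝ) ≤ ((D.image fun d => (d.1, d.2.1)).image Prod.fst).card * (8 * M ^ 3 + 1) := by
    refine card_fib_real _ _ _ fun b hb => ?_
    set E := (D.image fun d => (d.1, d.2.1)).filter fun a => a.1 = b with hE
    have hi : (E.image fun a => a.2).card = E.card := by
      apply Finset.card_image_of_injOn
      rintro ⟨x, y⟩ h ⟨x', y'⟩ h' hz
      have e1 := (Finset.mem_filter.mp h).2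
      have e2 := (Finset.mem_filter.mp h').2
      simp_all
    rw [← hi]
    have := int_card_le (E.image fun a => a.2) (u * b - 4 * M ^ 3) (u * b + 4 * M ^ 3) (by linarith) (by
        intro z hz
        obtain ⟨e, he, rfl⟩ := Finset.mem_image.mp hz
        obtain ⟨he1, he2⟩ := Finset.mem_filter.mp he
        obtain ⟨d, hd, rfl⟩ := Finset.mem_image.mp he1
        have h := abs_le.mp (hD d hd).2.2.1
        rw [← he2]
        simp only
        constructor <;> linarith only [h.1, h.2])
    linarith only [this]
  have h3 : (((D.image fun d => (d.1, d.2.1)).image Prod.fst).card : ℝ) ≤ M ^ 6 := by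
    have := int_card_le ((D.image fun d => (d.1, d.2.1)).image Prod.fst) 1 (M ^ 6) hM6 (by
        intro z hz
        obtain ⟨e, he, rfl⟩ := Finset.mem_image.mp hz
        obtain ⟨d, hd, rfl⟩ := Finset.mem_image.mp he
        exact ⟨by exact_mod_cast (hD d hd).1, (hD d hd).2.1⟩)
    linarith only [this]
  calc (D.card : ℝ) ≤ (M ^ 6 * (8 * M ^ 3 + 1)) * 3 := by
        refine h1.trans ?_
        gcongr
        refine h2.trans ?_
        gcongr
    _ ≤ (M ^ 6 * (8 * M ^ 3 + M ^ 3)) * 3 := by gcongr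
    _ = 27 * M ^ 9 := by ring
    _ ≤ 8 ^ 6 * M ^ 9 := by gcongr; norm_num
    _ ≤ M ^ 6 * M ^ 9 := by gcongr
    _ = _ := by ring

lemma strip_mult {M V N σ : ℝ} (hM : 1 ≤ M) (hV : 0 < V) (hN : 0 < N) (hσ : σ = V / N) (I : Finset ℤ) (x y : ℝ) (hx : 0 < x)
    (hxN : x * V ≤ 2 * M ^ 3 * N) (h : ∀ i ∈ I, |y - (i * σ) * x| ≤ 4 * M ^ 3) : (I.card : ℝ) ≤ 10 * M ^ 3 * (N / V) * (1 / x) := by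
  have hσ0 : 0 < σ := by rw [hσ]; positivity
  have hsx : 0 < σ * x := by positivity
  have hM3 : 0 < M ^ 3 := by positivity
  have := int_card_le I ((y - 4 * M ^ 3) / (σ * x)) ((y + 4 * M ^ 3) / (σ * x)) (by gcongr; linarith) (by
    intro i hi
    obtain ⟨h1, h2⟩ := abs_le.mp (h i hi)
    rw [div_le_iff₀ hsx, le_div_iff₀ hsx]
    constructor <;> linarith only [h1, h2])
  refine this.trans ?_
  have e : (y + 4 * M ^ 3) / (σ * x) - (y - 4 * M ^ 3) / (σ * x) = 8 * M ^ 3 * (N / V) * (1 / x) := by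
    rw [hσ]; field_simp; ring
  rw [e]
  have : 1 ≤ 2 * M ^ 3 * (N / V) * (1 / x) := by
    rw [show 2 * M ^ 3 * (N / V) * (1 / x) = 2 * M ^ 3 * N / (x * V) by field_simp]
    rwa [one_le_div (by positivity)]
  linarith

lemma double_count {I : Finset ℤ} (DL : ℤ → Finset (ℤ × ℤ × ℤ)) (c : (ℤ × ℤ × ℤ) → ℝ)
    (h : ∀ d ∈ I.biUnion DL, ((I.filter fun i => d ∈ DL i).card : ℝ) ≤ c d) :
    ∑ i ∈ I, ((DL i).card : ℝ) ≤ ∑ d ∈ I.biUnion DL, c d := by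
  classical
  calc ∑ i ∈ I, ((DL i).card : ℝ) = ∑ i ∈ I, ∑ d ∈ I.biUnion DL, if d ∈ DL i then (1 : ℝ) else 0 := by
        refine Finset.sum_congr rfl fun i hi => ?_
        rw [Finset.sum_ite_mem, Finset.inter_eq_right.mpr (Finset.subset_biUnion_of_mem DL hi)]
        simp
    _ = ∑ d ∈ I.biUnion DL, ∑ i ∈ I, if d ∈ DL i then (1 : ℝ) else 0 := Finset.sum_comm
    _ ≤ _ := by
        refine Finset.sum_le_sum fun d hd => le_trans (le_of_eq ?_) (h d hd)
        rw [Finset.sum_ite]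
        simp

end SecH2

section SecH3

lemma np_use {C : ℕ} {M V N X : ℝ} (hM : 2 ≤ M) (hV : 1 ≤ V) (hN : N = V ^ 14) (hX1 : 1 ≤ X) (hXN : X ≤ N)
    (T : Finset (ℤ × ℤ × ℤ))
    (h : ∑ p ∈ T, 1 / (p.1 : ℝ) ≤ (M ^ 30) ^ C * X ^ ((1 : ℝ) / (28 : ℕ)) * (1 + Real.log X)) :
    ∑ p ∈ T, 1 / (p.1 : ℝ) ≤ M ^ (30 * C + 6) * V ^ ((3 : ℝ) / 4) := by
  have hM0 : 0 < M := by linarith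
  have hV0 : 0 < V := by linarith
  have hX0 : 0 < X := by linarith
  refine h.trans ?_
  have h1 : X ^ ((1 : ℝ) / (28 : ℕ)) ≤ V ^ ((1 : ℝ) / 2) := by
    calc X ^ ((1 : ℝ) / (28 : ℕ)) ≤ N ^ ((1 : ℝ) / (28 : ℕ)) := by gcongr
      _ = V ^ ((1 : ℝ) / 2) := by
        rw [hN, ← Real.rpow_natCast V 14, ← Real.rpow_mul hV0.le]
        norm_num
  have h2 : 1 + Real.log X ≤ 64 * V ^ ((1 : ℝ) / 4) := by
    have a1 : Real.log X ≤ 14 * Real.log V := by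
      rw [← Real.log_rpow hV0, ]
      apply Real.log_le_log hX0
      refine hXN.trans (le_of_eq ?_)
      rw [hN, ← Real.rpow_natCast V 14]; norm_num
    have a2 : Real.log V ≤ V ^ ((1 : ℝ) / 4) / (1 / 4) := Real.log_le_rpow_div hV0.le (by norm_num)
    have a3 : 1 ≤ V ^ ((1 : ℝ) / 4) := Real.one_le_rpow hV (by norm_num)
    linarith
  have h3 : 0 ≤ 1 + Real.log X := by have := Real.log_nonneg hX1; linarith
  calc (M ^ 30) ^ C * X ^ ((1 : ℝ) / (28 : ℕ)) * (1 + Real.log X)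
      ≤ (M ^ 30) ^ C * V ^ ((1 : ℝ) / 2) * (64 * V ^ ((1 : ℝ) / 4)) := by gcongr
    _ = 2 ^ 6 * (M ^ 30) ^ C * (V ^ ((1 : ℝ) / 2) * V ^ ((1 : ℝ) / 4)) := by ring
    _ ≤ M ^ 6 * (M ^ 30) ^ C * (V ^ ((1 : ℝ) / 2) * V ^ ((1 : ℝ) / 4)) := by gcongr
    _ = _ := by
      rw [← Real.rpow_add hV0, ← pow_mul, ← pow_add, add_comm]; norm_num

/-- the final numeric estimate -/
lemma crit_numeric {C : ℕ} {M V N l : ℝ} (hM : 2000 ≤ M) (hV : M ^ (4 * (30 * C + 40)) ≤ V) (hN : 0 < N) (hl : M ^ 3 * l ≤ V)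
    (hl0 : 0 ≤ l) :
    2 * M * (N / V) * (6 + 6 * (24 * l + (3 * (M + 1) + 14)) + 864 * M ^ 15) +
      864 * (10 * M ^ 3 * (N / V) * (M ^ (30 * C + 6) * V ^ ((3 : ℝ) / 4))) ≤ N / M := by
  have hM0 : 0 < M := by linarith
  have hM1 : 1 ≤ M := by linarith
  have hV0 : 0 < V := lt_of_lt_of_le (by positivity) hV
  have hV4 : M ^ (30 * C + 40) ≤ V ^ ((1 : ℝ) / 4) := by
    calc M ^ (30 * C + 40) = (M ^ (4 * (30 * C + 40))) ^ ((1 : ℝ) / 4) := by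
          rw [mul_comm 4, pow_mul, ← Real.rpow_natCast (M ^ (30 * C + 40)) 4, ← Real.rpow_mul (by positivity)]
          norm_num
      _ ≤ _ := by gcongr
  have e1 : V ^ ((3 : ℝ) / 4) * V ^ ((1 : ℝ) / 4) = V := by
    rw [← Real.rpow_add hV0]; norm_num
  have hV20 : M ^ 20 ≤ V := le_trans (pow_le_pow_right₀ hM1 (by omega)) hV
  have t1 : 2 * M * (N / V) * (144 * l) ≤ N / (4 * M) := by
    have : 1152 * l * M ^ 2 ≤ V := by
      calc 1152 * l * M ^ 2 ≤ M * l * M ^ 2 := by gcongr; linarith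
        _ = M ^ 3 * l := by ring
        _ ≤ V := hl
    rw [le_div_iff₀ (by positivity)]
    calc 2 * M * (N / V) * (144 * l) * (4 * M) = (N / V) * (1152 * l * M ^ 2) := by ring
      _ ≤ (N / V) * V := by gcongr
      _ = N := by field_simp
  have t2 : 2 * M * (N / V) * (6 + 6 * (3 * (M + 1) + 14) + 864 * M ^ 15) ≤ N / (4 * M) := by
    have : 8 * M ^ 2 * (6 + 6 * (3 * (M + 1) + 14) + 864 * M ^ 15) ≤ V := by
      calc 8 * M ^ 2 * (6 + 6 * (3 * (M + 1) + 14) + 864 * M ^ 15) = 8 * M ^ 2 * (108 * 1 + 18 * M + 864 * M ^ 15) := by ring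
        _ ≤ 8 * M ^ 2 * (108 * M ^ 15 + 18 * M ^ 15 + 864 * M ^ 15) := by
            gcongr
            · exact one_le_pow₀ hM1
            · exact le_self_pow₀ hM1 (by norm_num)
        _ = 7920 * M ^ 17 := by ring
        _ ≤ 2000 ^ 3 * M ^ 17 := by gcongr; norm_num
        _ ≤ M ^ 3 * M ^ 17 := by gcongr
        _ = M ^ 20 := by ring
        _ ≤ V := hV20
    rw [le_div_iff₀ (by positivity)]
    calc 2 * M * (N / V) * (6 + 6 * (3 * (M + 1) + 14) + 864 * M ^ 15) * (4 * M) = (N / V) * (8 * M ^ 2 * (6 + 6 * (3 * (M + 1) + 14) + 864 * M ^ 15)) := by ring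
      _ ≤ (N / V) * V := by gcongr
      _ = N := by field_simp
  have t3 : 864 * (10 * M ^ 3 * (N / V) * (M ^ (30 * C + 6) * V ^ ((3 : ℝ) / 4))) ≤ N / (4 * M) := by
    rw [le_div_iff₀ (by positivity)]
    calc 864 * (10 * M ^ 3 * (N / V) * (M ^ (30 * C + 6) * V ^ ((3 : ℝ) / 4))) * (4 * M)
        = (N / V) * V ^ ((3 : ℝ) / 4) * (34560 * M ^ (30 * C + 10)) := by ring
      _ ≤ (N / V) * V ^ ((3 : ℝ) / 4) * (2000 ^ 30 * M ^ (30 * C + 10)) := by gcongr; norm_num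
      _ ≤ (N / V) * V ^ ((3 : ℝ) / 4) * (M ^ 30 * M ^ (30 * C + 10)) := by gcongr
      _ = (N / V) * V ^ ((3 : ℝ) / 4) * M ^ (30 * C + 40) := by ring
      _ ≤ (N / V) * V ^ ((3 : ℝ) / 4) * V ^ ((1 : ℝ) / 4) := by gcongr
      _ = (N / V) * V := by rw [mul_assoc, e1]
      _ = N := by field_simp
  have e : N / M = N / (4 * M) + N / (4 * M) + N / (4 * M) + N / (4 * M) := by field_simp; ring
  have p : 0 ≤ N / (4 * M) := by positivity
  rw [e]
  have e2 : 2 * M * (N / V) * (6 + 6 * (24 * l + (3 * (M + 1) + 14)) + 864 * M ^ 15) =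
    2 * M * (N / V) * (144 * l) + 2 * M * (N / V) * (6 + 6 * (3 * (M + 1) + 14) + 864 * M ^ 15) := by ring
  rw [e2]
  linarith only [t1, t2, t3, p]

end SecH3

section SecH4

noncomputable def sidx (V N : ℝ) (p : ℤ × ℤ × ℤ) : ℤ := ⌊((p.2.1 : ℝ) / p.1) * (N / V)⌋

lemma sidx_spec {A B : ℤ} {M V N : ℝ} (hM : 2 ≤ M) (hV : 0 < V) (hN : 4 * M * V ≤ N) {p : ℤ × ℤ × ℤ} (hp : CPt A B M N p) :
    CStrip (sidx V N p * (V / N)) V p ∧ 1 ≤ 4 * M * (sidx V N p * (V / N)) ∧ sidx V N p * (V / N) ≤ M ∧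
      (0 : ℝ) ≤ sidx V N p ∧ (sidx V N p : ℝ) ≤ M * (N / V) := by
  have hM0 : 0 < M := by linarith
  have hN0 : 0 < N := lt_of_lt_of_le (by positivity) hN
  have n1 := hp.n1
  have n2 := hp.n2
  have q1 := hp.q1
  have q2 := hp.q2
  have q0 : (0 : ℝ) < p.2.1 := by exact_mod_cast hp.q0
  have hi1 := Int.floor_le (((p.2.1 : ℝ) / p.1) * (N / V))
  have hi2 := Int.lt_floor_add_one (((p.2.1 : ℝ) / p.1) * (N / V))
  have hi0 : (0 : ℝ) ≤ ⌊((p.2.1 : ℝ) / p.1) * (N / V)⌋ := by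
    have : (0 : ℤ) ≤ ⌊((p.2.1 : ℝ) / p.1) * (N / V)⌋ := Int.floor_nonneg.mpr (by
      have : (0 : ℝ) ≤ p.1 := by linarith
      positivity)
    exact_mod_cast this
  unfold sidx CStrip
  generalize (⌊((p.2.1 : ℝ) / p.1) * (N / V)⌋ : ℝ) = i at *
  generalize (p.2.1 : ℝ) = q at *
  generalize (p.1 : ℝ) = n at *
  have hn0 : 0 < n := by linarith
  have a1 : i * (V / N) ≤ q / n := by
    calc i * (V / N) ≤ (q / n * (N / V)) * (V / N) := by gcongr
      _ = q / n := by field_simp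
  have a2 : q / n ≤ i * (V / N) + V / N := by
    calc q / n = (q / n * (N / V)) * (V / N) := by field_simp
      _ ≤ (i + 1) * (V / N) := by gcongr
      _ = _ := by ring
  have a3 : q / n ≤ M := by
    rw [div_le_iff₀ hn0]
    exact q2.trans (by gcongr)
  have a4 : 1 ≤ 2 * M * (q / n) := by
    rw [mul_div_assoc', one_le_div hn0]
    linarith only [n2, q1]
  have a5 : 4 * M * (V / N) ≤ 1 := by
    rw [mul_div_assoc', div_le_one hN0]; exact hN
  refine ⟨⟨?_, ?_⟩, ?_, a1.trans a3, hi0, ?_⟩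
  · have : i * (V / N) * n ≤ q / n * n := by gcongr
    rw [div_mul_cancel₀ _ hn0.ne'] at this
    linarith only [this]
  · have h1 : q / n * n ≤ (i * (V / N) + V / N) * n := by gcongr
    rw [div_mul_cancel₀ _ hn0.ne'] at h1
    have h2 : V / N * n ≤ V / N * (2 * N) := by gcongr
    have h3 : V / N * (2 * N) = 2 * V := by field_simp
    linarith only [h1, h2, h3]
  · have : 2 * M * (q / n) ≤ 2 * M * (i * (V / N) + V / N) := by gcongr
    linarith only [this, a4, a5]
  · exact hi1.trans (by gcongr)

lemma exists_l {M V : ℝ} (hM : 2 ≤ M) (hV : M ^ 10 ≤ V) : ∃ l : ℕ, l.Prime ∧ V ≤ 2 * M ^ 3 * l ∧ M ^ 3 * l ≤ V := by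
  have hM0 : 0 < M := by linarith
  have h1 : 1 ≤ V / (2 * M ^ 3) := by
    rw [one_le_div (by positivity)]
    refine le_trans ?_ hV
    calc 2 * M ^ 3 ≤ M * M ^ 3 := by gcongr
      _ = M ^ 4 := by ring
      _ ≤ M ^ 10 := pow_le_pow_right₀ (by linarith) (by norm_num)
  have h2 : 1 ≤ ⌊V / (2 * M ^ 3)⌋₊ := Nat.le_floor (by simpa using h1)
  obtain ⟨l, hl, hl1, hl2⟩ := Nat.exists_prime_lt_and_le_two_mul ⌊V / (2 * M ^ 3)⌋₊ (by omega)
  refine ⟨l, hl, ?_, ?_⟩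
  · have : V / (2 * M ^ 3) < l := (Nat.floor_lt (by positivity)).mp hl1
    rw [div_lt_iff₀ (by positivity)] at this
    linarith
  · have h3 : (⌊V / (2 * M ^ 3)⌋₊ : ℝ) ≤ V / (2 * M ^ 3) := Nat.floor_le (by positivity)
    have h4 : (l : ℝ) ≤ 2 * ⌊V / (2 * M ^ 3)⌋₊ := by exact_mod_cast hl2
    calc M ^ 3 * (l : ℝ) ≤ M ^ 3 * (2 * (V / (2 * M ^ 3))) := by gcongr; linarith
      _ = V := by field_simp

theorem crit : ∃ C0 : ℕ, ∀ A B : ℤ, (∀ a b : ℤ, b ≠ 0 → a ^ 3 + A * a * b ^ 2 + B * b ^ 3 ≠ 0) →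
    ∀ M : ℝ, 2000 ≤ M → |(A : ℝ)| ≤ M → |(B : ℝ)| ≤ M → ∀ V : ℝ, M ^ C0 ≤ V → ∀ N : ℝ, N = V ^ 14 →
    ∀ S : Finset (ℤ × ℤ × ℤ), Set.InjOn Prod.fst (S : Set (ℤ × ℤ × ℤ)) → (∀ p ∈ S, CPt A B M N p) → (S.card : ℝ) ≤ N / M := by
  classical
  obtain ⟨C, hC⟩ := np_full 28 (by norm_num)
  refine ⟨4 * (30 * C + 40), ?_⟩
  intro A B hnr M hM hA hB V hV N hN S hinj hS
  have hM0 : 0 < M := by linarith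
  have hM1 : 1 ≤ M := by linarith
  have hM2 : 2 ≤ M := by linarith
  have hV90 : M ^ 90 ≤ V := le_trans (pow_le_pow_right₀ hM1 (by omega)) hV
  have hV1 : 1 ≤ V := le_trans (one_le_pow₀ hM1) hV90
  have hV0 : 0 < V := by linarith
  have hVN : V ^ 2 ≤ N := by rw [hN]; exact pow_le_pow_right₀ hV1 (by norm_num)
  have hMV : 4 * M ^ 19 ≤ V := by
    refine le_trans ?_ hV90
    calc 4 * M ^ 19 ≤ M * M ^ 19 := by gcongr; linarith
      _ = M ^ 20 := by ring
      _ ≤ M ^ 90 := pow_le_pow_right₀ hM1 (by norm_num)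
  have hN4 : 4 * M ^ 19 * V ≤ N := by
    refine le_trans ?_ hVN
    rw [sq]; gcongr
  have hN4' : 4 * M * V ≤ N := by
    refine le_trans ?_ hN4
    gcongr
    exact le_self_pow₀ hM1 (by norm_num)
  have hN0 : 0 < N := lt_of_lt_of_le (by positivity) hVN
  have hN1 : 1 ≤ N := by rw [hN]; exact one_le_pow₀ hV1
  obtain ⟨l, hl, hl1, hl2⟩ := exists_l hM2 (le_trans (pow_le_pow_right₀ hM1 (by norm_num)) hV90)
  have hl0 : (0 : ℝ) < l := by exact_mod_cast hl.pos
  have hlV : (l : ℝ) ≤ V := by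
    refine le_trans ?_ hl2
    have : 1 ≤ M ^ 3 := one_le_pow₀ hM1
    nlinarith
  have hlN : (l : ℝ) ≤ N := by
    refine hlV.trans (le_trans ?_ hVN)
    exact le_self_pow₀ hV1 (by norm_num)
  set σ := V / N with hσ
  set I := S.image (sidx V N) with hI
  have hIs : ∀ i ∈ I, 1 ≤ 4 * M * (i * σ) ∧ i * σ ≤ M ∧ (0 : ℝ) ≤ i ∧ (i : ℝ) ≤ M * (N / V) := by
    intro i hi
    obtain ⟨p, hp, rfl⟩ := Finset.mem_image.mp hi
    exact (sidx_spec hM2 hV0 hN4' (hS p hp)).2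
  have hIc : (I.card : ℝ) ≤ 2 * M * (N / V) := by
    have h0 : 0 ≤ M * (N / V) := by positivity
    have := int_card_le I 0 (M * (N / V)) h0 (fun i hi => (hIs i hi).2.2)
    have h1 : 1 ≤ M * (N / V) := by
      rw [mul_div_assoc', one_le_div hV0]
      calc V = 1 * V := by ring
        _ ≤ M * N := by gcongr; refine le_trans ?_ hVN; exact le_self_pow₀ hV1 (by norm_num)
    linarith
  set Si := fun i : ℤ => S.filter fun p => sidx V N p = i with hSi
  set Di := fun i : ℤ => (((Si i) ×ˢ (Si i)).filter fun pq => pq.1.1 < pq.2.1 ∧ CCong l pq.1 pq.2).image (fun pq => cdiff l pq.1 pq.2) with hDi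
  have hSiS : ∀ i, ∀ p ∈ Si i, CPt A B M N p ∧ CStrip (i * σ) V p := by
    intro i p hp
    obtain ⟨h1, h2⟩ := Finset.mem_filter.mp hp
    refine ⟨hS p h1, ?_⟩
    rw [← h2]
    exact (sidx_spec hM2 hV0 hN4' (hS p h1)).1
  have huv : ∀ i ∈ I, ∃ v : ℝ, (i * σ) * v = 1 ∧ 0 < i * σ ∧ v ≤ 4 * M := by
    intro i hi
    have h := (hIs i hi).1
    have hu0 : 0 < i * σ := by
      by_contra hcon
      have : 4 * M * (i * σ) ≤ 0 := mul_nonpos_of_nonneg_of_nonpos (by positivity) (by linarith)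
      linarith
    refine ⟨(i * σ)⁻¹, mul_inv_cancel₀ hu0.ne', hu0, ?_⟩
    rw [inv_le_iff_one_le_mul₀ hu0]; exact h
  choose! v hv1 hv2 hv3 using huv
  have hDf : ∀ i ∈ I, ∀ d ∈ Di i, 1 ≤ d.1 ∧ (d.1 : ℝ) * l ≤ N ∧ |(d.2.1 : ℝ) - (i * σ) * d.1| ≤ 4 * M ^ 3 ∧
      |(d.2.2 : ℝ) + 2 * (v i) ^ 3 * d.2.1 - 3 * (v i) ^ 2 * d.1| ≤ 4 * M ^ 19 * V / N := by
    intro i hi d hd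
    obtain ⟨⟨p, q⟩, hpq, rfl⟩ := Finset.mem_image.mp hd
    obtain ⟨h1, h2, h3⟩ := Finset.mem_filter.mp hpq
    obtain ⟨h4, h5⟩ := Finset.mem_product.mp h1
    obtain ⟨cp, sp⟩ := hSiS i p h4
    obtain ⟨cq, sq⟩ := hSiS i q h5
    refine pair_delta hM2 hA hB hV1 hN1 (hv1 i hi) (hv2 i hi) (hv3 i hi) hl hl1 cp cq sp sq ?_ h3 h2
    have := cp.q1
    have h6 : M * (l : ℝ) < M * p.2.1 := by
      refine lt_of_lt_of_le ?_ this
      calc M * (l : ℝ) < 4 * M * V := by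
            have : M * (l : ℝ) ≤ M * V := by gcongr
            have : 0 < M * V := by positivity
            linarith
        _ ≤ N := hN4'
    exact_mod_cast lt_of_mul_lt_mul_left h6 hM0.le
  -- per strip bound
  have hstrip : ∀ i ∈ I, ((Si i).card : ℝ) ≤ 6 + 6 * (24 * l + 144 * (Di i).card + (3 * (M + 1) + 14)) := by
    intro i hi
    refine strip_bound (u := i * σ) hM2 hA hB hV90 hN (hIs i hi).1 hnr (Si i) (hinj.mono (by intro x hx; exact (Finset.mem_filter.mp hx).1))
      (hSiS i) l hl (Di i) ?_
    intro p hp q hq hpq hc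
    exact Finset.mem_image.mpr ⟨(p, q), Finset.mem_filter.mpr ⟨Finset.mem_product.mpr ⟨hp, hq⟩, hpq, hc⟩, rfl⟩
  set DL := fun i : ℤ => (Di i).filter fun d => ¬ ((d.1 : ℝ) < M ^ 6) with hDL
  have hsplit : ∀ i ∈ I, ((Di i).card : ℝ) ≤ M ^ 15 + (DL i).card := by
    intro i hi
    have h1 := Finset.card_filter_add_card_filter_not (s := Di i) (fun d => (d.1 : ℝ) < M ^ 6)
    have h2 : (((Di i).filter fun d => (d.1 : ℝ) < M ^ 6).card : ℝ) ≤ M ^ 15 := by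
      refine small_card (u := i * σ) (v := v i) (by linarith) _ ?_
      intro d hd
      obtain ⟨h3, h4⟩ := Finset.mem_filter.mp hd
      obtain ⟨g1, g2, g3, g4⟩ := hDf i hi d h3
      refine ⟨g1, h4.le, g3, g4.trans ?_⟩
      rw [div_le_one hN0]; exact hN4
    have h3 : ((Di i).card : ℝ) = ((Di i).filter fun d => (d.1 : ℝ) < M ^ 6).card + (DL i).card := by
      exact_mod_cast h1.symm
    rw [h3]
    gcongr
  have hDLsum : ∑ i ∈ I, ((DL i).card : ℝ) ≤ 10 * M ^ 3 * (N / V) * (M ^ (30 * C + 6) * V ^ ((3 : ℝ) / 4)) := by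
    refine (double_count DL (fun d => 10 * M ^ 3 * (N / V) * (1 / (d.1 : ℝ))) ?_).trans ?_
    · intro d hd
      obtain ⟨i, hi, hdi⟩ := Finset.mem_biUnion.mp hd
      obtain ⟨g1, g2, g3, g4⟩ := hDf i hi d (Finset.mem_filter.mp hdi).1
      refine strip_mult hM1 hV0 hN0 hσ _ d.1 d.2.1 (by exact_mod_cast g1) ?_ ?_
      · have hd0 : (0 : ℝ) ≤ d.1 := by exact_mod_cast (by omega : 0 ≤ d.1)
        calc (d.1 : ℝ) * V ≤ d.1 * (2 * M ^ 3 * l) := by gcongr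
          _ = 2 * M ^ 3 * (d.1 * l) := by ring
          _ ≤ _ := by gcongr
      · intro j hj
        obtain ⟨hj1, hj2⟩ := Finset.mem_filter.mp hj
        exact (hDf j hj1 d (Finset.mem_filter.mp hj2).1).2.2.1
    · rw [← Finset.mul_sum]
      gcongr
      refine np_use (X := N / l) hM2 hV1 hN (by rw [one_le_div hl0]; exact hlN) (div_le_self hN0.le (by exact_mod_cast hl.one_lt.le)) _ ?_
      refine hC (M ^ 30) ?_ (N / l) (by rw [one_le_div hl0]; exact hlN) _ ?_
      · exact hM2.trans (le_self_pow₀ hM1 (by norm_num))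
      · intro d hd
        obtain ⟨i, hi, hdi⟩ := Finset.mem_biUnion.mp hd
        obtain ⟨k1, k2⟩ := Finset.mem_filter.mp hdi
        obtain ⟨g1, g2, g3, g4⟩ := hDf i hi d k1
        refine ⟨?_, ?_⟩
        · exact delta_nfam (by linarith) hV1 hN1 (hv1 i hi) (hv2 i hi) (hIs i hi).2.1 (hv3 i hi) hl0 hl1 (not_lt.mp k2) g2 g3 g4
        · rw [le_div_iff₀ hl0]; exact g2
  have hScard : (S.card : ℝ) = ∑ i ∈ I, ((Si i).card : ℝ) := by
    rw [Finset.card_eq_sum_card_image (sidx V N) S]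
    push_cast
    rfl
  rw [hScard]
  refine le_trans ?_ (crit_numeric (C := C) hM hV hN0 hl2 hl0.le)
  calc ∑ i ∈ I, ((Si i).card : ℝ) ≤ ∑ i ∈ I, ((6 + 6 * (24 * (l : ℝ) + (3 * (M + 1) + 14)) + 864 * M ^ 15) + 864 * ((DL i).card : ℝ)) := by
        refine Finset.sum_le_sum fun i hi => (hstrip i hi).trans ?_
        have := hsplit i hi
        linarith only [this]
    _ = I.card * (6 + 6 * (24 * (l : ℝ) + (3 * (M + 1) + 14)) + 864 * M ^ 15) + 864 * ∑ i ∈ I, ((DL i).card : ℝ) := by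
        rw [Finset.sum_add_distrib, Finset.sum_const, nsmul_eq_mul, ← Finset.mul_sum]
    _ ≤ _ := by gcongr

end SecH4

section SecW1

open Polynomial in
lemma sqrt_approx (J : ℕ) : ∃ s : ℝ[X], s.natDegree ≤ J ∧ ∃ C : ℝ, 0 < C ∧ ∃ d : ℝ, 0 < d ∧ d ≤ 1 / 2 ∧
    ∀ x : ℝ, |x| ≤ d → |√(1 + x) - s.eval x| ≤ C * |x| ^ (J + 1) := by
  have h1 : AnalyticAt ℝ (fun x : ℝ => √x) 1 := by
    have := Real.contDiffAt_sqrt (x := 1) (n := ⊤) one_ne_zero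
    exact this.analyticAt
  obtain ⟨p, hp⟩ := h1
  have h2 := hp.isBigO_sub_partialSum_pow (J + 1)
  obtain ⟨C, hC, h3⟩ := h2.exists_pos
  rw [Asymptotics.IsBigOWith, Metric.eventually_nhds_iff] at h3
  obtain ⟨e, he, h4⟩ := h3
  refine ⟨∑ k ∈ Finset.range (J + 1), Polynomial.C (p.coeff k) * X ^ k, ?_, C, hC, min (e / 2) (1 / 2), by positivity, min_le_right _ _, ?_⟩
  · apply natDegree_sum_le_of_forall_le
    intro i hi
    have := Finset.mem_range.mp hi
    exact (natDegree_C_mul_X_pow_le _ _).trans (by omega)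
  · intro x hx
    have h5 := @h4 x (by
      rw [dist_zero_right, Real.norm_eq_abs]
      have := min_le_left (e / 2) (1 / 2)
      linarith)
    have h6 : p.partialSum (J + 1) x = (∑ k ∈ Finset.range (J + 1), Polynomial.C (p.coeff k) * X ^ k).eval x := by
      rw [FormalMultilinearSeries.partialSum, eval_finsetSum]
      refine Finset.sum_congr rfl fun k _ => ?_
      rw [FormalMultilinearSeries.apply_eq_pow_smul_coeff, eval_mul, eval_C, eval_pow, eval_X, smul_eq_mul, mul_comm]
    rw [h6] at h5
    simpa [Real.norm_eq_abs] using h5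

lemma prod_pow_fin (D : ℕ) (L : ℝ) : ∏ i : Fin D, L ^ (i : ℕ) = L ^ (D * (D - 1) / 2) := by
  rw [Finset.prod_pow_eq_pow_sum, Fin.sum_univ_eq_sum_range (fun i => i) D, Finset.sum_range_id]

noncomputable def winU {D : ℕ} (c : Fin D → ℝ) : Matrix (Fin (D + 1)) (Fin (D + 1)) ℝ :=
  Matrix.of fun i j => if i = j then 1 else if j = Fin.last D then - (Fin.snoc (α := fun _ => ℝ) c 0 i) else 0

lemma winU_det {D : ℕ} (c : Fin D → ℝ) : (winU c).det = 1 := by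
  rw [Matrix.det_of_isUpperTriangular]
  · simp [winU]
  · intro i j hij
    have hij' : j < i := hij
    have h1 : i ≠ j := ne_of_gt hij'
    have h2 : j ≠ Fin.last D := ne_of_lt (lt_of_lt_of_le hij' (Fin.le_last i))
    simp [winU, h1, h2]

lemma winU_mul_cast {D : ℕ} (c : Fin D → ℝ) (a : Fin (D + 1) → ℝ) (j : Fin D) :
    ∑ l, a l * winU c l j.castSucc = a j.castSucc := by
  rw [Finset.sum_eq_single j.castSucc]
  · simp [winU]
  · intro l _ hl
    simp [winU, hl, (Fin.castSucc_lt_last j).ne]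
  · simp

lemma winU_mul_last {D : ℕ} (c : Fin D → ℝ) (a : Fin (D + 1) → ℝ) :
    ∑ l, a l * winU c l (Fin.last D) = a (Fin.last D) - ∑ i : Fin D, a i.castSucc * c i := by
  rw [Fin.sum_univ_castSucc]
  have : ∀ i : Fin D, a i.castSucc * winU c i.castSucc (Fin.last D) = - (a i.castSucc * c i) := by
    intro i
    simp [winU, (Fin.castSucc_lt_last i).ne]
  simp only [this, Finset.sum_neg_distrib]
  simp [winU]
  ring

/-- determinant vanishing for points `(t,q)` with `q` near a polynomial. -/
lemma win_det {D : ℕ} (c : Fin D → ℝ) (L e : ℝ) (t q : Fin (D + 1) → ℤ) (ht : ∀ i, |(t i : ℝ)| ≤ L)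
    (hq : ∀ i, |(q i : ℝ) - ∑ l : Fin D, (t i : ℝ) ^ (l : ℕ) * c l| ≤ e)
    (hs : ((D + 1).factorial : ℝ) * (L ^ (D * (D - 1) / 2) * e) < 1) :
    Matrix.det (Matrix.of fun i : Fin (D + 1) => (Fin.snoc (α := fun _ => ℤ) (fun l : Fin D => t i ^ (l : ℕ)) (q i) : Fin (D + 1) → ℤ)) = 0 := by
  refine int_det_zero _ (winU c) (winU_det c) (Fin.snoc (α := fun _ => ℝ) (fun l : Fin D => L ^ (l : ℕ)) e) ?_ ?_
  · intro i j
    rw [Matrix.mul_apply]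
    induction j using Fin.lastCases with
    | last =>
      rw [winU_mul_last]
      simpa using hq i
    | cast j =>
      rw [winU_mul_cast]
      simp only [Matrix.map_apply, Matrix.of_apply, Fin.snoc_castSucc]
      push_cast
      rw [abs_pow]
      exact pow_le_pow_left₀ (abs_nonneg _) (ht i) _
  · rw [Fin.prod_univ_castSucc]
    simp only [Fin.snoc_castSucc, Fin.snoc_last]
    rw [prod_pow_fin]
    exact hs

open Polynomial in
/-- relation from vanishing determinants. -/
lemma win_rel {D : ℕ} (T : Finset (ℤ × ℤ)) (G : ℤ[X]) (m : ℤ) (hG3 : G.natDegree ≤ 3)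
    (hG : ∀ (a : ℤ) (H : ℤ[X]), a ≠ 0 → C a * G ≠ C m * H ^ 2) (hm : m ≠ 0)
    (hT : ∀ p ∈ T, m * p.2 ^ 2 = G.eval p.1) (hinj : Set.InjOn Prod.fst (T : Set (ℤ × ℤ)))
    (hdet : ∀ p : Fin (D + 1) → ℤ × ℤ, (∀ i, p i ∈ T) →
      Matrix.det (Matrix.of fun i : Fin (D + 1) => (Fin.snoc (α := fun _ => ℤ) (fun l : Fin D => (p i).1 ^ (l : ℕ)) (p i).2 : Fin (D + 1) → ℤ)) = 0) :
    T.card ≤ 2 * D + 3 := by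
  classical
  obtain ⟨c, hc, hrel⟩ := int_relation T (fun p : ℤ × ℤ => (Fin.snoc (α := fun _ => ℤ) (fun l : Fin D => p.1 ^ (l : ℕ)) p.2 : Fin (D + 1) → ℤ)) hdet
  set H : ℤ[X] := ∑ l : Fin D, C (c l.castSucc) * X ^ (l : ℕ) with hH
  set a := c (Fin.last D) with ha
  have hHe : ∀ p ∈ T, H.eval p.1 + a * p.2 = 0 := by
    intro p hp
    have := hrel p hp
    rw [Fin.sum_univ_castSucc] at this
    simp only [Fin.snoc_castSucc, Fin.snoc_last] at this
    rw [hH, eval_finsetSum]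
    simpa using this
  have hHd : H.natDegree ≤ D := by
    apply natDegree_sum_le_of_forall_le
    intro i _
    exact (natDegree_C_mul_X_pow_le _ _).trans i.2.le
  have hHc : ∀ l : Fin D, H.coeff l = c l.castSucc := by
    intro l
    rw [hH, finsetSum_coeff, Finset.sum_eq_single l]
    · simp
    · intro b _ hb
      rw [coeff_C_mul_X_pow, if_neg]
      intro h
      exact hb (Fin.ext h.symm)
    · simp
  set P : ℤ[X] := C (a ^ 2) * G - C m * H ^ 2 with hP
  have hP0 : P ≠ 0 := by
    intro h0
    by_cases ha0 : a = 0
    · rw [hP, ha0] at h0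
      have h1 : H = 0 := by
        have : C m * H ^ 2 = 0 := by
          have := h0
          simp at this
          rcases this with h | h
          · exact absurd h hm
          · simp [h]
        rcases mul_eq_zero.mp this with h | h
        · exact absurd (C_eq_zero.mp h) hm
        · exact pow_eq_zero_iff (two_ne_zero) |>.mp h
      have h2 : ∀ i, (2 : ℤ) ∣ c i := by
        intro i
        induction i using Fin.lastCases with
        | last => rw [← ha, ha0]; exact dvd_zero _
        | cast i => rw [← hHc, h1]; simp
      have := hc 2 h2
      exact absurd this (by decide)
    · exact hG (a ^ 2) H (pow_ne_zero 2 ha0) (sub_eq_zero.mp h0)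
  have hPd : P.natDegree ≤ 2 * D + 3 := by
    refine (natDegree_sub_le _ _).trans (max_le ?_ ?_)
    · exact (natDegree_C_mul_le _ _).trans (hG3.trans (by omega))
    · refine (natDegree_C_mul_le _ _).trans (natDegree_pow_le.trans ?_)
      omega
  have hsub : T.image Prod.fst ⊆ P.roots.toFinset := by
    intro t ht
    obtain ⟨p, hp, rfl⟩ := Finset.mem_image.mp ht
    rw [Multiset.mem_toFinset, mem_roots hP0, IsRoot.def, hP]
    simp only [eval_sub, eval_mul, eval_C, eval_pow]
    rw [← hT p hp]
    have h1 := hHe p hp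
    have h2 : H.eval p.1 = - (a * p.2) := by linarith
    rw [h2]
    ring
  calc T.card = (T.image Prod.fst).card := (Finset.card_image_of_injOn hinj).symm
    _ ≤ P.roots.toFinset.card := Finset.card_le_card hsub
    _ ≤ P.roots.card := Multiset.toFinset_card_le _
    _ ≤ P.natDegree := card_roots' P
    _ ≤ 2 * D + 3 := hPd

end SecW1

section SecW2

open Polynomial in
lemma win_full (J : ℕ) : ∃ K : ℝ, 0 < K ∧ ∃ d : ℝ, 0 < d ∧ d ≤ 1 / 2 ∧
    ∀ (T : Finset (ℤ × ℤ)) (G : ℤ[X]) (m q0 : ℤ) (L δ : ℝ), G.natDegree ≤ 3 →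
    (∀ (a : ℤ) (H : ℤ[X]), a ≠ 0 → C a * G ≠ C m * H ^ 2) → 0 < m → 0 < q0 → m * q0 ^ 2 = G.eval 0 →
    (∀ p ∈ T, m * p.2 ^ 2 = G.eval p.1 ∧ 0 < p.2 ∧ |(p.1 : ℝ)| ≤ L ∧ |((G.eval p.1 : ℤ) : ℝ) - (G.eval 0 : ℤ)| ≤ δ * (G.eval 0 : ℤ)) →
    Set.InjOn Prod.fst (T : Set (ℤ × ℤ)) → 0 ≤ δ → δ ≤ d → 
    ((3 * J + 2).factorial : ℝ) * (L ^ ((3 * J + 1) * (3 * J) / 2) * (q0 * (K * δ ^ (J + 1)))) < 1 →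
    T.card ≤ 6 * J + 5 := by
  obtain ⟨s, hsd, K, hK, d, hd, hd2, hs⟩ := sqrt_approx J
  refine ⟨K, hK, d, hd, hd2, ?_⟩
  intro T G m q0 L δ hG3 hG hm hq0 hG0 hT hinj hδ0 hδ hsmall
  have hG0r : ((G.eval 0 : ℤ) : ℝ) = m * (q0 : ℝ) ^ 2 := by rw [← hG0]; push_cast; ring
  have hmr : (0 : ℝ) < m := by exact_mod_cast hm
  have hqr : (0 : ℝ) < q0 := by exact_mod_cast hq0
  set g0 : ℝ := ((G.eval 0 : ℤ) : ℝ) with hg0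
  have hg0pos : 0 < g0 := by rw [hG0r]; positivity
  set xp : ℝ[X] := C (1 / g0) * (G.map (Int.castRingHom ℝ) - C g0) with hxp
  have hxpd : xp.natDegree ≤ 3 := by
    refine (natDegree_C_mul_le _ _).trans ((natDegree_sub_le _ _).trans (max_le ?_ ?_))
    · exact natDegree_map_le.trans hG3
    · simp
  set W : ℝ[X] := C (q0 : ℝ) * s.comp xp with hW
  have hWd : W.natDegree < 3 * J + 1 := by
    have h1 : W.natDegree ≤ (s.comp xp).natDegree := natDegree_C_mul_le _ _
    have h2 : (s.comp xp).natDegree ≤ s.natDegree * xp.natDegree := natDegree_comp_le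
    have h3 : s.natDegree * xp.natDegree ≤ J * 3 := Nat.mul_le_mul hsd hxpd
    omega
  have key : T.card ≤ 2 * (3 * J + 1) + 3 := by
    refine win_rel (D := 3 * J + 1) T G m hG3 hG hm.ne' (fun p hp => (hT p hp).1) hinj ?_
    intro p hp
    refine win_det (fun l : Fin (3 * J + 1) => W.coeff l) L (q0 * (K * δ ^ (J + 1))) (fun i => (p i).1) (fun i => (p i).2)
      (fun i => (hT _ (hp i)).2.2.1) ?_ ?_
    · intro i
      obtain ⟨h1, h2, h3, h4⟩ := hT _ (hp i)
      generalize p i = r at h1 h2 h3 h4 ⊢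
      have e1 : ∑ l : Fin (3 * J + 1), (r.1 : ℝ) ^ (l : ℕ) * W.coeff l = W.eval (r.1 : ℝ) := by
        rw [eval_eq_sum_range' hWd, Fin.sum_univ_eq_sum_range (fun l => (r.1 : ℝ) ^ l * W.coeff l)]
        exact Finset.sum_congr rfl fun _ _ => mul_comm _ _
      rw [e1]
      have e2 : (G.map (Int.castRingHom ℝ)).eval (r.1 : ℝ) = ((G.eval r.1 : ℤ) : ℝ) := by
        rw [eval_intCast_map]; rfl
      set x : ℝ := xp.eval (r.1 : ℝ) with hx
      have e3 : x = 1 / g0 * (((G.eval r.1 : ℤ) : ℝ) - g0) := by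
        rw [hx, hxp]; simp only [eval_mul, eval_C, eval_sub, e2]
      have e4 : |x| ≤ δ := by
        rw [e3, abs_mul, abs_of_pos (by positivity), one_div, inv_mul_le_iff₀ hg0pos, mul_comm]
        exact h4
      have e5 : W.eval (r.1 : ℝ) = q0 * s.eval x := by
        rw [hW, eval_mul, eval_C, eval_comp]
      have h2r : (0 : ℝ) < r.2 := by exact_mod_cast h2
      have e6 : (r.2 : ℝ) = q0 * √(1 + x) := by
        have e7 : (1 + x) = ((r.2 : ℝ) / q0) ^ 2 := by
          have : ((G.eval r.1 : ℤ) : ℝ) = m * (r.2 : ℝ) ^ 2 := by rw [← h1]; push_cast; ring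
          rw [e3, this, hG0r]
          field_simp
          ring
        rw [e7, Real.sqrt_sq (by positivity)]
        field_simp
      rw [e5, e6, ← mul_sub, abs_mul, abs_of_pos hqr]
      refine mul_le_mul_of_nonneg_left ?_ hqr.le
      refine (hs x (e4.trans hδ)).trans ?_
      gcongr
    · simpa using hsmall
  omega

open Polynomial in
lemma sep_ne_sq (F : ℤ[X]) (hF : (F.map (Int.castRingHom ℂ)).Separable) (hd : F.natDegree ≠ 0) (n0 m : ℤ) (hm : m ≠ 0)
    (a : ℤ) (H : ℤ[X]) (ha : a ≠ 0) : C a * F.comp (C m * X + C n0) ≠ C m * H ^ 2 := by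
  intro h
  have hlin : (C m * X + C n0 : ℤ[X]).natDegree = 1 := natDegree_linear hm
  have hHd : H.natDegree ≠ 0 := by
    intro h0
    have h1 := congrArg natDegree h
    rw [natDegree_C_mul ha, natDegree_C_mul hm, natDegree_comp, hlin, natDegree_pow, h0] at h1
    omega
  set φ := Int.castRingHom ℂ with hφ
  have hinj : Function.Injective φ := Int.cast_injective
  obtain ⟨ρ, hρ⟩ := IsAlgClosed.exists_root (H.map φ) (by
    rw [degree_map_eq_of_injective hinj]
    intro h0
    exact hHd (natDegree_eq_of_degree_eq_some h0))
  have h2 := congrArg (Polynomial.map φ) h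
  simp only [Polynomial.map_mul, Polynomial.map_pow, map_C, map_comp, Polynomial.map_add, map_X] at h2
  have e1 := congrArg (eval ρ) h2
  have h3 := congrArg derivative h2
  have e2 := congrArg (eval ρ) h3
  rw [IsRoot.def] at hρ
  simp only [eval_mul, eval_C, eval_comp, eval_add, eval_X, eval_pow, hρ] at e1
  simp only [derivative_mul, derivative_C, derivative_comp, derivative_add, derivative_X, derivative_pow, eval_mul, eval_add, eval_C,
    eval_comp, eval_X, eval_pow, hρ, eval_zero, eval_one] at e2
  have e1' : (F.map φ).eval (φ m * ρ + φ n0) = 0 := by simpa [ha] using e1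
  have e2' : (derivative (F.map φ)).eval (φ m * ρ + φ n0) = 0 := by simpa [ha, hm] using e2
  obtain ⟨u, v, huv⟩ := hF
  have := congrArg (eval (φ m * ρ + φ n0)) huv
  rw [eval_add, eval_mul, eval_mul, e1', e2'] at this
  simp at this

end SecW2

section SecW3

/-- points on `q² m = F(n)`. -/
structure FPt (F : Polynomial ℤ) (N Q R : ℝ) (p : ℤ × ℤ × ℤ) : Prop where
  n1 : N ≤ p.1
  n2 : (p.1 : ℝ) ≤ 2 * N
  q0 : 0 < p.2.1
  q1 : (p.2.1 : ℝ) ≤ Q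
  m0 : 0 < p.2.2
  m1 : (p.2.2 : ℝ) * R ≤ N
  e : p.2.1 ^ 2 * p.2.2 = F.eval p.1

open Polynomial in
lemma wcount (J : ℕ) : ∃ K : ℝ, 0 < K ∧ ∃ d : ℝ, 0 < d ∧
    ∀ (F : ℤ[X]), F.natDegree ≤ 3 → F.natDegree ≠ 0 → (∀ n0 m a : ℤ, ∀ H : ℤ[X], m ≠ 0 → a ≠ 0 → C a * F.comp (C m * X + C n0) ≠ C m * H ^ 2) →
    ∀ (N Q R E : ℝ) (L : ℕ), 0 < N → 0 < Q → 1 ≤ L → (L : ℝ) ≤ R → 0 ≤ E →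
    (∀ n n0 : ℤ, N ≤ n → (n : ℝ) ≤ 3 * N → N ≤ n0 → (n0 : ℝ) ≤ 3 * N → 0 < F.eval n0 ∧
      |((F.eval n : ℤ) : ℝ) - (F.eval n0 : ℤ)| ≤ E * (|(n : ℝ) - n0| / N) * (F.eval n0 : ℤ)) →
    E * (L / R) ≤ d →
    ((3 * J + 2).factorial : ℝ) * ((L : ℝ) ^ ((3 * J + 1) * (3 * J) / 2) * (Q * (K * (E * (L / R)) ^ (J + 1)))) < 1 →
    ∀ S : Finset (ℤ × ℤ × ℤ), Set.InjOn Prod.fst (S : Set (ℤ × ℤ × ℤ)) → (∀ p ∈ S, FPt F N Q R p) →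
    S.card * L ≤ (6 * J + 5) * ∑ n ∈ Finset.Icc ⌈N⌉ ⌊3 * N⌋, (F.eval n).natAbs.divisors.card := by
  classical
  obtain ⟨K, hK, d, hd, hd2, hwin⟩ := win_full J
  refine ⟨K, hK, d, hd, ?_⟩
  intro F hF3 hF0 hFs N Q R E L hN hQ hL hLR hE hFE hδ hsmall S hinj hS
  have hLr : (1 : ℝ) ≤ L := by exact_mod_cast hL
  have hR : 0 < R := by linarith
  rw [← Finset.card_sigma]
  have hcard : S.card * L = (S ×ˢ Finset.range L).card := by simp
  rw [hcard]
  let φ : (ℤ × ℤ × ℤ) × ℕ → (Σ _ : ℤ, ℕ) := fun x => ⟨x.1.1 + x.1.2.2 * x.2, x.1.2.2.toNat⟩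
  -- bound for m*t
  have hmt : ∀ x ∈ S ×ˢ Finset.range L, (0 : ℝ) ≤ x.1.2.2 * x.2 ∧ (x.1.2.2 : ℝ) * x.2 ≤ N := by
    intro x hx
    obtain ⟨h1, h2⟩ := Finset.mem_product.mp hx
    have hp := hS _ h1
    have hm : (0 : ℝ) < x.1.2.2 := by exact_mod_cast hp.m0
    have h3 : (x.2 : ℝ) ≤ L := by exact_mod_cast (Finset.mem_range.mp h2).le
    refine ⟨by positivity, ?_⟩
    calc (x.1.2.2 : ℝ) * x.2 ≤ x.1.2.2 * R := by gcongr; exact h3.trans hLR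
      _ ≤ N := hp.m1
  refine Finset.card_le_mul_card_image_of_maps_to (f := φ) ?_ _ ?_
  · intro x hx
    obtain ⟨h1, h2⟩ := Finset.mem_product.mp hx
    obtain ⟨h3, h4⟩ := hmt x hx
    have hp := hS _ h1
    have n1 := hp.n1
    have n2 := hp.n2
    have hc1 : N ≤ ((x.1.1 + x.1.2.2 * x.2 : ℤ) : ℝ) := by push_cast; linarith
    have hc2 : ((x.1.1 + x.1.2.2 * x.2 : ℤ) : ℝ) ≤ 3 * N := by push_cast; linarith
    refine Finset.mem_sigma.mpr ⟨Finset.mem_Icc.mpr ⟨Int.ceil_le.mpr hc1, Int.le_floor.mpr hc2⟩, ?_⟩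
    have hpos := (hFE _ _ hc1 hc2 hc1 hc2).1
    rw [Nat.mem_divisors]
    refine ⟨?_, by simpa using hpos.ne'⟩
    have hm0 := hp.m0
    have hd1 : x.1.2.2 ∣ F.eval (x.1.1 + x.1.2.2 * x.2) := by
      have h5 : (x.1.1 + x.1.2.2 * x.2) - x.1.1 ∣ F.eval (x.1.1 + x.1.2.2 * x.2) - F.eval x.1.1 := sub_dvd_eval_sub _ _ _
      have h6 : x.1.2.2 ∣ F.eval (x.1.1 + x.1.2.2 * x.2) - F.eval x.1.1 := by
        refine dvd_trans ?_ h5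
        rw [add_sub_cancel_left]; exact dvd_mul_right _ _
      have h7 : x.1.2.2 ∣ F.eval x.1.1 := by rw [← hp.e]; exact dvd_mul_left _ _
      have := dvd_add h6 h7
      rwa [sub_add_cancel] at this
    have : x.1.2.2.toNat = x.1.2.2.natAbs := by omega
    show x.1.2.2.toNat ∣ _
    rw [this]
    exact Int.natAbs_dvd_natAbs.mpr hd1
  · rintro ⟨b, mb⟩ hb
    set Φ := (S ×ˢ Finset.range L).filter (fun x => φ x = ⟨b, mb⟩) with hΦ
    rcases Φ.eq_empty_or_nonempty with h0 | ⟨y, hy⟩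
    · rw [h0]; simp
    have hmem : ∀ x ∈ Φ, x.1 ∈ S ∧ x.2 < L ∧ x.1.1 = b - y.1.2.2 * x.2 ∧ x.1.2.2 = y.1.2.2 := by
      have aux : ∀ x ∈ Φ, x.1 ∈ S ∧ x.2 < L ∧ x.1.1 + x.1.2.2 * x.2 = b ∧ x.1.2.2.toNat = mb := by
        intro x hx
        obtain ⟨h1, h2⟩ := Finset.mem_filter.mp hx
        obtain ⟨h3, h4⟩ := Finset.mem_product.mp h1
        simp only [φ, Sigma.mk.injEq, heq_eq_eq] at h2
        exact ⟨h3, Finset.mem_range.mp h4, h2.1, h2.2⟩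
      intro x hx
      obtain ⟨a1, a2, a3, a4⟩ := aux x hx
      obtain ⟨b1, b2, b3, b4⟩ := aux y hy
      have e1 : x.1.2.2 = y.1.2.2 := by
        have := (hS _ a1).m0
        have := (hS _ b1).m0
        omega
      refine ⟨a1, a2, ?_, e1⟩
      rw [← e1]; linarith
    obtain ⟨y1, y2, y3, -⟩ := hmem y hy
    have hpy := hS _ y1
    set m := y.1.2.2 with hm
    set n0 := y.1.1 with hn0
    have hdiff : ∀ x ∈ Φ, x.1.1 = m * ((y.2 : ℤ) - x.2) + n0 := by
      intro x hx
      obtain ⟨x1, x2, x3, x4⟩ := hmem x hx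
      rw [x3, y3]; ring
    have hinjΦ : ∀ x ∈ Φ, ∀ x' ∈ Φ, x.2 = x'.2 → x = x' := by
      intro x hx x' hx' h
      have h1 := hdiff x hx
      have h2 := hdiff x' hx'
      have h3 : x.1.1 = x'.1.1 := by rw [h1, h2, h]
      exact Prod.ext (hinj (hmem x hx).1 (hmem x' hx').1 h3) h
    let ψ : (ℤ × ℤ × ℤ) × ℕ → ℤ × ℤ := fun x => ((y.2 : ℤ) - x.2, x.1.2.1)
    have hψ : Set.InjOn ψ (Φ : Set ((ℤ × ℤ × ℤ) × ℕ)) := by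
      intro x hx x' hx' h
      refine hinjΦ x hx x' hx' ?_
      have := congrArg Prod.fst h
      simp only [ψ] at this
      omega
    rw [← Finset.card_image_of_injOn hψ]
    have hGe : ∀ t : ℤ, (F.comp (C m * X + C n0)).eval t = F.eval (m * t + n0) := by
      intro t; simp [eval_comp]
    refine hwin (Φ.image ψ) (F.comp (C m * X + C n0)) m y.1.2.1 L (E * (L / R)) ?_ ?_ hpy.m0 hpy.q0 ?_ ?_ ?_ (by positivity) hδ ?_
    · rw [natDegree_comp, natDegree_linear hpy.m0.ne', mul_one]; exact hF3
    · intro a H ha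
      exact hFs n0 m a H hpy.m0.ne' ha
    · rw [hGe, mul_zero, zero_add, ← hpy.e]; ring
    · intro p hp
      obtain ⟨x, hx, rfl⟩ := Finset.mem_image.mp hp
      obtain ⟨x1, x2, x3, x4⟩ := hmem x hx
      have hpx := hS _ x1
      have hdx := hdiff x hx
      simp only [ψ]
      rw [hGe, hGe, mul_zero, zero_add, ← hdx]
      have ht : |(((y.2 : ℤ) - x.2 : ℤ) : ℝ)| ≤ L := by
        have : |((y.2 : ℤ) - x.2 : ℤ)| ≤ L := by rw [abs_le]; omega
        exact_mod_cast this
      refine ⟨?_, hpx.q0, ht, ?_⟩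
      · rw [← hpx.e, x4]; ring
      · have hx1 := hpx.n1
        have hx2 := hpx.n2
        have hy1 := hpy.n1
        have hy2 := hpy.n2
        obtain ⟨f1, f2⟩ := hFE x.1.1 n0 hx1 (by linarith) hy1 (by linarith)
        refine f2.trans ?_
        have f1r : (0 : ℝ) < (F.eval n0 : ℤ) := by exact_mod_cast f1
        have hmr : (0 : ℝ) < m := by exact_mod_cast hpy.m0
        have g1 : |(x.1.1 : ℝ) - n0| ≤ m * L := by
          rw [hdx]
          push_cast
          rw [add_sub_cancel_right, abs_mul, abs_of_pos hmr]
          push_cast at ht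
          gcongr
        have g2 : |(x.1.1 : ℝ) - n0| / N ≤ L / R := by
          rw [div_le_div_iff₀ hN hR]
          have := hpy.m1
          calc |(x.1.1 : ℝ) - n0| * R ≤ (m * L) * R := by gcongr
            _ = L * (m * R) := by ring
            _ ≤ L * N := by gcongr
        gcongr
    · intro p hp p' hp' h
      obtain ⟨x, hx, rfl⟩ := Finset.mem_image.mp (Finset.mem_coe.mp hp)
      obtain ⟨x', hx', rfl⟩ := Finset.mem_image.mp (Finset.mem_coe.mp hp')
      simp only [ψ] at h
      rw [hinjΦ x hx x' hx' (by omega)]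
    · refine lt_of_le_of_lt ?_ hsmall
      have := hpy.q1
      gcongr

end SecW3

section SecW4

lemma div_aux (k : ℕ) : ∃ C : ℝ, 1 ≤ C ∧ ∀ v : ℕ, ((v : ℝ) + 1) ^ k ≤ C * 2 ^ v := by
  have h := (tendsto_pow_const_div_const_pow_of_one_lt k (r := (2 : ℝ)) (by norm_num)).bddAbove_range
  obtain ⟨C, hC⟩ := h
  refine ⟨max 1 (2 * C), le_max_left _ _, fun v => ?_⟩
  have h1 : (((v + 1 : ℕ) : ℝ)) ^ k / 2 ^ (v + 1) ≤ C := hC ⟨v + 1, rfl⟩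
  rw [div_le_iff₀ (by positivity)] at h1
  push_cast at h1
  calc ((v : ℝ) + 1) ^ k ≤ C * 2 ^ (v + 1) := h1
    _ = 2 * C * 2 ^ v := by ring
    _ ≤ _ := by gcongr; exact le_max_right _ _

lemma divisor_bound (k : ℕ) : ∃ C : ℝ, 1 ≤ C ∧ ∀ n : ℕ, n ≠ 0 → (n.divisors.card : ℝ) ^ k ≤ C * n := by
  obtain ⟨C, hC1, hC⟩ := div_aux k
  refine ⟨C ^ (2 ^ k), one_le_pow₀ hC1, fun n hn => ?_⟩
  rw [Nat.card_divisors hn]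
  have hn' : (n : ℝ) = ∏ p ∈ n.primeFactors, (p : ℝ) ^ (n.factorization p) := by
    conv_lhs => rw [← Nat.prod_factorization_pow_eq_self hn]
    rw [Finsupp.prod, Nat.support_factorization]
    push_cast
    rfl
  have h1 : ∀ p ∈ n.primeFactors, ((n.factorization p : ℝ) + 1) ^ k ≤ (if p < 2 ^ k then C else 1) * (p : ℝ) ^ (n.factorization p) := by
    intro p hp
    have hp2 : 2 ≤ p := (Nat.prime_of_mem_primeFactors hp).two_le
    set v := n.factorization p
    split_ifs with h
    · refine (hC v).trans ?_
      have : (2 : ℝ) ≤ p := by exact_mod_cast hp2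
      gcongr
    · push Not at h
      rw [one_mul]
      have h2 : v + 1 ≤ 2 ^ v := Nat.lt_two_pow_self
      have h3 : (v + 1) ^ k ≤ p ^ v := by
        calc (v + 1) ^ k ≤ (2 ^ v) ^ k := Nat.pow_le_pow_left h2 k
          _ = (2 ^ k) ^ v := by rw [← pow_mul, ← pow_mul, mul_comm]
          _ ≤ p ^ v := Nat.pow_le_pow_left h v
      exact_mod_cast h3
  push_cast
  rw [← Finset.prod_pow, hn']
  refine (Finset.prod_le_prod (fun _ _ => by positivity) h1).trans ?_
  rw [Finset.prod_mul_distrib]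
  refine mul_le_mul_of_nonneg_right ?_ (Finset.prod_nonneg fun _ _ => by positivity)
  rw [Finset.prod_ite]
  simp only [Finset.prod_const, one_pow, mul_one]
  refine pow_le_pow_right₀ hC1 ?_
  calc _ ≤ (Finset.range (2 ^ k)).card := Finset.card_le_card (by
        intro p hp
        exact Finset.mem_range.mpr (Finset.mem_filter.mp hp).2)
    _ = 2 ^ k := Finset.card_range _

open Polynomial in
lemma poly_lip (F : ℝ[X]) (e : ℕ) (hF : F.natDegree ≤ e + 1) : ∃ E : ℝ, 0 < E ∧ ∀ N x y : ℝ, 1 ≤ N →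
    0 ≤ x → x ≤ 3 * N → 0 ≤ y → y ≤ 3 * N → |F.eval x - F.eval y| ≤ E * N ^ e * |x - y| := by
  refine ⟨1 + ∑ i ∈ Finset.range (e + 2), |F.coeff i| * (i * 3 ^ e), by positivity, ?_⟩
  intro N x y hN hx hx3 hy hy3
  rw [eval_eq_sum_range' (n := e + 2) (by omega), eval_eq_sum_range' (n := e + 2) (by omega), ← Finset.sum_sub_distrib]
  have h1 : ∀ i ∈ Finset.range (e + 2), |F.coeff i * x ^ i - F.coeff i * y ^ i| ≤ |F.coeff i| * (i * 3 ^ e) * (N ^ e * |x - y|) := by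
    intro i hi
    have hi' : i - 1 ≤ e := by have := Finset.mem_range.mp hi; omega
    rw [← mul_sub, abs_mul]
    have h2 := abs_pow_sub_pow_le x y i
    have h3 : max |x| |y| ≤ 3 * N := by
      rw [abs_of_nonneg hx, abs_of_nonneg hy]; exact max_le hx3 hy3
    have h4 : max |x| |y| ^ (i - 1) ≤ (3 * N) ^ e :=
      (pow_le_pow_left₀ (le_max_of_le_left (abs_nonneg _)) h3 _).trans (pow_le_pow_right₀ (by linarith) hi')
    calc |F.coeff i| * |x ^ i - y ^ i| ≤ |F.coeff i| * (|x - y| * i * (3 * N) ^ e) := by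
          gcongr
          exact h2.trans (by gcongr)
      _ = _ := by rw [mul_pow]; ring
  calc _ ≤ ∑ i ∈ Finset.range (e + 2), |F.coeff i * x ^ i - F.coeff i * y ^ i| := Finset.abs_sum_le_sum_abs _ _
    _ ≤ ∑ i ∈ Finset.range (e + 2), |F.coeff i| * (i * 3 ^ e) * (N ^ e * |x - y|) := Finset.sum_le_sum h1
    _ = (∑ i ∈ Finset.range (e + 2), |F.coeff i| * (i * 3 ^ e)) * (N ^ e * |x - y|) := by rw [Finset.sum_mul]
    _ ≤ (1 + ∑ i ∈ Finset.range (e + 2), |F.coeff i| * (i * 3 ^ e)) * (N ^ e * |x - y|) := by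
        gcongr; linarith
    _ = _ := by ring

open Polynomial in
lemma poly_lower (F : ℤ[X]) (hl : 0 < F.leadingCoeff) : ∃ N0 : ℝ, 1 ≤ N0 ∧ ∀ x : ℝ, N0 ≤ x → 
    1 / 2 * x ^ F.natDegree ≤ (F.map (Int.castRingHom ℝ)).eval x := by
  have hinj : Function.Injective (Int.castRingHom ℝ) := Int.cast_injective
  have h := Polynomial.isEquivalent_atTop_lead (F.map (Int.castRingHom ℝ))
  rw [natDegree_map_eq_of_injective hinj, leadingCoeff_map_of_injective hinj] at h
  have h2 := h.def (c := 1 / 2) (by norm_num)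
  rw [Filter.eventually_atTop] at h2
  obtain ⟨a, ha⟩ := h2
  refine ⟨max a 1, le_max_right _ _, fun x hx => ?_⟩
  have h3 := ha x ((le_max_left _ _).trans hx)
  have hx1 : 1 ≤ x := (le_max_right _ _).trans hx
  have hlc : (1 : ℝ) ≤ F.leadingCoeff := by exact_mod_cast hl
  simp only [Pi.sub_apply, Real.norm_eq_abs, eq_intCast] at h3
  have hp : (0 : ℝ) ≤ x ^ F.natDegree := by positivity
  rw [abs_of_nonneg (a := (F.leadingCoeff : ℝ) * x ^ F.natDegree) (by positivity)] at h3
  have h4 := (abs_le.mp h3).1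
  have h5 : x ^ F.natDegree ≤ F.leadingCoeff * x ^ F.natDegree := le_mul_of_one_le_left hp hlc
  linarith

open Polynomial in
lemma poly_bounds (F : ℤ[X]) (hl : 0 < F.leadingCoeff) (h0 : F.natDegree ≠ 0) : ∃ E N0 : ℝ, 1 ≤ E ∧ 1 ≤ N0 ∧ ∀ N : ℝ, N0 ≤ N → 
    ∀ n n0 : ℤ, N ≤ n → (n : ℝ) ≤ 3 * N → N ≤ n0 → (n0 : ℝ) ≤ 3 * N → 0 < F.eval n0 ∧
      |((F.eval n : ℤ) : ℝ) - (F.eval n0 : ℤ)| ≤ E * (|(n : ℝ) - n0| / N) * (F.eval n0 : ℤ) ∧ ((F.eval n0 : ℤ) : ℝ) ≤ E * N ^ F.natDegree := by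
  obtain ⟨e, he⟩ := Nat.exists_eq_succ_of_ne_zero h0
  set Fr := F.map (Int.castRingHom ℝ) with hFr
  obtain ⟨E1, hE1, hlip⟩ := poly_lip Fr e (natDegree_map_le.trans he.le)
  obtain ⟨N0, hN0, hlow⟩ := poly_lower F hl
  have hev : ∀ n : ℤ, ((F.eval n : ℤ) : ℝ) = Fr.eval (n : ℝ) := by
    intro n; rw [hFr, eval_intCast_map]; rfl
  refine ⟨1 + 3 * E1 + |Fr.eval 0| + 2 * E1, N0, by positivity |> fun (_ : (0:ℝ) ≤ 3 * E1 + |Fr.eval 0| + 2 * E1) => by linarith, hN0, ?_⟩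
  intro N hN n n0 hn hn3 hm hm3
  have hN1 : 1 ≤ N := hN0.trans hN
  have hN0' : 0 < N := by linarith
  have hl0 := hlow n0 (hN.trans hm)
  rw [← hFr, ← hev] at hl0
  have hpow : N ^ F.natDegree ≤ (n0 : ℝ) ^ F.natDegree := by gcongr
  have hpos : (0 : ℝ) < (F.eval n0 : ℤ) := by
    have : 0 < N ^ F.natDegree := by positivity
    linarith
  refine ⟨by exact_mod_cast hpos, ?_, ?_⟩
  · have h1 := hlip N n n0 hN1 (by linarith) hn3 (by linarith) hm3
    rw [← hev, ← hev] at h1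
    refine h1.trans ?_
    have h2 : N ^ e * N ≤ 2 * (F.eval n0 : ℤ) := by
      rw [← pow_succ, ← Nat.succ_eq_add_one, ← he]; linarith
    calc E1 * N ^ e * |(n : ℝ) - n0| = E1 * (|(n : ℝ) - n0| / N) * (N ^ e * N) := by field_simp
      _ ≤ E1 * (|(n : ℝ) - n0| / N) * (2 * (F.eval n0 : ℤ)) := by gcongr
      _ = 2 * E1 * (|(n : ℝ) - n0| / N) * (F.eval n0 : ℤ) := by ring
      _ ≤ _ := by
        gcongr
        have := abs_nonneg (Fr.eval 0)
        linarith
  · have h1 := hlip N n0 0 hN1 (by linarith) hm3 le_rfl (by linarith)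
    rw [← hev, sub_zero, abs_of_nonneg (a := (n0 : ℝ)) (by linarith)] at h1
    have h2 := (abs_le.mp h1).2
    have h3 : E1 * N ^ e * n0 ≤ 3 * E1 * N ^ F.natDegree := by
      rw [he, pow_succ]
      calc E1 * N ^ e * n0 ≤ E1 * N ^ e * (3 * N) := by gcongr
        _ = _ := by ring
    have h4 : (1 : ℝ) ≤ N ^ F.natDegree := one_le_pow₀ hN1
    have h5 : Fr.eval 0 ≤ |Fr.eval 0| * N ^ F.natDegree := (le_abs_self _).trans (le_mul_of_one_le_right (abs_nonneg _) h4)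
    have h6 : 0 ≤ (1 + 2 * E1) * N ^ F.natDegree := by positivity
    linarith only [h2, h3, h5, h6]

end SecW4

section SecW5

lemma small_aux (f a Q K E L R d : ℝ) (J P r s : ℕ) (hf : 0 ≤ f) (hK : 0 < K) (hE : 1 ≤ E) (hL : 1 ≤ L) (hR : R = L ^ s)
    (hQ0 : 0 < Q) (hQ : Q ≤ (2 * L) ^ (2 * r)) (hP : P + 2 * r + (J + 1) + 1 ≤ s * (J + 1))
    (hb : f * (2 ^ (2 * r) * K * E ^ (J + 1)) < L) :
    f * (L ^ P * (Q * (K * (E * (L / R)) ^ (J + 1)))) < 1 := by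
  have hL0 : 0 < L := by linarith
  subst hR
  have h1 : f * (L ^ P * (Q * (K * (E * (L / L ^ s)) ^ (J + 1)))) ≤ f * (L ^ P * ((2 * L) ^ (2 * r) * (K * (E * (L / L ^ s)) ^ (J + 1)))) := by
    gcongr
  refine lt_of_le_of_lt h1 ?_
  have h2 : f * (L ^ P * ((2 * L) ^ (2 * r) * (K * (E * (L / L ^ s)) ^ (J + 1)))) =
      f * (2 ^ (2 * r) * K * E ^ (J + 1)) * L ^ (P + 2 * r + (J + 1)) / L ^ (s * (J + 1)) := by
    rw [mul_pow, mul_pow, div_pow, ← pow_mul L s]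
    field_simp
    ring
  rw [h2, div_lt_one (by positivity)]
  calc f * (2 ^ (2 * r) * K * E ^ (J + 1)) * L ^ (P + 2 * r + (J + 1)) < L * L ^ (P + 2 * r + (J + 1)) := by gcongr
    _ = L ^ (P + 2 * r + (J + 1) + 1) := by ring
    _ ≤ L ^ (s * (J + 1)) := pow_le_pow_right₀ hL hP

lemma tau_aux (t c L N : ℝ) (r : ℕ) (hr : 1 ≤ r) (ht : 0 ≤ t) (hc : 1 ≤ c) (hL : 1 ≤ L) (hN0 : 0 ≤ N) (hN : N ≤ (2 * L) ^ r)
    (h : t ^ (6 * r) ≤ c * N ^ 3) : t ^ 2 ≤ c * 8 ^ r * L := by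
  have h1 : (t ^ 2) ^ (3 * r) ≤ (c * 8 ^ r * L) ^ (3 * r) := by
    have h8 : (1 : ℝ) ≤ c * 8 ^ r := by
      have : (1 : ℝ) ≤ 8 ^ r := one_le_pow₀ (by norm_num)
      nlinarith
    calc (t ^ 2) ^ (3 * r) = t ^ (6 * r) := by rw [← pow_mul]; congr 1; ring
      _ ≤ c * N ^ 3 := h
      _ ≤ c * ((2 * L) ^ r) ^ 3 := by gcongr
      _ = (c * 8 ^ r) * L ^ (3 * r) := by
        rw [← pow_mul, mul_comm r 3, mul_pow, pow_mul 2 3 r]; norm_num; ring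
      _ ≤ (c * 8 ^ r) ^ (3 * r) * L ^ (3 * r) := by
        gcongr
        exact le_self_pow₀ h8 (by omega)
      _ = _ := (mul_pow _ _ _).symm
  exact le_of_pow_le_pow_left₀ (by omega) (by positivity) h1

open Polynomial in
theorem wmain (F : ℤ[X]) (hF3 : F.natDegree ≤ 3) (hF0 : F.natDegree ≠ 0) (hFs : ∀ n0 m a : ℤ, ∀ H : ℤ[X], m ≠ 0 → a ≠ 0 → C a * F.comp (C m * X + C n0) ≠ C m * H ^ 2)
    (hl : 0 < F.leadingCoeff) (J s r : ℕ) (hr : 1 ≤ r) (hs : 2 ≤ s)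
    (hP : (3 * J + 1) * (3 * J) / 2 + 2 * r + (J + 1) + 1 ≤ s * (J + 1)) :
    ∃ C L0 : ℝ, 0 < C ∧ ∀ L : ℕ, L0 ≤ L → ∀ N : ℝ, (L : ℝ) ≤ N → N ≤ (2 * L : ℝ) ^ r →
    ∀ S : Finset (ℤ × ℤ × ℤ), Set.InjOn Prod.fst (S : Set (ℤ × ℤ × ℤ)) → (∀ p ∈ S, FPt F N (N ^ 2) ((L : ℝ) ^ s) p) →
    (S.card : ℝ) ^ 2 * L ≤ C * N ^ 2 := by
  obtain ⟨K, hK, d, hd, hw⟩ := wcount J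
  obtain ⟨E, N0, hE, hN0, hb⟩ := poly_bounds F hl hF0
  obtain ⟨Cd, hCd, hdiv⟩ := divisor_bound (6 * r)
  set fac : ℝ := ((3 * J + 2).factorial : ℝ) with hfac
  set c := Cd * E * 8 ^ r with hc
  have hE0 : 0 < E := by linarith
  refine ⟨((6 * J + 5) * 3) ^ 2 * c, max (max N0 (E / d)) (fac * (2 ^ (2 * r) * K * E ^ (J + 1)) + 1), by positivity, ?_⟩
  intro L hL N hLN' hNL S hinj hS
  have l1 : N0 ≤ L := (le_max_left _ _).trans ((le_max_left _ _).trans hL)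
  have l2 : E / d ≤ L := (le_max_right _ _).trans ((le_max_left _ _).trans hL)
  have l3 : fac * (2 ^ (2 * r) * K * E ^ (J + 1)) < L := by
    have := (le_max_right _ _).trans hL
    linarith
  have hL1 : (1 : ℝ) ≤ L := hN0.trans l1
  have hL0 : (0 : ℝ) < L := by linarith
  have hN1 : 1 ≤ N := hL1.trans hLN'
  have hNN := l1.trans hLN'
  have hLs : (L : ℝ) ^ 2 ≤ (L : ℝ) ^ s := pow_le_pow_right₀ hL1 hs
  have key := hw F hF3 hF0 hFs N (N ^ 2) ((L : ℝ) ^ s) E L (by linarith) (by positivity) (by exact_mod_cast hL1)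
    (le_self_pow₀ hL1 (by omega)) hE0.le (fun n n0 a1 a2 a3 a4 => ⟨(hb N hNN n n0 a1 a2 a3 a4).1, (hb N hNN n n0 a1 a2 a3 a4).2.1⟩)
    (by
      rw [div_le_iff₀ hd] at l2
      rw [mul_div_assoc', div_le_iff₀ (by positivity)]
      calc E * L ≤ (L * d) * L := by gcongr
        _ = d * (L : ℝ) ^ 2 := by ring
        _ ≤ d * (L : ℝ) ^ s := by gcongr)
    (small_aux _ 0 _ K E L _ d J _ r s (by positivity) hK hE hL1 rfl (by positivity) (by
      rw [mul_comm 2 r, pow_mul]; gcongr) hP l3) S hinj hS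
  have htau : ∀ n ∈ Finset.Icc ⌈N⌉ ⌊3 * N⌋, ((F.eval n).natAbs.divisors.card : ℝ) ≤ √(c * L) := by
    intro n hn
    obtain ⟨n1, n2⟩ := Finset.mem_Icc.mp hn
    have n1' := Int.ceil_le.mp n1
    have n2' := Int.le_floor.mp n2
    obtain ⟨f1, f2, f3⟩ := hb N hNN n n n1' n2' n1' n2'
    apply Real.le_sqrt_of_sq_le
    refine tau_aux _ (Cd * E) L N r hr (by positivity) (by nlinarith) hL1 (by linarith) hNL ?_
    refine (hdiv _ (by simpa using f1.ne')).trans ?_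
    have f4 : (((F.eval n).natAbs : ℕ) : ℝ) = (F.eval n : ℤ) := by
      have : (((F.eval n).natAbs : ℕ) : ℤ) = F.eval n := by omega
      rw [← Int.cast_natCast, this]
    rw [f4, mul_assoc]
    have : N ^ F.natDegree ≤ N ^ 3 := pow_le_pow_right₀ hN1 hF3
    gcongr
    exact f3.trans (by gcongr)
  have hcard : ((Finset.Icc ⌈N⌉ ⌊3 * N⌋).card : ℝ) ≤ 3 * N := by
    refine (int_card_le _ N (3 * N) (by linarith) ?_).trans (by linarith)
    intro n hn
    obtain ⟨n1, n2⟩ := Finset.mem_Icc.mp hn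
    exact ⟨Int.ceil_le.mp n1, Int.le_floor.mp n2⟩
  have hsum : ((∑ n ∈ Finset.Icc ⌈N⌉ ⌊3 * N⌋, (F.eval n).natAbs.divisors.card : ℕ) : ℝ) ≤ 3 * N * √(c * L) := by
    push_cast
    refine (Finset.sum_le_card_nsmul _ _ _ htau).trans ?_
    rw [nsmul_eq_mul]
    gcongr
  have key' : (S.card : ℝ) * L ≤ (6 * J + 5) * (3 * N * √(c * L)) := by
    have : (S.card : ℝ) * L ≤ (6 * J + 5) * ((∑ n ∈ Finset.Icc ⌈N⌉ ⌊3 * N⌋, (F.eval n).natAbs.divisors.card : ℕ) : ℝ) := by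
      exact_mod_cast key
    refine this.trans ?_
    gcongr
  have hsq : ((S.card : ℝ) * L) ^ 2 ≤ ((6 * J + 5) * (3 * N * √(c * L))) ^ 2 := by gcongr
  have hcL : (0 : ℝ) ≤ c * L := by positivity
  have e1 : ((6 * J + 5) * (3 * N * √(c * L))) ^ 2 = ((6 * J + 5) * 3) ^ 2 * c * N ^ 2 * L := by
    rw [mul_pow, mul_pow, Real.sq_sqrt hcL]; ring
  rw [e1] at hsq
  have e2 : ((S.card : ℝ) * L) ^ 2 = (S.card : ℝ) ^ 2 * L * L := by ring
  rw [e2] at hsq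
  exact le_of_mul_le_mul_right hsq hL0

end SecW5

section SecW6

structure BadN (f : Polynomial ℤ) (N : ℝ) (L : ℕ) (n : ℤ) : Prop where
  n1 : N ≤ n
  n2 : (n : ℝ) ≤ 3 / 2 * N
  f0 : f.eval n ≠ 0
  ex : ∃ q : ℤ, Prime q ∧ 0 < q ∧ N ≤ L * (q : ℝ) ∧ q ^ 2 ∣ f.eval n

def TConcl (f : Polynomial ℤ) : Prop := ∃ r : ℕ, 1 ≤ r ∧ ∃ C L0 : ℝ, 0 < C ∧ ∀ L : ℕ, L0 ≤ L → ∀ N : ℝ, (L : ℝ) ^ r ≤ N → N ≤ (2 * L : ℝ) ^ r →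
    ∀ B : Finset ℤ, (∀ n ∈ B, BadN f N L n) → (B.card : ℝ) ^ 2 * L ≤ C * N ^ 2

open Polynomial in
lemma cubic_ne_sq (A B : ℤ) (n0 m a : ℤ) (H : ℤ[X]) (hm : m ≠ 0) (ha : a ≠ 0) :
    C a * (X ^ 3 + C A * X + C B : ℤ[X]).comp (C m * X + C n0) ≠ C m * H ^ 2 := by
  intro h
  have h1 := congrArg natDegree h
  have h3 : (X ^ 3 + C A * X + C B : ℤ[X]).natDegree = 3 := by compute_degree!
  rw [natDegree_C_mul ha, natDegree_C_mul hm, natDegree_comp, natDegree_linear hm, natDegree_pow, h3] at h1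
  omega

lemma dist_le (x y C1 C2 L W : ℝ) (hx : x ^ 2 * L ≤ C1 * W) (hy : y ^ 2 * L ≤ C2 * W) (hL : 0 ≤ L) :
    (x + y) ^ 2 * L ≤ (2 * C1 + 2 * C2) * W := by
  have : (x + y) ^ 2 ≤ 2 * x ^ 2 + 2 * y ^ 2 := by nlinarith [sq_nonneg (x - y)]
  calc (x + y) ^ 2 * L ≤ (2 * x ^ 2 + 2 * y ^ 2) * L := by gcongr
    _ = 2 * (x ^ 2 * L) + 2 * (y ^ 2 * L) := by ring
    _ ≤ 2 * (C1 * W) + 2 * (C2 * W) := by gcongr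
    _ = _ := by ring

lemma mul_sq_aux (c L W M : ℝ) (hL : 1 ≤ L) (hM : L ≤ M) (hc0 : 0 ≤ c) (hc : c ≤ W / M) : c ^ 2 * L ≤ 1 * W ^ 2 := by
  have hM0 : 0 < M := by linarith
  have hcM : c * M ≤ W := (le_div_iff₀ hM0).mp hc
  have h1 : L ≤ M ^ 2 := by nlinarith
  calc c ^ 2 * L ≤ c ^ 2 * M ^ 2 := by gcongr
    _ = (c * M) ^ 2 := by ring
    _ ≤ W ^ 2 := by gcongr
    _ = _ := by ring

open Polynomial in
/-- monic depressed cubic without rational roots: all `q ≥ N/M`. -/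
lemma depressed (A B : ℤ) (hnr : ∀ a b : ℤ, b ≠ 0 → a ^ 3 + A * a * b ^ 2 + B * b ^ 3 ≠ 0) :
    ∃ r s : ℕ, 1 ≤ r ∧ 2 ≤ s ∧ ∃ C L0 : ℝ, 0 < C ∧ 1 ≤ L0 ∧ ∀ L : ℕ, L0 ≤ L → ∀ N : ℝ, (L : ℝ) ^ r ≤ N → N ≤ (2 * L : ℝ) ^ (r + 1) →
    ∀ S : Finset (ℤ × ℤ × ℤ), Set.InjOn Prod.fst (S : Set (ℤ × ℤ × ℤ)) →
    (∀ p ∈ S, N ≤ p.1 ∧ (p.1 : ℝ) ≤ 2 * N ∧ Prime p.2.1 ∧ 0 < p.2.1 ∧ N ≤ (L : ℝ) ^ s * p.2.1 ∧ p.2.1 ^ 2 * p.2.2 = p.1 ^ 3 + A * p.1 + B) →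
    (S.card : ℝ) ^ 2 * L ≤ C * N ^ 2 := by
  classical
  obtain ⟨C0, hcrit⟩ := crit
  set J := 28 * (C0 + 1) with hJ
  set s := (3 * J + 1) * (3 * J) / 2 + J + 4 with hs
  set r := 14 * (C0 + 1) * s with hr
  have hr1 : 1 ≤ r := by
    have : 1 ≤ s := by omega
    calc 1 ≤ s := this
      _ ≤ 14 * (C0 + 1) * s := Nat.le_mul_of_pos_left _ (by omega)
  have hs2 : 2 ≤ s := by omega
  set F : ℤ[X] := X ^ 3 + C A * X + C B with hF
  have hF3 : F.natDegree = 3 := by rw [hF]; compute_degree!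
  have hFl : F.leadingCoeff = 1 := by
    have : F.Monic := by rw [hF]; monicity!
    exact this
  have hFe : ∀ n, F.eval n = n ^ 3 + A * n + B := by intro n; simp [hF]
  obtain ⟨C, L1, hC, hw⟩ := wmain F hF3.le (by omega) (fun n0 m a H hm ha => cubic_ne_sq A B n0 m a H hm ha) (by rw [hFl]; norm_num)
    J s (r + 1) (by omega) hs2 (by
      have e1 : s * (J + 1) = 2 * r + s := by rw [hr, hJ]; ring
      rw [e1]
      generalize (3 * J + 1) * (3 * J) / 2 = P at hs ⊢
      omega)
  obtain ⟨E, N0, hE, hN0, hb⟩ := poly_bounds F (by rw [hFl]; norm_num) (by omega)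
  refine ⟨r, s, hr1, hs2, 2 * 1 + 2 * C, max (max L1 N0) (max 2000 (max E (max |(A : ℝ)| |(B : ℝ)|))), by positivity,
    hN0.trans ((le_max_right _ _).trans (le_max_left _ _)), ?_⟩
  intro L hL N hLN hNL S hinj hS
  have l1 : L1 ≤ L := (le_max_left _ _).trans ((le_max_left _ _).trans hL)
  have l2 : N0 ≤ L := (le_max_right _ _).trans ((le_max_left _ _).trans hL)
  have l3' := (le_max_right _ _).trans hL
  have l3 : (2000 : ℝ) ≤ L := (le_max_left _ _).trans l3'
  have l4' := (le_max_right _ _).trans l3'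
  have l4 : E ≤ L := (le_max_left _ _).trans l4'
  have l5' := (le_max_right _ _).trans l4'
  have l5 : |(A : ℝ)| ≤ L := (le_max_left _ _).trans l5'
  have l6 : |(B : ℝ)| ≤ L := (le_max_right _ _).trans l5'
  clear l5' l4' l3' hL
  have hL1 : (1 : ℝ) ≤ L := by linarith only [l3]
  set M : ℝ := (L : ℝ) ^ s with hM
  have hLM : (L : ℝ) ≤ M := le_self_pow₀ hL1 (by omega)
  have hM0 : 0 < M := by linarith only [hLM, hL1]
  have hLr : (L : ℝ) ≤ (L : ℝ) ^ r := le_self_pow₀ hL1 (by omega)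
  have hLN' : (L : ℝ) ≤ N := hLr.trans hLN
  have hN1 : 1 ≤ N := hL1.trans hLN'
  have hNN : N0 ≤ N := l2.trans hLN'
  have hNpos : 0 < N := by linarith only [hN1]
  set S1 := S.filter (fun p => (p.2.1 : ℝ) ≤ M * N) with hS1
  set S2 := S.filter (fun p => ¬ (p.2.1 : ℝ) ≤ M * N) with hS2
  have hcard : S1.card + S2.card = S.card := Finset.card_filter_add_card_filter_not _
  have hS1c : (S1.card : ℝ) ≤ N / M := by
    have hV : M ^ C0 ≤ N ^ ((1 : ℝ) / 14) := by
      have h1 : (M ^ C0) ^ 14 ≤ N := by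
        refine le_trans ?_ hLN
        rw [hM, ← pow_mul, ← pow_mul]
        refine pow_le_pow_right₀ hL1 ?_
        rw [hr]
        have : s * (C0 * 14) + 14 * s = 14 * (C0 + 1) * s := by ring
        rw [← this]
        exact Nat.le_add_right _ _
      calc M ^ C0 = ((M ^ C0) ^ 14) ^ ((1 : ℝ) / 14) := by
            rw [one_div]; exact (Real.pow_rpow_inv_natCast (by positivity) (by norm_num)).symm
        _ ≤ _ := by gcongr
    refine hcrit A B hnr M (l3.trans hLM) (l5.trans hLM) (l6.trans hLM) (N ^ ((1 : ℝ) / 14)) hV N ?_ S1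
      (hinj.mono (Finset.coe_subset.mpr (Finset.filter_subset _ _))) ?_
    · rw [one_div]; exact (Real.rpow_inv_natCast_pow hNpos.le (by norm_num)).symm
    · intro p hp
      obtain ⟨hp1, hp2⟩ := Finset.mem_filter.mp hp
      obtain ⟨a1, a2, a3, a4, a5, a6⟩ := hS p hp1
      exact ⟨a1, a2, a3, a4, a5, hp2, a6⟩
  have h1 := mul_sq_aux _ L N M hL1 hLM (by positivity) hS1c
  have h2 : (S2.card : ℝ) ^ 2 * L ≤ C * N ^ 2 := by
    refine hw L l1 N hLN' hNL S2 (hinj.mono (Finset.coe_subset.mpr (Finset.filter_subset _ _))) ?_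
    intro p hp
    obtain ⟨hp1, hp2⟩ := Finset.mem_filter.mp hp
    obtain ⟨a1, a2, a3, a4, a5, a6⟩ := hS p hp1
    obtain ⟨f1, -, f3⟩ := hb N hNN p.1 p.1 a1 (by linarith only [a2, hNpos]) a1 (by linarith only [a2, hNpos])
    have e6 : p.2.1 ^ 2 * p.2.2 = F.eval p.1 := by rw [hFe]; exact a6
    rw [← e6] at f1 f3
    rw [hF3] at f3
    push_cast at f3
    have hq2 : 0 < p.2.1 ^ 2 := by positivity
    have hm0 : 0 < p.2.2 := pos_of_mul_pos_right f1 hq2.le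
    have hm0r : (1 : ℝ) ≤ p.2.2 := by exact_mod_cast hm0
    have hqr : (0 : ℝ) < p.2.1 := by exact_mod_cast a4
    push Not at hp2
    refine ⟨a1, a2, a4, ?_, hm0, ?_, e6⟩
    · have h5 : (p.2.1 : ℝ) ^ 2 ≤ (N ^ 2) ^ 2 := by
        calc (p.2.1 : ℝ) ^ 2 ≤ (p.2.1 : ℝ) ^ 2 * p.2.2 := le_mul_of_one_le_right (by positivity) hm0r
          _ ≤ E * N ^ 3 := f3
          _ ≤ N * N ^ 3 := by gcongr; exact l4.trans hLN'
          _ = (N ^ 2) ^ 2 := by ring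
      exact le_of_sq_le_sq h5 (by positivity)
    · have h5 : (M * N) ^ 2 * p.2.2 ≤ E * N ^ 3 := by
        refine le_trans ?_ f3
        gcongr
      have h6 : (p.2.2 * M) * (M * N ^ 2) ≤ N * (M * N ^ 2) := by
        calc (p.2.2 * M) * (M * N ^ 2) = (M * N) ^ 2 * p.2.2 := by ring
          _ ≤ E * N ^ 3 := h5
          _ ≤ M * N ^ 3 := by gcongr; exact l4.trans hLM
          _ = _ := by ring
      exact le_of_mul_le_mul_right h6 (by positivity)
  have h3 := dist_le _ _ _ _ _ _ h1 h2 (by linarith only [hL1])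
  rw [← hcard]
  push_cast
  exact h3

end SecW6

section SecW7

open Polynomial in
lemma T1 (f : ℤ[X]) (a b c d : ℤ) (hf : ∀ n, f.eval n = a * n ^ 3 + b * n ^ 2 + c * n + d) (ha : 0 < a)
    (hnr : ∀ u v : ℤ, v ≠ 0 → a * u ^ 3 + b * u ^ 2 * v + c * u * v ^ 2 + d * v ^ 3 ≠ 0) : TConcl f := by
  classical
  set A : ℤ := 9 * a * c - 3 * b ^ 2 with hA
  set B : ℤ := 27 * a ^ 2 * d - 9 * a * b * c + 2 * b ^ 3 with hB
  have hnr' : ∀ x y : ℤ, y ≠ 0 → x ^ 3 + A * x * y ^ 2 + B * y ^ 3 ≠ 0 := by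
    intro x y hy h
    refine hnr (x - b * y) (3 * a * y) (by positivity) ?_
    have : a * (x - b * y) ^ 3 + b * (x - b * y) ^ 2 * (3 * a * y) + c * (x - b * y) * (3 * a * y) ^ 2 + d * (3 * a * y) ^ 3 =
        a * (x ^ 3 + A * x * y ^ 2 + B * y ^ 3) := by rw [hA, hB]; ring
    rw [this, h, mul_zero]
  have hid : ∀ n : ℤ, 27 * a ^ 2 * f.eval n = (3 * a * n + b) ^ 3 + A * (3 * a * n + b) + B := by
    intro n; rw [hf, hA, hB]; ring
  obtain ⟨r, s, hr, hs, C, L0, hC, hL0, hD⟩ := depressed A B hnr'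
  clear_value A B
  have har : (1 : ℝ) ≤ a := by exact_mod_cast ha
  refine ⟨r, hr, C * (5 / 2 * a) ^ 2, max L0 (max (5 * a) (2 * |(b : ℝ)|)), by positivity, ?_⟩
  intro L hL N hLN hNL T hT
  have l1 : L0 ≤ L := (le_max_left _ _).trans hL
  have l2 : (5 * a : ℝ) ≤ L := (le_max_left _ _).trans ((le_max_right _ _).trans hL)
  have l3 : 2 * |(b : ℝ)| ≤ L := (le_max_right _ _).trans ((le_max_right _ _).trans hL)
  have hL1 : (1 : ℝ) ≤ L := hL0.trans l1
  have hLN' : (L : ℝ) ≤ N := (le_self_pow₀ hL1 (by omega)).trans hLN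
  have hNpos : 0 < N := by linarith only [hL1, hLN']
  have hbN : 2 * |(b : ℝ)| ≤ N := l3.trans hLN'
  obtain ⟨hb1, hb2⟩ := abs_le.mp (show |(b : ℝ)| ≤ N / 2 by linarith only [hbN])
  have hNaN : N ≤ a * N := le_mul_of_one_le_left hNpos.le har
  choose! q hq1 hq2 hq3 hq4 using fun n (hn : n ∈ T) => (hT n hn).ex
  let ψ : ℤ → ℤ × ℤ × ℤ := fun n => (3 * a * n + b, q n, 27 * a ^ 2 * (f.eval n / q n ^ 2))
  have hψ : Function.Injective ψ := by
    intro n n' h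
    have := congrArg Prod.fst h
    simp only [ψ] at this
    have h2 : 3 * a * n = 3 * a * n' := by linarith only [this]
    exact mul_left_cancel₀ (by positivity) h2
  have key := hD L l1 (5 / 2 * a * N) (hLN.trans (by linarith only [hNaN, hNpos])) (by
      calc 5 / 2 * a * N ≤ (2 * L) * (2 * L : ℝ) ^ r :=
            mul_le_mul (by linarith only [l2, har]) hNL hNpos.le (by positivity)
        _ = _ := by ring) (T.image ψ) (by
      intro p hp p' hp' h
      obtain ⟨n, hn, rfl⟩ := Finset.mem_image.mp (Finset.mem_coe.mp hp)
      obtain ⟨n', hn', rfl⟩ := Finset.mem_image.mp (Finset.mem_coe.mp hp')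
      simp only [ψ] at h
      have h2 : 3 * a * n = 3 * a * n' := by linarith only [h]
      rw [mul_left_cancel₀ (by positivity) h2]) (by
      intro p hp
      obtain ⟨n, hn, rfl⟩ := Finset.mem_image.mp hp
      have hbad := hT n hn
      have n1 := hbad.n1
      have n2 := hbad.n2
      have g1 : a * N ≤ a * n := by gcongr
      have g2 : (a : ℝ) * n ≤ a * (3 / 2 * N) := by gcongr
      refine ⟨?_, ?_, hq1 n hn, hq2 n hn, ?_, ?_⟩
      · simp only [ψ]; push_cast
        linarith only [g1, hb1, hNaN]
      · simp only [ψ]; push_cast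
        linarith only [g2, hb2, hNaN]
      · simp only [ψ]
        have h3 := hq3 n hn
        have hqr : (0 : ℝ) < q n := by exact_mod_cast hq2 n hn
        calc 5 / 2 * a * N ≤ 5 / 2 * a * (L * q n) := by gcongr
          _ ≤ L * (L * q n) := by gcongr; linarith only [l2, har]
          _ = (L : ℝ) ^ 2 * q n := by ring
          _ ≤ (L : ℝ) ^ s * q n := by gcongr
      · simp only [ψ]
        rw [← hid]
        obtain ⟨k, hk⟩ := hq4 n hn
        have hq0 : q n ^ 2 ≠ 0 := pow_ne_zero 2 (hq2 n hn).ne'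
        rw [hk, Int.mul_ediv_cancel_left _ hq0]
        ring)
  rw [Finset.card_image_of_injective _ hψ] at key
  refine key.trans (le_of_eq ?_)
  ring

open Polynomial in
lemma T2 (f : ℤ[X]) (hsep : (f.map (Int.castRingHom ℂ)).Separable)
    (a b c d : ℤ) (hfp : f = C a * X ^ 3 + C b * X ^ 2 + C c * X + C d) (ha : 0 < a)
    (u v : ℤ) (hv : v ≠ 0) (hr : a * u ^ 3 + b * u ^ 2 * v + c * u * v ^ 2 + d * v ^ 3 = 0) : TConcl f := by
  classical
  have hf : ∀ n, f.eval n = a * n ^ 3 + b * n ^ 2 + c * n + d := by intro n; rw [hfp]; simp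
  set h2 : ℤ[X] := C (a * v ^ 2) * X ^ 2 + C (v * (a * u + b * v)) * X + C (a * u ^ 2 + b * u * v + c * v ^ 2) with hh2
  have hav : 0 < a * v ^ 2 := by positivity
  have hdeg : h2.natDegree = 2 := by rw [hh2]; exact natDegree_quadratic hav.ne'
  have hlead : h2.leadingCoeff = a * v ^ 2 := by rw [hh2]; exact leadingCoeff_quadratic hav.ne'
  have hfac : C (v ^ 3) * f = (C v * X - C u) * h2 := by
    have hd : d * v ^ 3 = - u * (a * u ^ 2 + b * u * v + c * v ^ 2) := by linarith only [hr]
    have : C (v ^ 3) * f = C (a * v ^ 3) * X ^ 3 + C (b * v ^ 3) * X ^ 2 + C (c * v ^ 3) * X + C (d * v ^ 3) := by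
      rw [hfp]; simp only [C_mul, C_pow]; ring
    rw [this, hd, hh2]
    simp only [C_mul, C_pow, C_neg, C_add]
    ring
  have hev : ∀ n : ℤ, v ^ 3 * f.eval n = (v * n - u) * h2.eval n := by
    intro n
    have := congrArg (eval n) hfac
    simpa using this
  have hh2e : ∀ n, h2.eval n = a * v ^ 2 * n ^ 2 + v * (a * u + b * v) * n + (a * u ^ 2 + b * u * v + c * v ^ 2) := by
    intro n; simp [hh2]
  set φ := Int.castRingHom ℂ with hφ
  have hφv : φ v ≠ 0 := by simpa [hφ] using hv
  have hsepf : (f.map φ * C (φ (v ^ 3))).Separable := by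
    refine (hsep.mul_unit ?_)
    rw [isUnit_C, isUnit_iff_ne_zero, map_pow]
    exact pow_ne_zero 3 hφv
  have hsep2 : (h2.map φ).Separable := by
    have e := congrArg (Polynomial.map φ) hfac
    simp only [Polynomial.map_mul, map_C] at e
    rw [mul_comm, e] at hsepf
    exact hsepf.of_mul_right
  -- resultant
  set R : ℤ := v ^ 2 * (3 * a * u ^ 2 + 2 * b * u * v + c * v ^ 2) with hR
  have hR0 : R ≠ 0 := by
    intro h0
    have h1 : 3 * a * u ^ 2 + 2 * b * u * v + c * v ^ 2 = 0 := by
      rcases mul_eq_zero.mp h0 with h | h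
      · exact absurd h (pow_ne_zero 2 hv)
      · exact h
    have h1' : (3 * (a : ℂ) * u ^ 2 + 2 * b * u * v + c * v ^ 2) = 0 := by exact_mod_cast h1
    have hr' : ((a : ℂ) * u ^ 3 + b * u ^ 2 * v + c * u * v ^ 2 + d * v ^ 3) = 0 := by exact_mod_cast hr
    have hvc : (v : ℂ) ≠ 0 := by exact_mod_cast hv
    obtain ⟨p, q, hpq⟩ := hsep
    have := congrArg (eval ((u : ℂ) / v)) hpq
    have hφz : ∀ z : ℤ, φ z = (z : ℂ) := fun _ => rfl
    have e1 : (f.map φ).eval ((u : ℂ) / v) = 0 := by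
      rw [hfp]
      simp only [Polynomial.map_add, Polynomial.map_mul, map_C, Polynomial.map_pow, map_X, eval_add, eval_mul, eval_C, eval_pow, eval_X, hφz]
      field_simp
      linear_combination hr'
    have e2 : (derivative (f.map φ)).eval ((u : ℂ) / v) = 0 := by
      rw [hfp]
      simp only [Polynomial.map_add, Polynomial.map_mul, map_C, Polynomial.map_pow, map_X, derivative_add, derivative_mul, derivative_C, derivative_X_pow, derivative_X,
        eval_add, eval_mul, eval_C, eval_pow, eval_X, hφz, eval_zero, eval_one, eval_natCast]
      have hs : (0 : ℂ) * (↑u / ↑v) ^ 3 + ↑a * (((3 : ℕ) : ℂ) * (↑u / ↑v) ^ (3 - 1)) + (0 * (↑u / ↑v) ^ 2 + ↑b * (((2 : ℕ) : ℂ) * (↑u / ↑v) ^ (2 - 1))) +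
          (0 * (↑u / ↑v) + ↑c * 1) + 0 = 3 * (a : ℂ) * (u / v) ^ 2 + 2 * b * (u / v) + c := by
        norm_num; ring
      refine Eq.trans ?_ (hs.trans ?_)
      · norm_num
      field_simp
      linear_combination h1'
    rw [eval_add, eval_mul, eval_mul, e1, e2] at this
    simp at this
  have hres : ∀ n q : ℤ, q ∣ v * n - u → q ∣ h2.eval n → q ∣ R := by
    intro n q h1 h3
    have : R = v ^ 2 * h2.eval n - (v * n - u) * (v ^ 2 * (2 * a * u + b * v + a * v * n)) := by
      rw [hh2e, hR]; ring
    rw [this]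
    exact dvd_sub (dvd_mul_of_dvd_right h3 _) (dvd_mul_of_dvd_left h1 _)
  clear_value R
  obtain ⟨K, L1, hK, hw⟩ := wmain h2 (by omega) (by omega) (fun n0 m a H hm ha => sep_ne_sq h2 hsep2 (by omega) n0 m hm a H ha)
    (by rw [hlead]; exact hav) 2 31 34 (by norm_num) (by norm_num) (by norm_num)
  obtain ⟨E, N0, hE, hN0, hb⟩ := poly_bounds h2 (by rw [hlead]; exact hav) (by omega)
  refine ⟨34, by norm_num, K, max (max L1 N0) (max (max E (|(R : ℝ)| + 1)) (max |(v : ℝ)| |(u : ℝ)| + 4)), hK, ?_⟩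
  intro L hL N hLN hNL T hT
  have l1 : L1 ≤ L := (le_max_left _ _).trans ((le_max_left _ _).trans hL)
  have l2 : N0 ≤ L := (le_max_right _ _).trans ((le_max_left _ _).trans hL)
  have l3' := (le_max_right _ _).trans hL
  have l3 : E ≤ L := (le_max_left _ _).trans ((le_max_left _ _).trans l3')
  have l4 : |(R : ℝ)| + 1 ≤ L := (le_max_right _ _).trans ((le_max_left _ _).trans l3')
  have l5' := (le_max_right _ _).trans l3'
  have l5 : |(v : ℝ)| + 4 ≤ L := le_trans (by gcongr; exact le_max_left _ _) l5'
  have l6 : |(u : ℝ)| + 4 ≤ L := le_trans (by gcongr; exact le_max_right _ _) l5'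
  clear l5' l3' hL
  have hL4 : (4 : ℝ) ≤ L := by have := abs_nonneg (u : ℝ); linarith only [this, l6]
  have hL1 : (1 : ℝ) ≤ L := by linarith only [hL4]
  have hL5 : (L : ℝ) ^ 5 ≤ N := le_trans (pow_le_pow_right₀ hL1 (by norm_num)) hLN
  have hLN' : (L : ℝ) ≤ N := (le_self_pow₀ hL1 (by norm_num)).trans hLN
  have hN1 : 1 ≤ N := hL1.trans hLN'
  have hNpos : 0 < N := by linarith only [hN1]
  have hNN : N0 ≤ N := l2.trans hLN'
  choose! q hq1 hq2 hq3 hq4 using fun n (hn : n ∈ T) => (hT n hn).ex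
  have hmain : ∀ n ∈ T, q n ^ 2 ∣ h2.eval n := by
    intro n hn
    have hbad := hT n hn
    have hqr : (0 : ℝ) < q n := by exact_mod_cast hq2 n hn
    have hqL : (L : ℝ) ^ 4 ≤ q n := by
      have := hq3 n hn
      have h5 : (L : ℝ) * L ^ 4 ≤ L * q n := by
        calc (L : ℝ) * L ^ 4 = L ^ 5 := by ring
          _ ≤ N := hL5
          _ ≤ _ := this
      exact le_of_mul_le_mul_left h5 (by linarith only [hL1])
    have hqL1 : (L : ℝ) ≤ q n := (le_self_pow₀ hL1 (by norm_num)).trans hqL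
    have hqR : ¬ (q n ∣ R) := by
      intro h
      have h1 := Int.le_of_dvd (abs_pos.mpr hR0) ((dvd_abs _ _).mpr h)
      have h1' : (q n : ℝ) ≤ |(R : ℝ)| := by exact_mod_cast h1
      linarith only [h1', hqL1, l4]
    have hdvd : q n ^ 2 ∣ (v * n - u) * h2.eval n := by
      rw [← hev]; exact dvd_mul_of_dvd_right (hq4 n hn) _
    have hlin0 : v * n - u ≠ 0 := by
      intro h0
      have := hev n
      rw [h0, zero_mul] at this
      exact (mul_ne_zero (pow_ne_zero 3 hv) hbad.f0) this
    by_cases hql : q n ∣ v * n - u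
    · exfalso
      have h3 : ¬ q n ∣ h2.eval n := fun h => hqR (hres n _ hql h)
      have hcop : IsCoprime (q n ^ 2) (h2.eval n) := IsCoprime.pow_left (((hq1 n hn).irreducible.coprime_iff_not_dvd).mpr h3)
      have h4 : q n ^ 2 ∣ v * n - u := hcop.dvd_of_dvd_mul_right hdvd
      have h5 := Int.le_of_dvd (abs_pos.mpr hlin0) ((dvd_abs _ _).mpr h4)
      have h5' : (q n : ℝ) ^ 2 ≤ |(v : ℝ) * n - u| := by exact_mod_cast h5
      have n1 := hbad.n1
      have n2 := hbad.n2
      have h6 : |(v : ℝ) * n - u| ≤ L * (2 * N) := by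
        calc |(v : ℝ) * n - u| ≤ |(v : ℝ) * n| + |(u : ℝ)| := abs_sub _ _
          _ = |(v : ℝ)| * n + |(u : ℝ)| := by rw [abs_mul, abs_of_nonneg (a := (n : ℝ)) (by linarith only [n1, hNpos])]
          _ ≤ |(v : ℝ)| * (3 / 2 * N) + |(u : ℝ)| := by gcongr
          _ ≤ (L - 4) * (3 / 2 * N) + L * 1 := by
            gcongr
            · linarith only [l5]
            · linarith only [l6]
          _ ≤ L * (2 * N) := by nlinarith only [hLN', hL4, hNpos]
      have h7 : N * N ≤ L ^ 2 * (L * (2 * N)) := by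
        have := hq3 n hn
        calc N * N ≤ (L * q n) * (L * q n) := by gcongr
          _ = L ^ 2 * (q n : ℝ) ^ 2 := by ring
          _ ≤ L ^ 2 * (L * (2 * N)) := by gcongr; exact h5'.trans h6
      have h8 : N ≤ 2 * L ^ 3 := by
        have : N * N ≤ (2 * L ^ 3) * N := by linarith only [h7]
        exact le_of_mul_le_mul_right this hNpos
      have h9 : (2 : ℝ) * L ^ 3 < L ^ 5 := by
        have : (2 : ℝ) < L ^ 2 := by nlinarith only [hL4]
        calc (2 : ℝ) * L ^ 3 < (L : ℝ) ^ 2 * L ^ 3 := by gcongr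
          _ = (L : ℝ) ^ 5 := by ring
      linarith only [h8, h9, hL5]
    · have hcop : IsCoprime (q n ^ 2) (v * n - u) := IsCoprime.pow_left (((hq1 n hn).irreducible.coprime_iff_not_dvd).mpr hql)
      exact hcop.dvd_of_dvd_mul_left hdvd
  let ψ : ℤ → ℤ × ℤ × ℤ := fun n => (n, q n, h2.eval n / q n ^ 2)
  have hψ : Function.Injective ψ := fun n n' h => congrArg Prod.fst h
  have key := hw L l1 N hLN' hNL (T.image ψ) (by
      intro p hp p' hp' h
      obtain ⟨n, hn, rfl⟩ := Finset.mem_image.mp (Finset.mem_coe.mp hp)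
      obtain ⟨n', hn', rfl⟩ := Finset.mem_image.mp (Finset.mem_coe.mp hp')
      have : n = n' := h
      rw [this]) (by
      intro p hp
      obtain ⟨n, hn, rfl⟩ := Finset.mem_image.mp hp
      have hbad := hT n hn
      have n1 := hbad.n1
      have n2 := hbad.n2
      obtain ⟨k, hk⟩ := hmain n hn
      have hqp := hq2 n hn
      have hqr : (0 : ℝ) < q n := by exact_mod_cast hqp
      have hq20 : 0 < q n ^ 2 := by positivity
      have hk' : h2.eval n / q n ^ 2 = k := by rw [hk, Int.mul_ediv_cancel_left _ hq20.ne']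
      obtain ⟨f1, -, f3⟩ := hb N hNN n n n1 (by linarith only [n2, hNpos]) n1 (by linarith only [n2, hNpos])
      rw [hdeg] at f3
      rw [hk] at f1 f3
      push_cast at f3
      have hk0 : 0 < k := pos_of_mul_pos_right f1 hq20.le
      have hk1 : (1 : ℝ) ≤ k := by exact_mod_cast hk0
      have f4 : (q n : ℝ) ^ 2 ≤ E * N ^ 2 := le_trans (le_mul_of_one_le_right (by positivity) hk1) f3
      refine ⟨n1, by simp only [ψ]; linarith only [n2, hNpos], hqp, ?_, by simp only [ψ, hk']; exact hk0, ?_, by simp only [ψ, hk']; exact hk.symm⟩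
      · simp only [ψ]
        have : (q n : ℝ) ^ 2 ≤ (N ^ 2) ^ 2 := by
          calc (q n : ℝ) ^ 2 ≤ E * N ^ 2 := f4
            _ ≤ N ^ 2 * N ^ 2 := by
              gcongr
              exact (l3.trans hLN').trans (le_self_pow₀ hN1 (by norm_num))
            _ = _ := by ring
        exact le_of_sq_le_sq this (by positivity)
      · simp only [ψ, hk']
        have h3 := hq3 n hn
        have : (k : ℝ) * N ^ 2 ≤ (L ^ 3) * N ^ 2 := by
          calc (k : ℝ) * N ^ 2 ≤ k * (L * q n) ^ 2 := by gcongr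
            _ = L ^ 2 * ((q n : ℝ) ^ 2 * k) := by ring
            _ ≤ L ^ 2 * (E * N ^ 2) := by gcongr
            _ ≤ L ^ 2 * (L * N ^ 2) := by gcongr
            _ = _ := by ring
        have h4 : (k : ℝ) ≤ L ^ 3 := le_of_mul_le_mul_right this (by positivity)
        calc (k : ℝ) * L ^ 31 ≤ (L : ℝ) ^ 3 * L ^ 31 := by gcongr
          _ = (L : ℝ) ^ 34 := by ring
          _ ≤ N := hLN)
  rw [Finset.card_image_of_injective _ hψ] at key
  exact key

end SecW7

section SecX1
open Polynomial

lemma TAll_pos (f : Polynomial ℤ) (hdeg : f.natDegree = 3)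
    (hsep : Squarefree (f.map (Int.castRingHom ℚ))) (ha : 0 < f.coeff 3) : TConcl f := by
  have hsepC : (f.map (Int.castRingHom ℂ)).Separable := by
    have h1 := PerfectField.separable_iff_squarefree.mpr hsep
    have h2 := h1.map (f := algebraMap ℚ ℂ)
    rw [Polynomial.map_map] at h2
    rw [RingHom.ext_int (Int.castRingHom ℂ) ((algebraMap ℚ ℂ).comp (Int.castRingHom ℚ))]
    exact h2
  have hfp : f = C (f.coeff 3) * X ^ 3 + C (f.coeff 2) * X ^ 2 + C (f.coeff 1) * X + C (f.coeff 0) := by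
    conv_lhs => rw [f.as_sum_range_C_mul_X_pow, hdeg]
    simp only [Finset.sum_range_succ, Finset.range_zero, Finset.sum_empty]
    ring
  by_cases h : ∀ u v : ℤ, v ≠ 0 → f.coeff 3 * u ^ 3 + f.coeff 2 * u ^ 2 * v + f.coeff 1 * u * v ^ 2 + f.coeff 0 * v ^ 3 ≠ 0
  · refine T1 f _ _ _ _ (fun n => ?_) ha h
    conv_lhs => rw [hfp]
    simp
  · push Not at h
    obtain ⟨u, v, hv, hr⟩ := h
    exact T2 f hsepC _ _ _ _ hfp ha u v hv hr

lemma BadN_neg {f : Polynomial ℤ} {N : ℝ} {L : ℕ} {n : ℤ} (h : BadN f N L n) : BadN (-f) N L n := by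
  refine ⟨h.n1, h.n2, ?_, ?_⟩
  · simpa using h.f0
  · obtain ⟨q, h1, h2, h3, h4⟩ := h.ex
    exact ⟨q, h1, h2, h3, by simpa using h4⟩

theorem TAll (f : Polynomial ℤ) (hdeg : f.natDegree = 3)
    (hsep : Squarefree (f.map (Int.castRingHom ℚ))) : TConcl f := by
  have h0 : f.coeff 3 ≠ 0 := by
    rw [← hdeg]; intro h
    have : f = 0 := by simpa using h
    simp [this] at hdeg
  rcases lt_or_gt_of_ne h0 with h | h
  · have hneg : TConcl (-f) := by
      refine TAll_pos (-f) (by simpa using hdeg) ?_ (by simpa using h)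
      rw [Polynomial.map_neg]
      intro x hx
      exact hsep x ((dvd_neg).mp hx)
    obtain ⟨r, hr, K, L0, hK, H⟩ := hneg
    exact ⟨r, hr, K, L0, hK, fun L hL N h1 h2 B hB => H L hL N h1 h2 B (fun n hn => BadN_neg (hB n hn))⟩
  · exact TAll_pos f hdeg hsep h

end SecX1

section SecX2

lemma ap_fact_dvd (k a J : ℕ) : J.factorial ∣ k ^ J * ∏ j ∈ Finset.range J, (k * (j + 1) + a) := by
  rw [Nat.dvd_iff_prime_pow_dvd_dvd]
  intro p e hp he
  by_cases hpk : p ∣ k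
  · have h1 : e ≤ J := by
      have h2 := (hp.pow_dvd_iff_le_factorization (Nat.factorial_ne_zero J)).mp he
      have h3 := Nat.factorization_factorial_le_div_pred hp J
      have h4 : (J / (p - 1) : ℕ) ≤ J := Nat.div_le_self _ _
      exact h2.trans (h3.trans h4)
    exact dvd_mul_of_dvd_left ((pow_dvd_pow_of_dvd hpk e).trans (pow_dvd_pow k h1)) _
  · have hcop : Nat.Coprime k (p ^ e) := (Nat.Coprime.pow_right e ((Nat.Prime.coprime_iff_not_dvd hp).mpr hpk).symm)
    apply dvd_mul_of_dvd_right
    have hu : IsUnit ((k : ZMod (p ^ e))) := (ZMod.isUnit_iff_coprime k (p ^ e)).mpr hcop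
    obtain ⟨t', ht'⟩ := hu.exists_right_inv
    haveI : NeZero (p ^ e) := ⟨pow_ne_zero _ hp.ne_zero⟩
    have ht0 : ((t'.val : ℕ) : ZMod (p ^ e)) = t' := ZMod.natCast_zmod_val t'
    set t := t'.val
    rw [← ht0] at ht'
    rw [← ZMod.natCast_eq_zero_iff]
    have h5 : p ^ e ∣ (a * t + 1).ascFactorial J := he.trans (Nat.factorial_dvd_ascFactorial _ _)
    rw [← ZMod.natCast_eq_zero_iff, Nat.ascFactorial_eq_prod_range] at h5
    have h6 : ((∏ j ∈ Finset.range J, (k * (j + 1) + a) : ℕ) : ZMod (p ^ e)) = (k : ZMod (p ^ e)) ^ J * ((∏ i ∈ Finset.range J, (a * t + 1 + i) : ℕ) : ZMod (p ^ e)) := by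
      push_cast
      rw [show (k : ZMod (p ^ e)) ^ J = ∏ j ∈ Finset.range J, (k : ZMod (p ^ e)) by simp, ← Finset.prod_mul_distrib]
      refine Finset.prod_congr rfl fun j _ => ?_
      linear_combination (-(a : ZMod (p ^ e))) * ht'
    rw [h6, h5, mul_zero]

lemma ap_cheb (k N ν : ℕ) (hk : 2 ≤ k) (hkN : k ≤ N) :
    ∑ p ∈ (Finset.Ioc N (2 * N)).filter (fun p => p.Prime ∧ p ≡ ν [MOD k]), Real.log p
      ≤ (2 * N / k : ℝ) * (2 * Real.log k + 1) := by
  set S := (Finset.Ioc N (2 * N)).filter (fun p => p.Prime ∧ p ≡ ν [MOD k]) with hS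
  set a := ν % k with ha
  set J := 2 * N / k with hJ
  have hkpos : 0 < k := by omega
  have hak : a < k := Nat.mod_lt _ hkpos
  have hJN : J ≤ N := by
    rw [hJ]; exact Nat.div_le_of_le_mul (by nlinarith only [hk])
  set P := ∏ j ∈ Finset.range J, (k * (j + 1) + a) with hP
  have hPpos : 0 < P := Finset.prod_pos fun j _ => by positivity
  have hmem : ∀ p ∈ S, N < p ∧ p ≤ 2 * N ∧ p.Prime ∧ p % k = a := by
    intro p hp
    rw [hS, Finset.mem_filter, Finset.mem_Ioc] at hp
    exact ⟨hp.1.1, hp.1.2, hp.2.1, hp.2.2⟩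
  have hdvdP : ∀ p ∈ S, p ∣ P := by
    intro p hp
    obtain ⟨h1, h2, h3, h4⟩ := hmem p hp
    have h5 := Nat.div_add_mod p k
    have h6 : 1 ≤ p / k := (Nat.one_le_div_iff hkpos).mpr (by omega)
    have h7 : p / k ≤ J := Nat.div_le_div_right h2
    have : p = k * ((p / k - 1) + 1) + a := by
      rw [Nat.sub_add_cancel h6, ← h4]; exact h5.symm
    rw [this]
    exact Finset.dvd_prod_of_mem _ (Finset.mem_range.mpr (by omega))
  have hprod : (∏ p ∈ S, p) ∣ P := by
    refine Finset.prod_primes_dvd P (fun p hp => (hmem p hp).2.2.1.prime) hdvdP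
  have hcop : Nat.Coprime (∏ p ∈ S, p) J.factorial := by
    refine Nat.Coprime.prod_left fun p hp => ?_
    obtain ⟨h1, h2, h3, h4⟩ := hmem p hp
    refine (Nat.Prime.coprime_iff_not_dvd h3).mpr fun h => ?_
    have := (h3.dvd_factorial).mp h
    omega
  have hmul : (∏ p ∈ S, p) * J.factorial ∣ k ^ J * P :=
    hcop.mul_dvd_of_dvd_of_dvd (dvd_mul_of_dvd_right hprod _) (ap_fact_dvd k a J)
  have hle := Nat.le_of_dvd (by positivity) hmul
  have hPle : P ≤ k ^ J * (J + 1).factorial := by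
    have : k ^ J * (J + 1).factorial = ∏ j ∈ Finset.range J, (k * (j + 2)) := by
      rw [Finset.prod_mul_distrib, Finset.prod_const, Finset.card_range]
      congr 1
      rw [← Finset.prod_range_add_one_eq_factorial, Finset.prod_range_succ']
      simp [add_assoc]
    rw [this]
    refine Finset.prod_le_prod' fun j _ => ?_
    nlinarith only [hak]
  have hle2 : (∏ p ∈ S, p) ≤ k ^ (2 * J) * (J + 1) := by
    have h1 : (∏ p ∈ S, p) * J.factorial ≤ (k ^ (2 * J) * (J + 1)) * J.factorial := by
      calc _ ≤ k ^ J * P := hle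
        _ ≤ k ^ J * (k ^ J * (J + 1).factorial) := by gcongr
        _ = _ := by rw [Nat.factorial_succ, two_mul, pow_add]; ring
    exact Nat.le_of_mul_le_mul_right h1 (Nat.factorial_pos J)
  have hlog : ∑ p ∈ S, Real.log p = Real.log ((∏ p ∈ S, p : ℕ) : ℝ) := by
    push_cast
    rw [Real.log_prod]
    intro p hp
    have := (hmem p hp).2.2.1.pos
    positivity
  have hSpos : 0 < ∏ p ∈ S, p := Finset.prod_pos fun p hp => (hmem p hp).2.2.1.pos
  have hJr : (J : ℝ) ≤ 2 * N / k := by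
    have := @Nat.cast_div_le ℝ _ _ _ (2 * N) k
    push_cast at this
    exact this
  have hk1 : (1 : ℝ) ≤ k := by exact_mod_cast hkpos
  have hlk := Real.log_nonneg hk1
  calc ∑ p ∈ S, Real.log p = Real.log ((∏ p ∈ S, p : ℕ) : ℝ) := hlog
    _ ≤ Real.log ((k : ℝ) ^ (2 * J) * (J + 1)) := by
      apply Real.log_le_log (by exact_mod_cast hSpos)
      exact_mod_cast hle2
    _ = 2 * J * Real.log k + Real.log (J + 1) := by
      rw [Real.log_mul (by positivity) (by positivity), Real.log_pow]; push_cast; ring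
    _ ≤ 2 * J * Real.log k + J := by
      gcongr
      have := Real.log_le_sub_one_of_pos (show (0 : ℝ) < J + 1 by positivity)
      linarith only [this]
    _ = J * (2 * Real.log k + 1) := by ring
    _ ≤ _ := by gcongr

end SecX2

section SecX3
open Polynomial

lemma clear_den (A : Polynomial ℚ) : ∃ (n : ℤ) (A' : Polynomial ℤ), n ≠ 0 ∧ A'.map (Int.castRingHom ℚ) = C (n : ℚ) * A := by
  obtain ⟨b, hb⟩ := IsLocalization.integerNormalization_map_to_map (nonZeroDivisors ℤ) A
  refine ⟨b, IsLocalization.integerNormalization (nonZeroDivisors ℤ) A, nonZeroDivisors.ne_zero b.2, ?_⟩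
  have : algebraMap ℤ ℚ = Int.castRingHom ℚ := rfl
  rw [← this, hb, ← Polynomial.smul_eq_C_mul]
  ext i
  simp [Submonoid.smul_def]

lemma int_bezout (f : Polynomial ℤ) (hsep : Squarefree (f.map (Int.castRingHom ℚ))) :
    ∃ (R : ℤ) (A B : Polynomial ℤ), R ≠ 0 ∧ A * f + B * derivative f = C R := by
  obtain ⟨A, B, h⟩ := PerfectField.separable_iff_squarefree.mpr hsep
  obtain ⟨n, A', hn, hA⟩ := clear_den A
  obtain ⟨m, B', hm, hB⟩ := clear_den B
  refine ⟨n * m, C m * A', C n * B', mul_ne_zero hn hm, ?_⟩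
  apply Polynomial.map_injective (Int.castRingHom ℚ) Int.cast_injective
  simp only [Polynomial.map_add, Polynomial.map_mul, map_C, hA, hB, ← derivative_map]
  simp only [eq_intCast, Int.cast_mul, C_mul]
  linear_combination (C (n : ℚ) * C (m : ℚ)) * h

lemma root_lift (f A B : Polynomial ℤ) (R : ℤ) (h : A * f + B * derivative f = C R) (q : ℤ) (hq : Prime q) (hqR : ¬ q ∣ R)
    (x y : ℤ) (hx : q ^ 2 ∣ f.eval x) (hy : q ^ 2 ∣ f.eval y) (hxy : q ∣ y - x) : q ^ 2 ∣ y - x := by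
  obtain ⟨t, ht⟩ := hxy
  have h1 : y = x + q * t := by linarith only [ht]
  obtain ⟨k, hk⟩ := f.binomExpansion x (q * t)
  rw [← h1] at hk
  have h2 : q ^ 2 ∣ q * (eval x (derivative f) * t) := by
    have : q * (eval x (derivative f) * t) = eval y f - eval x f - q ^ 2 * (k * t ^ 2) := by rw [hk]; ring
    rw [this]
    exact dvd_sub (dvd_sub hy hx) (dvd_mul_right _ _)
  rw [pow_two] at h2
  have h3 := (mul_dvd_mul_iff_left hq.ne_zero).mp h2
  rcases hq.dvd_or_dvd h3 with h4 | h4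
  · exfalso
    apply hqR
    have h5 := congrArg (eval x) h
    simp only [eval_add, eval_mul, eval_C] at h5
    rw [← h5]
    exact dvd_add (dvd_mul_of_dvd_right ((dvd_pow_self q two_ne_zero).trans hx) _) (dvd_mul_of_dvd_right h4 _)
  · rw [ht, pow_two]
    exact mul_dvd_mul_left q h4

def rootsq (f : Polynomial ℤ) (q : ℕ) : Finset ℕ :=
  (Finset.range (q ^ 2)).filter (fun n : ℕ => (q : ℤ) ^ 2 ∣ f.eval (n : ℤ))

lemma rootsq_card (f : Polynomial ℤ) (hdeg : f.natDegree = 3)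
    (hsep : Squarefree (f.map (Int.castRingHom ℚ))) :
    ∃ q0 : ℕ, ∀ q : ℕ, q.Prime → q0 < q → (rootsq f q).card ≤ 3 := by
  obtain ⟨R, A, B, hR, h⟩ := int_bezout f hsep
  have h0 : f.coeff 3 ≠ 0 := by
    rw [← hdeg]; intro h
    have : f = 0 := by simpa using h
    simp [this] at hdeg
  refine ⟨R.natAbs + (f.coeff 3).natAbs, fun q hq hq0 => ?_⟩
  have hnd : ∀ z : ℤ, z ≠ 0 → z.natAbs < q → ¬ (q : ℤ) ∣ z := by
    intro z hz hzq hd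
    have := Nat.le_of_dvd (Int.natAbs_pos.mpr hz) (Int.natCast_dvd.mp hd)
    omega
  have hqR := hnd R hR (by omega)
  have hqa := hnd _ h0 (by omega)
  have hqp : Prime (q : ℤ) := Nat.prime_iff_prime_int.mp hq
  haveI := Fact.mk hq
  set g := f.map (Int.castRingHom (ZMod q)) with hg
  have hgd : g.natDegree = 3 := by
    rw [← hdeg]
    apply Polynomial.natDegree_map_of_leadingCoeff_ne_zero
    rw [leadingCoeff, hdeg]
    intro h
    exact hqa ((ZMod.intCast_zmod_eq_zero_iff_dvd _ _).mp h)
  have hg0 : g ≠ 0 := by intro h; rw [h] at hgd; simp at hgd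
  have hc : (g.roots.toFinset).card ≤ 3 := by
    rw [← hgd]
    exact (Multiset.toFinset_card_le _).trans (card_roots' g)
  refine le_trans ?_ hc
  refine Finset.card_le_card_of_injOn (fun n : ℕ => ((n : ℤ) : ZMod q)) ?_ ?_
  · intro n hn
    have hn' := (Finset.mem_filter.mp hn).2
    rw [Finset.mem_coe, Multiset.mem_toFinset, mem_roots hg0, IsRoot.def, hg, eval_intCast_map]
    exact (ZMod.intCast_zmod_eq_zero_iff_dvd _ _).mpr ((dvd_pow_self _ two_ne_zero).trans hn')
  · intro n hn m hm hnm
    obtain ⟨hn1, hn2⟩ := Finset.mem_filter.mp hn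
    obtain ⟨hm1, hm2⟩ := Finset.mem_filter.mp hm
    have h1 := (ZMod.intCast_eq_intCast_iff_dvd_sub _ _ _).mp hnm
    have h2 := root_lift f A B R h q hqp hqR n m hn2 hm2 h1
    have h3 : (n : ℕ) ≡ m [MOD q ^ 2] := by
      rw [Nat.modEq_iff_dvd]
      exact_mod_cast h2
    exact Nat.ModEq.eq_of_lt_of_lt h3 (Finset.mem_range.mp hn1) (Finset.mem_range.mp hm1)

lemma mem_rootsq (f : Polynomial ℤ) (q n : ℕ) (hq : 0 < q) (h : (q : ℤ) ^ 2 ∣ f.eval (n : ℤ)) :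
    n % q ^ 2 ∈ rootsq f q := by
  refine Finset.mem_filter.mpr ⟨Finset.mem_range.mpr (Nat.mod_lt _ (by positivity)), ?_⟩
  have h1 : ((n : ℤ) - ((n % q ^ 2 : ℕ) : ℤ)) ∣ f.eval (n : ℤ) - f.eval ((n % q ^ 2 : ℕ) : ℤ) := Polynomial.sub_dvd_eval_sub _ _ _
  have h2 : (q : ℤ) ^ 2 ∣ ((n : ℤ) - ((n % q ^ 2 : ℕ) : ℤ)) := by
    have := (Nat.modEq_iff_dvd).mp (Nat.mod_modEq n (q ^ 2))
    exact_mod_cast this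
  exact (dvd_sub_right h).mp (h2.trans h1)

lemma class_card (N r v : ℕ) (hr : 0 < r) :
    (((Finset.Ioc N (2 * N)).filter (fun x => x ≡ v [MOD r])).card : ℝ) ≤ N / r + 1 := by
  have h := Nat.Ioc_filter_modEq_card N (2 * N) hr v
  set c := ((Finset.Ioc N (2 * N)).filter (fun x => x ≡ v [MOD r])).card
  have hrr : (0 : ℝ) < r := by exact_mod_cast hr
  have hq : (c : ℚ) ≤ N / r + 1 := by
    have h' : (c : ℚ) = (max (⌊(((2 * N : ℕ) : ℚ) - v) / r⌋ - ⌊((N : ℚ) - v) / r⌋) 0 : ℤ) := by exact_mod_cast h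
    rw [h']
    push_cast
    apply max_le
    · have h1 := Int.floor_le (((2 * (N : ℚ)) - v) / r)
      have h2 := Int.lt_floor_add_one (((N : ℚ) - v) / r)
      have h3 : ((2 * (N : ℚ)) - v) / r = ((N : ℚ) - v) / r + N / r := by ring
      linarith only [h1, h2, h3]
    · positivity
  have hR : ((c : ℚ) : ℝ) ≤ ((N / r + 1 : ℚ) : ℝ) := Rat.cast_le.mpr hq
  push_cast at hR
  exact hR

lemma triv_count (f : Polynomial ℤ) (q N : ℕ) (hq : 0 < q) (hc : (rootsq f q).card ≤ 3) :
    (((Finset.Ioc N (2 * N)).filter (fun n : ℕ => (q : ℤ) ^ 2 ∣ f.eval (n : ℤ))).card : ℝ) ≤ 3 * (N / q ^ 2 + 1) := by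
  have hsub : (Finset.Ioc N (2 * N)).filter (fun n : ℕ => (q : ℤ) ^ 2 ∣ f.eval (n : ℤ)) ⊆
      (rootsq f q).biUnion (fun v => (Finset.Ioc N (2 * N)).filter (fun x => x ≡ v [MOD q ^ 2])) := by
    intro n hn
    obtain ⟨h1, h2⟩ := Finset.mem_filter.mp hn
    refine Finset.mem_biUnion.mpr ⟨n % q ^ 2, mem_rootsq f q n hq h2, Finset.mem_filter.mpr ⟨h1, (Nat.mod_modEq _ _).symm⟩⟩
  have h1 := (Finset.card_le_card hsub).trans Finset.card_biUnion_le
  have h1' : (((Finset.Ioc N (2 * N)).filter (fun n : ℕ => (q : ℤ) ^ 2 ∣ f.eval (n : ℤ))).card : ℝ) ≤ ∑ v ∈ rootsq f q,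
      (((Finset.Ioc N (2 * N)).filter (fun x => x ≡ v [MOD q ^ 2])).card : ℝ) := by exact_mod_cast h1
  refine h1'.trans ?_
  have h2 : ∀ v ∈ rootsq f q, (((Finset.Ioc N (2 * N)).filter (fun x => x ≡ v [MOD q ^ 2])).card : ℝ) ≤ N / q ^ 2 + 1 := by
    intro v _
    have := class_card N (q ^ 2) v (by positivity)
    push_cast at this
    exact this
  refine (Finset.sum_le_card_nsmul _ _ _ h2).trans ?_
  rw [nsmul_eq_mul]
  have : ((rootsq f q).card : ℝ) ≤ 3 := by exact_mod_cast hc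
  gcongr

end SecX3

section SecX4
open Polynomial

noncomputable def Lr (r : ℕ) (x : ℝ) : ℕ := ⌊x ^ ((r : ℝ)⁻¹)⌋₊

lemma Lr_spec (r : ℕ) (hr : 1 ≤ r) (x : ℝ) (hx : 1 ≤ x) :
    1 ≤ Lr r x ∧ (Lr r x : ℝ) ^ r ≤ x ∧ x ≤ (2 * (Lr r x : ℝ)) ^ r := by
  have h0 : 0 ≤ x := by linarith only [hx]
  have hy : 1 ≤ x ^ ((r : ℝ)⁻¹) := Real.one_le_rpow hx (by positivity)
  have hyr : (x ^ ((r : ℝ)⁻¹)) ^ r = x := Real.rpow_inv_natCast_pow h0 (by omega)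
  have h1 : 1 ≤ Lr r x := Nat.le_floor (by simpa using hy)
  have h1' : (1 : ℝ) ≤ Lr r x := by exact_mod_cast h1
  have h2 : (Lr r x : ℝ) ≤ x ^ ((r : ℝ)⁻¹) := Nat.floor_le (by linarith only [hy])
  have h3 : x ^ ((r : ℝ)⁻¹) < Lr r x + 1 := Nat.lt_floor_add_one _
  refine ⟨h1, ?_, ?_⟩
  · calc (Lr r x : ℝ) ^ r ≤ (x ^ ((r : ℝ)⁻¹)) ^ r := by gcongr
      _ = x := hyr
  · calc x = (x ^ ((r : ℝ)⁻¹)) ^ r := hyr.symm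
      _ ≤ (2 * (Lr r x : ℝ)) ^ r := by
        gcongr
        linarith only [h1', h3]

lemma Lr_mono (r : ℕ) (x y : ℝ) (hx : 0 ≤ x) (h : x ≤ y) : Lr r x ≤ Lr r y :=
  Nat.floor_mono (Real.rpow_le_rpow hx h (by positivity))

lemma logL (r : ℕ) (δ : ℝ) (hδ : 0 < δ) : ∃ L0 : ℝ, ∀ L : ℝ, L0 ≤ L → (Real.log 2 + r * Real.log (2 * L)) ^ 2 ≤ δ * L := by
  have h := (Real.isLittleO_pow_log_id_atTop (n := 2)).bound (show 0 < δ / (2 * (1 + r) ^ 2) by positivity)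
  obtain ⟨x0, hx0⟩ := Filter.eventually_atTop.mp h
  refine ⟨max 1 x0, fun L hL => ?_⟩
  have hL1 : 1 ≤ L := (le_max_left _ _).trans hL
  have hL2 : x0 ≤ L := (le_max_right _ _).trans hL
  have h1 := hx0 (2 * L) (by linarith only [hL1, hL2])
  simp only [id, Real.norm_eq_abs] at h1
  rw [abs_of_nonneg (sq_nonneg _), abs_of_nonneg (by linarith only [hL1])] at h1
  have h2 : Real.log 2 ≤ Real.log (2 * L) := Real.log_le_log (by norm_num) (by linarith only [hL1])
  have h3 : 0 ≤ Real.log 2 := Real.log_nonneg (by norm_num)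
  have h4 : 0 ≤ Real.log (2 * L) := h3.trans h2
  calc (Real.log 2 + r * Real.log (2 * L)) ^ 2 ≤ (Real.log (2 * L) + r * Real.log (2 * L)) ^ 2 := by gcongr
    _ = (1 + r) ^ 2 * Real.log (2 * L) ^ 2 := by ring
    _ ≤ (1 + r) ^ 2 * (δ / (2 * (1 + r) ^ 2) * (2 * L)) := by gcongr
    _ = δ * L := by field_simp

lemma logN (r : ℕ) (hr : 1 ≤ r) (δ : ℝ) (hδ : 0 < δ) (L1 : ℝ) :
    ∃ N0 : ℝ, 1 ≤ N0 ∧ ∀ N : ℝ, N0 ≤ N → L1 ≤ Lr r N ∧ (Real.log (2 * N)) ^ 2 ≤ δ * Lr r N := by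
  obtain ⟨L0, hL0⟩ := logL r δ hδ
  refine ⟨(2 * max 1 (max L1 L0)) ^ r, ?_, fun N hN => ?_⟩
  · apply one_le_pow₀
    have := le_max_left 1 (max L1 L0)
    linarith only [this]
  have hM1 := le_max_left 1 (max L1 L0)
  have hM2 : L1 ≤ max 1 (max L1 L0) := (le_max_left _ _).trans (le_max_right _ _)
  have hM3 : L0 ≤ max 1 (max L1 L0) := (le_max_right _ _).trans (le_max_right _ _)
  set M := max 1 (max L1 L0)
  have hN1 : 1 ≤ N := le_trans (one_le_pow₀ (by linarith only [hM1])) hN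
  obtain ⟨h1, h2, h3⟩ := Lr_spec r hr N hN1
  have h1' : (1 : ℝ) ≤ Lr r N := by exact_mod_cast h1
  have h4 : M ≤ Lr r N := by
    have := le_of_pow_le_pow_left₀ (by omega) (by positivity) (hN.trans h3)
    linarith only [this]
  refine ⟨hM2.trans h4, le_trans ?_ (hL0 _ (hM3.trans h4))⟩
  have h5 : 0 ≤ Real.log (2 * N) := Real.log_nonneg (by linarith only [hN1])
  gcongr
  calc Real.log (2 * N) ≤ Real.log (2 * (2 * (Lr r N : ℝ)) ^ r) := Real.log_le_log (by linarith only [hN1]) (by gcongr)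
    _ = _ := by rw [Real.log_mul (by norm_num) (by positivity), Real.log_pow]

open Classical in
noncomputable def BadSet (f : Polynomial ℤ) (N : ℕ) : Finset ℕ :=
  (Finset.Ioc N (2 * N)).filter (fun n : ℕ => f.eval (n : ℤ) ≠ 0 ∧ ∃ q : ℕ, q.Prime ∧ N < q ^ 4 ∧ (q : ℤ) ^ 2 ∣ f.eval (n : ℤ))

/-- medium-large primes, trivial bound -/
lemma triv_part (f : Polynomial ℤ) (q0 : ℕ) (hq0 : ∀ q : ℕ, q.Prime → q0 < q → (rootsq f q).card ≤ 3)
    (N s M : ℕ) (hs : 1 ≤ s) (hsq : q0 ≤ s) (B : Finset ℕ)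
    (hB : ∀ n ∈ B, n ∈ Finset.Ioc N (2 * N) ∧ ∃ q : ℕ, q.Prime ∧ s < q ∧ q ≤ M ∧ (q : ℤ) ^ 2 ∣ f.eval (n : ℤ)) :
    (B.card : ℝ) ≤ 3 * N / s + 3 * M := by
  rcases lt_or_ge M s with hMs | hMs
  · have : B = ∅ := by
      refine Finset.eq_empty_of_forall_notMem fun n hn => ?_
      obtain ⟨q, _, h1, h2, _⟩ := (hB n hn).2
      omega
    rw [this]; simp; positivity
  set Q := (Finset.Ioc s M).filter Nat.Prime
  have hsub : B ⊆ Q.biUnion (fun q => (Finset.Ioc N (2 * N)).filter (fun n : ℕ => (q : ℤ) ^ 2 ∣ f.eval (n : ℤ))) := by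
    intro n hn
    obtain ⟨h1, q, h2, h3, h4, h5⟩ := hB n hn
    exact Finset.mem_biUnion.mpr ⟨q, Finset.mem_filter.mpr ⟨Finset.mem_Ioc.mpr ⟨h3, h4⟩, h2⟩, Finset.mem_filter.mpr ⟨h1, h5⟩⟩
  have h1 := (Finset.card_le_card hsub).trans Finset.card_biUnion_le
  have h1' : (B.card : ℝ) ≤ ∑ q ∈ Q, (((Finset.Ioc N (2 * N)).filter (fun n : ℕ => (q : ℤ) ^ 2 ∣ f.eval (n : ℤ))).card : ℝ) := by
    exact_mod_cast h1
  have h2 : ∑ q ∈ Finset.Ioc s M, (((q : ℝ) ^ 2)⁻¹) ≤ (s : ℝ)⁻¹ := by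
    have := sum_Ioc_inv_sq_le_sub (α := ℝ) (show s ≠ 0 by omega) hMs
    have h3 : (0 : ℝ) ≤ (M : ℝ)⁻¹ := by positivity
    linarith only [this, h3]
  calc (B.card : ℝ) ≤ ∑ q ∈ Q, (((Finset.Ioc N (2 * N)).filter (fun n : ℕ => (q : ℤ) ^ 2 ∣ f.eval (n : ℤ))).card : ℝ) := h1'
    _ ≤ ∑ q ∈ Q, (3 * N * ((q : ℝ) ^ 2)⁻¹ + 3) := by
      refine Finset.sum_le_sum fun q hq => ?_
      obtain ⟨h3, h4⟩ := Finset.mem_filter.mp hq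
      have h5 := Finset.mem_Ioc.mp h3
      have := triv_count f q N h4.pos (hq0 q h4 (by omega))
      refine this.trans (le_of_eq ?_)
      rw [div_eq_mul_inv]; ring
    _ ≤ ∑ q ∈ Finset.Ioc s M, (3 * N * ((q : ℝ) ^ 2)⁻¹ + 3) :=
      Finset.sum_le_sum_of_subset_of_nonneg (Finset.filter_subset _ _) (fun _ _ _ => by positivity)
    _ = 3 * N * ∑ q ∈ Finset.Ioc s M, (((q : ℝ) ^ 2)⁻¹) + 3 * (M - s) := by
      rw [Finset.sum_add_distrib, ← Finset.mul_sum, Finset.sum_const, Nat.card_Ioc, nsmul_eq_mul, Nat.cast_sub hMs]; ring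
    _ ≤ 3 * N * (s : ℝ)⁻¹ + 3 * M := by
      gcongr
      have : (0 : ℝ) ≤ s := by positivity
      linarith only [this]
    _ = _ := by rw [div_eq_mul_inv]

lemma T_part (f : Polynomial ℤ) (r : ℕ) (C L0 : ℝ)
    (H : ∀ L : ℕ, L0 ≤ L → ∀ N : ℝ, (L:ℝ)^r ≤ N → N ≤ (2*L:ℝ)^r →
      ∀ B : Finset ℤ, (∀ n ∈ B, BadN f N L n) → (B.card:ℝ)^2 * L ≤ C * N^2) (hC : 0 < C) (hr : 1 ≤ r) (δ N : ℝ) (hδ : 0 < δ) (hN : 1 ≤ N)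
    (hL0 : L0 ≤ Lr r N) (hlog : (Real.log (2 * N)) ^ 2 ≤ δ ^ 2 / C * Lr r N) (B : Finset ℕ)
    (hB : ∀ n ∈ B, BadN f N (Lr r N) n) : (B.card : ℝ) * Real.log (2 * N) ≤ δ * N := by
  obtain ⟨h1, h2, h3⟩ := Lr_spec r hr N hN
  have h := H _ hL0 N h2 h3 (B.map Nat.castEmbedding) (by
    intro n hn
    obtain ⟨m, hm, rfl⟩ := Finset.mem_map.mp hn
    exact hB m hm)
  rw [Finset.card_map] at h
  have h1' : (0 : ℝ) < Lr r N := by exact_mod_cast h1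
  refine le_of_sq_le_sq ?_ (by positivity)
  calc ((B.card : ℝ) * Real.log (2 * N)) ^ 2 = (B.card : ℝ) ^ 2 * Real.log (2 * N) ^ 2 := by ring
    _ ≤ (B.card : ℝ) ^ 2 * (δ ^ 2 / C * Lr r N) := by gcongr
    _ = δ ^ 2 / C * ((B.card : ℝ) ^ 2 * Lr r N) := by ring
    _ ≤ δ ^ 2 / C * (C * N ^ 2) := by gcongr
    _ = (δ * N) ^ 2 := by field_simp

end SecX4

section SecX5
open Polynomial

open Classical in
lemma bad_small (f : Polynomial ℤ) (hdeg : f.natDegree = 3)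
    (hsep : Squarefree (f.map (Int.castRingHom ℚ))) (ε : ℝ) (hε : 0 < ε) :
    ∃ N0 : ℕ, ∀ N : ℕ, N0 ≤ N → ((BadSet f N).card : ℝ) * Real.log (2 * N) ≤ ε * N := by
  obtain ⟨r, hr, K, L0, hK, H⟩ := TAll f hdeg hsep
  obtain ⟨q0, hq0⟩ := rootsq_card f hdeg hsep
  obtain ⟨N1, hN1, H1⟩ := logN r hr ((ε / 8) ^ 2 / K) (by positivity) L0
  obtain ⟨N2, hN2, H2⟩ := logN r hr (ε / 24) (by positivity) 1
  obtain ⟨N3, hN3, H3⟩ := logN 4 (by norm_num) (ε / 24) (by positivity) q0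
  refine ⟨⌈max (max N1 N2) (max N3 4)⌉₊, fun N hN => ?_⟩
  have hN' := Nat.ceil_le.mp hN
  have n1 : N1 ≤ N := (le_max_left _ _).trans ((le_max_left _ _).trans hN')
  have n2 : N2 ≤ N := (le_max_right _ _).trans ((le_max_left _ _).trans hN')
  have n3 : N3 ≤ N := (le_max_left _ _).trans ((le_max_right _ _).trans hN')
  have n4 : (4 : ℝ) ≤ N := (le_max_right _ _).trans ((le_max_right _ _).trans hN')
  clear hN hN'
  have hNr : (1 : ℝ) ≤ N := by linarith only [n4]
  obtain ⟨a1, a2⟩ := H1 N n1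
  obtain ⟨a1', a2'⟩ := H1 (3 / 2 * N) (by linarith only [n1, hNr])
  obtain ⟨b1, b2⟩ := H2 N n2
  obtain ⟨c1, c2⟩ := H3 N n3
  obtain ⟨d1, d2, d3⟩ := Lr_spec 4 (by norm_num) N hNr
  have hmono := Lr_mono r N (3 / 2 * N) (by linarith only [hNr]) (by linarith only [hNr])
  have hlog1 : 1 ≤ Real.log (2 * N) := by
    rw [Real.le_log_iff_exp_le (by linarith only [hNr])]
    have := Real.exp_one_lt_d9
    linarith only [this, n4]
  have hlog2 : Real.log (2 * N) ≤ Real.log (2 * N) ^ 2 := by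
    rw [pow_two]; exact le_mul_of_one_le_left (by linarith only [hlog1]) hlog1
  set L := Lr r N with hLd
  set L' := Lr r (3 / 2 * N) with hLd'
  set s := Lr 4 N
  have hL1 : (1 : ℝ) ≤ L := b1
  have hLpos : 0 < L := by exact_mod_cast (show (0 : ℝ) < L by linarith only [hL1])
  clear_value s
  set B1 := (BadSet f N).filter (fun n : ℕ => ∃ q : ℕ, q.Prime ∧ s < q ∧ q ≤ 2 * N / L ∧ (q : ℤ) ^ 2 ∣ f.eval (n : ℤ)) with hB1
  set B2 := (BadSet f N).filter (fun n : ℕ => (n : ℝ) ≤ 3 / 2 * N ∧ ∃ q : ℕ, q.Prime ∧ 2 * N ≤ L * q ∧ (q : ℤ) ^ 2 ∣ f.eval (n : ℤ)) with hB2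
  set B3 := (BadSet f N).filter (fun n : ℕ => 3 / 2 * (N : ℝ) ≤ n ∧ ∃ q : ℕ, q.Prime ∧ 2 * N ≤ L * q ∧ (q : ℤ) ^ 2 ∣ f.eval (n : ℤ)) with hB3
  have hmem : ∀ n ∈ BadSet f N, n ∈ Finset.Ioc N (2 * N) ∧ f.eval (n : ℤ) ≠ 0 ∧ ∃ q : ℕ, q.Prime ∧ N < q ^ 4 ∧ (q : ℤ) ^ 2 ∣ f.eval (n : ℤ) :=
    fun n hn => Finset.mem_filter.mp hn
  have hsub : BadSet f N ⊆ B1 ∪ (B2 ∪ B3) := by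
    intro n hn
    obtain ⟨h1, h2, q, h3, h4, h5⟩ := hmem n hn
    by_cases hq : q ≤ 2 * N / L
    · refine Finset.mem_union_left _ (Finset.mem_filter.mpr ⟨hn, q, h3, ?_, hq, h5⟩)
      have h6 : s ^ 4 ≤ N := by exact_mod_cast d2
      exact lt_of_pow_lt_pow_left₀ 4 (by omega) (h6.trans_lt h4)
    · have hq' : 2 * N ≤ L * q := by
        by_contra hcon
        push Not at hcon
        exact hq ((Nat.le_div_iff_mul_le hLpos).mpr (by rw [mul_comm]; exact hcon.le))
      apply Finset.mem_union_right
      rcases le_total (n : ℝ) (3 / 2 * N) with h | h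
      · exact Finset.mem_union_left _ (Finset.mem_filter.mpr ⟨hn, h, q, h3, hq', h5⟩)
      · exact Finset.mem_union_right _ (Finset.mem_filter.mpr ⟨hn, h, q, h3, hq', h5⟩)
  have hcard : ((BadSet f N).card : ℝ) ≤ B1.card + (B2.card + B3.card) := by
    have h1 := Finset.card_le_card hsub
    have h2 := Finset.card_union_le B1 (B2 ∪ B3)
    have h3 := Finset.card_union_le B2 B3
    exact_mod_cast (by omega : (BadSet f N).card ≤ B1.card + (B2.card + B3.card))
  have e1 : (B1.card : ℝ) ≤ 3 * N / s + 3 * (2 * N / L : ℕ) := by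
    refine triv_part f q0 hq0 N s _ d1 (by exact_mod_cast c1) B1 fun n hn => ?_
    obtain ⟨h1, h2⟩ := Finset.mem_filter.mp hn
    exact ⟨(hmem n h1).1, h2⟩
  have hs0 : (0 : ℝ) < s := by exact_mod_cast d1
  have hL0 : (0 : ℝ) < L := by linarith only [hL1]
  have e1' : (B1.card : ℝ) * Real.log (2 * N) ≤ 3 / 8 * ε * N := by
    have h1 : (((2 * N / L : ℕ)) : ℝ) ≤ 2 * N / L := by
      have := @Nat.cast_div_le ℝ _ _ _ (2 * N) L
      push_cast at this
      exact this
    calc (B1.card : ℝ) * Real.log (2 * N) ≤ (3 * N / s + 3 * (2 * N / L : ℝ)) * Real.log (2 * N) := by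
          gcongr
          exact e1.trans (by gcongr)
      _ = 3 * N / s * Real.log (2 * N) + 6 * N / L * Real.log (2 * N) := by ring
      _ ≤ 3 * N / s * (ε / 24 * s) + 6 * N / L * (ε / 24 * L) := by
          gcongr
          · exact hlog2.trans c2
          · exact hlog2.trans b2
      _ = 3 / 8 * ε * N := by field_simp; ring
  have e2 : (B2.card : ℝ) * Real.log (2 * N) ≤ ε / 8 * N := by
    refine T_part f r K L0 H hK hr (ε / 8) N (by positivity) hNr a1 a2 B2 fun n hn => ?_
    obtain ⟨h1, h2, q, h3, h4, h5⟩ := Finset.mem_filter.mp hn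
    obtain ⟨g1, g2, -⟩ := hmem n h1
    have g3 : (N : ℝ) ≤ n := by exact_mod_cast (Finset.mem_Ioc.mp g1).1.le
    refine ⟨by push_cast; exact g3, by push_cast; exact h2, g2, q, Nat.prime_iff_prime_int.mp h3, by exact_mod_cast h3.pos, ?_, h5⟩
    have h4' : 2 * (N : ℝ) ≤ L * q := by exact_mod_cast h4
    push_cast
    linarith only [h4', hNr]
  have e3 : (B3.card : ℝ) * Real.log (2 * N) ≤ ε / 8 * (3 / 2 * N) := by
    have hle : Real.log (2 * N) ≤ Real.log (2 * (3 / 2 * N)) := Real.log_le_log (by linarith only [hNr]) (by linarith only [hNr])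
    refine le_trans (mul_le_mul_of_nonneg_left hle (by positivity)) ?_
    refine T_part f r K L0 H hK hr (ε / 8) (3 / 2 * N) (by positivity) (by linarith only [hNr]) a1' a2' B3 fun n hn => ?_
    obtain ⟨h1, h2, q, h3, h4, h5⟩ := Finset.mem_filter.mp hn
    obtain ⟨g1, g2, -⟩ := hmem n h1
    have g3 : (n : ℝ) ≤ 2 * N := by exact_mod_cast (Finset.mem_Ioc.mp g1).2
    refine ⟨by push_cast; exact h2, by push_cast; linarith only [g3, hNr], g2, q, Nat.prime_iff_prime_int.mp h3, by exact_mod_cast h3.pos, ?_, h5⟩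
    have h4' : 2 * (N : ℝ) ≤ L * q := by exact_mod_cast h4
    have hm' : (L : ℝ) ≤ L' := by exact_mod_cast hmono
    have h6 : (L : ℝ) * q ≤ L' * q := by gcongr
    push_cast
    linarith only [h4', h6, hNr]
  calc ((BadSet f N).card : ℝ) * Real.log (2 * N) ≤ (B1.card + (B2.card + B3.card)) * Real.log (2 * N) := by gcongr
    _ = B1.card * Real.log (2 * N) + B2.card * Real.log (2 * N) + B3.card * Real.log (2 * N) := by ring
    _ ≤ 3 / 8 * ε * N + ε / 8 * N + ε / 8 * (3 / 2 * N) := by gcongr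
    _ ≤ ε * N := by
      have : 0 ≤ ε * N := by positivity
      linarith only [this]

end SecX5

section SecX6

lemma fiber_bound (Q : Finset ℕ) (hQ : ∀ q ∈ Q, q.Prime) (i : ℕ) :
    ∑ q ∈ Q.filter (fun q => Nat.log 2 q = i), Real.log q / (q : ℝ) ^ 2 ≤ 2 * Real.log 4 * (1 / 2) ^ i := by
  have h1 : ∀ q ∈ Q.filter (fun q => Nat.log 2 q = i), 2 ^ i ≤ q ∧ q < 2 ^ (i + 1) ∧ q.Prime := by
    intro q hq
    obtain ⟨h2, h3⟩ := Finset.mem_filter.mp hq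
    have hp := hQ q h2
    exact ⟨by rw [← h3]; exact Nat.pow_log_le_self 2 hp.ne_zero, by rw [← h3]; exact Nat.lt_pow_succ_log_self (by norm_num) q, hp⟩
  have h2 : ∑ q ∈ Q.filter (fun q => Nat.log 2 q = i), Real.log q ≤ Real.log 4 * 2 ^ (i + 1) := by
    have h3 := Chebyshev.theta_le_log4_mul_x (x := (2 : ℝ) ^ (i + 1)) (by positivity)
    refine le_trans ?_ h3
    unfold Chebyshev.theta
    refine Finset.sum_le_sum_of_subset_of_nonneg ?_ (fun q _ _ => Real.log_natCast_nonneg q)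
    intro q hq
    obtain ⟨h4, h5, h6⟩ := h1 q hq
    refine Finset.mem_filter.mpr ⟨Finset.mem_Ioc.mpr ⟨h6.pos, Nat.le_floor ?_⟩, h6⟩
    exact_mod_cast h5.le
  calc ∑ q ∈ Q.filter (fun q => Nat.log 2 q = i), Real.log q / (q : ℝ) ^ 2
      ≤ ∑ q ∈ Q.filter (fun q => Nat.log 2 q = i), Real.log q / ((2 : ℝ) ^ i) ^ 2 := by
        refine Finset.sum_le_sum fun q hq => ?_
        obtain ⟨h4, h5, h6⟩ := h1 q hq
        have h7 : (2 : ℝ) ^ i ≤ q := by exact_mod_cast h4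
        have := Real.log_natCast_nonneg q
        gcongr
    _ = (∑ q ∈ Q.filter (fun q => Nat.log 2 q = i), Real.log q) / ((2 : ℝ) ^ i) ^ 2 := by rw [Finset.sum_div]
    _ ≤ Real.log 4 * 2 ^ (i + 1) / ((2 : ℝ) ^ i) ^ 2 := by gcongr
    _ = _ := by rw [pow_succ]; field_simp; rw [← mul_pow]; norm_num

lemma tail1 (s : ℕ) (Q : Finset ℕ) (hQ : ∀ q ∈ Q, q.Prime ∧ 2 ^ s < q) :
    ∑ q ∈ Q, Real.log q / (q : ℝ) ^ 2 ≤ 4 * Real.log 4 * (1 / 2) ^ s := by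
  set I := Q.image (Nat.log 2)
  rw [← Finset.sum_fiberwise_of_maps_to (s := Q) (t := I) (g := Nat.log 2) (fun q hq => Finset.mem_image_of_mem _ hq)]
  have hI : ∀ i ∈ I, s ≤ i := by
    intro i hi
    obtain ⟨q, hq, rfl⟩ := Finset.mem_image.mp hi
    exact Nat.le_log_of_pow_le (by norm_num) (hQ q hq).2.le
  clear_value I
  have hl4 : 0 ≤ Real.log 4 := Real.log_nonneg (by norm_num)
  have hgeo : ∑ i ∈ I, ((1 : ℝ) / 2) ^ i ≤ 2 * (1 / 2) ^ s := by
    have h1 : ∑ i ∈ I, ((1 : ℝ) / 2) ^ i = (1 / 2) ^ s * ∑ i ∈ I.image (fun i => i - s), ((1 : ℝ) / 2) ^ i := by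
      rw [Finset.sum_image, Finset.mul_sum]
      · refine Finset.sum_congr rfl fun i hi => ?_
        rw [← pow_add, Nat.add_sub_cancel' (hI i hi)]
      · intro i hi j hj h
        have := hI i hi
        have := hI j hj
        simp only at h
        omega
    rw [h1, mul_comm]
    gcongr
    calc _ ≤ ∑' i : ℕ, ((1 : ℝ) / 2) ^ i := Summable.sum_le_tsum _ (fun _ _ => by positivity) summable_geometric_two
      _ = 2 := tsum_geometric_two
  calc _ ≤ ∑ i ∈ I, 2 * Real.log 4 * (1 / 2) ^ i := Finset.sum_le_sum fun i _ => fiber_bound Q (fun q hq => (hQ q hq).1) i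
    _ = 2 * Real.log 4 * ∑ i ∈ I, (1 / 2) ^ i := by rw [Finset.mul_sum]
    _ ≤ 2 * Real.log 4 * (2 * (1 / 2) ^ s) := by gcongr
    _ = _ := by ring

lemma tail2 (s : ℕ) (hs : 1 ≤ s) (Q : Finset ℕ) (hQ : ∀ q ∈ Q, q.Prime ∧ 2 ^ s < q) :
    ∑ q ∈ Q, (2 * Real.log ((primorial (2 ^ s) ^ 2 : ℕ) : ℝ) + 4 * Real.log q + 1) / (q : ℝ) ^ 2 ≤ (200 / s : ℝ) := by
  have hl2 : 1 / 2 ≤ Real.log 2 := by linarith only [Real.log_two_gt_d9]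
  have hl4' : Real.log 4 = 2 * Real.log 2 := by
    rw [show (4 : ℝ) = 2 ^ 2 by norm_num, Real.log_pow]; norm_num
  have hl4 : Real.log 4 ≤ 2 := by linarith only [hl4', Real.log_two_lt_d9]
  have hsr : (1 : ℝ) ≤ s := by exact_mod_cast hs
  set w : ℝ := 2 ^ s with hw
  have hw1 : 1 ≤ w := one_le_pow₀ (by norm_num)
  have hws : (s : ℝ) ≤ w := by rw [hw]; exact_mod_cast (Nat.lt_two_pow_self (n := s)).le
  have hD : Real.log ((primorial (2 ^ s) ^ 2 : ℕ) : ℝ) ≤ 4 * w := by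
    push_cast
    rw [Real.log_pow]
    have h1 : Real.log (primorial (2 ^ s) : ℝ) ≤ Real.log ((4 : ℝ) ^ (2 ^ s)) := by
      apply Real.log_le_log
      · exact_mod_cast primorial_pos _
      · exact_mod_cast primorial_le_four_pow (2 ^ s)
    rw [Real.log_pow] at h1
    push_cast at h1 ⊢
    nlinarith only [h1, hl4, hw1, hw]
  set LD := Real.log ((primorial (2 ^ s) ^ 2 : ℕ) : ℝ)
  clear_value LD
  have hterm : ∀ q ∈ Q, (2 * LD + 4 * Real.log q + 1) / (q : ℝ) ^ 2 ≤ (18 * w / s + 4) * (Real.log q / (q : ℝ) ^ 2) := by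
    intro q hq
    obtain ⟨h1, h2⟩ := hQ q hq
    have h3 : (s : ℝ) / 2 ≤ Real.log q := by
      have : Real.log ((2 : ℝ) ^ s) ≤ Real.log q := Real.log_le_log (by positivity) (by exact_mod_cast h2.le)
      rw [Real.log_pow] at this
      nlinarith only [this, hl2, hsr]
    rw [← mul_div_assoc]
    gcongr
    have h4 : 9 * w ≤ 18 * w / s * Real.log q := by
      calc 9 * w = 18 * w / s * (s / 2) := by field_simp; norm_num
        _ ≤ _ := by gcongr
    linarith only [h4, hD, hw1]
  have ht := tail1 s Q hQ
  have hw2 : ((1 : ℝ) / 2) ^ s = 1 / w := by rw [hw]; simp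
  rw [hw2] at ht
  calc _ ≤ ∑ q ∈ Q, (18 * w / s + 4) * (Real.log q / (q : ℝ) ^ 2) := Finset.sum_le_sum hterm
    _ = (18 * w / s + 4) * ∑ q ∈ Q, (Real.log q / (q : ℝ) ^ 2) := by rw [Finset.mul_sum]
    _ ≤ (18 * w / s + 4) * (4 * 2 * (1 / w)) := by
      gcongr
      exact ht.trans (by gcongr)
    _ = 144 / s + 32 / w := by field_simp; ring
    _ ≤ 144 / s + 32 / s := by gcongr
    _ ≤ 200 / s := by rw [← add_div]; gcongr; norm_num

end SecX6

section SecX7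
open Polynomial

lemma sum_biUnion_le' {ι : Type*} [DecidableEq ι] (s : Finset ι) (t : ι → Finset ℕ) (g : ℕ → ℝ) (hg : ∀ n, 0 ≤ g n) :
    ∑ n ∈ s.biUnion t, g n ≤ ∑ i ∈ s, ∑ n ∈ t i, g n := by
  induction s using Finset.induction_on with
  | empty => simp
  | insert i s hi ih =>
    rw [Finset.biUnion_insert, Finset.sum_insert hi]
    have h1 := Finset.sum_union_inter (s₁ := t i) (s₂ := s.biUnion t) (f := g)
    have h2 : 0 ≤ ∑ n ∈ t i ∩ s.biUnion t, g n := Finset.sum_nonneg fun n _ => hg n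
    linarith only [h1, h2, ih]

lemma sum_union_le' (s t : Finset ℕ) (g : ℕ → ℝ) (hg : ∀ n, 0 ≤ g n) :
    ∑ n ∈ s ∪ t, g n ≤ ∑ n ∈ s, g n + ∑ n ∈ t, g n := by
  have h1 := Finset.sum_union_inter (s₁ := s) (s₂ := t) (f := g)
  have h2 : 0 ≤ ∑ n ∈ s ∩ t, g n := Finset.sum_nonneg fun n _ => hg n
  linarith only [h1, h2]

lemma class_pair (D q b v N : ℕ) (hD : 2 ≤ D) (hq : 1 < q) (hcop : Nat.Coprime D (q ^ 2)) (hN : D * q ^ 2 ≤ N) :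
    ∑ p ∈ (Finset.Ioc N (2 * N)).filter (fun p => p.Prime ∧ p ≡ b [MOD D] ∧ p ≡ v [MOD q ^ 2]), Real.log p ≤
      2 * N / D * ((2 * Real.log D + 4 * Real.log q + 1) / (q : ℝ) ^ 2) := by
  set c := Nat.chineseRemainder hcop b v
  have hk : 2 ≤ D * q ^ 2 := by
    have : 1 ≤ q ^ 2 := Nat.one_le_pow _ _ (by omega)
    nlinarith only [this, hD]
  have h := ap_cheb (D * q ^ 2) N c hk hN
  have hsub : (Finset.Ioc N (2 * N)).filter (fun p => p.Prime ∧ p ≡ b [MOD D] ∧ p ≡ v [MOD q ^ 2]) ⊆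
      (Finset.Ioc N (2 * N)).filter (fun p => p.Prime ∧ p ≡ c [MOD D * q ^ 2]) := by
    intro p hp
    obtain ⟨h1, h2, h3, h4⟩ := Finset.mem_filter.mp hp
    refine Finset.mem_filter.mpr ⟨h1, h2, ?_⟩
    exact (Nat.modEq_and_modEq_iff_modEq_mul hcop).mp ⟨h3.trans c.2.1.symm, h4.trans c.2.2.symm⟩
  refine (Finset.sum_le_sum_of_subset_of_nonneg hsub (fun p _ _ => Real.log_natCast_nonneg p)).trans (h.trans (le_of_eq ?_))
  have hD0 : (D : ℝ) ≠ 0 := by positivity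
  have hq0 : (q : ℝ) ≠ 0 := by positivity
  push_cast
  rw [Real.log_mul hD0 (by positivity), Real.log_pow]
  field_simp
  push_cast
  ring

open Classical in
lemma block_bound (f : Polynomial ℤ) (hdeg : f.natDegree = 3)
    (hsep : Squarefree (f.map (Int.castRingHom ℚ))) (q0 s : ℕ) (hs : 1 ≤ s)
    (hq0 : ∀ q : ℕ, q.Prime → q0 < q → (rootsq f q).card ≤ 3) (hsq : q0 ≤ 2 ^ s)
    (b : ℕ) (hb : ∀ q : ℕ, q.Prime → q ≤ 2 ^ s → ¬ (q : ℤ) ^ 2 ∣ f.eval (b : ℤ))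
    (hfin : {p : ℕ | p.Prime ∧ Squarefree (f.eval (p : ℤ))}.Finite) (ε : ℝ) (hε : 0 < ε) :
    ∃ N0 : ℕ, ∀ N : ℕ, N0 ≤ N →
      ∑ p ∈ (Finset.Ioc N (2 * N)).filter (fun p => p.Prime ∧ p ≡ b [MOD primorial (2 ^ s) ^ 2]), Real.log p ≤
        1200 / s * (N / (primorial (2 ^ s) ^ 2 : ℕ)) + ε * N := by
  have hf0 : f ≠ 0 := by intro h; rw [h] at hdeg; simp at hdeg
  obtain ⟨N1, hN1⟩ := bad_small f hdeg hsep ε hε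
  have hroot : ∃ P1 : ℕ, ∀ p : ℕ, P1 < p → f.eval (p : ℤ) ≠ 0 := by
    refine ⟨∑ z ∈ f.roots.toFinset, z.natAbs, fun p hp h => ?_⟩
    have h1 : (p : ℤ) ∈ f.roots.toFinset := by
      rw [Multiset.mem_toFinset, mem_roots hf0]; exact h
    have := Finset.single_le_sum (f := fun z : ℤ => z.natAbs) (fun _ _ => Nat.zero_le _) h1
    simp only [Int.natAbs_natCast] at this
    omega
  obtain ⟨P1, hP1⟩ := hroot
  obtain ⟨P0, hP0⟩ := hfin.bddAbove
  set D := primorial (2 ^ s) ^ 2 with hDdef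
  have hprimdvd : ∀ q : ℕ, q.Prime → q ≤ 2 ^ s → q ∣ primorial (2 ^ s) := by
    intro q hq hqs
    unfold primorial
    exact Finset.dvd_prod_of_mem _ (Finset.mem_filter.mpr ⟨Finset.mem_range.mpr (by omega), hq⟩)
  have hD2 : 2 ≤ D := by
    have h1 := Nat.le_of_dvd (primorial_pos _) (hprimdvd 2 Nat.prime_two (Nat.le_self_pow (by omega) 2))
    rw [hDdef]; nlinarith only [h1]
  refine ⟨max (max N1 (D ^ 2)) (max P0 P1), fun N hN => ?_⟩
  have n1 : N1 ≤ N := (le_max_left _ _).trans ((le_max_left _ _).trans hN)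
  have n2 : D ^ 2 ≤ N := (le_max_right _ _).trans ((le_max_left _ _).trans hN)
  have n3 : P0 ≤ N := (le_max_left _ _).trans ((le_max_right _ _).trans hN)
  have n4 : P1 ≤ N := (le_max_right _ _).trans ((le_max_right _ _).trans hN)
  have hbad := hN1 N n1
  clear hN hN1
  have hNpos : 0 < N := by nlinarith only [n2, hD2]
  set Q := (Finset.range (N + 1)).filter (fun q => q.Prime ∧ 2 ^ s < q ∧ q ^ 4 ≤ N) with hQ
  have hQm : ∀ q ∈ Q, q.Prime ∧ 2 ^ s < q ∧ q ^ 4 ≤ N := fun q hq => (Finset.mem_filter.mp hq).2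
  set F : ℕ → ℕ → Finset ℕ := fun q v => (Finset.Ioc N (2 * N)).filter (fun p => p.Prime ∧ p ≡ b [MOD D] ∧ p ≡ v [MOD q ^ 2]) with hF
  have hsub : (Finset.Ioc N (2 * N)).filter (fun p => p.Prime ∧ p ≡ b [MOD D]) ⊆
      (Q.biUnion fun q => (rootsq f q).biUnion fun v => F q v) ∪ BadSet f N := by
    intro p hp
    obtain ⟨h1, h2, h3⟩ := Finset.mem_filter.mp hp
    have hNp := (Finset.mem_Ioc.mp h1).1
    have hfp := hP1 p (by omega)
    have hns : ¬ Squarefree (f.eval (p : ℤ)) := by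
      intro h
      have := hP0 (show p ∈ {p : ℕ | p.Prime ∧ Squarefree (f.eval (p : ℤ))} from ⟨h2, h⟩)
      omega
    rw [← Int.squarefree_natAbs, Nat.squarefree_iff_prime_squarefree] at hns
    push Not at hns
    obtain ⟨q, hq, hqd⟩ := hns
    have hqd' : (q : ℤ) ^ 2 ∣ f.eval (p : ℤ) := by
      have := Int.natCast_dvd.mpr hqd
      rw [pow_two]; exact_mod_cast this
    have hqs : 2 ^ s < q := by
      by_contra hcon
      push Not at hcon
      apply hb q hq hcon
      have h4 : (q : ℤ) ^ 2 ∣ (p : ℤ) - b := by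
        have h5 : q ^ 2 ∣ D := by rw [hDdef]; exact pow_dvd_pow_of_dvd (hprimdvd q hq hcon) 2
        have h6 := (Nat.modEq_iff_dvd).mp (h3.symm)
        have h7 : (q : ℤ) ^ 2 ∣ (D : ℤ) := by exact_mod_cast h5
        exact h7.trans h6
      have h5 := h4.trans (Polynomial.sub_dvd_eval_sub (p : ℤ) (b : ℤ) f)
      exact (dvd_sub_right hqd').mp h5
    by_cases hq4 : q ^ 4 ≤ N
    · refine Finset.mem_union_left _ (Finset.mem_biUnion.mpr ⟨q, ?_, Finset.mem_biUnion.mpr ⟨p % q ^ 2, mem_rootsq f q p hq.pos hqd', ?_⟩⟩)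
      · refine Finset.mem_filter.mpr ⟨Finset.mem_range.mpr ?_, hq, hqs, hq4⟩
        have := Nat.le_self_pow (n := 4) (by norm_num) q
        omega
      · exact Finset.mem_filter.mpr ⟨h1, h2, h3, (Nat.mod_modEq _ _).symm⟩
    · exact Finset.mem_union_right _ (Finset.mem_filter.mpr ⟨h1, hfp, q, hq, by omega, hqd'⟩)
  have hlog0 : ∀ n : ℕ, 0 ≤ Real.log (n : ℝ) := Real.log_natCast_nonneg
  have hpair : ∀ q ∈ Q, ∀ v ∈ rootsq f q, ∑ p ∈ F q v, Real.log p ≤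
      2 * N / D * ((2 * Real.log D + 4 * Real.log q + 1) / (q : ℝ) ^ 2) := by
    intro q hq v _
    obtain ⟨h1, h2, h3⟩ := hQm q hq
    refine class_pair D q b v N hD2 h1.one_lt ?_ ?_
    · rw [hDdef]
      apply Nat.Coprime.pow
      rw [Nat.coprime_comm, Nat.Prime.coprime_iff_not_dvd h1]
      unfold primorial
      rw [Prime.dvd_finset_prod_iff h1.prime]
      rintro ⟨r, hr, hqr⟩
      obtain ⟨g1, g2⟩ := Finset.mem_filter.mp hr
      have g3 := (Nat.prime_dvd_prime_iff_eq h1 g2).mp hqr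
      have := Finset.mem_range.mp g1
      omega
    · refine (Nat.pow_le_pow_iff_left two_ne_zero).mp ?_
      calc (D * q ^ 2) ^ 2 = D ^ 2 * q ^ 4 := by ring
        _ ≤ N * N := Nat.mul_le_mul n2 h3
        _ = N ^ 2 := by ring
  have hmed : ∑ n ∈ (Q.biUnion fun q => (rootsq f q).biUnion fun v => F q v), Real.log (n : ℝ) ≤ 1200 / s * (N / D) := by
    calc _ ≤ ∑ q ∈ Q, ∑ n ∈ (rootsq f q).biUnion (fun v => F q v), Real.log (n : ℝ) := sum_biUnion_le' _ _ _ hlog0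
      _ ≤ ∑ q ∈ Q, 3 * (2 * N / D * ((2 * Real.log D + 4 * Real.log q + 1) / (q : ℝ) ^ 2)) := by
        refine Finset.sum_le_sum fun q hq => ?_
        obtain ⟨h1, h2, h3⟩ := hQm q hq
        refine (sum_biUnion_le' _ _ _ hlog0).trans ?_
        refine (Finset.sum_le_card_nsmul _ _ _ (hpair q hq)).trans ?_
        rw [nsmul_eq_mul]
        have h4 : ((rootsq f q).card : ℝ) ≤ 3 := by exact_mod_cast hq0 q h1 (by omega)
        have h5 := hlog0 q
        have h6 := hlog0 D
        gcongr
      _ = 6 * N / D * ∑ q ∈ Q, ((2 * Real.log D + 4 * Real.log q + 1) / (q : ℝ) ^ 2) := by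
        rw [Finset.mul_sum]
        refine Finset.sum_congr rfl fun q _ => by ring
      _ ≤ 6 * N / D * (200 / s) := by
        gcongr
        exact tail2 s hs Q fun q hq => ⟨(hQm q hq).1, (hQm q hq).2.1⟩
      _ = _ := by ring
  have hB : ∑ n ∈ BadSet f N, Real.log (n : ℝ) ≤ ε * N := by
    refine le_trans ?_ hbad
    rw [← nsmul_eq_mul]
    refine Finset.sum_le_card_nsmul _ _ _ fun n hn => ?_
    obtain ⟨h1, -⟩ := Finset.mem_filter.mp hn
    have h2 := Finset.mem_Ioc.mp h1
    have h3 : (n : ℝ) ≤ 2 * N := by exact_mod_cast h2.2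
    exact Real.log_le_log (by exact_mod_cast (by omega : 0 < n)) h3
  calc _ ≤ _ := Finset.sum_le_sum_of_subset_of_nonneg hsub (fun p _ _ => hlog0 p)
    _ ≤ _ := sum_union_le' _ _ _ hlog0
    _ ≤ _ := add_le_add hmed hB

end SecX7

section SecX8
open ArithmeticFunction.vonMangoldt

lemma dyadic_sum (g : ℕ → ℝ) (hg : ∀ n, 0 ≤ g n) (C c ρ : ℝ) (k0 : ℕ) (hc : 0 ≤ c) (hρ : 0 ≤ ρ) (hρ1 : ρ < 1)
    (h0 : ∑ n ∈ Finset.range (2 ^ k0 + 1), g n ≤ C)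
    (hk : ∀ k, k0 ≤ k → ∑ n ∈ Finset.Ioc (2 ^ k) (2 * 2 ^ k), g n ≤ c * ρ ^ k) (n : ℕ) :
    ∑ i ∈ Finset.range n, g i ≤ C + c * (1 - ρ)⁻¹ := by
  have h1 : ∀ k, k0 ≤ k → ∑ n ∈ Finset.range (2 ^ k + 1), g n ≤ C + c * ∑ i ∈ Finset.range k, ρ ^ i := by
    intro k hkk
    induction k, hkk using Nat.le_induction with
    | base =>
      have : 0 ≤ c * ∑ i ∈ Finset.range k0, ρ ^ i := mul_nonneg hc (Finset.sum_nonneg fun i _ => by positivity)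
      linarith only [this, h0]
    | succ k hkk ih =>
      have h2 : (2 ^ (k + 1) : ℕ) = 2 * 2 ^ k := by rw [pow_succ]; ring
      have h3 : Finset.range (2 ^ (k + 1) + 1) = Finset.range (2 ^ k + 1) ∪ Finset.Ioc (2 ^ k) (2 * 2 ^ k) := by
        ext i
        simp only [Finset.mem_range, Finset.mem_union, Finset.mem_Ioc]
        omega
      have h4 : Disjoint (Finset.range (2 ^ k + 1)) (Finset.Ioc (2 ^ k) (2 * 2 ^ k)) := by
        rw [Finset.disjoint_left]
        intro i hi hi'
        rw [Finset.mem_range] at hi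
        rw [Finset.mem_Ioc] at hi'
        omega
      rw [h3, Finset.sum_union h4, Finset.sum_range_succ (fun i => ρ ^ i), mul_add]
      have := hk k hkk
      linarith only [this, ih]
  have h2 : ∑ i ∈ Finset.range n, g i ≤ ∑ i ∈ Finset.range (2 ^ (max n k0) + 1), g i := by
    refine Finset.sum_le_sum_of_subset_of_nonneg (Finset.range_subset_range.mpr ?_) (fun i _ _ => hg i)
    have h3 : max n k0 < 2 ^ (max n k0) := Nat.lt_two_pow_self
    have := le_max_left n k0
    omega
  refine h2.trans ((h1 _ (le_max_right _ _)).trans ?_)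
  gcongr
  rw [← tsum_geometric_of_lt_one hρ hρ1]
  exact Summable.sum_le_tsum _ (fun _ _ => by positivity) (summable_geometric_of_lt_one hρ hρ1)

lemma rho_bound (t : ℝ) (h0 : 0 < t) (h1 : t ≤ 1) : ((1 : ℝ) / 2) ^ t < 1 ∧ (1 - ((1 : ℝ) / 2) ^ t)⁻¹ ≤ 2 / t := by
  have h := rpow_one_add_le_one_add_mul_self (s := -(1 / 2)) (p := t) (by norm_num) h0.le h1
  rw [show (1 : ℝ) + -(1 / 2) = 1 / 2 by norm_num] at h
  refine ⟨by linarith only [h, h0], ?_⟩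
  rw [show 2 / t = (t / 2)⁻¹ by rw [inv_div]]
  apply inv_anti₀ (by positivity)
  linarith only [h]

lemma ap_contra (D : ℕ) [NeZero D] (a : ZMod D) (ha : IsUnit a) (N0 : ℕ)
    (H : ∀ N : ℕ, N0 ≤ N → ∑ p ∈ (Finset.Ioc N (2 * N)).filter (fun p : ℕ => p.Prime ∧ (p : ZMod D) = a), Real.log p ≤
      1 / 4 * ((D.totient : ℝ)⁻¹ * N)) : False := by
  obtain ⟨C, hC⟩ := LSeries_residueClass_lower_bound ha
  set φ := (D.totient : ℝ)⁻¹ with hφ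
  have hφ0 : 0 < φ := inv_pos.mpr (mod_cast D.totient.pos_of_neZero)
  set u := residueClass a with hu
  have hu0 : ∀ n, 0 ≤ u n := residueClass_nonneg a
  set C0 := ∑' n : ℕ, (if n.Prime then 0 else u n) / n with hC0
  set C1 := ∑ n ∈ Finset.range (2 ^ N0 + 1), u n with hC1
  have key : ∀ x : ℝ, x ∈ Set.Ioc (1 : ℝ) 2 → ∑' n, u n / (n : ℝ) ^ x ≤ C0 + C1 + φ / 2 / (x - 1) := by
    rintro x ⟨hx1, hx2⟩
    have hnx : ∀ n : ℕ, 1 ≤ n → (1 : ℝ) ≤ (n : ℝ) ^ x := fun n hn => Real.one_le_rpow (by exact_mod_cast hn) (by linarith only [hx1])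
    set g : ℕ → ℝ := fun n => (if n.Prime then u n else 0) / (n : ℝ) ^ x with hg
    set h : ℕ → ℝ := fun n => (if n.Prime then 0 else u n) / n with hh
    have hg0 : ∀ n, 0 ≤ g n := by
      intro n; simp only [hg]; split_ifs
      · exact div_nonneg (hu0 n) (Real.rpow_nonneg (Nat.cast_nonneg n) x)
      · simp
    obtain ⟨hr1, hr2⟩ := rho_bound (x - 1) (by linarith only [hx1]) (by linarith only [hx2])
    have hpart : ∀ n, ∑ i ∈ Finset.range n, g i ≤ C1 + φ / 4 * (1 - ((1 : ℝ) / 2) ^ (x - 1))⁻¹ := by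
      refine dyadic_sum g hg0 C1 (φ / 4) _ N0 (by positivity) (by positivity) hr1 ?_ ?_
      · refine Finset.sum_le_sum fun n _ => ?_
        simp only [hg]
        split_ifs with hp
        · exact div_le_self (hu0 n) (hnx n hp.one_lt.le)
        · simpa using hu0 n
      · intro k hk
        have hN := H (2 ^ k) (hk.trans Nat.lt_two_pow_self.le)
        have e1 : ∑ n ∈ Finset.Ioc (2 ^ k) (2 * 2 ^ k), g n ≤
            (∑ p ∈ (Finset.Ioc (2 ^ k) (2 * 2 ^ k)).filter (fun p : ℕ => p.Prime ∧ (p : ZMod D) = a), Real.log p) / ((2 : ℝ) ^ k) ^ x := by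
          rw [Finset.sum_filter, Finset.sum_div]
          refine Finset.sum_le_sum fun n hn => ?_
          have hn' := (Finset.mem_Ioc.mp hn).1
          simp only [hg]
          by_cases hp : n.Prime
          · by_cases hna : (n : ZMod D) = a
            · rw [if_pos hp, if_pos ⟨hp, hna⟩]
              have : u n = Real.log n := by
                rw [hu, residueClass, Set.indicator_of_mem (by exact hna), ArithmeticFunction.vonMangoldt_apply_prime hp]
              rw [this]
              have h2 : (2 : ℝ) ^ k ≤ n := by exact_mod_cast hn'.le
              have h3 := Real.log_natCast_nonneg n
              gcongr
            · rw [if_pos hp, if_neg (fun h => hna h.2)]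
              have : u n = 0 := by
                rw [hu, residueClass, Set.indicator_of_notMem (by exact hna)]
              rw [this, zero_div, zero_div]
          · rw [if_neg hp, if_neg (fun h => hp h.1), zero_div, zero_div]
        refine e1.trans ?_
        have h2k : (0 : ℝ) < 2 ^ k := by positivity
        calc _ ≤ (1 / 4 * (φ * ((2 ^ k : ℕ) : ℝ))) / ((2 : ℝ) ^ k) ^ x := by gcongr
          _ = φ / 4 * ((2 : ℝ) ^ k / ((2 : ℝ) ^ k) ^ x) := by push_cast; ring
          _ = φ / 4 * (((1 : ℝ) / 2) ^ (x - 1)) ^ k := by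
            congr 1
            rw [← Real.rpow_natCast (((1 : ℝ) / 2) ^ (x - 1)), ← Real.rpow_mul (by norm_num), mul_comm, Real.rpow_mul (by norm_num), Real.rpow_natCast,
              one_div, inv_pow, Real.inv_rpow h2k.le, Real.rpow_sub h2k, Real.rpow_one, inv_div]
    have hgs : Summable g := summable_of_sum_range_le hg0 hpart
    have hgt : ∑' n, g n ≤ C1 + φ / 4 * (1 - ((1 : ℝ) / 2) ^ (x - 1))⁻¹ := Real.tsum_le_of_sum_range_le hg0 hpart
    have hhs : Summable h := summable_residueClass_non_primes_div a
    have hle : ∀ n, u n / (n : ℝ) ^ x ≤ h n + g n := by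
      intro n
      simp only [hh, hg]
      split_ifs with hp
      · simp
      · rcases Nat.eq_zero_or_pos n with rfl | hn
        · have : u 0 = 0 := residueClass_apply_zero a
          simp [this]
        · rw [zero_div, add_zero]
          refine div_le_div_of_nonneg_left (hu0 n) (mod_cast hn) ?_
          conv_lhs => rw [← Real.rpow_one n]
          exact Real.rpow_le_rpow_of_exponent_le (by exact_mod_cast hn) hx1.le
    have hsu : Summable (fun n : ℕ => u n / (n : ℝ) ^ x) :=
      Summable.of_nonneg_of_le (fun n => div_nonneg (hu0 n) (Real.rpow_nonneg (Nat.cast_nonneg n) x)) hle (hhs.add hgs)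
    calc ∑' n, u n / (n : ℝ) ^ x ≤ ∑' n, (h n + g n) := Summable.tsum_le_tsum hle hsu (hhs.add hgs)
      _ = C0 + ∑' n, g n := hhs.tsum_add hgs
      _ ≤ C0 + (C1 + φ / 4 * (2 / (x - 1))) := by
        gcongr
        exact hgt.trans (by gcongr)
      _ = _ := by ring
  -- contradiction
  have hall : ∀ x : ℝ, x ∈ Set.Ioc (1 : ℝ) 2 → φ / 2 / (x - 1) ≤ C + C0 + C1 := by
    intro x hx
    have h1 := hC hx
    have h2 := key x hx
    have h3 : φ / (x - 1) = φ / 2 / (x - 1) + φ / 2 / (x - 1) := by ring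
    linarith only [h1, h2, h3]
  set K := C + C0 + C1
  have hK : 0 < K := by
    have := hall 2 ⟨by norm_num, le_refl _⟩
    norm_num at this
    linarith only [this, hφ0]
  have ht : 0 < min 1 (φ / (4 * K)) := lt_min (by norm_num) (by positivity)
  have h5 := hall (1 + min 1 (φ / (4 * K))) ⟨by linarith only [ht], by linarith only [min_le_left 1 (φ / (4 * K))]⟩
  rw [add_sub_cancel_left, div_le_iff₀ ht] at h5
  have h6 : K * min 1 (φ / (4 * K)) ≤ φ / 4 := by
    calc K * min 1 (φ / (4 * K)) ≤ K * (φ / (4 * K)) := by gcongr; exact min_le_right _ _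
      _ = φ / 4 := by field_simp
  linarith only [h5, h6, hφ0]

end SecX8

section SecX9
open Polynomial

lemma crt_class (f : Polynomial ℤ) (hloc : ∀ q : ℕ, q.Prime →
      ∃ x : ZMod (q ^ 2), IsUnit x ∧
        Polynomial.eval x (f.map (Int.castRingHom (ZMod (q ^ 2)))) ≠ 0) (w : ℕ) :
    ∃ b : ℕ, Nat.Coprime b (primorial w ^ 2) ∧ ∀ q : ℕ, q.Prime → q ≤ w → ¬ (q : ℤ) ^ 2 ∣ f.eval (b : ℤ) := by
  choose! x hx1 hx2 using hloc
  set Q := (Finset.range (w + 1)).filter Nat.Prime with hQ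
  have hQm : ∀ q ∈ Q, q.Prime := fun q hq => (Finset.mem_filter.mp hq).2
  obtain ⟨b, hb⟩ := Nat.chineseRemainderOfFinset (fun q => (x q).val) (fun q => q ^ 2) Q
    (fun q hq => pow_ne_zero 2 (hQm q hq).ne_zero) (by
      intro p hp q hq hpq
      exact Nat.Coprime.pow 2 2 ((Nat.coprime_primes (hQm p hp) (hQm q hq)).mpr hpq))
  have hbx : ∀ q ∈ Q, (b : ZMod (q ^ 2)) = x q := by
    intro q hq
    haveI : NeZero (q ^ 2) := ⟨pow_ne_zero 2 (hQm q hq).ne_zero⟩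
    have := (ZMod.natCast_eq_natCast_iff _ _ _).mpr (hb q hq)
    rw [this, ZMod.natCast_zmod_val]
  refine ⟨b, ?_, ?_⟩
  · apply Nat.Coprime.pow_right
    unfold primorial
    apply Nat.Coprime.prod_right
    intro q hq
    have h1 := hx1 q (hQm q hq)
    rw [← hbx q hq, ZMod.isUnit_iff_coprime] at h1
    exact Nat.Coprime.coprime_dvd_right (dvd_pow_self q two_ne_zero) h1
  · intro q hq hqw hd
    have hqQ : q ∈ Q := Finset.mem_filter.mpr ⟨Finset.mem_range.mpr (by omega), hq⟩
    apply hx2 q hq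
    rw [← hbx q hqQ, ← Int.cast_natCast, eval_intCast_map]
    apply (ZMod.intCast_zmod_eq_zero_iff_dvd _ _).mpr
    push_cast
    exact hd


end SecX9

theorem erdos_conjecture_cubic (f : Polynomial ℤ)
    (hdeg : f.natDegree = 3)
    (hsep : Squarefree (f.map (Int.castRingHom ℚ)))
    (hloc : ∀ q : ℕ, q.Prime →
      ∃ x : ZMod (q ^ 2), IsUnit x ∧
        Polynomial.eval x (f.map (Int.castRingHom (ZMod (q ^ 2)))) ≠ 0) :
    {p : ℕ | p.Prime ∧ Squarefree (f.eval (p : ℤ))}.Infinite := by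
  by_contra hcon
  have hfin := Set.not_infinite.mp hcon
  obtain ⟨q0, hq0⟩ := rootsq_card f hdeg hsep
  obtain ⟨s, hs⟩ : ∃ s : ℕ, s = 9600 + q0 := ⟨_, rfl⟩
  have hs1 : 9600 ≤ s := by omega
  have hsq : q0 ≤ 2 ^ s := le_trans (by omega : q0 ≤ s) Nat.lt_two_pow_self.le
  clear hs
  obtain ⟨b, hb1, hb2⟩ := crt_class f hloc (2 ^ s)
  have hD0 : 0 < primorial (2 ^ s) ^ 2 := pow_pos (primorial_pos _) 2
  have hφ0 : (0 : ℝ) < ((primorial (2 ^ s) ^ 2).totient : ℝ)⁻¹ := inv_pos.mpr (mod_cast Nat.totient_pos.mpr hD0)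
  obtain ⟨N0, hN0⟩ := block_bound f hdeg hsep q0 s (by omega) hq0 hsq b hb2 hfin
    (((primorial (2 ^ s) ^ 2).totient : ℝ)⁻¹ / 8) (by positivity)
  generalize hDD : primorial (2 ^ s) ^ 2 = D at *
  haveI : NeZero D := ⟨hD0.ne'⟩
  refine ap_contra D (b : ZMod D) ((ZMod.isUnit_iff_coprime b D).mpr hb1) N0 fun N hN => ?_
  have h := hN0 N hN
  have hset : (Finset.Ioc N (2 * N)).filter (fun p : ℕ => p.Prime ∧ (p : ZMod D) = (b : ZMod D)) =
      (Finset.Ioc N (2 * N)).filter (fun p => p.Prime ∧ p ≡ b [MOD D]) := by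
    refine Finset.filter_congr fun p _ => ?_
    rw [ZMod.natCast_eq_natCast_iff]
  rw [hset]
  refine h.trans ?_
  have hsr : (9600 : ℝ) ≤ s := by exact_mod_cast hs1
  have h1 : (1200 / s : ℝ) ≤ 1 / 8 := by
    rw [div_le_div_iff₀ (by linarith only [hsr]) (by norm_num)]; linarith only [hsr]
  have h2 : (N / D : ℝ) ≤ (D.totient : ℝ)⁻¹ * N := by
    rw [div_eq_inv_mul]
    gcongr
    exact Nat.totient_le D
  calc (1200 / s * (N / D) + (D.totient : ℝ)⁻¹ / 8 * N : ℝ) ≤ 1 / 8 * ((D.totient : ℝ)⁻¹ * N) + (D.totient : ℝ)⁻¹ / 8 * N := by gcongr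
    _ = _ := by ring
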